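/- Let n be a fixed positive integer. For an odd prime p let a_p(λ) := -∑_{x∈F_p} φ(x(x-1)(x-λ)). Then, as p tends to infinity through the primes, p^{-(n+1)} · ∑_{λ∈F_p, λ≠0,1} a_p(λ)^{2n} converges to the Catalan number (2n)!/(n!(n+1)!). -/

import Mathlib

open Finset Filter

namespace LegendreMoments

open PowerSeries

/-- The generating series `∑ i, q ^ f i` of a function with finite fibres. -/
noncomputable def genSeries {ι : Type*} (f : ι → ℕ) : ℤ⟦X⟧ :=
  PowerSeries.mk fun n => (Nat.card {i // f i = n} : ℤ)

lemma coeff_genSeries {ι : Type*} (f : ι → ℕ) (n : ℕ) :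
    coeff n (genSeries f) = (Nat.card {i // f i = n} : ℤ) := coeff_mk _ _

lemma genSeries_comp_equiv {ι κ : Type*} (e : ι ≃ κ) (f : κ → ℕ) :
    genSeries (f ∘ e) = genSeries f := by
  ext n
  simp only [coeff_genSeries]
  congr 1
  exact Nat.card_congr (e.subtypeEquiv fun a => Iff.rfl)

lemma genSeries_congr {ι κ : Type*} (e : ι ≃ κ) (f : ι → ℕ) (g : κ → ℕ)
    (h : ∀ i, f i = g (e i)) : genSeries f = genSeries g := by
  rw [← genSeries_comp_equiv e g]
  congr 1
  exact funext h

lemma genSeries_mul {ι κ : Type*} (f : ι → ℕ) (g : κ → ℕ)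
    (hf : ∀ n, Finite {i // f i = n}) (hg : ∀ n, Finite {i // g i = n}) :
    genSeries f * genSeries g = genSeries fun x : ι × κ => f x.1 + g x.2 := by
  ext n
  rw [coeff_mul]
  simp only [coeff_genSeries]
  have e : {x : ι × κ // f x.1 + g x.2 = n} ≃
      Σ d : {d // d ∈ antidiagonal n}, {i // f i = d.1.1} × {j // g j = d.1.2} :=
    { toFun := fun x => ⟨⟨(f x.1.1, g x.1.2), by simpa using x.2⟩, ⟨x.1.1, rfl⟩, ⟨x.1.2, rfl⟩⟩
      invFun := fun y => ⟨(y.2.1.1, y.2.2.1), by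
        rw [y.2.1.2, y.2.2.2]; exact mem_antidiagonal.1 y.1.2⟩
      left_inv := fun x => rfl
      right_inv := by
        rintro ⟨⟨⟨a, b⟩, h⟩, ⟨i, hi⟩, ⟨j, hj⟩⟩
        dsimp only at hi hj
        subst hi hj
        rfl }
  have := fun n => Fintype.ofFinite {i // f i = n}
  have := fun n => Fintype.ofFinite {i // g i = n}
  rw [Nat.card_congr e, Nat.card_sigma, Nat.cast_sum]
  simp only [Nat.card_prod, Nat.cast_mul]
  exact (Finset.sum_coe_sort (antidiagonal n) fun d =>
    ((Nat.card {i // f i = d.1} : ℤ) * (Nat.card {j // g j = d.2} : ℤ))).symm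

lemma genSeries_sum {ι κ : Type*} (f : ι ⊕ κ → ℕ) (hf : ∀ n, Finite {i // f i = n}) :
    genSeries f = genSeries (f ∘ Sum.inl) + genSeries (f ∘ Sum.inr) := by
  ext n
  simp only [map_add, coeff_genSeries, Function.comp]
  have e := Equiv.subtypeSum (p := fun i => f i = n)
  have h1 : Finite {i // f (Sum.inl i) = n} :=
    Finite.of_injective (fun i => (⟨Sum.inl i.1, i.2⟩ : {i // f i = n})) fun a b h => by
      ext; simpa using h
  have h2 : Finite {i // f (Sum.inr i) = n} :=
    Finite.of_injective (fun i => (⟨Sum.inr i.1, i.2⟩ : {i // f i = n})) fun a b h => by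
      ext; simpa using h
  rw [Nat.card_congr e, Nat.card_sum, Nat.cast_add]

lemma expand_genSeries {ι : Type*} (f : ι → ℕ) (k : ℕ) (hk : k ≠ 0) :
    expand k hk (genSeries f) = genSeries fun i => k * f i := by
  ext n
  rw [coeff_expand]
  split_ifs with h
  · obtain ⟨m, rfl⟩ := h
    rw [Nat.mul_div_cancel_left _ (Nat.pos_of_ne_zero hk)]
    simp only [coeff_genSeries, Nat.mul_right_inj hk]
  · rw [coeff_genSeries]
    have : IsEmpty {i // k * f i = n} := ⟨fun i => h ⟨f i.1, i.2.symm⟩⟩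
    simp

lemma X_mul_genSeries {ι : Type*} (f : ι → ℕ) :
    X * genSeries f = genSeries fun i => f i + 1 := by
  ext n
  cases n with
  | zero => simp [coeff_genSeries]
  | succ n => simp [coeff_succ_X_mul, coeff_genSeries]

/-- The theta series `∑ q ^ (m ^ 2)`, over all integers `m`. -/
noncomputable def thetaA : ℤ⟦X⟧ := genSeries fun m : ℤ => (m ^ 2).toNat

/-- The theta series `∑ q ^ (m * (m + 1))`, over natural numbers `m`. -/
noncomputable def thetaPsi : ℤ⟦X⟧ := genSeries fun m : ℕ => m * (m + 1)

lemma int_mul_succ_nonneg (m : ℤ) : 0 ≤ m * (m + 1) := by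
  rcases le_or_gt 0 m with h | h
  · positivity
  · nlinarith

lemma finite_sq_fibre (n : ℕ) : Finite {m : ℤ // (m ^ 2).toNat = n} := by
  refine Finite.of_injective (fun m => (⟨m.1, ?_⟩ : Set.Icc (-(n : ℤ)) n)) fun a b h => by
    ext; simpa using h
  obtain ⟨m, hm⟩ := m
  have h : m ^ 2 = n := by
    have := Int.toNat_of_nonneg (sq_nonneg m); omega
  constructor <;> nlinarith [sq_nonneg m, sq_nonneg (m - 1), sq_nonneg (m + 1)]

lemma finite_pronic_fibre (n : ℕ) : Finite {m : ℕ // m * (m + 1) = n} := by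
  refine Finite.of_injective (fun m => (⟨m.1, ?_⟩ : Set.Iic n)) fun a b h => by
    ext; simpa using h
  obtain ⟨m, hm⟩ := m
  simp only [Set.mem_Iic]
  nlinarith

lemma finite_int_pronic_fibre (n : ℕ) : Finite {m : ℤ // (m * (m + 1)).toNat = n} := by
  refine Finite.of_injective (fun m => (⟨m.1, ?_⟩ : Set.Icc (-(n : ℤ) - 1) n)) fun a b h => by
    ext; simpa using h
  obtain ⟨m, hm⟩ := m
  have h : m * (m + 1) = n := by
    have := Int.toNat_of_nonneg (int_mul_succ_nonneg m); omega
  constructor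
  · by_contra! hc
    nlinarith
  · by_contra! hc
    nlinarith

/-- Integers as natural numbers together with the images of the naturals under `m ↦ -1 - m`. -/
def natSumNatEquivInt : ℕ ⊕ ℕ ≃ ℤ :=
  { toFun := Sum.elim (fun m => (m : ℤ)) (fun m => -1 - (m : ℤ))
    invFun := fun z => if 0 ≤ z then Sum.inl z.toNat else Sum.inr (-1 - z).toNat
    left_inv := by
      rintro (m | m)
      · simp
      · have : ¬ (0 ≤ -1 - (m : ℤ)) := by omega
        simp only [Sum.elim_inr, this, if_false]
        congr 1
        omega
    right_inv := by
      intro z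
      by_cases h : 0 ≤ z
      · simp [h]
      · simp only [h, if_false, Sum.elim_inr]; omega }

lemma two_mul_thetaPsi : 2 * thetaPsi = genSeries fun m : ℤ => (m * (m + 1)).toNat := by
  rw [← genSeries_comp_equiv natSumNatEquivInt, genSeries_sum]
  · rw [two_mul, thetaPsi]
    congr 2
    ext m
    have : (-1 - (m : ℤ)) * (-1 - (m : ℤ) + 1) = ((m * (m + 1) : ℕ) : ℤ) := by push_cast; ring
    exact (congrArg Int.toNat this).symm
  · intro n
    have := finite_int_pronic_fibre n
    exact Finite.of_equiv _ (natSumNatEquivInt.subtypeEquiv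
      (p := fun a => ((fun m : ℤ => (m * (m + 1)).toNat) ∘ natSumNatEquivInt) a = n)
      (q := fun m : ℤ => (m * (m + 1)).toNat = n) fun a => Iff.rfl).symm

/-- Pairs of integers, split according to the parity of their sum. -/
def parityEquiv : (ℤ × ℤ) ⊕ (ℤ × ℤ) ≃ ℤ × ℤ :=
  { toFun := Sum.elim (fun x => (x.1 + x.2, x.1 - x.2)) (fun x => (x.1 + x.2 + 1, x.1 - x.2))
    invFun := fun x => if (x.1 + x.2) % 2 = 0 then Sum.inl ((x.1 + x.2) / 2, (x.1 - x.2) / 2)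
      else Sum.inr ((x.1 + x.2) / 2, (x.1 - x.2) / 2)
    left_inv := by
      rintro (⟨s, t⟩ | ⟨s, t⟩)
      · have : (s + t + (s - t)) % 2 = 0 := by omega
        simp only [Sum.elim_inl, this, if_true]
        congr 2 <;> omega
      · have : ¬ (s + t + 1 + (s - t)) % 2 = 0 := by omega
        simp only [Sum.elim_inr, this, if_false]
        congr 2 <;> omega
    right_inv := by
      rintro ⟨s, t⟩
      by_cases h : (s + t) % 2 = 0
      · simp only [h, if_true, Sum.elim_inl]
        congr 1 <;> omega
      · simp only [h, if_false, Sum.elim_inr]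
        congr 1 <;> omega }

lemma finite_add_fibre {ι κ : Type*} (f : ι → ℕ) (g : κ → ℕ)
    (hf : ∀ n, Finite {i // f i = n}) (hg : ∀ n, Finite {i // g i = n}) (n : ℕ) :
    Finite {x : ι × κ // f x.1 + g x.2 = n} := by
  refine Finite.of_injective (β := Σ a : Fin (n + 1), {i // f i = a} × {j // g j = n - a})
    (fun x => ⟨⟨f x.1.1, by have := x.2; omega⟩, ⟨x.1.1, rfl⟩, ⟨x.1.2, by
      have := x.2; dsimp only; omega⟩⟩) ?_
  rintro ⟨⟨i, j⟩, h⟩ ⟨⟨i', j'⟩, h'⟩ hh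
  have h1 := congrArg (fun y => (y.2.1.1 : ι)) hh
  have h2 := congrArg (fun y => (y.2.2.1 : κ)) hh
  dsimp only at h1 h2
  subst h1 h2
  rfl

lemma finite_comp_equiv {ι κ : Type*} (e : ι ≃ κ) (f : κ → ℕ) (hf : ∀ n, Finite {i // f i = n})
    (n : ℕ) : Finite {i // (f ∘ e) i = n} := by
  have := hf n
  exact Finite.of_equiv _ (e.subtypeEquiv (p := fun a => (f ∘ e) a = n)
    (q := fun m => f m = n) fun a => Iff.rfl).symm

lemma finite_mul_fibre {ι : Type*} (f : ι → ℕ) (hf : ∀ n, Finite {i // f i = n}) (n : ℕ) :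
    Finite {i // 2 * f i = n} := by
  have := hf (n / 2)
  exact Finite.of_injective (fun i => (⟨i.1, by have := i.2; omega⟩ : {i // f i = n / 2}))
    fun a b h => by ext; simpa using h

/-- Landen's transformation of the theta series `∑ q ^ (m ^ 2)`. -/
lemma thetaA_sq : thetaA ^ 2 = expand 2 two_ne_zero thetaA ^ 2 +
    4 * X * expand 2 two_ne_zero thetaPsi ^ 2 := by
  have h4 : 4 * X * expand 2 two_ne_zero thetaPsi ^ 2 =
      X * expand 2 two_ne_zero (2 * thetaPsi) ^ 2 := by
    rw [map_mul, show (expand 2 two_ne_zero (2 : ℤ⟦X⟧)) = 2 from map_ofNat _ 2]; ring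
  rw [h4, two_mul_thetaPsi, thetaA, expand_genSeries, expand_genSeries, sq, sq, sq,
    genSeries_mul _ _ finite_sq_fibre finite_sq_fibre,
    genSeries_mul _ _ (finite_mul_fibre _ finite_sq_fibre) (finite_mul_fibre _ finite_sq_fibre),
    genSeries_mul _ _ (finite_mul_fibre _ finite_int_pronic_fibre)
      (finite_mul_fibre _ finite_int_pronic_fibre), X_mul_genSeries,
    ← genSeries_comp_equiv parityEquiv, genSeries_sum _
      (finite_comp_equiv _ _ (finite_add_fibre _ _ finite_sq_fibre finite_sq_fibre))]
  congr 2
  · ext ⟨s, t⟩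
    simp only [Function.comp, parityEquiv, Equiv.coe_fn_mk, Sum.elim_inl]
    zify
    rw [Int.toNat_of_nonneg (sq_nonneg _), Int.toNat_of_nonneg (sq_nonneg _),
      Int.toNat_of_nonneg (sq_nonneg _), Int.toNat_of_nonneg (sq_nonneg _)]
    ring
  · ext ⟨s, t⟩
    simp only [Function.comp, parityEquiv, Equiv.coe_fn_mk, Sum.elim_inr]
    zify
    rw [Int.toNat_of_nonneg (sq_nonneg _), Int.toNat_of_nonneg (sq_nonneg _),
      Int.toNat_of_nonneg (int_mul_succ_nonneg _), Int.toNat_of_nonneg (int_mul_succ_nonneg _)]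
    ring

/-- Landen's transformation of the theta series `∑ q ^ (m * (m + 1))`. -/
lemma thetaPsi_sq : thetaPsi ^ 2 = expand 2 two_ne_zero thetaPsi * expand 2 two_ne_zero thetaA := by
  have h4 : (2 * thetaPsi) ^ 2 =
      2 * (expand 2 two_ne_zero (2 * thetaPsi) * expand 2 two_ne_zero thetaA) := by
    rw [two_mul_thetaPsi, thetaA, expand_genSeries, expand_genSeries, sq,
      genSeries_mul _ _ finite_int_pronic_fibre finite_int_pronic_fibre,
      genSeries_mul _ _ (finite_mul_fibre _ finite_int_pronic_fibre)
      (finite_mul_fibre _ finite_sq_fibre),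
      ← genSeries_comp_equiv parityEquiv, genSeries_sum _
      (finite_comp_equiv _ _
        (finite_add_fibre _ _ finite_int_pronic_fibre finite_int_pronic_fibre)), two_mul]
    congr 1
    · congr 1
      ext ⟨s, t⟩
      simp only [Function.comp, parityEquiv, Equiv.coe_fn_mk, Sum.elim_inl]
      zify
      rw [Int.toNat_of_nonneg (sq_nonneg _), Int.toNat_of_nonneg (int_mul_succ_nonneg _),
        Int.toNat_of_nonneg (int_mul_succ_nonneg _), Int.toNat_of_nonneg (int_mul_succ_nonneg _)]
      ring
    · refine genSeries_congr ((Equiv.prodComm ℤ ℤ).trans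
        (Equiv.prodCongr (Equiv.refl ℤ) (Equiv.addRight (1 : ℤ)))) _ _ ?_
      rintro ⟨s, t⟩
      simp only [Function.comp, parityEquiv, Equiv.coe_fn_mk, Sum.elim_inr, Equiv.trans_apply,
        Equiv.prodComm_apply, Prod.swap, Equiv.prodCongr_apply, Prod.map, Equiv.refl_apply,
        Equiv.coe_addRight]
      zify
      rw [Int.toNat_of_nonneg (sq_nonneg _), Int.toNat_of_nonneg (int_mul_succ_nonneg _),
        Int.toNat_of_nonneg (int_mul_succ_nonneg _), Int.toNat_of_nonneg (int_mul_succ_nonneg _)]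
      ring
  rw [map_mul, show (expand 2 two_ne_zero (2 : ℤ⟦X⟧)) = 2 from map_ofNat _ 2] at h4
  have h5 : (4 : ℤ⟦X⟧) * thetaPsi ^ 2 =
      4 * (expand 2 two_ne_zero thetaPsi * expand 2 two_ne_zero thetaA) := by
    linear_combination h4
  refine mul_left_cancel₀ ?_ h5
  rw [← map_ofNat (C (R := ℤ)) 4, map_ne_zero_iff _ C_injective]
  norm_num

end LegendreMoments

namespace LegendreMoments

open PowerSeries

/-- The operator `q d/dq`. -/
noncomputable def qDeriv {R : Type*} [CommRing R] (f : R⟦X⟧) : R⟦X⟧ := X * d⁄dX R f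

section qDeriv

variable {R : Type*} [CommRing R]

lemma coeff_qDeriv (f : R⟦X⟧) (n : ℕ) : coeff n (qDeriv f) = n * coeff n f := by
  cases n with
  | zero => simp [qDeriv]
  | succ n => rw [qDeriv, coeff_succ_X_mul, coeff_derivative]; push_cast; ring

lemma qDeriv_add (f g : R⟦X⟧) : qDeriv (f + g) = qDeriv f + qDeriv g := by
  simp [qDeriv, mul_add]

lemma qDeriv_mul (f g : R⟦X⟧) : qDeriv (f * g) = f * qDeriv g + g * qDeriv f := by
  simp only [qDeriv, Derivation.leibniz, smul_eq_mul]; ring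

lemma qDeriv_pow (f : R⟦X⟧) (n : ℕ) : qDeriv (f ^ n) = n * f ^ (n - 1) * qDeriv f := by
  simp only [qDeriv, Derivation.leibniz_pow, smul_eq_mul, nsmul_eq_mul]; ring

lemma qDeriv_X : qDeriv (X : R⟦X⟧) = X := by simp [qDeriv]

lemma qDeriv_ofNat_mul (n : ℕ) (f : R⟦X⟧) : qDeriv ((n : R⟦X⟧) * f) = (n : R⟦X⟧) * qDeriv f := by
  rw [← nsmul_eq_mul, ← nsmul_eq_mul]; simp [qDeriv, mul_left_comm]

lemma qDeriv_expand (f : R⟦X⟧) (k : ℕ) (hk : k ≠ 0) :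
    qDeriv (expand k hk f) = k * expand k hk (qDeriv f) := by
  ext n
  rw [← nsmul_eq_mul, map_nsmul, coeff_qDeriv, coeff_expand, coeff_expand]
  split_ifs with h
  · obtain ⟨m, rfl⟩ := h
    rw [Nat.mul_div_cancel_left _ (Nat.pos_of_ne_zero hk), coeff_qDeriv]
    push_cast; rw [nsmul_eq_mul]; ring
  · simp

end qDeriv

/-- A power series over a domain proportional to its image under `q ↦ q ^ 2`, with vanishing
constant coefficient, vanishes. -/
lemma eq_zero_of_mul_eq_mul_expand {R : Type*} [CommRing R] [IsDomain R] {b w f : R⟦X⟧}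
    (hb : constantCoeff b ≠ 0) (hf : constantCoeff f = 0)
    (h : b * f = w * expand 2 two_ne_zero f) : f = 0 := by
  by_contra hne
  have hb' : b.order = 0 := by
    by_contra h0
    exact hb (order_ne_zero_iff_constCoeff_eq_zero.1 h0)
  have h1 : (b * f).order = f.order := by rw [order_mul, hb', zero_add]
  have h2 : 2 • f.order ≤ f.order := by
    have : (expand 2 two_ne_zero f).order ≤ (w * expand 2 two_ne_zero f).order := by
      rw [order_mul]; exact le_add_self
    rw [← h, h1, order_expand] at this
    exact this
  have h3 : f.order ≠ 0 := order_ne_zero_iff_constCoeff_eq_zero.2 hf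
  have h4 : f.order ≠ ⊤ := by simpa [order_eq_top] using hne
  lift f.order to ℕ using h4 with n hn
  rw [two_nsmul] at h2
  norm_cast at h2 h3
  omega

lemma constantCoeff_thetaA : constantCoeff thetaA = 1 := by
  rw [← coeff_zero_eq_constantCoeff_apply, thetaA, coeff_genSeries]
  have : Unique {m : ℤ // (m ^ 2).toNat = 0} :=
    { default := ⟨0, by simp⟩
      uniq := fun ⟨m, hm⟩ => by
        ext
        have : m ^ 2 ≤ 0 := by simpa using hm
        exact pow_eq_zero_iff two_ne_zero |>.1 (le_antisymm this (sq_nonneg m)) }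
  simp

lemma constantCoeff_thetaPsi : constantCoeff thetaPsi = 1 := by
  rw [← coeff_zero_eq_constantCoeff_apply, thetaPsi, coeff_genSeries]
  have : Unique {m : ℕ // m * (m + 1) = 0} :=
    { default := ⟨0, by simp⟩
      uniq := fun ⟨m, hm⟩ => by
        ext
        simpa using hm }
  simp

/-- The fourth power of `∑ (-1) ^ m q ^ (m ^ 2)`. -/
noncomputable def thetaW : ℤ⟦X⟧ := thetaA ^ 4 - 16 * X * thetaPsi ^ 4

lemma thetaPsi_pow_four :
    (thetaPsi ^ 2) ^ 2 = expand 2 two_ne_zero (thetaA ^ 2) * expand 2 two_ne_zero (thetaPsi ^ 2) := by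
  rw [map_pow, map_pow]; nth_rw 1 [thetaPsi_sq]; ring

/-- The logarithmic derivative of the modular function `λ`, in terms of theta series. -/
lemma qDeriv_thetaA_thetaPsi :
    thetaA ^ 2 * thetaPsi ^ 2 + 2 * thetaA ^ 2 * qDeriv (thetaPsi ^ 2)
      - 2 * thetaPsi ^ 2 * qDeriv (thetaA ^ 2) = thetaA ^ 2 * thetaPsi ^ 2 * thetaW := by
  have ha : thetaA ^ 2 = expand 2 two_ne_zero (thetaA ^ 2) +
      4 * X * expand 2 two_ne_zero (thetaPsi ^ 2) := by
    rw [map_pow, map_pow]; exact thetaA_sq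
  have hb := thetaPsi_pow_four
  have hW : thetaW = (thetaA ^ 2) ^ 2 - 16 * X * (thetaPsi ^ 2) ^ 2 := by rw [thetaW]; ring
  have hca : constantCoeff (thetaA ^ 2) = 1 := by simp [constantCoeff_thetaA]
  have hcb : constantCoeff (thetaPsi ^ 2) = 1 := by simp [constantCoeff_thetaPsi]
  rw [hW]
  generalize thetaA ^ 2 = a at *
  generalize thetaPsi ^ 2 = b at *
  rw [← sub_eq_zero]
  set a₂ := expand 2 two_ne_zero a with ha2
  set b₂ := expand 2 two_ne_zero b with hb2
  have hDa2 : 2 * expand 2 two_ne_zero (qDeriv a) = qDeriv a₂ := by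
    rw [ha2, qDeriv_expand]; norm_cast
  have hDb2 : 2 * expand 2 two_ne_zero (qDeriv b) = qDeriv b₂ := by
    rw [hb2, qDeriv_expand]; norm_cast
  have hDa : qDeriv a = qDeriv a₂ + 4 * X * b₂ + 4 * X * qDeriv b₂ := by
    have h4 : qDeriv ((4 : ℤ⟦X⟧) * (X * b₂)) = 4 * qDeriv (X * b₂) :=
      by exact_mod_cast qDeriv_ofNat_mul 4 (X * b₂)
    rw [ha, qDeriv_add, mul_assoc, h4, qDeriv_mul, qDeriv_X]; ring
  have hDb : 2 * b * qDeriv b = a₂ * qDeriv b₂ + b₂ * qDeriv a₂ := by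
    have := congrArg qDeriv hb
    rw [qDeriv_pow, qDeriv_mul] at this
    simpa using this
  refine eq_zero_of_mul_eq_mul_expand (b := b) (w := a₂ - 4 * X * b₂) (by rw [hcb]; exact one_ne_zero)
    ?_ ?_
  · simp [hca, hcb, qDeriv]
  · simp only [map_sub, map_add, map_mul, map_pow, expand_X, ← ha2, ← hb2,
      show (expand 2 two_ne_zero (2 : ℤ⟦X⟧)) = 2 from map_ofNat _ 2,
      show (expand 2 two_ne_zero (16 : ℤ⟦X⟧)) = 16 from map_ofNat _ 16]
    generalize expand 2 two_ne_zero (qDeriv a) = da at *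
    rw [hDa, ha]
    linear_combination (a₂ + 4 * X * b₂) * hDb +
      (a₂ + 4 * X * b₂ - 2 * (qDeriv a₂ + 4 * X * b₂ + 4 * X * qDeriv b₂)
        - (a₂ + 4 * X * b₂) ^ 3 + 16 * X * (a₂ + 4 * X * b₂) * (b ^ 2 + a₂ * b₂)) * hb
      - (a₂ - 4 * X * b₂) * a₂ * hDb2 + (a₂ - 4 * X * b₂) * b₂ * hDa2

/-- The unit part of the `q`-expansion of `16 / λ`. -/
noncomputable def hauptUnit : ℤ⟦X⟧ := (thetaA * invOfUnit thetaPsi 1) ^ 4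

lemma thetaPsi_mul_inv : thetaPsi * invOfUnit thetaPsi 1 = 1 :=
  mul_invOfUnit _ _ (by rw [constantCoeff_thetaPsi]; rfl)

lemma hauptUnit_mul : hauptUnit * thetaPsi ^ 4 = thetaA ^ 4 := by
  rw [hauptUnit]
  linear_combination thetaA ^ 4 * (thetaPsi ^ 3 * (invOfUnit thetaPsi 1) ^ 3
    + thetaPsi ^ 2 * (invOfUnit thetaPsi 1) ^ 2 + thetaPsi * (invOfUnit thetaPsi 1) + 1)
    * thetaPsi_mul_inv

lemma thetaW_mul_hauptUnit : thetaW * hauptUnit = hauptUnit - qDeriv hauptUnit := by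
  have h := qDeriv_thetaA_thetaPsi
  have hE : hauptUnit * (thetaPsi ^ 2) ^ 2 = (thetaA ^ 2) ^ 2 := by
    rw [← pow_mul, ← pow_mul]; exact hauptUnit_mul
  have hcb : constantCoeff (thetaPsi ^ 2) = 1 := by simp [constantCoeff_thetaPsi]
  generalize hauptUnit = E at *
  generalize thetaA ^ 2 = a at *
  generalize thetaPsi ^ 2 = b at *
  have hD := congrArg qDeriv hE
  rw [qDeriv_mul, qDeriv_pow, qDeriv_pow] at hD
  norm_num at hD
  have hb : b ≠ 0 := by rintro rfl; simp at hcb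
  refine mul_left_cancel₀ (pow_ne_zero 3 hb) ?_
  linear_combination (-a) * h + b * hD - (b - b * thetaW + 2 * qDeriv b) * hE

lemma coeff_hauptUnit_pow_mul_thetaW (k : ℕ) (hk : k ≠ 0) :
    coeff k (hauptUnit ^ k * thetaW) = 0 := by
  obtain ⟨j, rfl⟩ := Nat.exists_eq_succ_of_ne_zero hk
  have h1 : ((j + 1 : ℕ) : ℤ⟦X⟧) * (hauptUnit ^ (j + 1) * thetaW) =
      ((j + 1 : ℕ) : ℤ⟦X⟧) * hauptUnit ^ (j + 1) - qDeriv (hauptUnit ^ (j + 1)) := by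
    rw [qDeriv_pow, Nat.add_sub_cancel]
    linear_combination ((j + 1 : ℕ) : ℤ⟦X⟧) * hauptUnit ^ j * thetaW_mul_hauptUnit
  have h2 := congrArg (coeff (j + 1)) h1
  rw [map_sub, coeff_qDeriv, ← nsmul_eq_mul, ← nsmul_eq_mul, map_nsmul, map_nsmul,
    nsmul_eq_mul, nsmul_eq_mul, sub_self] at h2
  rcases mul_eq_zero.1 h2 with h | h
  · norm_cast at h
  · exact h

end LegendreMoments

namespace LegendreMoments

open PowerSeries

/-- The Hecke-type operator keeping the coefficients whose index is a multiple of `p`. -/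
noncomputable def heckeU {R : Type*} [Semiring R] (p : ℕ) (f : R⟦X⟧) : R⟦X⟧ :=
  PowerSeries.mk fun n => coeff (p * n) f

lemma heckeU_expand_mul {R : Type*} [CommRing R] (p : ℕ) (hp : p ≠ 0) (h f : R⟦X⟧) :
    heckeU p (expand p hp h * f) = h * heckeU p f := by
  ext n
  rw [heckeU, coeff_mk, coeff_mul, coeff_mul]
  symm
  refine Finset.sum_of_injOn (fun d => (p * d.1, p * d.2)) ?_ ?_ ?_ ?_
  · rintro ⟨a, b⟩ _ ⟨c, d⟩ _ h
    simpa [hp] using h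
  · rintro ⟨a, b⟩ h
    simp only [mem_coe, HasAntidiagonal.mem_antidiagonal] at *
    rw [← mul_add, h]
  · rintro ⟨a, b⟩ hab hn
    simp only [HasAntidiagonal.mem_antidiagonal] at hab
    rw [coeff_expand_of_not_dvd, zero_mul]
    rintro ⟨c, rfl⟩
    have hd : p ∣ b := (Nat.dvd_add_right ⟨c, rfl⟩).1 (hab ▸ ⟨n, rfl⟩)
    obtain ⟨d, rfl⟩ := hd
    refine hn ⟨(c, d), ?_, rfl⟩
    rw [← mul_add] at hab
    simpa using Nat.eq_of_mul_eq_mul_left (Nat.pos_of_ne_zero hp) hab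
  · rintro ⟨a, b⟩ h
    simp [heckeU, coeff_expand_mul]

lemma zmod_expand_eq_pow (p : ℕ) [Fact p.Prime] (hp : p ≠ 0) (f : (ZMod p)⟦X⟧) :
    expand p hp f = f ^ p := by
  have h := MvPowerSeries.map_frobenius_expand (σ := Unit) (R := ZMod p) p hp (f := f)
  rw [ZMod.frobenius_zmod] at h
  rw [← h]
  exact (congrFun (congrArg DFunLike.coe
    (MvPowerSeries.map_id (σ := Unit) (R := ZMod p))) _).symm

/-- The polynomial `∑ C(m,i)² x ^ i`, the Hasse invariant of the Legendre family when
`p = 2 m + 1`. -/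
noncomputable def hassePoly (R : Type*) [CommRing R] (m : ℕ) : Polynomial R :=
  ∑ i ∈ range (m + 1), Polynomial.C ((m.choose i : R) ^ 2) * Polynomial.X ^ i

lemma choose_central_zmod (p m : ℕ) [Fact p.Prime] (hm : p = 2 * m + 1) (i : ℕ) (hi : i ≤ m) :
    (-1 : ZMod p) ^ i * ((2 * i).choose i : ZMod p) = 4 ^ i * (m.choose i : ZMod p) := by
  induction i with
  | zero => simp
  | succ i ih =>
    have ih := ih (by omega)
    have h1 : ((i + 1 : ℕ) : ZMod p) ≠ 0 := by
      rw [Ne, ZMod.natCast_eq_zero_iff]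
      intro h
      have := Nat.le_of_dvd (by omega) h
      omega
    have h2 : (i + 1) * (2 * (i + 1)).choose (i + 1) = 2 * (2 * i + 1) * (2 * i).choose i := by
      have := Nat.succ_mul_centralBinom_succ i
      simpa [Nat.centralBinom] using this
    have h3 : m.choose (i + 1) * (i + 1) = m.choose i * (m - i) := Nat.choose_succ_right_eq m i
    have h2' := congrArg (Nat.cast (R := ZMod p)) h2
    have h3' := congrArg (Nat.cast (R := ZMod p)) h3
    have hp0 : (2 * (m : ZMod p) + 1) = 0 := by
      have := ZMod.natCast_self p
      have h' := congrArg (Nat.cast (R := ZMod p)) hm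
      rw [this] at h'
      push_cast at h'
      exact h'.symm
    push_cast [Nat.cast_sub (show i ≤ m by omega)] at h1 h2' h3'
    refine mul_left_cancel₀ h1 ?_
    rw [pow_succ, pow_succ]
    linear_combination (-1) * (-1 : ZMod p) ^ i * h2' - 4 * 4 ^ i * h3'
      - 2 * (2 * (i : ZMod p) + 1) * ih + 2 * 4 ^ i * (m.choose i : ZMod p) * (-1) * hp0

/-- The middle coefficient of `((x + y z) (x z + y)) ^ m`. -/
lemma coeff_linear_mul_pow {R : Type*} [CommRing R] (m : ℕ) (x y : R) :
    (((Polynomial.C x + Polynomial.C y * Polynomial.X) *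
      (Polynomial.C x * Polynomial.X + Polynomial.C y)) ^ m).coeff m =
      ∑ i ∈ range (m + 1), (m.choose i : R) ^ 2 * (y ^ 2) ^ i * (x ^ 2) ^ (m - i) := by
  have h1 : ∀ (a b : R) (j : ℕ), j ≤ m →
      ((Polynomial.C a + Polynomial.C b * Polynomial.X) ^ m).coeff j =
      (m.choose j : R) * b ^ j * a ^ (m - j) := by
    intro a b j hj
    rw [add_comm, add_pow, Polynomial.finsetSum_coeff, Finset.sum_eq_single j]
    · rw [mul_pow, ← Polynomial.C_pow, ← Polynomial.C_pow, ← Polynomial.C_eq_natCast,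
        mul_assoc, ← Polynomial.C_mul, Polynomial.coeff_mul_C, Polynomial.coeff_C_mul,
        Polynomial.coeff_X_pow_self]
      ring
    · intro k _ hk
      rw [mul_pow, ← Polynomial.C_pow, ← Polynomial.C_pow, ← Polynomial.C_eq_natCast,
        mul_assoc, ← Polynomial.C_mul, Polynomial.coeff_mul_C, Polynomial.coeff_C_mul,
        Polynomial.coeff_X_pow, if_neg (Ne.symm hk)]
      ring
    · intro h; exact absurd (mem_range.2 (by omega)) h
  rw [mul_pow, Polynomial.coeff_mul, Finset.Nat.sum_antidiagonal_eq_sum_range_succ_mk]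
  refine Finset.sum_congr rfl fun i hi => ?_
  have hi' : i ≤ m := by simpa [Nat.lt_succ_iff] using hi
  rw [h1 _ _ _ hi', add_comm (Polynomial.C x * Polynomial.X), h1 _ _ _ (Nat.sub_le _ _),
    Nat.sub_sub_self hi', Nat.choose_symm hi']
  ring

lemma coeff_X_sub_one_pow_two_mul {R : Type*} [CommRing R] (i : ℕ) :
    (((Polynomial.X - 1 : Polynomial R) ^ 2) ^ i).coeff i = (-1) ^ i * ((2 * i).choose i : R) := by
  rw [← pow_mul, show (Polynomial.X - 1 : Polynomial R) = Polynomial.X + Polynomial.C (-1) by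
    simp [sub_eq_add_neg], Polynomial.coeff_X_add_C_pow]
  congr 2; omega

/-- Landen's transformation of the Hasse polynomial, in homogeneous form. -/
lemma hasse_landen (p m : ℕ) [Fact p.Prime] (hm : p = 2 * m + 1) {R : Type*} [CommRing R]
    [Algebra (ZMod p) R] (x y : R) :
    ∑ i ∈ range (m + 1), (m.choose i : R) ^ 2 * (4 * x * y) ^ i * ((x + y) ^ 2) ^ (m - i) =
      ∑ i ∈ range (m + 1), (m.choose i : R) ^ 2 * (y ^ 2) ^ i * (x ^ 2) ^ (m - i) := by
  rw [← coeff_linear_mul_pow]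
  have h1 : (Polynomial.C x + Polynomial.C y * Polynomial.X) *
      (Polynomial.C x * Polynomial.X + Polynomial.C y) =
      Polynomial.C (x * y) * (Polynomial.X - 1) ^ 2 + Polynomial.C ((x + y) ^ 2) * Polynomial.X := by
    simp only [map_mul, map_pow, map_add]; ring
  rw [h1, add_pow (Polynomial.C (x * y) * _), Polynomial.finsetSum_coeff]
  refine Finset.sum_congr rfl fun i hi => ?_
  have hi' : i ≤ m := by simpa [Nat.lt_succ_iff] using hi
  have hc := congrArg (algebraMap (ZMod p) R) (choose_central_zmod p m hm i hi')
  simp only [map_mul, map_pow, map_neg, map_one, map_natCast, map_ofNat] at hc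
  have h2 : ((Polynomial.C (x * y) * (Polynomial.X - 1) ^ 2) ^ i *
      (Polynomial.C ((x + y) ^ 2) * Polynomial.X) ^ (m - i) * ((m.choose i : ℕ) : Polynomial R)) =
      Polynomial.C ((x * y) ^ i * ((x + y) ^ 2) ^ (m - i) * (m.choose i : R)) *
        (((Polynomial.X - 1) ^ 2) ^ i * Polynomial.X ^ (m - i)) := by
    simp only [map_mul, map_pow, Polynomial.C_eq_natCast, mul_pow]
    ring
  rw [h2, Polynomial.coeff_C_mul, Polynomial.coeff_mul_X_pow', if_pos (Nat.sub_le _ _),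
    Nat.sub_sub_self hi', coeff_X_sub_one_pow_two_mul, hc]
  ring

/-- The reductions modulo `p` of integral power series. -/
noncomputable abbrev redMod (p : ℕ) : ℤ⟦X⟧ →+* (ZMod p)⟦X⟧ := PowerSeries.map (Int.castRingHom (ZMod p))

/-- The Hasse invariant evaluated at the modular function `λ` is the inverse of `θ₃ ^ (2 (p - 1))`
modulo `p`. -/
lemma hasse_theta (p m : ℕ) [Fact p.Prime] (hm : p = 2 * m + 1) :
    ∑ i ∈ range (m + 1), (m.choose i : (ZMod p)⟦X⟧) ^ 2 *
      (redMod p (16 * X * thetaPsi ^ 4)) ^ i * (redMod p (thetaA ^ 4)) ^ (m - i) = 1 := by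
  rw [← sub_eq_zero]
  refine eq_zero_of_mul_eq_mul_expand (b := 1) (w := 1) (by simp) ?_ ?_
  · rw [map_sub, map_one, map_sum, Finset.sum_eq_single 0]
    · simp only [redMod, pow_zero, Nat.choose_zero_right, Nat.cast_one, one_pow, mul_one, one_mul,
        Nat.sub_zero, map_pow, ← coeff_zero_eq_constantCoeff_apply, coeff_map]
      rw [coeff_zero_eq_constantCoeff_apply, constantCoeff_thetaA]
      simp
    · intro i _ hi
      simp [redMod, hi]
    · intro h; simp at h
  · rw [one_mul, one_mul, map_sub, map_one, map_sum]
    congr 1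
    have ha : thetaA ^ 2 = expand 2 two_ne_zero (thetaA ^ 2) +
        4 * X * expand 2 two_ne_zero (thetaPsi ^ 2) := by
      rw [map_pow, map_pow]; exact thetaA_sq
    have h := hasse_landen p m hm (redMod p (expand 2 two_ne_zero (thetaA ^ 2)))
      (redMod p (4 * X * expand 2 two_ne_zero (thetaPsi ^ 2)))
    refine Eq.trans (Eq.trans ?_ h) ?_
    · refine Finset.sum_congr rfl fun i _ => ?_
      rw [← map_add, ← ha]
      congr 2
      · rw [show (4 : (ZMod p)⟦X⟧) = redMod p 4 from (map_ofNat _ 4).symm, ← map_mul, ← map_mul]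
        congr 2
        linear_combination 16 * X * thetaPsi_pow_four
      · rw [← map_pow, ← pow_mul]
    · have hV : expand 2 two_ne_zero (redMod p (16 * X * thetaPsi ^ 4)) =
          (redMod p (4 * X * expand 2 two_ne_zero (thetaPsi ^ 2))) ^ 2 := by
        rw [redMod, ← map_expand, ← map_pow]
        congr 1
        simp only [map_mul, map_pow, expand_X,
          show (expand 2 two_ne_zero (16 : ℤ⟦X⟧)) = 16 from map_ofNat _ 16]
        ring
      have hU : expand 2 two_ne_zero (redMod p (thetaA ^ 4)) =
          (redMod p (expand 2 two_ne_zero (thetaA ^ 2))) ^ 2 := by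
        rw [redMod, ← map_expand, ← map_pow, ← map_pow, ← pow_mul]
      refine Finset.sum_congr rfl fun i _ => ?_
      rw [← hV, ← hU, map_mul (expand (R := ZMod p) 2 _), map_mul (expand (R := ZMod p) 2 _)]
      generalize redMod p (16 * X * thetaPsi ^ 4) = V
      generalize redMod p (thetaA ^ 4) = U
      simp only [map_pow, map_natCast]

end LegendreMoments

namespace LegendreMoments

open PowerSeries

/-- The unit part of the `q`-expansion of `θ₂ ^ (4 e) θ₃ ^ (4 (r - e))`. -/
noncomputable def thetaMono (r e : ℕ) : ℤ⟦X⟧ := thetaA ^ (4 * (r - e)) * thetaPsi ^ (4 * e)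

lemma constantCoeff_thetaMono (r e : ℕ) : constantCoeff (thetaMono r e) = 1 := by
  simp [thetaMono, constantCoeff_thetaA, constantCoeff_thetaPsi]

/-- The diagonal `e`-th matrix coefficient of the Hecke operator `U_p`. -/
noncomputable def traceTerm (r p e : ℕ) : ℤ :=
  coeff e (invOfUnit (thetaMono r e) 1 * heckeU p (X ^ e * (thetaMono r e * thetaW)))

/-- Minus the trace of the Hecke operator `U_p` on forms of level `Γ(2)`. -/
noncomputable def traceS (r p : ℕ) : ℤ := -∑ e ∈ range r, traceTerm r p e

lemma map_heckeU {R S : Type*} [CommRing R] [CommRing S] (φ : R →+* S) (p : ℕ) (f : R⟦X⟧) :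
    PowerSeries.map φ (heckeU p f) = heckeU p (PowerSeries.map φ f) := by
  ext n; simp [heckeU]

lemma constantCoeff_thetaW : constantCoeff thetaW = 1 := by
  simp [thetaW, constantCoeff_thetaA]

lemma traceTerm_zmod (p m r e : ℕ) [Fact p.Prime] (hm : p = 2 * m + 1) (he : e ≤ r) :
    (traceTerm r p e : ZMod p) = (hassePoly (ZMod p) m ^ (2 * r)).coeff ((p - 1) * e) := by
  have hp0 : p ≠ 0 := by omega
  set a := redMod p thetaA with ha
  set s := redMod p thetaPsi with hs
  set W := redMod p thetaW with hWdef
  set gi := redMod p (invOfUnit (thetaMono r e) 1) with hgi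
  set ai := redMod p (invOfUnit thetaA 1) with hai
  set si := redMod p (invOfUnit thetaPsi 1) with hsi
  have haai : a * ai = 1 := by
    rw [ha, hai, ← map_mul, mul_invOfUnit _ _ (by rw [constantCoeff_thetaA]; rfl), map_one]
  have hssi : s * si = 1 := by
    rw [hs, hsi, ← map_mul, thetaPsi_mul_inv, map_one]
  set E := redMod p hauptUnit with hE
  have hE' : E = a ^ 4 * si ^ 4 := by
    rw [hE, hauptUnit, mul_pow, map_mul, map_pow, map_pow]
  have hg : redMod p (thetaMono r e) = a ^ (4 * (r - e)) * s ^ (4 * e) := by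
    rw [thetaMono, map_mul, map_pow, map_pow]
  have hggi : redMod p (thetaMono r e) * gi = 1 := by
    rw [hgi, ← map_mul, mul_invOfUnit _ _ (by rw [constantCoeff_thetaMono]; rfl), map_one]
  have hgi' : gi = ai ^ (4 * (r - e)) * si ^ (4 * e) := by
    have h1 : redMod p (thetaMono r e) * (ai ^ (4 * (r - e)) * si ^ (4 * e)) = 1 := by
      rw [hg]
      calc _ = (a * ai) ^ (4 * (r - e)) * (s * si) ^ (4 * e) := by ring
        _ = 1 := by rw [haai, hssi]; simp
    calc gi = (redMod p (thetaMono r e) * (ai ^ (4 * (r - e)) * si ^ (4 * e))) * gi := by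
          rw [h1, one_mul]
      _ = (redMod p (thetaMono r e) * gi) * (ai ^ (4 * (r - e)) * si ^ (4 * e)) := by ring
      _ = _ := by rw [hggi, one_mul]
  set L : (ZMod p)⟦X⟧ := 16 * X * s ^ 4 * ai ^ 4 with hL
  have hLE : L * E = 16 * X := by
    rw [hL, hE']
    calc _ = 16 * X * (a * ai) ^ 4 * (s * si) ^ 4 := by ring
      _ = _ := by rw [haai, hssi]; ring
  -- the Hasse invariant
  have hH : Polynomial.aeval L (hassePoly (ZMod p) m) = ai ^ (4 * m) := by
    have h := hasse_theta p m hm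
    have hV : redMod p (16 * X * thetaPsi ^ 4) = 16 * X * s ^ 4 := by
      rw [map_mul, map_mul, map_pow, PowerSeries.map_X]
      congr 2
      exact map_ofNat _ 16
    rw [hV, map_pow] at h
    rw [hassePoly, map_sum]
    calc _ = ai ^ (4 * m) * ∑ i ∈ range (m + 1), (m.choose i : (ZMod p)⟦X⟧) ^ 2 *
          (16 * X * s ^ 4) ^ i * (a ^ 4) ^ (m - i) := by
          rw [Finset.mul_sum]
          refine Finset.sum_congr rfl fun i hi => ?_
          have hi' : i ≤ m := by simpa [Nat.lt_succ_iff] using hi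
          have h2 : ai ^ (4 * m) = ai ^ (4 * i) * ai ^ (4 * (m - i)) := by
            rw [← pow_add]; congr 1; omega
          have h3 : ai ^ (4 * (m - i)) * (a ^ 4) ^ (m - i) = 1 := by
            rw [← pow_mul, ← mul_pow, mul_comm, haai, one_pow]
          simp only [map_mul, map_pow, Polynomial.aeval_X, map_natCast]
          rw [h2, hL, mul_pow (16 * X * s ^ 4) (ai ^ 4) i, ← pow_mul]
          linear_combination (-((m.choose i : (ZMod p)⟦X⟧)) ^ 2 * (16 * X * s ^ 4) ^ i *
            ai ^ (4 * i)) * h3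
      _ = _ := by rw [h, mul_one]
  set N := (p - 1) * e with hN
  have hgipow : gi ^ (p - 1) = Polynomial.aeval L (hassePoly (ZMod p) m ^ (2 * r)) * E ^ N := by
    rw [map_pow, hH, hgi', hE', hN, show p - 1 = 2 * m by omega]
    obtain ⟨d, rfl⟩ := Nat.exists_eq_add_of_le he
    rw [Nat.add_sub_cancel_left]
    have h3 : (ai * a) ^ (4 * (2 * m * e)) = 1 := by rw [mul_comm ai, haai, one_pow]
    calc _ = ai ^ (4 * d * (2 * m)) * si ^ (4 * e * (2 * m)) := by ring
      _ = ai ^ (4 * d * (2 * m)) * si ^ (4 * e * (2 * m)) * (ai * a) ^ (4 * (2 * m * e)) := by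
        rw [h3, mul_one]
      _ = _ := by ring
  have key : (traceTerm r p e : ZMod p) = coeff N (gi ^ (p - 1) * W) := by
    rw [traceTerm, ← eq_intCast (Int.castRingHom (ZMod p)), ← coeff_map, map_mul, map_heckeU]
    change coeff e (gi * heckeU p (redMod p (X ^ e * (thetaMono r e * thetaW)))) = _
    rw [map_mul (redMod p), map_mul (redMod p), map_pow (redMod p), PowerSeries.map_X,
      ← heckeU_expand_mul p hp0,
      zmod_expand_eq_pow, heckeU, coeff_mk]
    have : gi ^ p * (X ^ e * (redMod p (thetaMono r e) * redMod p thetaW)) =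
        X ^ e * (gi ^ (p - 1) * W) := by
      have : gi ^ p = gi ^ (p - 1) * gi := by rw [← pow_succ]; congr 1; omega
      rw [this]
      linear_combination X ^ e * gi ^ (p - 1) * W * hggi
    rw [this, show p * e = N + e by
      rw [hN, Nat.sub_mul, one_mul, Nat.sub_add_cancel (Nat.le_mul_of_pos_left _ (by omega))],
      coeff_X_pow_mul]
  rw [key, hgipow]
  generalize hassePoly (ZMod p) m ^ (2 * r) = P
  have hmono : ∀ n, coeff N (L ^ n * E ^ N * W) = if n = N then 1 else 0 := by
    intro n
    rcases le_or_gt n N with hn | hn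
    · have h1 : L ^ n * E ^ N * W = X ^ n * (C (16 ^ n) * (E ^ (N - n) * W)) := by
        have h2 : E ^ N = E ^ n * E ^ (N - n) := by rw [← pow_add]; congr 1; omega
        rw [h2]
        calc _ = (L * E) ^ n * (E ^ (N - n) * W) := by ring
          _ = _ := by rw [hLE, map_pow, show C (16 : ZMod p) = 16 from map_ofNat _ 16]; ring
      rw [h1, coeff_X_pow_mul', if_pos hn, coeff_C_mul]
      split_ifs with hnN
      · rw [hnN]
        have h16 : (16 : ZMod p) ^ N = 1 := by
          rw [hN, mul_comm, pow_mul]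
          refine ZMod.pow_card_sub_one_eq_one (pow_ne_zero _ ?_)
          have h2 : (2 : ZMod p) ≠ 0 := by
            intro h
            have : ((2 : ℕ) : ZMod p) = 0 := by exact_mod_cast h
            rw [ZMod.natCast_eq_zero_iff] at this
            have := Nat.le_of_dvd (by norm_num) this
            have := (Fact.out : p.Prime).two_le
            omega
          rw [show (16 : ZMod p) = 2 ^ 4 by norm_num]
          exact pow_ne_zero _ h2
        rw [h16, Nat.sub_self, pow_zero, one_mul, one_mul, coeff_zero_eq_constantCoeff_apply]
        rw [hWdef, ← coeff_zero_eq_constantCoeff_apply, coeff_map,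
          coeff_zero_eq_constantCoeff_apply, constantCoeff_thetaW, map_one]
      · have := coeff_hauptUnit_pow_mul_thetaW (N - n) (by omega)
        rw [hE, hWdef, ← map_pow, ← map_mul, coeff_map, this, map_zero, mul_zero]
    · rw [if_neg (by omega)]
      have : L ^ n * E ^ N * W = X ^ n * ((16 * s ^ 4 * ai ^ 4) ^ n * E ^ N * W) := by
        rw [hL]; ring
      rw [this, coeff_X_pow_mul', if_neg (by omega)]
  rw [Polynomial.aeval_eq_sum_range, Finset.sum_mul, Finset.sum_mul, map_sum]
  have : ∀ i ∈ range (P.natDegree + 1), coeff N (P.coeff i • L ^ i * E ^ N * W) =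
      if i = N then P.coeff i else 0 := by
    intro i _
    rw [smul_mul_assoc, smul_mul_assoc, coeff_smul, hmono]
    split_ifs <;> simp
  rw [Finset.sum_congr rfl this, Finset.sum_ite_eq']
  split_ifs with h
  · rfl
  · rw [Polynomial.coeff_eq_zero_of_natDegree_lt]
    simpa using h

lemma hassePoly_natDegree_le (R : Type*) [CommRing R] (m : ℕ) : (hassePoly R m).natDegree ≤ m := by
  refine Polynomial.natDegree_sum_le_of_forall_le _ _ fun i hi => ?_
  refine (Polynomial.natDegree_C_mul_X_pow_le _ _).trans ?_
  simpa [Nat.lt_succ_iff] using hi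

lemma hassePoly_coeff_self (R : Type*) [CommRing R] (m : ℕ) : (hassePoly R m).coeff m = 1 := by
  rw [hassePoly, Polynomial.finsetSum_coeff, Finset.sum_eq_single m]
  · simp
  · intro i _ hi
    rw [Polynomial.coeff_C_mul_X_pow, if_neg (Ne.symm hi)]
  · simp

lemma hassePoly_eval_one (p m : ℕ) [Fact p.Prime] (hm : p = 2 * m + 1) :
    (hassePoly (ZMod p) m).eval 1 ^ 2 = 1 := by
  have h1 : (hassePoly (ZMod p) m).eval 1 = ((2 * m).choose m : ZMod p) := by
    rw [hassePoly, Polynomial.eval_finsetSum]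
    simp only [Polynomial.eval_mul, Polynomial.eval_C, Polynomial.eval_pow, Polynomial.eval_X,
      one_pow, mul_one]
    have := Nat.sum_range_choose_sq m
    rw [← Nat.centralBinom_eq_two_mul_choose]
    rw [Nat.centralBinom_eq_two_mul_choose, ← this]
    push_cast
    rfl
  have h2 : ∀ i ≤ 2 * m, ((2 * m).choose i : ZMod p) = (-1) ^ i := by
    intro i
    induction i with
    | zero => simp
    | succ i ih =>
      intro hi
      have h3 : (p.choose (i + 1) : ZMod p) = 0 := by
        rw [ZMod.natCast_eq_zero_iff]
        exact (Fact.out : p.Prime).dvd_choose_self (by omega) (by omega)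
      rw [show p.choose (i + 1) = (2 * m).choose i + (2 * m).choose (i + 1) by
        rw [hm, Nat.choose_succ_succ]] at h3
      push_cast at h3
      rw [ih (by omega)] at h3
      rw [pow_succ]
      linear_combination h3
  rw [h1, h2 m (by omega), ← pow_mul, mul_comm, pow_mul]
  simp

/-- The trace of `U_p` modulo `p` in terms of the Hasse invariant. -/
theorem traceS_zmod (p m r : ℕ) [Fact p.Prime] (hm : p = 2 * m + 1) :
    ((traceS r p - 2 : ℤ) : ZMod p) =
      ∑ l ∈ univ.filter (fun l : ZMod p => l ≠ 0 ∧ l ≠ 1),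
        (hassePoly (ZMod p) m).eval l ^ (2 * r) := by
  set P := hassePoly (ZMod p) m ^ (2 * r) with hP
  have hm0 : 0 < m := by
    have := (Fact.out : p.Prime).two_le
    omega
  have hdeg : P.natDegree ≤ r * (p - 1) := by
    refine Polynomial.natDegree_pow_le.trans ?_
    calc 2 * r * (hassePoly (ZMod p) m).natDegree ≤ 2 * r * m :=
          Nat.mul_le_mul_left _ (hassePoly_natDegree_le _ _)
      _ = _ := by rw [hm, Nat.add_sub_cancel]; ring
  have hlead : P.coeff ((p - 1) * r) = 1 := by
    rw [show (p - 1) * r = (2 * r) * m by rw [hm, Nat.add_sub_cancel]; ring, hP,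
      Polynomial.coeff_pow_of_natDegree_le (hassePoly_natDegree_le _ _), hassePoly_coeff_self,
      one_pow]
  have hunits : ∑ x : (ZMod p)ˣ, P.eval (x : ZMod p) = -∑ e ∈ range (r + 1), P.coeff ((p - 1) * e) := by
    have h1 : ∀ x : ZMod p, P.eval x = ∑ i ∈ range (r * (p - 1) + 1), P.coeff i * x ^ i :=
      fun x => Polynomial.eval_eq_sum_range' (by omega) x
    simp only [h1]
    rw [Finset.sum_comm]
    have h2 : ∀ i ∈ range (r * (p - 1) + 1), ∑ x : (ZMod p)ˣ, P.coeff i * (x : ZMod p) ^ i =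
        if (p - 1) ∣ i then -P.coeff i else 0 := by
      intro i _
      have := FiniteField.sum_pow_units (ZMod p) i
      rw [ZMod.card] at this
      rw [← Finset.mul_sum, this]
      split_ifs <;> simp
    rw [Finset.sum_congr rfl h2, ← Finset.sum_filter, ← Finset.sum_neg_distrib]
    symm
    refine Finset.sum_nbij (fun e => (p - 1) * e) ?_ ?_ ?_ ?_
    · intro e he
      simp only [mem_range, mem_filter] at *
      refine ⟨?_, dvd_mul_right _ _⟩
      have : (p - 1) * e ≤ (p - 1) * r := Nat.mul_le_mul_left _ (by omega)
      rw [mul_comm r]; omega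
    · intro e _ e' _ h
      exact Nat.eq_of_mul_eq_mul_left (by omega) h
    · intro i hi
      simp only [coe_filter, mem_range, Set.mem_ofPred_eq] at hi
      obtain ⟨h3, e, rfl⟩ := hi
      refine ⟨e, ?_, rfl⟩
      simp only [coe_range, Set.mem_Iio]
      have h5 : (p - 1) * e ≤ (p - 1) * r := by rw [mul_comm r] at h3; omega
      have := Nat.le_of_mul_le_mul_left h5 (by omega)
      omega
    · intro e _; rfl
  have hne : ∑ x : (ZMod p)ˣ, P.eval (x : ZMod p) =
      ∑ l ∈ univ.filter (fun l : ZMod p => l ≠ 0), P.eval l := by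
    refine Finset.sum_bij (fun x _ => (x : ZMod p)) ?_ ?_ ?_ ?_
    · intro x _; simp
    · intro x _ y _ h; exact Units.ext h
    · intro l hl
      exact ⟨Units.mk0 l (by simpa using hl), mem_univ _, rfl⟩
    · intro x _; rfl
  have hsplit : ∑ l ∈ univ.filter (fun l : ZMod p => l ≠ 0), P.eval l =
      P.eval 1 + ∑ l ∈ univ.filter (fun l : ZMod p => l ≠ 0 ∧ l ≠ 1), P.eval l := by
    rw [← Finset.sum_erase_add _ _ (a := (1 : ZMod p)) (by simp), add_comm]
    congr 1
    refine Finset.sum_congr ?_ fun _ _ => rfl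
    ext l; simp [and_comm]
  have hev : ∀ l, (hassePoly (ZMod p) m).eval l ^ (2 * r) = P.eval l := by
    intro l; rw [hP, Polynomial.eval_pow]
  have hone : P.eval 1 = 1 := by
    rw [hP, Polynomial.eval_pow, pow_mul, hassePoly_eval_one p m hm, one_pow]
  have htr : ((traceS r p : ℤ) : ZMod p) = -∑ e ∈ range r, P.coeff ((p - 1) * e) := by
    rw [traceS]
    push_cast
    congr 1
    refine Finset.sum_congr rfl fun e he => ?_
    rw [traceTerm_zmod p m r e hm (by simp at he; omega)]
  simp only [hev]
  rw [sum_range_succ, hlead] at hunits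
  push_cast
  rw [htr]
  linear_combination (-1 : ZMod p) * hunits + hne + hsplit + hone

end LegendreMoments

namespace LegendreMoments

open PowerSeries

/-- Integral power series converging absolutely on the open unit disc. -/
def Conv (f : ℤ⟦X⟧) : Prop := ∀ r : ℝ, 0 ≤ r → r < 1 → Summable fun n => |((coeff n f : ℤ) : ℝ)| * r ^ n

/-- The value of an integral power series at a complex number. -/
noncomputable def ev (f : ℤ⟦X⟧) (z : ℂ) : ℂ := ∑' n, ((coeff n f : ℤ) : ℂ) * z ^ n

lemma Conv.summable_norm {f : ℤ⟦X⟧} (hf : Conv f) {z : ℂ} (hz : ‖z‖ < 1) :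
    Summable fun n => ‖((coeff n f : ℤ) : ℂ) * z ^ n‖ := by
  refine (hf ‖z‖ (norm_nonneg _) hz).congr fun n => ?_
  rw [norm_mul, norm_pow, Complex.norm_intCast]

lemma Conv.hasSum {f : ℤ⟦X⟧} (hf : Conv f) {z : ℂ} (hz : ‖z‖ < 1) :
    HasSum (fun n => ((coeff n f : ℤ) : ℂ) * z ^ n) (ev f z) :=
  (hf.summable_norm hz).of_norm.hasSum

lemma Conv.add {f g : ℤ⟦X⟧} (hf : Conv f) (hg : Conv g) : Conv (f + g) := fun r h0 h1 => by
  refine ((hf r h0 h1).add (hg r h0 h1)).of_nonneg_of_le (fun n => by positivity) fun n => ?_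
  rw [← add_mul, map_add]
  push_cast
  exact mul_le_mul_of_nonneg_right (abs_add_le _ _) (pow_nonneg h0 _)

lemma Conv.neg {f : ℤ⟦X⟧} (hf : Conv f) : Conv (-f) := fun r h0 h1 => by
  simpa using hf r h0 h1

lemma Conv.sub {f g : ℤ⟦X⟧} (hf : Conv f) (hg : Conv g) : Conv (f - g) := by
  rw [sub_eq_add_neg]; exact hf.add hg.neg

lemma Conv.mul {f g : ℤ⟦X⟧} (hf : Conv f) (hg : Conv g) : Conv (f * g) := fun r h0 h1 => by
  have h2 : ∀ h : ℤ⟦X⟧, Conv h → Summable fun n => ‖((coeff n h : ℤ) : ℝ) * r ^ n‖ := fun h hh => by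
    refine (hh r h0 h1).congr fun n => ?_
    rw [norm_mul, Real.norm_eq_abs, Real.norm_of_nonneg (pow_nonneg h0 _)]
  refine (summable_norm_sum_mul_antidiagonal_of_summable_norm (h2 f hf) (h2 g hg)).congr fun n => ?_
  rw [coeff_mul, ← Real.norm_eq_abs, ← Real.norm_of_nonneg (pow_nonneg h0 n), ← norm_mul]
  congr 1
  push_cast
  rw [Finset.sum_mul]
  refine Finset.sum_congr rfl fun x hx => ?_
  rw [← HasAntidiagonal.mem_antidiagonal.1 hx, pow_add]
  ring

lemma conv_of_finite_support {f : ℤ⟦X⟧} (N : ℕ) (h : ∀ n, N ≤ n → coeff n f = 0) : Conv f :=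
  fun r _ _ => summable_of_ne_finset_zero (s := range N) fun n hn => by
    rw [h n (by simpa using hn)]; simp

lemma conv_one : Conv 1 := conv_of_finite_support 1 fun n hn => by
  rw [coeff_one, if_neg (by omega)]

lemma conv_X : Conv X := conv_of_finite_support 2 fun n hn => by
  rw [coeff_X, if_neg (by omega)]

lemma conv_natCast (k : ℕ) : Conv (k : ℤ⟦X⟧) := conv_of_finite_support 1 fun n hn => by
  rw [show (k : ℤ⟦X⟧) = C (k : ℤ) by simp, coeff_C, if_neg (by omega)]

lemma conv_ofNat (k : ℕ) [k.AtLeastTwo] : Conv (OfNat.ofNat k : ℤ⟦X⟧) := conv_natCast k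

lemma Conv.pow {f : ℤ⟦X⟧} (hf : Conv f) (n : ℕ) : Conv (f ^ n) := by
  induction n with
  | zero => rw [pow_zero]; exact conv_one
  | succ n ih => rw [pow_succ]; exact ih.mul hf

section ev
variable {f g : ℤ⟦X⟧} {z : ℂ}

lemma ev_add (hf : Conv f) (hg : Conv g) (hz : ‖z‖ < 1) : ev (f + g) z = ev f z + ev g z := by
  refine HasSum.unique ((hf.add hg).hasSum hz) ?_
  refine ((hf.hasSum hz).add (hg.hasSum hz)).congr_fun ?_
  intro n; simp [add_mul]

lemma ev_neg : ev (-f) z = - ev f z := by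
  rw [ev, ev, ← tsum_neg]; simp

lemma ev_sub (hf : Conv f) (hg : Conv g) (hz : ‖z‖ < 1) : ev (f - g) z = ev f z - ev g z := by
  rw [sub_eq_add_neg, ev_add hf hg.neg hz, ev_neg, sub_eq_add_neg]

lemma ev_mul (hf : Conv f) (hg : Conv g) (hz : ‖z‖ < 1) : ev (f * g) z = ev f z * ev g z := by
  rw [ev, ev, ev, tsum_mul_tsum_eq_tsum_sum_antidiagonal_of_summable_norm (hf.summable_norm hz)
    (hg.summable_norm hz)]
  refine tsum_congr fun n => ?_
  rw [coeff_mul]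
  push_cast
  rw [Finset.sum_mul]
  refine Finset.sum_congr rfl fun x hx => ?_
  rw [← HasAntidiagonal.mem_antidiagonal.1 hx, pow_add]
  ring

lemma ev_one : ev 1 z = 1 := by
  rw [ev, tsum_eq_single 0]
  · simp
  · intro n hn; rw [coeff_one, if_neg hn]; simp

lemma ev_X : ev X z = z := by
  rw [ev, tsum_eq_single 1]
  · simp
  · intro n hn; rw [coeff_X, if_neg hn]; simp

lemma ev_natCast (k : ℕ) : ev (k : ℤ⟦X⟧) z = k := by
  rw [ev, tsum_eq_single 0]
  · rw [show (k : ℤ⟦X⟧) = C (k : ℤ) by simp]; simp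
  · intro n hn
    rw [show (k : ℤ⟦X⟧) = C (k : ℤ) by simp, coeff_C, if_neg hn]; simp

lemma ev_ofNat (k : ℕ) [k.AtLeastTwo] : ev (OfNat.ofNat k : ℤ⟦X⟧) z = OfNat.ofNat k := ev_natCast k

lemma ev_pow (hf : Conv f) (hz : ‖z‖ < 1) (n : ℕ) : ev (f ^ n) z = ev f z ^ n := by
  induction n with
  | zero => rw [pow_zero, pow_zero, ev_one]
  | succ n ih => rw [pow_succ, pow_succ, ev_mul (hf.pow n) hf hz, ih]

lemma ev_zero_right : ev f 0 = constantCoeff f := by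
  rw [ev, tsum_eq_single 0]
  · simp
  · intro n hn; simp [hn]

lemma hasSum_expand (hf : Conv f) (k : ℕ) (hk : k ≠ 0) (hz : ‖z‖ < 1) :
    HasSum (fun n => ((coeff n (expand k hk f) : ℤ) : ℂ) * z ^ n) (ev f (z ^ k)) := by
  have hz' : ‖z ^ k‖ < 1 := by rw [norm_pow]; exact pow_lt_one₀ (norm_nonneg _) hz hk
  have h := hf.hasSum hz'
  have hinj : Function.Injective fun n : ℕ => k * n :=
    fun a b h => Nat.eq_of_mul_eq_mul_left (Nat.pos_of_ne_zero hk) h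
  rw [← hinj.hasSum_iff]
  · refine h.congr_fun ?_
    intro n
    simp [coeff_expand_mul, pow_mul]
  · intro n hn
    rw [coeff_expand_of_not_dvd]
    · simp
    · rintro ⟨d, rfl⟩; exact hn ⟨d, rfl⟩

lemma ev_expand (hf : Conv f) (k : ℕ) (hk : k ≠ 0) (hz : ‖z‖ < 1) :
    ev (expand k hk f) z = ev f (z ^ k) := (hasSum_expand hf k hk hz).tsum_eq

lemma Conv.expand (hf : Conv f) (k : ℕ) (hk : k ≠ 0) : Conv (expand k hk f) := fun r h0 h1 => by
  have hinj : Function.Injective fun n : ℕ => k * n :=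
    fun a b h => Nat.eq_of_mul_eq_mul_left (Nat.pos_of_ne_zero hk) h
  rw [← hinj.summable_iff]
  · refine (hf (r ^ k) (pow_nonneg h0 _) (pow_lt_one₀ h0 h1 hk)).congr ?_
    intro n
    simp [coeff_expand_mul, pow_mul]
  · intro n hn
    rw [coeff_expand_of_not_dvd]
    · simp
    · rintro ⟨d, rfl⟩; exact hn ⟨d, rfl⟩

lemma Conv.qDeriv (hf : Conv f) : Conv (qDeriv f) := fun r h0 h1 => by
  obtain ⟨s, hs, hs1⟩ := exists_between h1
  have hs0 : 0 < s := h0.trans_lt hs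
  have hlim : Tendsto (fun n : ℕ => (n : ℝ) * (r / s) ^ n) atTop (nhds 0) :=
    tendsto_self_mul_const_pow_of_lt_one (by positivity) ((div_lt_one hs0).2 hs)
  obtain ⟨B, hB⟩ := hlim.bddAbove_range
  refine ((hf s hs0.le hs1).mul_left B).of_nonneg_of_le (fun n => by positivity) fun n => ?_
  have := hB ⟨n, rfl⟩
  rw [coeff_qDeriv]
  push_cast
  rw [abs_mul, Nat.abs_cast]
  calc _ = (n * (r / s) ^ n) * (|((coeff n f : ℤ) : ℝ)| * s ^ n) := by
        rw [div_pow]; field_simp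
    _ ≤ _ := mul_le_mul_of_nonneg_right this (by positivity)

lemma hasDerivAt_ev (hf : Conv f) (hz : ‖z‖ < 1) :
    HasDerivAt (ev f) (∑' n, ((coeff n f : ℤ) : ℂ) * (n * z ^ (n - 1))) z := by
  obtain ⟨s, hs, hs1⟩ := exists_between hz
  have hs0 : 0 < s := (norm_nonneg _).trans_lt hs
  have hsum : Summable fun n : ℕ => |((coeff n f : ℤ) : ℝ)| * (n * s ^ (n - 1)) := by
    refine ((hf.qDeriv s hs0.le hs1).mul_left s⁻¹).congr fun n => ?_
    rw [coeff_qDeriv]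
    push_cast
    rw [abs_mul, Nat.abs_cast]
    rcases n with _ | n
    · simp
    · rw [Nat.add_sub_cancel, pow_succ]; field_simp
  refine hasDerivAt_tsum_of_isPreconnected (t := Metric.ball (0 : ℂ) s) (y₀ := 0) hsum
    Metric.isOpen_ball (convex_ball _ _).isPreconnected
    (fun n y _ => ((hasDerivAt_pow n y).const_mul ((coeff n f : ℤ) : ℂ))) ?_ (by simpa using hs0)
    ((hf.hasSum (by simp)).summable) (by simpa using hs)
  intro n y hy
  have hy' : ‖y‖ ≤ s := by simpa using (Metric.mem_ball.1 hy).le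
  rw [norm_mul, norm_mul, norm_pow, Complex.norm_intCast, Complex.norm_natCast]
  gcongr

lemma ev_qDeriv : ev (qDeriv f) z = z * ∑' n, ((coeff n f : ℤ) : ℂ) * (n * z ^ (n - 1)) := by
  rw [ev, ← tsum_mul_left]
  refine tsum_congr fun n => ?_
  rw [coeff_qDeriv]
  push_cast
  rcases n with _ | n
  · simp
  · rw [Nat.add_sub_cancel, pow_succ]; ring

lemma continuousAt_ev (hf : Conv f) (hz : ‖z‖ < 1) : ContinuousAt (ev f) z :=
  (hasDerivAt_ev hf hz).continuousAt

/-- The generating series of a family with summable powers. -/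
lemma hasSum_genSeries {ι : Type*} (f : ι → ℕ) (hfin : ∀ n, Finite {i // f i = n}) {E : Type*}
    [NormedField E] [CompleteSpace E] {w : E} (hs : Summable fun i => w ^ f i) :
    HasSum (fun n => ((coeff n (genSeries f) : ℤ) : E) * w ^ n) (∑' i, w ^ f i) := by
  have h := (Equiv.sigmaFiberEquiv f).hasSum_iff.2 hs.hasSum
  refine (h.sigma (fun n => ?_) : HasSum _ _)
  have := Fintype.ofFinite {i // f i = n}
  have h5 := hasSum_fintype fun c : {i // f i = n} =>
    ((fun i => w ^ f i) ∘ ⇑(Equiv.sigmaFiberEquiv f)) ⟨n, c⟩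
  convert h5 using 1
  rw [Finset.sum_congr rfl (g := fun _ => w ^ n)]
  · rw [coeff_genSeries]
    simp [Nat.card_eq_fintype_card]
  · rintro ⟨i, hi⟩ _
    simp [Equiv.sigmaFiberEquiv, hi]

lemma conv_genSeries {ι : Type*} (f : ι → ℕ) (hfin : ∀ n, Finite {i // f i = n})
    (hs : ∀ r : ℝ, 0 ≤ r → r < 1 → Summable fun i => r ^ f i) : Conv (genSeries f) :=
  fun r h0 h1 => by
    refine (hasSum_genSeries f hfin (hs r h0 h1)).summable.congr fun n => ?_
    rw [coeff_genSeries]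
    simp

end ev

lemma summable_pow_sq {r : ℝ} (h0 : 0 ≤ r) (h1 : r < 1) :
    Summable fun m : ℤ => r ^ (m ^ 2).toNat := by
  have key : Summable fun n : ℕ => r ^ ((n : ℤ) ^ 2).toNat := by
    refine (summable_geometric_of_lt_one h0 h1).of_nonneg_of_le (fun n => by positivity) fun n => ?_
    refine pow_le_pow_of_le_one h0 h1.le ?_
    zify
    rw [Int.toNat_of_nonneg (by positivity)]
    nlinarith [Int.natCast_nonneg n, Int.natCast_nonneg (n-1), sq_nonneg ((n:ℤ) - 1), (by
      rcases n with _ | n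
      · simp
      · push_cast; nlinarith : (n : ℤ) ≤ (n : ℤ) ^ 2)]
  refine Summable.of_nat_of_neg key ?_
  simpa using key

lemma conv_thetaA : Conv thetaA :=
  conv_genSeries _ finite_sq_fibre fun _ h0 h1 => summable_pow_sq h0 h1

lemma conv_thetaPsi : Conv thetaPsi :=
  conv_genSeries _ finite_pronic_fibre fun r h0 h1 =>
    (summable_geometric_of_lt_one h0 h1).of_nonneg_of_le (fun n => by positivity) fun n =>
      pow_le_pow_of_le_one h0 h1.le (by nlinarith)

lemma conv_thetaW : Conv thetaW :=
  (conv_thetaA.pow 4).sub (((conv_ofNat 16).mul conv_X).mul (conv_thetaPsi.pow 4))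

end LegendreMoments

namespace LegendreMoments

open PowerSeries

section disc
variable {z : ℂ}

lemma norm_sq_lt_one (hz : ‖z‖ < 1) : ‖z ^ 2‖ < 1 := by
  rw [norm_pow]; exact pow_lt_one₀ (norm_nonneg _) hz two_ne_zero

lemma ev_thetaA_sq (hz : ‖z‖ < 1) :
    ev thetaA z ^ 2 = ev thetaA (z ^ 2) ^ 2 + 4 * z * ev thetaPsi (z ^ 2) ^ 2 := by
  have h := congrArg (fun f => ev f z) thetaA_sq
  have hA := conv_thetaA.expand 2 two_ne_zero
  have hP := conv_thetaPsi.expand 2 two_ne_zero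
  rw [ev_pow conv_thetaA hz, ev_add (hA.pow 2) (((conv_ofNat 4).mul conv_X).mul (hP.pow 2)) hz,
    ev_mul ((conv_ofNat 4).mul conv_X) (hP.pow 2) hz, ev_mul (conv_ofNat 4) conv_X hz,
    ev_pow hA hz, ev_pow hP hz, ev_X, ev_ofNat, ev_expand conv_thetaA _ _ hz,
    ev_expand conv_thetaPsi _ _ hz] at h
  exact h

lemma ev_thetaA_neg_sq (hz : ‖z‖ < 1) :
    ev thetaA (-z) ^ 2 = ev thetaA (z ^ 2) ^ 2 - 4 * z * ev thetaPsi (z ^ 2) ^ 2 := by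
  rw [ev_thetaA_sq (by rwa [norm_neg]), neg_sq]; ring

lemma ev_thetaPsi_sq (hz : ‖z‖ < 1) :
    ev thetaPsi z ^ 2 = ev thetaPsi (z ^ 2) * ev thetaA (z ^ 2) := by
  have h := congrArg (fun f => ev f z) thetaPsi_sq
  have hA := conv_thetaA.expand 2 two_ne_zero
  have hP := conv_thetaPsi.expand 2 two_ne_zero
  rwa [ev_pow conv_thetaPsi hz, ev_mul hP hA hz, ev_expand conv_thetaA _ _ hz,
    ev_expand conv_thetaPsi _ _ hz] at h

/-- Jacobi's identity. -/
lemma ev_thetaA_neg_pow_four (hz : ‖z‖ < 1) :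
    ev thetaA (-z) ^ 4 = ev thetaA z ^ 4 - 16 * z * ev thetaPsi z ^ 4 := by
  have h1 := ev_thetaA_sq hz
  have h2 := ev_thetaA_neg_sq hz
  have h3 := ev_thetaPsi_sq hz
  have : ev thetaA (-z) ^ 4 = (ev thetaA (-z) ^ 2) ^ 2 := by ring
  rw [this, h2, show ev thetaA z ^ 4 = (ev thetaA z ^ 2) ^ 2 by ring, h1,
    show ev thetaPsi z ^ 4 = (ev thetaPsi z ^ 2) ^ 2 by ring, h3]
  ring

lemma ev_thetaW (hz : ‖z‖ < 1) : ev thetaW z = ev thetaA z ^ 4 - 16 * z * ev thetaPsi z ^ 4 := by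
  rw [thetaW, ev_sub (conv_thetaA.pow 4) (((conv_ofNat 16).mul conv_X).mul (conv_thetaPsi.pow 4)) hz,
    ev_mul ((conv_ofNat 16).mul conv_X) (conv_thetaPsi.pow 4) hz, ev_mul (conv_ofNat 16) conv_X hz,
    ev_pow conv_thetaA hz, ev_pow conv_thetaPsi hz, ev_X, ev_ofNat]

lemma ne_zero_of_iterate {F : ℂ → ℂ} (hc : ContinuousAt F 0) (h0 : F 0 ≠ 0) (s : ℂ → ℂ)
    (hs : ∀ z, ‖s z‖ = ‖z‖ ^ 2) (hF : ∀ z, ‖z‖ < 1 → F z = 0 → F (s z) = 0) (hz : ‖z‖ < 1) :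
    F z ≠ 0 := by
  intro h
  have hn : ∀ n : ℕ, F (s^[n] z) = 0 ∧ ‖s^[n] z‖ ≤ ‖z‖ ^ (n + 1) := by
    intro n
    induction n with
    | zero => simp [h]
    | succ n ih =>
      have h1 : ‖s^[n] z‖ < 1 :=
        ih.2.trans_lt (pow_lt_one₀ (norm_nonneg _) hz (by omega))
      rw [Function.iterate_succ_apply']
      refine ⟨hF _ h1 ih.1, ?_⟩
      rw [hs]
      calc ‖s^[n] z‖ ^ 2 ≤ (‖z‖ ^ (n + 1)) ^ 2 := by gcongr; exact ih.2
        _ = ‖z‖ ^ ((n + 1) * 2) := by rw [← pow_mul]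
        _ ≤ _ := pow_le_pow_of_le_one (norm_nonneg _) hz.le (by omega)
  have ht : Tendsto (fun n => s^[n] z) atTop (nhds 0) := by
    refine squeeze_zero_norm (fun n => (hn n).2) ?_
    exact (tendsto_pow_atTop_nhds_zero_of_lt_one (norm_nonneg _) hz).comp (tendsto_add_atTop_nat 1)
  have := hc.tendsto.comp ht
  have h2 : Tendsto (F ∘ fun n => s^[n] z) atTop (nhds 0) := by
    refine tendsto_const_nhds.congr fun n => ?_
    simp [(hn n).1]
  exact h0 (tendsto_nhds_unique this h2)

lemma ev_thetaA_ne_zero (hz : ‖z‖ < 1) : ev thetaA z ≠ 0 := by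
  refine ne_zero_of_iterate (continuousAt_ev conv_thetaA (by simp)) ?_ (fun z => -z ^ 2)
    (fun z => by simp) (fun w hw h => ?_) hz
  · simp [ev_zero_right, constantCoeff_thetaA]
  · have h1 := ev_thetaA_sq hw
    have h2 := ev_thetaA_neg_sq hw
    have h3 := ev_thetaA_neg_pow_four (norm_sq_lt_one hw)
    have h4 : ev thetaA (-w ^ 2) ^ 4 = (ev thetaA w * ev thetaA (-w)) ^ 2 := by
      rw [h3, mul_pow, h1, h2]; ring
    rw [h, zero_mul, zero_pow two_ne_zero] at h4
    exact pow_eq_zero_iff (by norm_num) |>.1 h4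

lemma ev_thetaPsi_ne_zero (hz : ‖z‖ < 1) : ev thetaPsi z ≠ 0 := by
  refine ne_zero_of_iterate (continuousAt_ev conv_thetaPsi (by simp)) ?_ (fun z => z ^ 2)
    (fun z => by simp) (fun w hw h => ?_) hz
  · simp [ev_zero_right, constantCoeff_thetaPsi]
  · have h3 := ev_thetaPsi_sq hw
    rw [h, zero_pow two_ne_zero] at h3
    exact (mul_eq_zero.1 h3.symm).resolve_right (ev_thetaA_ne_zero (norm_sq_lt_one hw))

end disc

/-- The nome `exp (π i τ)`. -/
noncomputable def qq (τ : ℂ) : ℂ := Complex.exp (Real.pi * Complex.I * τ)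

lemma norm_qq (τ : ℂ) : ‖qq τ‖ = Real.exp (-Real.pi * τ.im) := by
  rw [qq, Complex.norm_exp]; simp

lemma norm_qq_lt_one {τ : ℂ} (hτ : 0 < τ.im) : ‖qq τ‖ < 1 := by
  rw [norm_qq, Real.exp_lt_one_iff]
  have := Real.pi_pos
  nlinarith

lemma qq_ne_zero (τ : ℂ) : qq τ ≠ 0 := Complex.exp_ne_zero _

lemma qq_add (τ σ : ℂ) : qq (τ + σ) = qq τ * qq σ := by
  rw [qq, qq, qq, ← Complex.exp_add]; ring_nf

lemma qq_one : qq 1 = -1 := by rw [qq, mul_one, Complex.exp_pi_mul_I]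

lemma qq_add_one (τ : ℂ) : qq (τ + 1) = -qq τ := by rw [qq_add, qq_one]; ring

lemma qq_natCast_mul (n : ℕ) (τ : ℂ) : qq (n * τ) = qq τ ^ n := by
  rw [qq, qq, ← Complex.exp_nat_mul]; ring_nf

lemma hasDerivAt_qq (τ : ℂ) : HasDerivAt qq (Real.pi * Complex.I * qq τ) τ := by
  have := ((hasDerivAt_id τ).const_mul (Real.pi * Complex.I : ℂ)).cexp
  refine this.congr_deriv ?_
  simp [qq, mul_comm]

/-- The function `θ₃ ^ 4`. -/
noncomputable def uu (τ : ℂ) : ℂ := ev thetaA (qq τ) ^ 4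

/-- The function `θ₂ ^ 4`. -/
noncomputable def vv (τ : ℂ) : ℂ := 16 * qq τ * ev thetaPsi (qq τ) ^ 4

/-- The function `θ₄ ^ 4`. -/
noncomputable def ww (τ : ℂ) : ℂ := ev thetaA (-qq τ) ^ 4

/-- The modular function `1 / λ`. -/
noncomputable def xx (τ : ℂ) : ℂ := uu τ / vv τ

section upper
variable {τ : ℂ}

lemma ww_eq (hτ : 0 < τ.im) : ww τ = uu τ - vv τ := ev_thetaA_neg_pow_four (norm_qq_lt_one hτ)

lemma ww_eq_ev (hτ : 0 < τ.im) : ww τ = ev thetaW (qq τ) := by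
  rw [ev_thetaW (norm_qq_lt_one hτ), ww_eq hτ]; rfl

lemma uu_ne_zero (hτ : 0 < τ.im) : uu τ ≠ 0 :=
  pow_ne_zero _ (ev_thetaA_ne_zero (norm_qq_lt_one hτ))

lemma vv_ne_zero (hτ : 0 < τ.im) : vv τ ≠ 0 :=
  mul_ne_zero (mul_ne_zero (by norm_num) (qq_ne_zero _))
    (pow_ne_zero _ (ev_thetaPsi_ne_zero (norm_qq_lt_one hτ)))

lemma ww_ne_zero (hτ : 0 < τ.im) : ww τ ≠ 0 :=
  pow_ne_zero _ (ev_thetaA_ne_zero (by rw [norm_neg]; exact norm_qq_lt_one hτ))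

lemma xx_ne_zero (hτ : 0 < τ.im) : xx τ ≠ 0 := div_ne_zero (uu_ne_zero hτ) (vv_ne_zero hτ)

lemma xx_sub_one (hτ : 0 < τ.im) : xx τ - 1 = ww τ / vv τ := by
  rw [xx, ww_eq hτ, sub_div, div_self (vv_ne_zero hτ)]

lemma xx_ne_one (hτ : 0 < τ.im) : xx τ ≠ 1 := by
  rw [← sub_ne_zero, xx_sub_one hτ]
  exact div_ne_zero (ww_ne_zero hτ) (vv_ne_zero hτ)

lemma uu_add_one (τ : ℂ) : uu (τ + 1) = ww τ := by rw [uu, ww, qq_add_one]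

lemma ww_add_one (τ : ℂ) : ww (τ + 1) = uu τ := by rw [uu, ww, qq_add_one, neg_neg]

lemma vv_add_one (hτ : 0 < τ.im) : vv (τ + 1) = -vv τ := by
  have h1 := ww_eq (τ := τ + 1) (by simpa using hτ)
  rw [uu_add_one, ww_add_one, ww_eq hτ] at h1
  linear_combination h1

lemma jacobiTheta_eq_ev (hτ : 0 < τ.im) : jacobiTheta τ = ev thetaA (qq τ) := by
  have hs : Summable fun m : ℤ => qq τ ^ (m ^ 2).toNat := by
    refine Summable.of_norm ?_
    simp only [norm_pow]
    exact summable_pow_sq (norm_nonneg _) (norm_qq_lt_one hτ)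
  rw [ev, show thetaA = genSeries fun m : ℤ => (m ^ 2).toNat from rfl,
    (hasSum_genSeries _ finite_sq_fibre hs).tsum_eq, jacobiTheta]
  refine tsum_congr fun m => ?_
  rw [qq, ← Complex.exp_nat_mul]
  congr 1
  have : (((m ^ 2).toNat : ℕ) : ℂ) = (m : ℂ) ^ 2 := by
    rw [← Int.cast_natCast, Int.toNat_of_nonneg (sq_nonneg m)]; push_cast; rfl
  rw [this]; ring

lemma im_neg_one_div (hτ : 0 < τ.im) : 0 < (-1 / τ).im := by
  have := UpperHalfPlane.im_inv_neg_coe_pos ⟨τ, hτ⟩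
  have h2 : -1 / τ = (-τ)⁻¹ := by rw [inv_neg, neg_div, one_div]
  rw [h2]; exact this

lemma ev_thetaA_S_sq (hτ : 0 < τ.im) :
    ev thetaA (qq (-1 / τ)) ^ 2 = (-Complex.I * τ) * ev thetaA (qq τ) ^ 2 := by
  have h := jacobiTheta_S_smul ⟨τ, hτ⟩
  have h1 : ((ModularGroup.S • (⟨τ, hτ⟩ : UpperHalfPlane) : UpperHalfPlane) : ℂ) = -1 / τ := by
    rw [UpperHalfPlane.modular_S_smul]
    simp [neg_div]
  rw [h1] at h
  rw [← jacobiTheta_eq_ev (im_neg_one_div hτ), ← jacobiTheta_eq_ev hτ, h, mul_pow]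
  congr 1
  rw [one_div, show (2⁻¹ : ℂ) = ((2 : ℕ) : ℂ)⁻¹ by norm_num, Complex.cpow_nat_inv_pow _ two_ne_zero]

lemma uu_S (hτ : 0 < τ.im) : uu (-1 / τ) = -τ ^ 2 * uu τ := by
  have h := ev_thetaA_S_sq hτ
  rw [uu, uu, show (4 : ℕ) = 2 * 2 by norm_num, pow_mul, pow_mul, h, mul_pow, mul_pow, neg_sq,
    Complex.I_sq]
  ring

lemma ww_S (hτ : 0 < τ.im) : ww (-1 / τ) = -τ ^ 2 * vv τ := by
  have hτ2 : 0 < (τ / 2).im := by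
    rw [show τ / 2 = τ * ((1 / 2 : ℝ) : ℂ) by push_cast; ring, Complex.im_mul_ofReal]; linarith
  have hS := im_neg_one_div hτ
  have hτ0 : τ ≠ 0 := by rintro rfl; simp at hτ
  have hq : qq τ = qq (τ / 2) ^ 2 := by
    rw [← qq_natCast_mul]; congr 1; push_cast; ring
  have hq2 : qq (-1 / (τ / 2)) = qq (-1 / τ) ^ 2 := by
    rw [← qq_natCast_mul]; congr 1; push_cast; field_simp
  have h1 := ev_thetaA_sq (norm_qq_lt_one hτ2)
  have h2 := ev_thetaA_neg_sq (norm_qq_lt_one hS)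
  have h2' := ev_thetaA_sq (norm_qq_lt_one hS)
  have h3 := ev_thetaA_S_sq hτ
  have h4 := ev_thetaA_S_sq hτ2
  rw [hq2] at h4
  rw [← hq] at h1
  have h5 : ev thetaA (-qq (-1 / τ)) ^ 2 = (-Complex.I * τ) * (4 * qq (τ / 2) * ev thetaPsi (qq τ) ^ 2) := by
    linear_combination h2 + h2' - h3 + 2 * h4 - Complex.I * τ * h1
  rw [ww, vv, show ∀ a : ℂ, a ^ 4 = (a ^ 2) ^ 2 from fun a => by ring, h5, hq]
  linear_combination 16 * τ ^ 2 * qq (τ / 2) ^ 2 * ev thetaPsi (qq (τ / 2) ^ 2) ^ 4 * Complex.I_sq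

lemma vv_S (hτ : 0 < τ.im) : vv (-1 / τ) = -τ ^ 2 * ww τ := by
  have h1 := ww_eq (im_neg_one_div hτ)
  rw [ww_S hτ, uu_S hτ] at h1
  rw [ww_eq hτ]
  linear_combination h1

lemma hasDerivAt_ev_qq {f : ℤ⟦X⟧} (hf : Conv f) (hτ : 0 < τ.im) :
    HasDerivAt (fun τ => ev f (qq τ)) (Real.pi * Complex.I * ev (qDeriv f) (qq τ)) τ := by
  have := (hasDerivAt_ev hf (norm_qq_lt_one hτ)).comp τ (hasDerivAt_qq τ)
  refine this.congr_deriv ?_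
  rw [ev_qDeriv]; ring

lemma isOpen_upper : IsOpen {τ : ℂ | 0 < τ.im} := isOpen_lt continuous_const Complex.continuous_im

lemma differentiableAt_uu (hτ : 0 < τ.im) : DifferentiableAt ℂ uu τ :=
  ((hasDerivAt_ev_qq conv_thetaA hτ).differentiableAt).pow 4

lemma differentiableAt_vv (hτ : 0 < τ.im) : DifferentiableAt ℂ vv τ :=
  ((hasDerivAt_qq τ).differentiableAt.const_mul 16).mul
    (((hasDerivAt_ev_qq conv_thetaPsi hτ).differentiableAt).pow 4)

lemma differentiableAt_ww (hτ : 0 < τ.im) : DifferentiableAt ℂ ww τ := by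
  refine ((differentiableAt_uu hτ).sub (differentiableAt_vv hτ)).congr_of_eventuallyEq ?_
  filter_upwards [isOpen_upper.mem_nhds hτ] with σ hσ
  exact ww_eq hσ

lemma hasDerivAt_xx (hτ : 0 < τ.im) :
    HasDerivAt xx (Real.pi * Complex.I * (-(ww τ * xx τ))) τ := by
  have hz := norm_qq_lt_one hτ
  have hf := congrArg (fun f => ev f (qq τ)) qDeriv_thetaA_thetaPsi
  have cA := conv_thetaA.pow 2
  have cP := conv_thetaPsi.pow 2
  rw [ev_sub ((cA.mul cP).add (((conv_ofNat 2).mul cA).mul cP.qDeriv))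
      (((conv_ofNat 2).mul cP).mul cA.qDeriv) hz,
    ev_add (cA.mul cP) (((conv_ofNat 2).mul cA).mul cP.qDeriv) hz,
    ev_mul ((conv_ofNat 2).mul cA) cP.qDeriv hz, ev_mul ((conv_ofNat 2).mul cP) cA.qDeriv hz,
    ev_mul (conv_ofNat 2) cA hz, ev_mul (conv_ofNat 2) cP hz, ev_mul (cA.mul cP) conv_thetaW hz,
    ev_mul cA cP hz, ev_ofNat, ← ww_eq_ev hτ] at hf
  have hA := hasDerivAt_ev_qq cA hτ
  have hP := hasDerivAt_ev_qq cP hτ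
  have hx : (fun τ => ev (thetaA ^ 2) (qq τ) ^ 2 / (16 * qq τ * ev (thetaPsi ^ 2) (qq τ) ^ 2))
      =ᶠ[nhds τ] xx := by
    filter_upwards [isOpen_upper.mem_nhds hτ] with σ hσ
    have hz := norm_qq_lt_one hσ
    rw [xx, uu, vv, ev_pow conv_thetaA hz, ev_pow conv_thetaPsi hz, ← pow_mul, ← pow_mul]
  have hA0 : ev (thetaA ^ 2) (qq τ) ≠ 0 := by
    rw [ev_pow conv_thetaA hz]; exact pow_ne_zero _ (ev_thetaA_ne_zero hz)
  have hP0 : ev (thetaPsi ^ 2) (qq τ) ≠ 0 := by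
    rw [ev_pow conv_thetaPsi hz]; exact pow_ne_zero _ (ev_thetaPsi_ne_zero hz)
  have hq0 := qq_ne_zero τ
  refine HasDerivAt.congr_of_eventuallyEq ?_ hx.symm
  rw [← hx.eq_of_nhds]
  refine ((hA.fun_pow 2).fun_div (((hasDerivAt_qq τ).const_mul 16).fun_mul (hP.fun_pow 2))
    (mul_ne_zero (mul_ne_zero (by norm_num) hq0) (pow_ne_zero _ hP0))).congr_deriv ?_
  generalize ev (thetaA ^ 2) (qq τ) = a at *
  generalize ev (thetaPsi ^ 2) (qq τ) = b at *
  generalize ev (qDeriv (thetaA ^ 2)) (qq τ) = a' at *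
  generalize ev (qDeriv (thetaPsi ^ 2)) (qq τ) = b' at *
  generalize qq τ = q at *
  field_simp
  push_cast
  ring_nf
  linear_combination (-(a * b)) * hf

lemma differentiableAt_xx (hτ : 0 < τ.im) : DifferentiableAt ℂ xx τ :=
  (hasDerivAt_xx hτ).differentiableAt

end upper

end LegendreMoments

namespace LegendreMoments

open Matrix MatrixGroups

/-- The denominator `c τ + d` of the Möbius action of an integer matrix. -/
noncomputable def den (M : Matrix (Fin 2) (Fin 2) ℤ) (τ : ℂ) : ℂ := M 1 0 * τ + M 1 1

/-- The Möbius action of an integer matrix. -/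
noncomputable def mob (M : Matrix (Fin 2) (Fin 2) ℤ) (τ : ℂ) : ℂ :=
  (M 0 0 * τ + M 0 1) / den M τ

section mobius
variable {M N : Matrix (Fin 2) (Fin 2) ℤ} {τ : ℂ}

lemma den_ne_zero (hM : M.det ≠ 0) (hτ : 0 < τ.im) : den M τ ≠ 0 := by
  intro h
  have him := congrArg Complex.im h
  have hre := congrArg Complex.re h
  simp [den] at him hre
  rcases him with h1 | h1
  · rw [h1] at hre
    simp at hre
    exact hM (by rw [Matrix.det_fin_two, h1, hre]; ring)
  · exact hτ.ne' h1

lemma im_mob (M : Matrix (Fin 2) (Fin 2) ℤ) (τ : ℂ) :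
    (mob M τ).im = M.det * τ.im / Complex.normSq (den M τ) := by
  rw [mob, Complex.div_im, ← sub_div, Matrix.det_fin_two]
  congr 1
  simp [den]
  ring

lemma im_mob_pos (hM : 0 < M.det) (hτ : 0 < τ.im) : 0 < (mob M τ).im := by
  rw [im_mob]
  have h1 := Complex.normSq_pos.2 (den_ne_zero hM.ne' hτ)
  have h2 : (0 : ℝ) < M.det := by exact_mod_cast hM
  positivity

lemma den_mul (hN : N.det ≠ 0) (hτ : 0 < τ.im) :
    den (M * N) τ = den M (mob N τ) * den N τ := by
  have h := den_ne_zero hN hτ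
  rw [den, mob, den, add_mul, mul_assoc, div_mul_cancel₀ _ h, den]
  simp [Matrix.mul_apply, Fin.sum_univ_two]
  ring

lemma mob_mul (hN : N.det ≠ 0) (hτ : 0 < τ.im) : mob (M * N) τ = mob M (mob N τ) := by
  have h := den_ne_zero hN hτ
  have h2 : mob M (mob N τ) = ((M 0 0 * mob N τ + M 0 1) * den N τ) /
      (den M (mob N τ) * den N τ) := (mul_div_mul_right _ _ h).symm
  rw [h2, ← den_mul hN hτ, mob]
  congr 1
  rw [mob, add_mul, mul_assoc, div_mul_cancel₀ _ h, den]
  simp [Matrix.mul_apply, Fin.sum_univ_two]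
  ring

@[simp] lemma den_one (τ : ℂ) : den 1 τ = 1 := by simp [den]

@[simp] lemma mob_one (τ : ℂ) : mob 1 τ = τ := by simp [mob, den]

lemma hasDerivAt_mob (hM : M.det ≠ 0) (hτ : 0 < τ.im) :
    HasDerivAt (mob M) (M.det / den M τ ^ 2) τ := by
  have h := den_ne_zero hM hτ
  have h1 : HasDerivAt (fun τ : ℂ => M 0 0 * τ + M 0 1) (M 0 0 : ℂ) τ := by
    simpa using ((hasDerivAt_id τ).const_mul (M 0 0 : ℂ)).add_const (M 0 1 : ℂ)
  have h2 : HasDerivAt (den M) (M 1 0 : ℂ) τ := by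
    exact (((hasDerivAt_id τ).const_mul (M 1 0 : ℂ)).add_const (M 1 1 : ℂ)).congr_deriv (by simp)
  refine (h1.div h2 h).congr_deriv ?_
  rw [Matrix.det_fin_two]
  congr 1
  simp only [den]
  push_cast
  ring

lemma coe_smul_eq_mob (g : SL(2, ℤ)) (z : UpperHalfPlane) :
    ((g • z : UpperHalfPlane) : ℂ) = mob g.1 z := by
  rw [UpperHalfPlane.coe_specialLinearGroup_apply]
  simp [mob, den]

end mobius

/-- The matrices by which `SL(2, ℤ / 2)` acts on `(θ₃ ^ 4, θ₂ ^ 4)`. -/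
def thetaRep (a b c d : ZMod 2) : Matrix (Fin 2) (Fin 2) ℤ :=
  if a = 1 ∧ b = 0 ∧ c = 0 ∧ d = 1 then !![1, 0; 0, 1]
  else if a = 1 ∧ b = 1 ∧ c = 0 ∧ d = 1 then !![1, -1; 0, -1]
  else if a = 0 ∧ b = 1 ∧ c = 1 ∧ d = 0 then !![-1, 0; -1, 1]
  else if a = 1 ∧ b = 1 ∧ c = 1 ∧ d = 0 then !![1, -1; 0, -1] * !![-1, 0; -1, 1]
  else if a = 0 ∧ b = 1 ∧ c = 1 ∧ d = 1 then !![-1, 0; -1, 1] * !![1, -1; 0, -1]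
  else !![1, -1; 0, -1] * !![-1, 0; -1, 1] * !![1, -1; 0, -1]

lemma thetaRep_mul : ∀ a b c d a' b' c' d' : ZMod 2, a * d - b * c = 1 → a' * d' - b' * c' = 1 →
    thetaRep (a * a' + b * c') (a * b' + b * d') (c * a' + d * c') (c * b' + d * d') =
      thetaRep a b c d * thetaRep a' b' c' d' := by
  decide

/-- The action of `γ` on `(θ₃ ^ 4, θ₂ ^ 4)` through its reduction modulo `2`. -/
def thetaRepInt (M : Matrix (Fin 2) (Fin 2) ℤ) : Matrix (Fin 2) (Fin 2) ℤ :=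
  thetaRep (M 0 0 : ZMod 2) (M 0 1 : ZMod 2) (M 1 0 : ZMod 2) (M 1 1 : ZMod 2)

lemma thetaRepInt_mul {M N : Matrix (Fin 2) (Fin 2) ℤ} (hM : M.det = 1) (hN : N.det = 1) :
    thetaRepInt (M * N) = thetaRepInt M * thetaRepInt N := by
  have h1 := congrArg (Int.cast : ℤ → ZMod 2) hM
  have h2 := congrArg (Int.cast : ℤ → ZMod 2) hN
  rw [Matrix.det_fin_two] at h1 h2
  push_cast at h1 h2
  have := thetaRep_mul _ _ _ _ _ _ _ _ h1 h2
  rw [thetaRepInt, thetaRepInt, thetaRepInt, ← this]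
  simp [Matrix.mul_apply, Fin.sum_univ_two]

/-- The transformation law of `(θ₃ ^ 4, θ₂ ^ 4)` under an integer matrix. -/
def ThetaLaw (M : Matrix (Fin 2) (Fin 2) ℤ) : Prop :=
  ∀ τ : ℂ, 0 < τ.im →
    uu (mob M τ) = den M τ ^ 2 * (thetaRepInt M 0 0 * uu τ + thetaRepInt M 0 1 * vv τ) ∧
    vv (mob M τ) = den M τ ^ 2 * (thetaRepInt M 1 0 * uu τ + thetaRepInt M 1 1 * vv τ)

lemma ThetaLaw.mul {M N : Matrix (Fin 2) (Fin 2) ℤ} (hM : ThetaLaw M) (hN : ThetaLaw N)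
    (dM : M.det = 1) (dN : N.det = 1) : ThetaLaw (M * N) := by
  intro τ hτ
  have hN0 : N.det ≠ 0 := by rw [dN]; norm_num
  obtain ⟨h1, h2⟩ := hN τ hτ
  obtain ⟨h3, h4⟩ := hM (mob N τ) (im_mob_pos (by rw [dN]; norm_num) hτ)
  rw [mob_mul hN0 hτ, den_mul hN0 hτ, thetaRepInt_mul dM dN, h3, h4, h1, h2]
  simp only [Matrix.mul_apply, Fin.sum_univ_two]
  push_cast
  constructor <;> ring

lemma thetaLaw_one : ThetaLaw 1 := by
  intro τ _
  have : thetaRepInt 1 = !![1, 0; 0, 1] := by decide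
  rw [this]
  simp

lemma thetaLaw_neg_one : ThetaLaw (-1) := by
  intro τ _
  have : thetaRepInt (-1) = !![1, 0; 0, 1] := by decide
  rw [this]
  simp [mob, den]

lemma thetaLaw_T : ThetaLaw !![1, 1; 0, 1] := by
  intro τ hτ
  have : thetaRepInt !![1, 1; 0, 1] = !![1, -1; 0, -1] := by decide
  rw [this]
  simp [mob, den, uu_add_one, vv_add_one hτ, ww_eq hτ, sub_eq_add_neg]

lemma thetaLaw_S : ThetaLaw !![0, -1; 1, 0] := by
  intro τ hτ
  have : thetaRepInt !![0, -1; 1, 0] = !![-1, 0; -1, 1] := by decide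
  rw [this]
  have h1 := uu_S hτ
  have h2 := vv_S hτ
  rw [ww_eq hτ] at h2
  simp [mob, den]
  rw [h1, h2]
  constructor <;> ring

lemma thetaLaw_TInv : ThetaLaw !![1, -1; 0, 1] := by
  intro τ hτ
  have : thetaRepInt !![1, -1; 0, 1] = !![1, -1; 0, -1] := by decide
  rw [this]
  have hσ : 0 < (τ - 1).im := by simpa using hτ
  have h1 := ww_add_one (τ - 1)
  have h2 := vv_add_one hσ
  rw [sub_add_cancel] at h1 h2
  rw [ww_eq hτ] at h1
  have h3 : mob !![1, -1; 0, 1] τ = τ - 1 := by simp [mob, den, sub_eq_add_neg]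
  rw [h3, ← h1]
  simp [den, h2, sub_eq_add_neg]

/-- The modular transformation law for all of `SL(2, ℤ)`. -/
lemma thetaLaw (g : SL(2, ℤ)) : ThetaLaw g.1 := by
  have hg : g ∈ Subgroup.closure {ModularGroup.S, ModularGroup.T} := by
    rw [SpecialLinearGroup.SL2Z_generators]; trivial
  have hS : ModularGroup.S.1 = !![0, -1; 1, 0] := rfl
  have hT : ModularGroup.T.1 = !![1, 1; 0, 1] := rfl
  induction hg using Subgroup.closure_induction_left with
  | one => exact thetaLaw_one
  | mul_left x hx y hy ih =>
    refine ThetaLaw.mul ?_ ih x.2 y.2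
    rcases hx with rfl | rfl
    · rw [hS]; exact thetaLaw_S
    · rw [hT]; exact thetaLaw_T
  | inv_mul_cancel x hx y hy ih =>
    refine ThetaLaw.mul ?_ ih (x⁻¹).2 y.2
    rcases hx with rfl | rfl
    · have : (ModularGroup.S⁻¹).1 = (-1) * !![0, -1; 1, 0] := by decide
      rw [this]
      exact thetaLaw_neg_one.mul thetaLaw_S (by simp [Matrix.det_fin_two]) (by simp)
    · have : (ModularGroup.T⁻¹).1 = !![1, -1; 0, 1] := by decide
      rw [this]
      exact thetaLaw_TInv

/-- An integer matrix that is the identity modulo `2`. -/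
def Level2 (M : Matrix (Fin 2) (Fin 2) ℤ) : Prop :=
  Odd (M 0 0) ∧ Even (M 0 1) ∧ Even (M 1 0) ∧ Odd (M 1 1)

lemma Level2.mul {M N : Matrix (Fin 2) (Fin 2) ℤ} (hM : Level2 M) (hN : Level2 N) :
    Level2 (M * N) := by
  obtain ⟨a, b, c, d⟩ := hM
  obtain ⟨a', b', c', d'⟩ := hN
  simp only [Level2, Matrix.mul_apply, Fin.sum_univ_two]
  exact ⟨(a.mul a').add_even (b.mul_right _), (b'.mul_left _).add (b.mul_right _),
    (c.mul_right _).add (c'.mul_left _), (c.mul_right _).add_odd (d.mul d')⟩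

lemma Level2.thetaRepInt {M : Matrix (Fin 2) (Fin 2) ℤ} (hM : Level2 M) :
    thetaRepInt M = 1 := by
  obtain ⟨a, b, c, d⟩ := hM
  have h0 {n : ℤ} (h : Even n) : (n : ZMod 2) = 0 := (ZMod.intCast_eq_zero_iff_even).2 h
  have h1 {n : ℤ} (h : Odd n) : (n : ZMod 2) = 1 := (ZMod.intCast_eq_one_iff_odd).2 h
  rw [LegendreMoments.thetaRepInt, h1 a, h0 b, h0 c, h1 d]
  decide

section level
variable {g : SL(2, ℤ)} {τ : ℂ}

lemma uu_level (hg : Level2 g.1) (hτ : 0 < τ.im) : uu (mob g.1 τ) = den g.1 τ ^ 2 * uu τ := by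
  simpa [hg.thetaRepInt] using (thetaLaw g τ hτ).1

lemma vv_level (hg : Level2 g.1) (hτ : 0 < τ.im) : vv (mob g.1 τ) = den g.1 τ ^ 2 * vv τ := by
  simpa [hg.thetaRepInt] using (thetaLaw g τ hτ).2

lemma sl_det_pos (g : SL(2, ℤ)) : 0 < g.1.det := by rw [g.2]; norm_num

lemma sl_det_ne (g : SL(2, ℤ)) : g.1.det ≠ 0 := (sl_det_pos g).ne'

lemma ww_level (hg : Level2 g.1) (hτ : 0 < τ.im) : ww (mob g.1 τ) = den g.1 τ ^ 2 * ww τ := by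
  rw [ww_eq hτ, ww_eq (im_mob_pos (sl_det_pos g) hτ), uu_level hg hτ, vv_level hg hτ]; ring

lemma xx_level (hg : Level2 g.1) (hτ : 0 < τ.im) : xx (mob g.1 τ) = xx τ := by
  rw [xx, xx, uu_level hg hτ, vv_level hg hτ,
    mul_div_mul_left _ _ (pow_ne_zero _ (den_ne_zero (sl_det_ne g) hτ))]

end level

end LegendreMoments

namespace LegendreMoments

open Matrix MatrixGroups Topology

/-- The filter of complex numbers with imaginary part tending to infinity. -/
def imInf : Filter ℂ := comap Complex.im atTop

lemma eventually_imInf (Y : ℝ) : ∀ᶠ τ in imInf, Y < τ.im :=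
  tendsto_comap.eventually (eventually_gt_atTop Y)

lemma eventually_imInf_iff {P : ℂ → Prop} :
    (∀ᶠ τ in imInf, P τ) ↔ ∃ Y : ℝ, ∀ τ : ℂ, Y ≤ τ.im → P τ := by
  rw [imInf, (atTop_basis.comap Complex.im).eventually_iff]
  simp

lemma tendsto_qq_imInf : Tendsto qq imInf (𝓝 0) := by
  rw [tendsto_zero_iff_norm_tendsto_zero]
  simp only [norm_qq]
  refine Real.tendsto_exp_atBot.comp ?_
  have h : Tendsto (fun τ : ℂ => Real.pi * τ.im) imInf atTop :=
    tendsto_comap.const_mul_atTop Real.pi_pos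
  exact (tendsto_neg_atTop_atBot.comp h).congr fun τ => by simp

lemma tendsto_ev_qq {f : PowerSeries ℤ} (hf : Conv f) :
    Tendsto (fun τ => ev f (qq τ)) imInf (𝓝 (ev f 0)) :=
  (continuousAt_ev hf (by simp)).tendsto.comp tendsto_qq_imInf

lemma tendsto_uu : Tendsto uu imInf (𝓝 1) := by
  have := (tendsto_ev_qq conv_thetaA).pow 4
  rwa [ev_zero_right, constantCoeff_thetaA, Int.cast_one, one_pow] at this

lemma tendsto_vv_div_qq : Tendsto (fun τ => vv τ / qq τ) imInf (𝓝 16) := by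
  have := ((tendsto_ev_qq conv_thetaPsi).pow 4).const_mul 16
  rw [ev_zero_right, constantCoeff_thetaPsi, Int.cast_one, one_pow, mul_one] at this
  refine this.congr fun τ => ?_
  rw [vv]
  field_simp [qq_ne_zero τ]

lemma tendsto_vv : Tendsto vv imInf (𝓝 0) := by
  have := tendsto_vv_div_qq.mul tendsto_qq_imInf
  rw [mul_zero] at this
  exact this.congr fun τ => div_mul_cancel₀ _ (qq_ne_zero τ)

lemma tendsto_ww : Tendsto ww imInf (𝓝 1) := by
  have := tendsto_uu.sub tendsto_vv
  rw [sub_zero] at this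
  refine this.congr' ?_
  filter_upwards [eventually_imInf 0] with τ hτ
  rw [ww_eq hτ]

/-- The modular function `λ` in terms of the variable `q`. -/
noncomputable def lamQ (z : ℂ) : ℂ := 16 * z * ev thetaPsi z ^ 4 / ev thetaA z ^ 4

lemma xx_eq_lamQ_inv (τ : ℂ) : xx τ = (lamQ (qq τ))⁻¹ := by
  rw [lamQ, inv_div]; rfl

lemma hasDerivAt_lamQ {z : ℂ} (hz : ‖z‖ < 1) : DifferentiableAt ℂ lamQ z := by
  have h1 := (hasDerivAt_ev conv_thetaA hz).differentiableAt
  have h2 := (hasDerivAt_ev conv_thetaPsi hz).differentiableAt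
  exact ((differentiableAt_id.const_mul 16).mul (h2.pow 4)).div (h1.pow 4)
    (pow_ne_zero _ (ev_thetaA_ne_zero hz))

lemma hasStrictDerivAt_lamQ : HasStrictDerivAt lamQ 16 0 := by
  have h1 := (hasDerivAt_ev conv_thetaA (z := 0) (by simp)).differentiableAt.hasDerivAt
  have h2 := (hasDerivAt_ev conv_thetaPsi (z := 0) (by simp)).differentiableAt.hasDerivAt
  have h3 : ev thetaA 0 = 1 := by rw [ev_zero_right, constantCoeff_thetaA, Int.cast_one]
  have h4 : ev thetaPsi 0 = 1 := by rw [ev_zero_right, constantCoeff_thetaPsi, Int.cast_one]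
  have h5 : HasDerivAt lamQ 16 0 := by
    refine ((((hasDerivAt_id (0 : ℂ)).const_mul 16).mul (h2.pow 4)).div (h1.pow 4)
      (by simp [h3])).congr_deriv ?_
    simp [h3, h4]
  have h6 : AnalyticAt ℂ lamQ 0 := by
    rw [Complex.analyticAt_iff_eventually_differentiableAt]
    filter_upwards [Metric.ball_mem_nhds (0 : ℂ) one_pos] with z hz
    exact hasDerivAt_lamQ (by simpa using hz)
  rw [← h5.deriv]
  exact h6.hasStrictDerivAt

lemma xx_mob (g : SL(2, ℤ)) {τ : ℂ} (hτ : 0 < τ.im) :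
    xx (mob g.1 τ) = (thetaRepInt g.1 0 0 * xx τ + thetaRepInt g.1 0 1) /
      (thetaRepInt g.1 1 0 * xx τ + thetaRepInt g.1 1 1) := by
  obtain ⟨h1, h2⟩ := thetaLaw g τ hτ
  have hv := vv_ne_zero hτ
  have h (a b : ℂ) : a * uu τ + b * vv τ = (a * xx τ + b) * vv τ := by
    rw [add_mul, mul_assoc, xx, div_mul_cancel₀ _ hv]
  rw [xx, h1, h2, mul_div_mul_left _ _ (pow_ne_zero _ (den_ne_zero (sl_det_ne g) hτ)),
    h, h, mul_div_mul_right _ _ hv]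

lemma thetaRep_entries : ∀ a b c d : ZMod 2, a * d - b * c = 1 →
    (|thetaRep a b c d 0 0| ≤ 1 ∧ |thetaRep a b c d 0 1| ≤ 1) ∧
    ((thetaRep a b c d 1 0 = 0 ∧ |thetaRep a b c d 1 1| = 1) ∨
    (|thetaRep a b c d 1 0| = 1 ∧ thetaRep a b c d 1 1 = 0) ∨
    (|thetaRep a b c d 1 0| = 1 ∧ thetaRep a b c d 1 1 = - thetaRep a b c d 1 0)) := by
  decide

lemma thetaRepInt_entries (g : SL(2, ℤ)) :
    (|thetaRepInt g.1 0 0| ≤ 1 ∧ |thetaRepInt g.1 0 1| ≤ 1) ∧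
    ((thetaRepInt g.1 1 0 = 0 ∧ |thetaRepInt g.1 1 1| = 1) ∨
    (|thetaRepInt g.1 1 0| = 1 ∧ thetaRepInt g.1 1 1 = 0) ∨
    (|thetaRepInt g.1 1 0| = 1 ∧ thetaRepInt g.1 1 1 = - thetaRepInt g.1 1 0)) := by
  have h1 := congrArg (Int.cast : ℤ → ZMod 2) g.2
  rw [Matrix.det_fin_two] at h1
  push_cast at h1
  exact thetaRep_entries _ _ _ _ h1

lemma norm_xx_mob_le (g : SL(2, ℤ)) {τ : ℂ} (hτ : 0 < τ.im) {δ : ℝ} (hδ : 0 < δ) (h1 : δ ≤ 1)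
    (h2 : δ ≤ ‖xx τ‖) (h3 : δ ≤ ‖xx τ - 1‖) : ‖xx (mob g.1 τ)‖ ≤ (‖xx τ‖ + 1) / δ := by
  obtain ⟨⟨ha, hb⟩, hcd⟩ := thetaRepInt_entries g
  rw [xx_mob g hτ, norm_div]
  have cast1 : ∀ n : ℤ, ‖(n : ℂ)‖ = ((|n| : ℤ) : ℝ) := by
    intro n; rw [Complex.norm_intCast]; simp
  refine div_le_div₀ (by positivity) ?_ hδ ?_
  · refine (norm_add_le _ _).trans ?_
    rw [norm_mul, cast1, cast1]
    have ha' : ((|thetaRepInt g.1 0 0| : ℤ) : ℝ) ≤ 1 := by exact_mod_cast ha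
    have hb' : ((|thetaRepInt g.1 0 1| : ℤ) : ℝ) ≤ 1 := by exact_mod_cast hb
    nlinarith [norm_nonneg (xx τ)]
  · rcases hcd with ⟨hc, hd⟩ | ⟨hc, hd⟩ | ⟨hc, hd⟩
    · rw [hc]; simp only [Int.cast_zero, zero_mul, zero_add]
      rw [cast1, hd]; simpa using h1
    · rw [hd]; simp only [Int.cast_zero, add_zero]
      rw [norm_mul, cast1, hc]; simpa using h2
    · rw [hd]
      have : (thetaRepInt g.1 1 0 : ℂ) * xx τ + ((-thetaRepInt g.1 1 0 : ℤ) : ℂ) =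
          thetaRepInt g.1 1 0 * (xx τ - 1) := by push_cast; ring
      rw [this, norm_mul, cast1, hc]; simpa using h3

lemma level2_iff (g : SL(2, ℤ)) : Level2 g.1 ↔ g ∈ CongruenceSubgroup.Gamma 2 := by
  rw [CongruenceSubgroup.Gamma_mem, Level2, ← ZMod.intCast_eq_one_iff_odd,
    ← ZMod.intCast_eq_one_iff_odd, ← ZMod.intCast_eq_zero_iff_even,
    ← ZMod.intCast_eq_zero_iff_even]

/-- Equivalence under the principal congruence subgroup of level two. -/
def Equiv2 (σ τ : UpperHalfPlane) : Prop := ∃ g : SL(2, ℤ), Level2 g.1 ∧ g • σ = τ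

lemma Equiv2.symm {σ τ : UpperHalfPlane} (h : Equiv2 σ τ) : Equiv2 τ σ := by
  obtain ⟨g, hg, rfl⟩ := h
  refine ⟨g⁻¹, ?_, by simp⟩
  rw [level2_iff] at hg ⊢
  exact inv_mem hg

lemma Equiv2.trans {ρ σ τ : UpperHalfPlane} (h : Equiv2 ρ σ) (h' : Equiv2 σ τ) : Equiv2 ρ τ := by
  obtain ⟨g, hg, rfl⟩ := h
  obtain ⟨g', hg', rfl⟩ := h'
  refine ⟨g' * g, ?_, by simp [mul_smul]⟩
  rw [level2_iff] at hg hg' ⊢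
  exact mul_mem hg' hg

lemma Equiv2.xx_eq {σ τ : UpperHalfPlane} (h : Equiv2 σ τ) : xx σ = xx τ := by
  obtain ⟨g, hg, rfl⟩ := h
  rw [coe_smul_eq_mob, xx_level hg σ.2]

lemma tendsto_xx : Tendsto (fun τ => (xx τ)⁻¹) imInf (𝓝 0) := by
  have h := tendsto_vv.div tendsto_uu one_ne_zero
  rw [zero_div] at h
  exact h.congr fun τ => by simp [xx]

lemma tendsto_norm_xx : Tendsto (fun τ => ‖xx τ‖) imInf atTop := by
  have h := tendsto_xx.norm
  rw [norm_zero] at h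
  have h2 : Tendsto (fun τ => ‖(xx τ)⁻¹‖) imInf (𝓝[>] 0) := by
    rw [tendsto_nhdsWithin_iff]
    refine ⟨h, ?_⟩
    filter_upwards [eventually_imInf 0] with τ hτ
    exact norm_pos_iff.2 (inv_ne_zero (xx_ne_zero hτ))
  refine h2.inv_tendsto_nhdsGT_zero.congr fun τ => ?_
  simp

lemma continuous_sl_smul (g : SL(2, ℤ)) : Continuous fun z : UpperHalfPlane => g • z :=
  continuous_const_smul (SpecialLinearGroup.mapGL ℝ g)

lemma exists_rep : ∃ rep : SL(2, ZMod 2) → SL(2, ℤ), ∀ g : SL(2, ℤ), ∃ s, 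
    Level2 ((rep s)⁻¹ * g).1 := by
  classical
  let red := SpecialLinearGroup.map (n := Fin 2) (Int.castRingHom (ZMod 2))
  refine ⟨fun s => if h : ∃ g, red g = s then h.choose else 1, fun g => ⟨red g, ?_⟩⟩
  have h : ∃ g', red g' = red g := ⟨g, rfl⟩
  dsimp only
  rw [dif_pos h, level2_iff]
  change red _ = 1
  rw [map_mul, map_inv, h.choose_spec, inv_mul_cancel]

/-- Points where `xx` stays away from the cusps lie in a compact set modulo `Γ(2)`. -/
lemma exists_compact_equiv {δ B : ℝ} (hδ : 0 < δ) (h1 : δ ≤ 1) :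
    ∃ C : Set UpperHalfPlane, IsCompact C ∧ ∀ τ : UpperHalfPlane, δ ≤ ‖xx τ‖ → δ ≤ ‖xx τ - 1‖ →
      ‖xx τ‖ ≤ B → ∃ σ ∈ C, Equiv2 τ σ := by
  obtain ⟨Y, hY⟩ := eventually_imInf_iff.1
    (tendsto_norm_xx.eventually (eventually_gt_atTop ((B + 1) / δ)))
  obtain ⟨rep, hrep⟩ := exists_rep
  refine ⟨⋃ s, ((rep s)⁻¹ • ·) '' ModularGroup.truncatedFundamentalDomain Y, ?_, ?_⟩
  · exact isCompact_iUnion fun s =>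
      (ModularGroup.isCompact_truncatedFundamentalDomain Y).image (continuous_sl_smul _)
  · intro τ h2 h3 h4
    obtain ⟨g, hg⟩ := ModularGroup.exists_smul_mem_fd τ
    have hb : (g • τ).im ≤ Y := by
      by_contra! hlt
      have h5 := hY (g • τ : UpperHalfPlane) hlt.le
      rw [coe_smul_eq_mob] at h5
      have h6 := norm_xx_mob_le g τ.2 hδ h1 h2 h3
      have h7 : (‖xx τ‖ + 1) / δ ≤ (B + 1) / δ := by gcongr
      linarith
    obtain ⟨s, hs⟩ := hrep g
    refine ⟨(rep s)⁻¹ • g • τ, Set.mem_iUnion.2 ⟨s, Set.mem_image_of_mem _ ⟨hg, hb⟩⟩, _, hs, ?_⟩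
    rw [mul_smul]

end LegendreMoments

namespace LegendreMoments

open Matrix MatrixGroups Topology

lemma xx_deriv_ne_zero {τ : ℂ} (hτ : 0 < τ.im) :
    (Real.pi * Complex.I * (-(ww τ * xx τ)) : ℂ) ≠ 0 :=
  mul_ne_zero (mul_ne_zero (by exact_mod_cast Real.pi_ne_zero) Complex.I_ne_zero)
    (neg_ne_zero.2 (mul_ne_zero (ww_ne_zero hτ) (xx_ne_zero hτ)))

lemma hasStrictDerivAt_xx {τ : ℂ} (hτ : 0 < τ.im) :
    HasStrictDerivAt xx (Real.pi * Complex.I * (-(ww τ * xx τ))) τ := by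
  have h : AnalyticAt ℂ xx τ := by
    rw [Complex.analyticAt_iff_eventually_differentiableAt]
    filter_upwards [isOpen_upper.mem_nhds hτ] with σ hσ
    exact differentiableAt_xx hσ
  rw [← (hasDerivAt_xx hτ).deriv]
  exact h.hasStrictDerivAt

lemma map_nhds_xx {τ : ℂ} (hτ : 0 < τ.im) : map xx (𝓝 τ) = 𝓝 (xx τ) :=
  (hasStrictDerivAt_xx hτ).map_nhds_eq (xx_deriv_ne_zero hτ)

lemma locally_injective {f : ℂ → ℂ} {f' a : ℂ} (hf : HasStrictDerivAt f f' a) (hf' : f' ≠ 0) :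
    ∃ U ∈ 𝓝 a, Set.InjOn f U := by
  have h := (hf.hasStrictFDerivAt_equiv hf').eventually_left_inverse
  refine ⟨_, h, fun x hx y hy hxy => ?_⟩
  rw [← hx, ← hy, hxy]

/-- The function `xx` restricted to the upper half-plane. -/
noncomputable def xH (τ : UpperHalfPlane) : ℂ := xx τ

lemma continuous_xH : Continuous xH := by
  rw [continuous_iff_continuousAt]
  intro τ
  exact (differentiableAt_xx τ.2).continuousAt.comp UpperHalfPlane.continuous_coe.continuousAt

lemma map_nhds_xH (τ : UpperHalfPlane) : map xH (𝓝 τ) = 𝓝 (xH τ) := by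
  have h : 𝓝 (τ : ℂ) = map (↑) (𝓝 τ) :=
    (UpperHalfPlane.isOpenEmbedding_coe.map_nhds_eq τ).symm
  have h2 := map_nhds_xx τ.2
  rw [show τ.1 = (τ : ℂ) from rfl, h, Filter.map_map] at h2
  exact h2

lemma isOpenMap_xH : IsOpenMap xH :=
  isOpenMap_iff_nhds_le.2 fun τ => (map_nhds_xH τ).ge

lemma locally_injective_xH (τ : UpperHalfPlane) : ∃ U ∈ 𝓝 τ, Set.InjOn xH U := by
  obtain ⟨U, hU, hinj⟩ := locally_injective (hasStrictDerivAt_xx τ.2) (xx_deriv_ne_zero τ.2)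
  refine ⟨UpperHalfPlane.coe ⁻¹' U, UpperHalfPlane.continuous_coe.continuousAt hU, fun x hx y hy hxy => ?_⟩
  exact UpperHalfPlane.ext (hinj hx hy hxy)

lemma isOpen_cuspCompl : IsOpen ({0, 1}ᶜ : Set ℂ) := (Set.toFinite _).isClosed.isOpen_compl

/-- Near a point different from `0` and `1`, the fibres of `xx` meet a fixed compact set. -/
lemma exists_compact_nhds {x : ℂ} (hx : x ∈ ({0, 1}ᶜ : Set ℂ)) :
    ∃ C : Set UpperHalfPlane, IsCompact C ∧ ∀ᶠ y in 𝓝 x, ∀ τ, xH τ = y → ∃ σ ∈ C, Equiv2 τ σ := by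
  simp only [Set.mem_compl_iff, Set.mem_insert_iff, Set.mem_singleton_iff, not_or] at hx
  have p0 : 0 < ‖x‖ := norm_pos_iff.2 hx.1
  have p1 : 0 < ‖x - 1‖ := norm_pos_iff.2 (sub_ne_zero.2 hx.2)
  obtain ⟨δ, hδ0, hδ⟩ := exists_between (lt_min one_pos (lt_min p0 p1))
  obtain ⟨h1, h2⟩ := lt_min_iff.1 hδ
  obtain ⟨h2, h3⟩ := lt_min_iff.1 h2
  obtain ⟨C, hC, hCτ⟩ := exists_compact_equiv (B := ‖x‖ + 1) hδ0 h1.le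
  refine ⟨C, hC, ?_⟩
  have e1 : ∀ᶠ y in 𝓝 x, δ < ‖y‖ := continuous_norm.continuousAt.eventually_const_lt h2
  have e2 : ∀ᶠ y in 𝓝 x, δ < ‖y - 1‖ :=
    (continuous_norm.comp (continuous_id.sub continuous_const)).continuousAt.eventually_const_lt h3
  have e3 : ∀ᶠ y in 𝓝 x, ‖y‖ < ‖x‖ + 1 :=
    continuous_norm.continuousAt.eventually_lt_const (lt_add_one _)
  filter_upwards [e1, e2, e3] with y g1 g2 g3
  rintro τ rfl
  exact hCτ τ g1.le g2.le g3.le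

lemma xH_mem (τ : UpperHalfPlane) : xH τ ∈ ({0, 1}ᶜ : Set ℂ) := by
  simp only [Set.mem_compl_iff, Set.mem_insert_iff, Set.mem_singleton_iff, not_or]
  exact ⟨xx_ne_zero τ.2, xx_ne_one τ.2⟩

lemma isPreconnected_cuspCompl : IsPreconnected ({0, 1}ᶜ : Set ℂ) :=
  (Set.Countable.isPathConnected_compl_of_one_lt_rank (by simp)
    (Set.toFinite _).countable).isConnected.isPreconnected

lemma range_xH : Set.range xH = ({0, 1}ᶜ : Set ℂ) := by
  refine subset_antisymm (Set.range_subset_iff.2 xH_mem) ?_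
  refine isPreconnected_cuspCompl.subset_left_of_subset_union isOpenMap_xH.isOpen_range
    (v := {0, 1}ᶜ \ Set.range xH) ?_ Set.disjoint_sdiff_right ?_ ?_
  · rw [isOpen_iff_mem_nhds]
    rintro x ⟨hx, hxR⟩
    obtain ⟨C, hC, h⟩ := exists_compact_nhds hx
    have hcl : IsClosed (xH '' C) := (hC.image continuous_xH).isClosed
    have hn : x ∉ xH '' C := fun h => hxR (Set.image_subset_range _ _ h)
    filter_upwards [h, hcl.isOpen_compl.mem_nhds hn, isOpen_cuspCompl.mem_nhds hx] with y h1 h2 h3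
    refine ⟨h3, ?_⟩
    rintro ⟨τ, hτ⟩
    obtain ⟨σ, hσ, hE⟩ := h1 τ hτ
    exact h2 ⟨σ, hσ, hE.xx_eq.symm.trans hτ⟩
  · intro x hx
    by_cases h : x ∈ Set.range xH
    · exact Or.inl h
    · exact Or.inr ⟨hx, h⟩
  · exact ⟨xH UpperHalfPlane.I, xH_mem _, Set.mem_range_self _⟩

lemma isOpen_equiv_of_eq :
    IsOpen {P : UpperHalfPlane × UpperHalfPlane | xH P.1 = xH P.2 → Equiv2 P.1 P.2} := by
  rw [isOpen_iff_mem_nhds]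
  rintro ⟨σ, τ⟩ h
  by_cases hx : xH σ = xH τ
  · obtain ⟨g, hg, hgσ⟩ := h hx
    obtain ⟨U, hU, hinj⟩ := locally_injective_xH τ
    have h1 : ∀ᶠ P : UpperHalfPlane × UpperHalfPlane in 𝓝 (σ, τ), g • P.1 ∈ U := by
      have : Tendsto (fun P : UpperHalfPlane × UpperHalfPlane => g • P.1) (𝓝 (σ, τ)) (𝓝 τ) := by
        rw [show τ = g • σ from hgσ.symm]
        exact ((continuous_sl_smul g).comp continuous_fst).continuousAt
      exact this hU
    have h2 : ∀ᶠ P : UpperHalfPlane × UpperHalfPlane in 𝓝 (σ, τ), P.2 ∈ U :=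
      continuous_snd.continuousAt hU
    filter_upwards [h1, h2] with P h1 h2 hP
    refine ⟨g, hg, hinj h1 h2 ?_⟩
    rw [← hP]
    exact (Equiv2.xx_eq ⟨g, hg, rfl⟩).symm
  · have : ∀ᶠ P : UpperHalfPlane × UpperHalfPlane in 𝓝 (σ, τ), xH P.1 ≠ xH P.2 :=
      (isOpen_ne_fun (continuous_xH.comp continuous_fst)
        (continuous_xH.comp continuous_snd)).mem_nhds hx
    filter_upwards [this] with P hP h
    exact absurd h hP

lemma finite_meeting {K L : Set UpperHalfPlane} (hK : IsCompact K) (hL : IsCompact L) :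
    {g : SL(2, ℤ) | ((g • ·) '' K ∩ L).Nonempty}.Finite := by
  have h := ProperlyDiscontinuousSMul.finite_disjoint_inter_image
    (Γ := (SpecialLinearGroup.mapGL ℝ : SL(2, ℤ) →* GL (Fin 2) ℝ).range) hK hL
  refine Set.Finite.of_finite_image (f := fun g : SL(2, ℤ) =>
    (SpecialLinearGroup.mapGL ℝ : SL(2, ℤ) →* GL (Fin 2) ℝ).rangeRestrict g) (h.subset ?_) ?_
  · rintro _ ⟨g, hg, rfl⟩
    exact hg
  · intro a _ b _ hab
    have := congrArg Subtype.val hab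
    exact SpecialLinearGroup.mapGL_injective this

lemma isOpen_not_equiv :
    IsOpen {P : UpperHalfPlane × UpperHalfPlane | ¬ Equiv2 P.1 P.2} := by
  rw [isOpen_iff_mem_nhds]
  rintro ⟨σ, τ⟩ h
  obtain ⟨K, hK, hKσ⟩ := exists_compact_mem_nhds σ
  obtain ⟨L, hL, hLτ⟩ := exists_compact_mem_nhds τ
  have hfin := finite_meeting hK hL
  have h1 : ∀ᶠ P : UpperHalfPlane × UpperHalfPlane in 𝓝 (σ, τ),
      ∀ g ∈ {g : SL(2, ℤ) | ((g • ·) '' K ∩ L).Nonempty}, Level2 g.1 → g • P.1 ≠ P.2 := by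
    rw [hfin.eventually_all]
    intro g _
    by_cases hg : Level2 g.1
    · have : g • σ ≠ τ := fun h' => h ⟨g, hg, h'⟩
      have : ∀ᶠ P : UpperHalfPlane × UpperHalfPlane in 𝓝 (σ, τ), g • P.1 ≠ P.2 :=
        (isOpen_ne_fun ((continuous_sl_smul g).comp continuous_fst) continuous_snd).mem_nhds this
      filter_upwards [this] with P hP _ using hP
    · exact Eventually.of_forall fun _ h' => absurd h' hg
  have h2 : ∀ᶠ P : UpperHalfPlane × UpperHalfPlane in 𝓝 (σ, τ), P.1 ∈ K :=
    continuous_fst.continuousAt hKσ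
  have h3 : ∀ᶠ P : UpperHalfPlane × UpperHalfPlane in 𝓝 (σ, τ), P.2 ∈ L :=
    continuous_snd.continuousAt hLτ
  filter_upwards [h1, h2, h3] with P h1 h2 h3
  rintro ⟨g, hg, hP⟩
  exact h1 g ⟨P.2, ⟨P.1, h2, hP⟩, h3⟩ hg hP

/-- The points over which the fibre of `xx` is a single `Γ(2)`-orbit. -/
def goodPts : Set ℂ := {x | x ∈ ({0, 1}ᶜ : Set ℂ) ∧ ∀ σ τ, xH σ = x → xH τ = x → Equiv2 σ τ}

lemma isOpen_goodPts : IsOpen goodPts := by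
  rw [isOpen_iff_mem_nhds]
  rintro x ⟨hx, hgood⟩
  obtain ⟨C, hC, h⟩ := exists_compact_nhds hx
  have hbad := ((hC.prod hC).inter_right isOpen_equiv_of_eq.isClosed_compl).image
    (continuous_xH.comp continuous_fst)
  have hn : x ∉ (xH ∘ Prod.fst) '' ((C ×ˢ C) ∩
      {P : UpperHalfPlane × UpperHalfPlane | xH P.1 = xH P.2 → Equiv2 P.1 P.2}ᶜ) := by
    rintro ⟨⟨σ, τ⟩, ⟨-, hP⟩, hσ⟩
    simp only [Set.mem_compl_iff, Set.mem_ofPred_eq, Classical.not_imp] at hP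
    simp only [Function.comp_apply] at hσ
    exact hP.2 (hgood σ τ hσ (hP.1 ▸ hσ))
  filter_upwards [h, hbad.isClosed.isOpen_compl.mem_nhds hn, isOpen_cuspCompl.mem_nhds hx] with
    y h1 h2 h3
  refine ⟨h3, fun σ τ hσ hτ => ?_⟩
  by_contra hne
  obtain ⟨σ', hσC, hσE⟩ := h1 σ hσ
  obtain ⟨τ', hτC, hτE⟩ := h1 τ hτ
  refine h2 ⟨(σ', τ'), ⟨⟨hσC, hτC⟩, ?_⟩, hσE.xx_eq.symm.trans hσ⟩
  simp only [Set.mem_compl_iff, Set.mem_ofPred_eq, Classical.not_imp]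
  refine ⟨?_, fun h' => hne ((hσE.trans h').trans hτE.symm)⟩
  have e1 : xH σ = xH σ' := hσE.xx_eq
  have e2 : xH τ = xH τ' := hτE.xx_eq
  rw [← e1, ← e2, hσ, hτ]

lemma isOpen_badPts : IsOpen (({0, 1}ᶜ : Set ℂ) \ goodPts) := by
  rw [isOpen_iff_mem_nhds]
  rintro x ⟨hx, hbad⟩
  have : ∃ σ τ, xH σ = x ∧ xH τ = x ∧ ¬ Equiv2 σ τ := by
    by_contra! h
    exact hbad ⟨hx, h⟩
  obtain ⟨σ, τ, hσ, hτ, hE⟩ := this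
  have hmem : {P : UpperHalfPlane × UpperHalfPlane | ¬ Equiv2 P.1 P.2} ∈ 𝓝 (σ, τ) :=
    isOpen_not_equiv.mem_nhds hE
  rw [nhds_prod_eq, mem_prod_iff] at hmem
  obtain ⟨U, hU, V, hV, hUV⟩ := hmem
  have h1 : xH '' U ∈ 𝓝 x := by rw [← hσ, ← map_nhds_xH]; exact image_mem_map hU
  have h2 : xH '' V ∈ 𝓝 x := by rw [← hτ, ← map_nhds_xH]; exact image_mem_map hV
  filter_upwards [h1, h2, isOpen_cuspCompl.mem_nhds hx] with y h1 h2 h3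
  refine ⟨h3, fun hy => ?_⟩
  obtain ⟨a, ha, hay⟩ := h1
  obtain ⟨b, hb, hby⟩ := h2
  have hab : (a, b) ∈ {P : UpperHalfPlane × UpperHalfPlane | ¬ Equiv2 P.1 P.2} :=
    hUV (Set.mk_mem_prod ha hb)
  exact hab (hy.2 a b hay hby)

end LegendreMoments

namespace LegendreMoments

open Matrix MatrixGroups Topology

lemma exists_fd_lower_bound : ∃ δ : ℝ, 0 < δ ∧ ∀ σ ∈ ModularGroup.fd,
    δ ≤ ‖xH σ‖ ∧ δ ≤ ‖xH σ - 1‖ := by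
  obtain ⟨Y, hY⟩ := eventually_imInf_iff.1 (tendsto_norm_xx.eventually (eventually_gt_atTop 2))
  have hK := ModularGroup.isCompact_truncatedFundamentalDomain Y
  have hf : Continuous fun σ => min ‖xH σ‖ ‖xH σ - 1‖ :=
    continuous_xH.norm.min (continuous_xH.sub continuous_const).norm
  have hpos : ∀ σ, 0 < min ‖xH σ‖ ‖xH σ - 1‖ := fun σ =>
    lt_min (norm_pos_iff.2 (xx_ne_zero σ.2)) (norm_pos_iff.2 (sub_ne_zero.2 (xx_ne_one σ.2)))
  obtain ⟨m, hm0, hm⟩ : ∃ m : ℝ, 0 < m ∧ ∀ σ ∈ ModularGroup.truncatedFundamentalDomain Y,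
      m ≤ min ‖xH σ‖ ‖xH σ - 1‖ := by
    rcases (ModularGroup.truncatedFundamentalDomain Y).eq_empty_or_nonempty with h | h
    · exact ⟨1, one_pos, by simp [h]⟩
    · obtain ⟨σ, -, hσ⟩ := hK.exists_isMinOn h hf.continuousOn
      exact ⟨_, hpos σ, fun τ hτ => hσ hτ⟩
  refine ⟨min m 1, lt_min hm0 one_pos, fun σ hσ => ?_⟩
  by_cases h : σ.im ≤ Y
  · exact le_min_iff.1 ((min_le_left _ _).trans (hm σ ⟨hσ, h⟩))
  · have h2 : 2 < ‖xH σ‖ := hY σ (not_le.1 h).le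
    have h3 := norm_sub_norm_le (xH σ) 1
    rw [norm_one] at h3
    exact ⟨(min_le_right _ _).trans (by linarith), (min_le_right _ _).trans (by linarith)⟩

lemma thetaRep_row : ∀ a b c d : ZMod 2, a * d - b * c = 1 → thetaRep a b c d 1 0 = 0 →
    c = 0 ∧ a = 1 ∧ d = 1 ∧ |thetaRep a b c d 1 1| = 1 := by
  decide

lemma T_smul_im (σ : UpperHalfPlane) : (ModularGroup.T • σ).im = σ.im := by
  rw [UpperHalfPlane.modular_T_smul]; simp

/-- A large value of `xx` is attained, up to `Γ(2)`, high in the upper half-plane. -/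
lemma exists_equiv_im_large (Y : ℝ) : ∃ B : ℝ, ∀ τ : UpperHalfPlane, B < ‖xH τ‖ →
    ∃ σ : UpperHalfPlane, Equiv2 τ σ ∧ Y < σ.im := by
  obtain ⟨δ, hδ, hfd⟩ := exists_fd_lower_bound
  obtain ⟨B, hB⟩ : ∃ B, ∀ σ ∈ ModularGroup.truncatedFundamentalDomain Y, ‖xH σ‖ ≤ B :=
    (ModularGroup.isCompact_truncatedFundamentalDomain Y).exists_bound_of_continuousOn
      continuous_xH.continuousOn
  refine ⟨max (1 + 2 / δ) (B + 1), fun τ hτ => ?_⟩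
  obtain ⟨hτ1, hτ2⟩ := max_lt_iff.1 hτ
  obtain ⟨g, hg⟩ := ModularGroup.exists_smul_mem_fd τ
  obtain ⟨h1, h2⟩ := hfd _ hg
  set σ := g • τ with hσ
  have hτσ : τ = g⁻¹ • σ := by simp [hσ]
  have hX : xH τ = (thetaRepInt (g⁻¹).1 0 0 * xH σ + thetaRepInt (g⁻¹).1 0 1) /
      (thetaRepInt (g⁻¹).1 1 0 * xH σ + thetaRepInt (g⁻¹).1 1 1) := by
    rw [xH, hτσ, coe_smul_eq_mob, xx_mob g⁻¹ σ.2]; rfl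
  obtain ⟨⟨ha, hb⟩, hcd⟩ := thetaRepInt_entries g⁻¹
  have cast1 : ∀ n : ℤ, ‖(n : ℂ)‖ = ((|n| : ℤ) : ℝ) := by
    intro n; rw [Complex.norm_intCast]; simp
  have hnum : ‖(thetaRepInt (g⁻¹).1 0 0 * xH σ + thetaRepInt (g⁻¹).1 0 1 : ℂ)‖ ≤ ‖xH σ‖ + 1 := by
    refine (norm_add_le _ _).trans ?_
    rw [norm_mul, cast1, cast1]
    have ha' : ((|thetaRepInt (g⁻¹).1 0 0| : ℤ) : ℝ) ≤ 1 := by exact_mod_cast ha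
    have hb' : ((|thetaRepInt (g⁻¹).1 0 1| : ℤ) : ℝ) ≤ 1 := by exact_mod_cast hb
    nlinarith [norm_nonneg (xH σ)]
  have hrow : thetaRepInt (g⁻¹).1 1 0 = 0 := by
    rcases hcd with ⟨hc, hd⟩ | ⟨hc, hd⟩ | ⟨hc, hd⟩
    · exact hc
    · exfalso
      rw [hX, hd, norm_div, Int.cast_zero, add_zero, norm_mul, cast1 (thetaRepInt _ 1 0), hc,
        Int.cast_one, one_mul, lt_div_iff₀ (by linarith)] at hτ1
      have : 2 / δ * δ = 2 := by field_simp
      have h3 : 2 / δ * δ ≤ 2 / δ * ‖xH σ‖ := by gcongr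
      linarith
    · exfalso
      have h3 : (thetaRepInt (g⁻¹).1 1 0 : ℂ) * xH σ + ((-thetaRepInt (g⁻¹).1 1 0 : ℤ) : ℂ) =
          thetaRepInt (g⁻¹).1 1 0 * (xH σ - 1) := by push_cast; ring
      rw [hX, hd, norm_div, h3, norm_mul, cast1 (thetaRepInt _ 1 0), hc,
        Int.cast_one, one_mul, lt_div_iff₀ (by linarith)] at hτ1
      have : 2 / δ * δ = 2 := by field_simp
      have h4 : 2 / δ * δ ≤ 2 / δ * ‖xH σ - 1‖ := by gcongr
      have h5 := norm_add_le (xH σ - 1) 1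
      rw [sub_add_cancel, norm_one] at h5
      linarith
  have hdet := congrArg (Int.cast : ℤ → ZMod 2) (g⁻¹).2
  rw [Matrix.det_fin_two] at hdet
  push_cast at hdet
  obtain ⟨hc, ha1, hd1, hd⟩ := thetaRep_row _ _ _ _ hdet hrow
  have him : Y < σ.im := by
    by_contra! hle
    have h3 := hB σ ⟨hg, hle⟩
    have h4 : ‖(thetaRepInt (g⁻¹).1 1 1 : ℂ)‖ = 1 := by
      rw [cast1, thetaRepInt, hd, Int.cast_one]
    rw [hX, hrow, Int.cast_zero, zero_mul, zero_add, norm_div, h4, div_one] at hτ2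
    linarith
  by_cases hb0 : (((g⁻¹).1 0 1 : ℤ) : ZMod 2) = 0
  · refine ⟨σ, Equiv2.symm ⟨g⁻¹, ?_, hτσ.symm⟩, him⟩
    rw [level2_iff, CongruenceSubgroup.Gamma_mem]
    exact ⟨ha1, hb0, hc, hd1⟩
  · refine ⟨ModularGroup.T • σ, Equiv2.symm ⟨g⁻¹ * ModularGroup.T⁻¹, ?_, ?_⟩, ?_⟩
    · have hb1 : (((g⁻¹).1 0 1 : ℤ) : ZMod 2) = 1 := by
        revert hb0; generalize (((g⁻¹).1 0 1 : ℤ) : ZMod 2) = b; revert b; decide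
      have hT : (ModularGroup.T⁻¹).1 = !![1, -1; 0, 1] := by decide
      rw [level2_iff, CongruenceSubgroup.Gamma_mem, Matrix.SpecialLinearGroup.coe_mul]
      simp only [Matrix.mul_apply, Fin.sum_univ_two, hT]
      simp only [Matrix.of_apply, Matrix.cons_val', Matrix.cons_val_zero, Matrix.cons_val_one,
        Matrix.cons_val_fin_one]
      push_cast
      rw [ha1, hb1, hc, hd1]
      decide
    · rw [mul_smul, inv_smul_smul, ← hτσ]
    · rwa [T_smul_im]

lemma equiv2_of_qq_eq {σ τ : UpperHalfPlane} (h : qq σ = qq τ) : Equiv2 σ τ := by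
  obtain ⟨n, hn⟩ := Complex.exp_eq_exp_iff_exists_int.1 h
  have hpi : (Real.pi * Complex.I : ℂ) ≠ 0 :=
    mul_ne_zero (by exact_mod_cast Real.pi_ne_zero) Complex.I_ne_zero
  have h2 : (τ : ℂ) = σ + ((-(2 * n) : ℤ) : ℂ) := by
    have : Real.pi * Complex.I * ((σ : ℂ) - τ - 2 * n) = 0 := by
      linear_combination hn
    have := (mul_eq_zero.1 this).resolve_left hpi
    push_cast
    linear_combination -this
  refine ⟨ModularGroup.T ^ (-(2 * n)), ?_, ?_⟩
  · rw [level2_iff, CongruenceSubgroup.Gamma_mem]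
    have : (ModularGroup.T ^ (-(2 * n))).1 = !![1, -(2 * n); 0, 1] := ModularGroup.coe_T_zpow _
    rw [this]
    simp
    left; rfl
  · refine UpperHalfPlane.ext ?_
    rw [UpperHalfPlane.modular_T_zpow_smul, UpperHalfPlane.coe_vadd, h2]
    push_cast
    ring

lemma goodPts_nonempty : goodPts.Nonempty := by
  obtain ⟨U, hU, hinj⟩ := locally_injective hasStrictDerivAt_lamQ (by norm_num)
  obtain ⟨Y, hY⟩ := eventually_imInf_iff.1 (tendsto_qq_imInf hU)
  obtain ⟨B, hB⟩ := exists_equiv_im_large Y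
  have hx : ‖((|B| + 2 : ℝ) : ℂ)‖ = |B| + 2 := by
    rw [Complex.norm_real, Real.norm_of_nonneg (by positivity)]
  have hBx : B < ‖((|B| + 2 : ℝ) : ℂ)‖ := by rw [hx]; linarith [le_abs_self B]
  refine ⟨((|B| + 2 : ℝ) : ℂ), ?_, fun σ τ hσ hτ => ?_⟩
  · simp only [Set.mem_compl_iff, Set.mem_insert_iff, Set.mem_singleton_iff, not_or]
    have := abs_nonneg B
    constructor
    · intro h; rw [h, norm_zero] at hx; linarith
    · intro h; rw [h, norm_one] at hx; linarith
  · obtain ⟨σ', hσE, hσY⟩ := hB σ (by rw [hσ]; exact hBx)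
    obtain ⟨τ', hτE, hτY⟩ := hB τ (by rw [hτ]; exact hBx)
    have h1 : xx σ' = xx τ' := by
      rw [← hσE.xx_eq, ← hτE.xx_eq]; exact hσ.trans hτ.symm
    rw [xx_eq_lamQ_inv, xx_eq_lamQ_inv, _root_.inv_inj] at h1
    exact (hσE.trans (equiv2_of_qq_eq (hinj (hY _ hσY.le) (hY _ hτY.le) h1))).trans hτE.symm

/-- The modular function `xx` separates `Γ(2)`-orbits. -/
lemma equiv2_of_xx_eq {σ τ : UpperHalfPlane} (h : xH σ = xH τ) : Equiv2 σ τ := by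
  have hsub : ({0, 1}ᶜ : Set ℂ) ⊆ goodPts := by
    refine isPreconnected_cuspCompl.subset_left_of_subset_union isOpen_goodPts isOpen_badPts
      Set.disjoint_sdiff_right ?_ ?_
    · intro x hx
      by_cases hg : x ∈ goodPts
      · exact Or.inl hg
      · exact Or.inr ⟨hx, hg⟩
    · obtain ⟨x, hx⟩ := goodPts_nonempty
      exact ⟨x, hx.1, hx⟩
  exact (hsub (xH_mem σ)).2 σ τ rfl h.symm

/-- A point of the upper half-plane at which `xx` takes a prescribed value. -/
lemma exists_xx_eq {x : ℂ} (h0 : x ≠ 0) (h1 : x ≠ 1) : ∃ τ : UpperHalfPlane, xH τ = x := by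
  have : x ∈ Set.range xH := by
    rw [range_xH]; simp [h0, h1]
  exact this

end LegendreMoments

namespace LegendreMoments

open Matrix MatrixGroups Topology

/-- Representatives of the `Γ(2)`-classes of integer matrices of determinant `p` that are
congruent to the identity modulo `2`. -/
def heckeMat (p : ℕ) : Option (Fin p) → Matrix (Fin 2) (Fin 2) ℤ
  | none => !![(p : ℤ), 0; 0, 1]
  | some j => !![1, 2 * ((j : ℕ) : ℤ); 0, (p : ℤ)]

lemma det_heckeMat (p : ℕ) (i : Option (Fin p)) : (heckeMat p i).det = p := by
  cases i <;> simp [heckeMat, Matrix.det_fin_two]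

lemma level2_heckeMat {p : ℕ} (hp : Odd p) (i : Option (Fin p)) : Level2 (heckeMat p i) := by
  have hp' : Odd (p : ℤ) := by exact_mod_cast hp
  cases i <;> simp [heckeMat, Level2, hp']

lemma exists_level2_first_column {x z : ℤ} (hx : Odd x) (hz : Even z) (hxz : IsCoprime x z) :
    ∃ g : SL(2, ℤ), Level2 g.1 ∧ g.1 0 0 = x ∧ g.1 1 0 = z := by
  obtain ⟨a, b, hab⟩ := hxz
  have key : ∀ y w : ℤ, x * w - y * z = 1 → Even y →
      ∃ g : SL(2, ℤ), Level2 g.1 ∧ g.1 0 0 = x ∧ g.1 1 0 = z := by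
    intro y w h hy
    refine ⟨⟨!![x, y; z, w], by rw [Matrix.det_fin_two]; simpa using h⟩, ?_, rfl, rfl⟩
    refine ⟨hx, hy, hz, ?_⟩
    have h1 : Odd (x * w) := by
      rw [show x * w = 1 + y * z by linarith]
      exact odd_one.add_even (hy.mul_right z)
    exact (Int.odd_mul.1 h1).2
  rcases Int.even_or_odd b with hb | hb
  · exact key (-b) a (by linarith) hb.neg
  · exact key (-b + x) (a + z) (by ring_nf; linarith) (hb.neg.add_odd hx)

/-- Every determinant-`p` matrix congruent to the identity modulo `2` is `Γ(2)`-equivalent to one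
of the representatives. -/
lemma exists_eq_mul_heckeMat {p : ℕ} (hp : p.Prime) (N : Matrix (Fin 2) (Fin 2) ℤ)
    (hN : Level2 N) (hdet : N.det = p) :
    ∃ (g : SL(2, ℤ)) (i : Option (Fin p)), Level2 g.1 ∧ N = g.1 * heckeMat p i := by
  obtain ⟨ha, hb, hc, hd⟩ := hN
  have hp0 : (p : ℤ) ≠ 0 := by exact_mod_cast hp.ne_zero
  have ha0 : N 0 0 ≠ 0 := by intro h; rw [h] at ha; simp at ha
  set e : ℤ := ((Int.gcd (N 0 0) (N 1 0) : ℕ) : ℤ) with he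
  have he0 : 0 < e := by
    have := Int.gcd_pos_of_ne_zero_left (N 1 0) ha0
    rw [he]
    exact_mod_cast this
  obtain ⟨x, hx⟩ : e ∣ N 0 0 := Int.gcd_dvd_left ..
  obtain ⟨z, hz⟩ : e ∣ N 1 0 := Int.gcd_dvd_right ..
  have hxz : IsCoprime x z := by
    rw [Int.isCoprime_iff_gcd_eq_one]
    have : (e : ℤ) = e * Int.gcd x z := by
      conv_lhs => rw [he, hx, hz, Int.gcd_mul_left]
      push_cast
      rw [abs_of_pos he0]
    have h2 : (Int.gcd x z : ℤ) = 1 := by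
      have : e * ((Int.gcd x z : ℤ) - 1) = 0 := by linarith
      rcases mul_eq_zero.1 this with h | h
      · exact absurd h he0.ne'
      · linarith
    exact_mod_cast h2
  have hox : Odd x := by rw [hx] at ha; exact (Int.odd_mul.1 ha).2
  have hoe : Odd e := by rw [hx] at ha; exact (Int.odd_mul.1 ha).1
  have hez : Even z := by
    rw [hz] at hc
    rcases Int.even_mul.1 hc with h | h
    · exact absurd hoe (Int.not_odd_iff_even.2 h)
    · exact h
  obtain ⟨g, hg, hg0, hg1⟩ := exists_level2_first_column hox hez hxz
  obtain ⟨-, hgy, -, hgw⟩ := hg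
  have hgdet := g.2
  rw [Matrix.det_fin_two, hg0, hg1] at hgdet
  rw [Matrix.det_fin_two, hx, hz] at hdet
  -- the upper triangular matrix `g⁻¹ N`
  set y := g.1 0 1
  set w := g.1 1 1
  set b' := w * N 0 1 - y * N 1 1 with hb'
  set d' := x * N 1 1 - z * N 0 1 with hd'
  have hed : e * d' = p := by rw [hd', ← hdet]; ring
  have hb'e : Even b' := (hb.mul_left _).sub (hgy.mul_right _)
  obtain ⟨b2, hb2⟩ := hb'e
  have hN01 : N 0 1 = x * b' + y * d' := by
    rw [hb', hd']; linear_combination (-(N 0 1)) * hgdet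
  have hN11 : N 1 1 = z * b' + w * d' := by
    rw [hb', hd']; linear_combination (-(N 1 1)) * hgdet
  -- translating by an even integer
  have key : ∀ (i : Option (Fin p)) (k : ℤ), heckeMat p i = !![e, b' - 2 * k * d'; 0, d'] →
      ∃ (g : SL(2, ℤ)) (i : Option (Fin p)), Level2 g.1 ∧ N = g.1 * heckeMat p i := by
    intro i k hi
    have hTk : (ModularGroup.T ^ (2 * k)).1 = !![1, 2 * k; 0, 1] := ModularGroup.coe_T_zpow _
    refine ⟨g * ModularGroup.T ^ (2 * k), i, ?_, ?_⟩
    · rw [Matrix.SpecialLinearGroup.coe_mul]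
      refine Level2.mul ⟨by rwa [hg0], hgy, by rwa [hg1], hgw⟩ ?_
      rw [hTk]
      simp [Level2]
    · rw [Matrix.SpecialLinearGroup.coe_mul, hTk, hi]
      ext r s
      fin_cases r <;> fin_cases s <;>
        simp [Matrix.mul_apply, Fin.sum_univ_two, hg0, hg1, hx, hz, hN01, hN11] <;> ring
  have hdvd : e ∣ (p : ℤ) := ⟨d', hed.symm⟩
  rcases (Nat.dvd_prime hp).1 (Int.natAbs_dvd_natAbs.2 hdvd) with h1 | h1
  · have he1 : e = 1 := by omega
    rw [he1, one_mul] at hed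
    have hlt : b2 % p < p := Int.emod_lt_of_pos _ (by exact_mod_cast hp.pos)
    have hge : 0 ≤ b2 % p := Int.emod_nonneg _ hp0
    refine key (some ⟨(b2 % p).toNat, by omega⟩) (b2 / p) ?_
    have := Int.emod_add_mul_ediv b2 p
    rw [heckeMat, he1, hed]
    simp only [Int.toNat_of_nonneg hge]
    congr 2
    ext r
    fin_cases r
    · simp
    · simp; rw [hb2]; linarith
  · have hep : e = p := by omega
    have hd1 : d' = 1 := by
      rw [hep] at hed
      exact mul_left_cancel₀ hp0 (by rw [hed, mul_one])
    refine key none b2 ?_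
    rw [heckeMat, hep, hd1]
    congr 2
    ext r
    fin_cases r
    · simp
    · simp; rw [hb2]; ring

lemma heckeMat_unique {p : ℕ} (hp : 1 < p) {g : SL(2, ℤ)} (hg : Level2 g.1)
    {i k : Option (Fin p)} (h : heckeMat p i = g.1 * heckeMat p k) : i = k := by
  have h00 := congrFun (congrFun h 0) 0
  have h01 := congrFun (congrFun h 0) 1
  have h10 := congrFun (congrFun h 1) 0
  have h11 := congrFun (congrFun h 1) 1
  have hdet := g.2
  have hpz : (1 : ℤ) < p := by exact_mod_cast hp
  rw [Matrix.det_fin_two] at hdet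
  obtain ⟨-, hy, -, -⟩ := hg
  have hmul : ∀ a b : ℤ, a * p = b → 0 ≤ b → b ≤ 1 → a = 0 ∧ b = 0 := by
    intro a b h h0 h1
    have ha : a = 0 := by
      rcases lt_trichotomy a 0 with h' | h' | h'
      · nlinarith
      · exact h'
      · nlinarith
    exact ⟨ha, by rw [← h, ha, zero_mul]⟩
  rcases i with _ | i <;> rcases k with _ | k <;>
    simp [heckeMat, Matrix.mul_apply, Fin.sum_univ_two] at h00 h01 h10 h11
  · rfl
  · rw [← h00, ← h10] at hdet
    have := hmul (g.1 1 1) 1 (by linarith) (by norm_num) le_rfl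
    exact absurd this.2 one_ne_zero
  · have := hmul (g.1 0 0) 1 h00.symm (by norm_num) le_rfl
    exact absurd this.2 one_ne_zero
  · rw [← h00] at h01
    obtain ⟨m, hm⟩ := hy
    rw [hm] at h01
    congr 1
    have hi := i.2
    have hk := k.2
    have h3 : ((i : ℕ) : ℤ) - (k : ℕ) = m * p := by linarith
    have hm0 : m = 0 := by
      rcases lt_trichotomy m 0 with h' | h' | h'
      · nlinarith
      · exact h'
      · nlinarith
    rw [hm0] at h3
    exact Fin.ext (by omega)

lemma level2_iff_mapMatrix (M : Matrix (Fin 2) (Fin 2) ℤ) :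
    Level2 M ↔ (Int.castRingHom (ZMod 2)).mapMatrix M = 1 := by
  rw [Level2, ← ZMod.intCast_eq_one_iff_odd, ← ZMod.intCast_eq_one_iff_odd,
    ← ZMod.intCast_eq_zero_iff_even, ← ZMod.intCast_eq_zero_iff_even, ← Matrix.ext_iff]
  simp [Fin.forall_fin_two, and_assoc]

/-- Conjugation by `g` permutes the `Γ(2)`-classes of the representatives. -/
lemma exists_heckePerm {p : ℕ} (hp : p.Prime) (hodd : Odd p) (g : SL(2, ℤ)) :
    ∃ e : Option (Fin p) ≃ Option (Fin p), ∀ i, ∃ h : SL(2, ℤ), Level2 h.1 ∧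
      heckeMat p i * g.1 = h.1 * (g.1 * heckeMat p (e i)) := by
  have hex : ∀ i, ∃ k, ∃ h : SL(2, ℤ), Level2 h.1 ∧
      heckeMat p i * g.1 = h.1 * (g.1 * heckeMat p k) := by
    intro i
    have hgg : g.1 * (g⁻¹).1 = 1 := by
      rw [← Matrix.SpecialLinearGroup.coe_mul, mul_inv_cancel]; rfl
    have hl : Level2 ((g⁻¹).1 * heckeMat p i * g.1) := by
      have hM := level2_heckeMat hodd i
      rw [level2_iff_mapMatrix] at hM ⊢
      rw [map_mul, map_mul, hM, mul_one, ← map_mul, ← Matrix.SpecialLinearGroup.coe_mul,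
        inv_mul_cancel, Matrix.SpecialLinearGroup.coe_one, map_one]
    obtain ⟨h, k, hh, he⟩ := exists_eq_mul_heckeMat hp _ hl (by
      rw [Matrix.det_mul, Matrix.det_mul, g.2, (g⁻¹).2, det_heckeMat]; ring)
    refine ⟨k, g * h * g⁻¹, ?_, ?_⟩
    · rw [level2_iff] at hh ⊢
      exact (CongruenceSubgroup.Gamma_normal 2).conj_mem _ hh g
    · have h2 : (g * h * g⁻¹).1 * (g.1 * heckeMat p k) = g.1 * (h.1 * heckeMat p k) := by
        rw [Matrix.SpecialLinearGroup.coe_mul, Matrix.SpecialLinearGroup.coe_mul]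
        have : (g⁻¹).1 * g.1 = 1 := by
          rw [← Matrix.SpecialLinearGroup.coe_mul, inv_mul_cancel]; rfl
        rw [← mul_assoc, mul_assoc (g.1 * h.1), this, mul_one, mul_assoc]
      rw [h2, ← he, ← mul_assoc, ← mul_assoc, hgg, one_mul]
  choose e he using hex
  have hinj : Function.Injective e := by
    intro i k hik
    obtain ⟨h, hh, h1⟩ := he i
    obtain ⟨h', hh', h2⟩ := he k
    refine heckeMat_unique hp.one_lt (g := h * h'⁻¹) ?_ ?_
    · rw [level2_iff] at hh hh' ⊢
      exact mul_mem hh (inv_mem hh')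
    · have h3 : (h * h'⁻¹).1 * (heckeMat p k * g.1) = heckeMat p i * g.1 := by
        have : (h'⁻¹).1 * h'.1 = 1 := by
          rw [← Matrix.SpecialLinearGroup.coe_mul, inv_mul_cancel]; rfl
        rw [h1, h2, hik, Matrix.SpecialLinearGroup.coe_mul, ← mul_assoc, mul_assoc h.1, this,
          mul_one]
      have hgg : g.1 * (g⁻¹).1 = 1 := by
        rw [← Matrix.SpecialLinearGroup.coe_mul, mul_inv_cancel]; rfl
      have h4 := congrArg (· * (g⁻¹).1) h3
      simp only [mul_assoc, hgg, mul_one] at h4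
      rw [h4]
  exact ⟨Equiv.ofBijective e (Finite.injective_iff_bijective.1 hinj), he⟩

end LegendreMoments

namespace LegendreMoments

open Matrix MatrixGroups Topology

/-- The weight `2r + 2` form `v ^ r w (u / v)` for `Γ(2)`. -/
noncomputable def phi (r : ℕ) (τ : ℂ) : ℂ := vv τ ^ r * ww τ * xx τ

/-- The unnormalised weight `2r + 2` slash action of an integer matrix on `phi r`. -/
noncomputable def slash (r : ℕ) (M : Matrix (Fin 2) (Fin 2) ℤ) (τ : ℂ) : ℂ :=
  phi r (mob M τ) / den M τ ^ (2 * r + 2)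

/-- The contribution of a coset to the Lefschetz function of a Hecke correspondence. -/
noncomputable def lefTerm (r p : ℕ) (g N : Matrix (Fin 2) (Fin 2) ℤ) (τ : ℂ) : ℂ :=
  (p : ℂ) ^ (2 * r + 1) * slash r (g * N) τ /
    (slash r g τ * (xx (mob g τ) - xx (mob (g * N) τ)))

/-- The Lefschetz function of the Hecke correspondence of degree `p + 1`, at the cusp `g`. -/
noncomputable def lefSum (r p : ℕ) (g : Matrix (Fin 2) (Fin 2) ℤ) (τ : ℂ) : ℂ :=
  ∑ i, lefTerm r p g (heckeMat p i) τ

section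
variable {r p : ℕ} {τ : ℂ} {M N : Matrix (Fin 2) (Fin 2) ℤ}

lemma phi_ne_zero (hτ : 0 < τ.im) : phi r τ ≠ 0 :=
  mul_ne_zero (mul_ne_zero (pow_ne_zero _ (vv_ne_zero hτ)) (ww_ne_zero hτ)) (xx_ne_zero hτ)

lemma differentiableAt_phi (hτ : 0 < τ.im) : DifferentiableAt ℂ (phi r) τ :=
  (((differentiableAt_vv hτ).pow r).mul (differentiableAt_ww hτ)).mul (differentiableAt_xx hτ)

lemma phi_level {g : SL(2, ℤ)} (hg : Level2 g.1) (hτ : 0 < τ.im) :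
    phi r (mob g.1 τ) = den g.1 τ ^ (2 * r + 2) * phi r τ := by
  rw [phi, phi, vv_level hg hτ, ww_level hg hτ, xx_level hg hτ]
  ring

lemma differentiableAt_den : DifferentiableAt ℂ (den M) τ := by
  unfold den
  fun_prop

lemma differentiableAt_slash (hM : 0 < M.det) (hτ : 0 < τ.im) :
    DifferentiableAt ℂ (slash r M) τ :=
  ((differentiableAt_phi (im_mob_pos hM hτ)).comp τ
    (hasDerivAt_mob hM.ne' hτ).differentiableAt).div (differentiableAt_den.pow _)
    (pow_ne_zero _ (den_ne_zero hM.ne' hτ))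

lemma differentiableAt_xx_mob (hM : 0 < M.det) (hτ : 0 < τ.im) :
    DifferentiableAt ℂ (fun τ => xx (mob M τ)) τ :=
  (differentiableAt_xx (im_mob_pos hM hτ)).comp τ (hasDerivAt_mob hM.ne' hτ).differentiableAt

lemma slash_level_mul {g : SL(2, ℤ)} (hg : Level2 g.1) (hM : 0 < M.det) (hτ : 0 < τ.im) :
    slash r (g.1 * M) τ = slash r M τ := by
  have h1 := im_mob_pos hM hτ
  rw [slash, slash, mob_mul hM.ne' hτ, den_mul hM.ne' hτ, phi_level hg h1, mul_pow,
    mul_div_mul_left _ _ (pow_ne_zero _ (den_ne_zero (sl_det_ne g) h1))]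

lemma xx_level_mul {g : SL(2, ℤ)} (hg : Level2 g.1) (hM : 0 < M.det) (hτ : 0 < τ.im) :
    xx (mob (g.1 * M) τ) = xx (mob M τ) := by
  rw [mob_mul hM.ne' hτ, xx_level hg (im_mob_pos hM hτ)]

lemma slash_mul (hN : 0 < N.det) (hτ : 0 < τ.im) :
    slash r (M * N) τ = slash r M (mob N τ) / den N τ ^ (2 * r + 2) := by
  rw [slash, slash, mob_mul hN.ne' hτ, den_mul hN.ne' hτ, mul_pow, div_div]

lemma slash_one : slash r 1 τ = phi r τ := by simp [slash, mob_one, den_one]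

lemma lefTerm_level_mul {g : SL(2, ℤ)} (hg : Level2 g.1) (hM : 0 < M.det) (hN : 0 < N.det)
    (hτ : 0 < τ.im) : lefTerm r p (g.1 * M) N τ = lefTerm r p M N τ := by
  have hMN : 0 < (M * N).det := by rw [Matrix.det_mul]; positivity
  rw [lefTerm, lefTerm, mul_assoc, slash_level_mul hg hMN hτ, slash_level_mul hg hM hτ,
    xx_level_mul hg hMN hτ, xx_level_mul hg hM hτ]

lemma det_heckeMat_pos (hp : p.Prime) (i : Option (Fin p)) : 0 < (heckeMat p i).det := by
  rw [det_heckeMat]; exact_mod_cast hp.pos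

lemma lefSum_mob (hp : p.Prime) (hodd : Odd p) (g : SL(2, ℤ)) (hτ : 0 < τ.im) :
    lefSum r p 1 (mob g.1 τ) = lefSum r p g.1 τ := by
  obtain ⟨e, he⟩ := exists_heckePerm hp hodd g
  rw [lefSum, lefSum, ← e.sum_comp fun i => lefTerm r p g.1 (heckeMat p i) τ]
  refine Finset.sum_congr rfl fun i _ => ?_
  obtain ⟨h, hh, heq⟩ := he i
  have hd := den_ne_zero (sl_det_ne g) hτ
  have hpos : 0 < (g.1 * heckeMat p (e i)).det := by
    rw [Matrix.det_mul]; exact mul_pos (sl_det_pos g) (det_heckeMat_pos hp _)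
  have h1 : slash r (g.1 * heckeMat p (e i)) τ =
      slash r (heckeMat p i) (mob g.1 τ) / den g.1 τ ^ (2 * r + 2) := by
    rw [← slash_mul (sl_det_pos g) hτ, heq, slash_level_mul hh hpos hτ]
  have h2 : xx (mob (g.1 * heckeMat p (e i)) τ) = xx (mob (heckeMat p i) (mob g.1 τ)) := by
    rw [← mob_mul (sl_det_ne g) hτ, heq, xx_level_mul hh hpos hτ]
  have h3 : slash r g.1 τ = phi r (mob g.1 τ) / den g.1 τ ^ (2 * r + 2) := rfl
  rw [lefTerm, lefTerm, h1, h2, one_mul, slash_one, mob_one, h3, ← mul_div_assoc,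
    div_mul_eq_mul_div, div_div_div_cancel_right₀ (pow_ne_zero _ hd)]

lemma lefSum_level (hp : p.Prime) (hodd : Odd p) {g : SL(2, ℤ)} (hg : Level2 g.1)
    (hτ : 0 < τ.im) : lefSum r p 1 (mob g.1 τ) = lefSum r p 1 τ := by
  rw [lefSum_mob hp hodd g hτ, lefSum, lefSum]
  refine Finset.sum_congr rfl fun i _ => ?_
  have := lefTerm_level_mul (r := r) (p := p) (M := 1) hg (by simp) (det_heckeMat_pos hp i) hτ
  rwa [mul_one] at this

/-- Whether the Hecke correspondence has a fixed point at `τ`. -/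
def IsFix (p : ℕ) (τ : ℂ) : Prop := ∃ i, xx (mob (heckeMat p i) τ) = xx τ

lemma isFix_mob (hp : p.Prime) (hodd : Odd p) (g : SL(2, ℤ)) (hτ : 0 < τ.im) :
    IsFix p (mob g.1 τ) ↔ ∃ i, xx (mob (g.1 * heckeMat p i) τ) = xx (mob g.1 τ) := by
  obtain ⟨e, he⟩ := exists_heckePerm hp hodd g
  rw [e.surjective.exists (p := fun i => xx (mob (g.1 * heckeMat p i) τ) = xx (mob g.1 τ)), IsFix]
  refine exists_congr fun i => ?_
  obtain ⟨h, hh, heq⟩ := he i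
  have hpos : 0 < (g.1 * heckeMat p (e i)).det := by
    rw [Matrix.det_mul]; exact mul_pos (sl_det_pos g) (det_heckeMat_pos hp _)
  rw [← mob_mul (sl_det_ne g) hτ, heq, xx_level_mul hh hpos hτ]

lemma isFix_level (hp : p.Prime) (hodd : Odd p) {g : SL(2, ℤ)} (hg : Level2 g.1)
    (hτ : 0 < τ.im) : IsFix p (mob g.1 τ) ↔ IsFix p τ := by
  rw [isFix_mob hp hodd g hτ, IsFix]
  refine exists_congr fun i => ?_
  rw [xx_level_mul hg (det_heckeMat_pos hp i) hτ, xx_level hg hτ]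

end

end LegendreMoments

namespace LegendreMoments

open Matrix MatrixGroups Topology ComplexConjugate

/-- The polynomials `(α ^ (2r+1) - β ^ (2r+1)) / (α - β)` in `t = α + β`, where `α β = p`. -/
def vPoly (p : ℤ) : ℕ → ℤ → ℤ
  | 0, _ => 1
  | 1, t => t ^ 2 - p
  | r + 2, t => (t ^ 2 - 2 * p) * vPoly p (r + 1) t - p ^ 2 * vPoly p r t

lemma vPoly_spec {α β : ℂ} {p t : ℤ} (h1 : α * β = p) (h2 : α + β = t) (r : ℕ) :
    (α - β) * vPoly p r t = α ^ (2 * r + 1) - β ^ (2 * r + 1) := by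
  induction r using Nat.twoStepInduction with
  | zero => simp [vPoly]
  | one => rw [vPoly]; push_cast; rw [← h1, ← h2]; ring
  | more r ih1 ih2 =>
    rw [vPoly]
    push_cast
    linear_combination (t ^ 2 - 2 * p : ℂ) * ih2 - (p : ℂ) ^ 2 * ih1 +
      (α ^ (2 * r + 3) - β ^ (2 * r + 3)) * (2 * h1 - (α + β + t) * h2) +
      (α ^ (2 * r + 1) - β ^ (2 * r + 1)) * (α * β + p) * h1

lemma two_re_residue {α : ℂ} {p t : ℤ} (h1 : α * conj α = p) (h2 : α + conj α = t)
    (h3 : α ≠ conj α) (r : ℕ) :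
    2 * (conj α ^ (2 * r + 1) / (α - conj α)).re = -vPoly p r t := by
  have hne : α - conj α ≠ 0 := sub_ne_zero.2 h3
  have h := vPoly_spec h1 h2 r
  have h4 : (conj α ^ (2 * r + 1) / (α - conj α)) + conj (conj α ^ (2 * r + 1) / (α - conj α)) =
      -vPoly p r t := by
    rw [map_div₀, map_pow, map_sub, Complex.conj_conj, ← neg_sub α (conj α), div_neg,
      ← sub_eq_add_neg, ← sub_div, div_eq_iff hne]
    linear_combination h
  rw [Complex.add_conj] at h4
  exact_mod_cast h4

/-- A section of the covering `xx` away from `0` and `1`. -/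
noncomputable def secX (z : ℂ) : UpperHalfPlane :=
  open Classical in if h : z ≠ 0 ∧ z ≠ 1 then (exists_xx_eq h.1 h.2).choose else UpperHalfPlane.I

lemma xx_secX {z : ℂ} (h0 : z ≠ 0) (h1 : z ≠ 1) : xx (secX z) = z := by
  rw [secX, dif_pos ⟨h0, h1⟩]
  exact (exists_xx_eq h0 h1).choose_spec

lemma exists_secX {τ : ℂ} (hτ : 0 < τ.im) :
    ∃ g : SL(2, ℤ), Level2 g.1 ∧ mob g.1 τ = secX (xx τ) := by
  have h : xH ⟨τ, hτ⟩ = xH (secX (xx τ)) := (xx_secX (xx_ne_zero hτ) (xx_ne_one hτ)).symm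
  obtain ⟨g, hg, he⟩ := equiv2_of_xx_eq h
  refine ⟨g, hg, ?_⟩
  rw [← he, coe_smul_eq_mob]

/-- The Lefschetz function as a function of `xx`. -/
noncomputable def lefH (r p : ℕ) (z : ℂ) : ℂ := lefSum r p 1 (secX z)

lemma lefH_xx {r p : ℕ} (hp : p.Prime) (hodd : Odd p) {τ : ℂ} (hτ : 0 < τ.im) :
    lefH r p (xx τ) = lefSum r p 1 τ := by
  obtain ⟨g, hg, he⟩ := exists_secX hτ
  rw [lefH, ← he, lefSum_level hp hodd hg hτ]

lemma isFix_secX {p : ℕ} (hp : p.Prime) (hodd : Odd p) {τ : ℂ} (hτ : 0 < τ.im) :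
    IsFix p (secX (xx τ)) ↔ IsFix p τ := by
  obtain ⟨g, hg, he⟩ := exists_secX hτ
  rw [← he, isFix_level hp hodd hg hτ]

lemma exists_local_section {τ : ℂ} (hτ : 0 < τ.im) : ∃ g : ℂ → ℂ,
    DifferentiableAt ℂ g (xx τ) ∧ g (xx τ) = τ ∧
      ∀ᶠ z in 𝓝 (xx τ), xx (g z) = z ∧ 0 < (g z).im := by
  have h := hasStrictDerivAt_xx hτ
  have h0 := xx_deriv_ne_zero hτ
  have hg0 : h.localInverse xx _ τ h0 (xx τ) = τ :=
    HasStrictFDerivAt.localInverse_apply_image (h.hasStrictFDerivAt_equiv h0)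
  have hd : DifferentiableAt ℂ (h.localInverse xx _ τ h0) (xx τ) :=
    (h.to_localInverse h0).hasDerivAt.differentiableAt
  refine ⟨h.localInverse xx _ τ h0, hd, hg0, ?_⟩
  have h1 := (h.hasStrictFDerivAt_equiv h0).eventually_right_inverse
  have h2 := hd.continuousAt.eventually (isOpen_upper.mem_nhds (by rwa [hg0] : _ ∈ {τ : ℂ | 0 < τ.im}))
  filter_upwards [h1, h2] with z hz hz'
  exact ⟨hz, hz'⟩

lemma differentiableAt_lefTerm {r p : ℕ} {N : Matrix (Fin 2) (Fin 2) ℤ} (hN : 0 < N.det) {τ : ℂ}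
    (hτ : 0 < τ.im) (hne : xx (mob N τ) ≠ xx τ) :
    DifferentiableAt ℂ (lefTerm r p 1 N) τ := by
  unfold lefTerm
  simp only [one_mul, mob_one, slash_one]
  exact ((differentiableAt_slash hN hτ).const_mul _).div
    ((differentiableAt_phi hτ).mul ((differentiableAt_xx hτ).sub (differentiableAt_xx_mob hN hτ)))
    (mul_ne_zero (phi_ne_zero hτ) (sub_ne_zero.2 hne.symm))

lemma differentiableAt_lefH {r p : ℕ} (hp : p.Prime) (hodd : Odd p) {z : ℂ} (h0 : z ≠ 0)
    (h1 : z ≠ 1) (hfix : ¬ IsFix p (secX z)) : DifferentiableAt ℂ (lefH r p) z := by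
  have hτ := (secX z).2
  have hz := xx_secX h0 h1
  obtain ⟨g, hg, hgτ, hev⟩ := exists_local_section hτ
  rw [hz] at hg hgτ hev
  have h : lefH r p =ᶠ[𝓝 z] lefSum r p 1 ∘ g := by
    filter_upwards [hev] with w hw
    rw [Function.comp_apply, ← lefH_xx hp hodd hw.2, hw.1]
  refine DifferentiableAt.congr_of_eventuallyEq ?_ h
  refine DifferentiableAt.comp z ?_ hg
  rw [hgτ]
  unfold lefSum
  refine DifferentiableAt.fun_sum fun i _ => differentiableAt_lefTerm (det_heckeMat_pos hp i) hτ ?_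
  exact fun h => hfix ⟨i, h⟩

lemma tendsto_nhdsNE_of_section {τ : ℂ} {g : ℂ → ℂ}
    (hg : DifferentiableAt ℂ g (xx τ)) (hgτ : g (xx τ) = τ)
    (hev : ∀ᶠ z in 𝓝 (xx τ), xx (g z) = z ∧ 0 < (g z).im) :
    Tendsto g (𝓝[≠] (xx τ)) (𝓝[≠] τ) := by
  refine tendsto_nhdsWithin_iff.2 ⟨?_, ?_⟩
  · have := hg.continuousAt.tendsto
    rw [hgτ] at this
    exact this.mono_left nhdsWithin_le_nhds
  · filter_upwards [nhdsWithin_le_nhds hev, self_mem_nhdsWithin] with z hz hz' h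
    rw [Set.mem_singleton_iff] at h
    exact hz' (by rw [← hz.1, h]; rfl)

lemma tendsto_mul_lefH {r p : ℕ} (hp : p.Prime) (hodd : Odd p) {z : ℂ} (h0 : z ≠ 0)
    (h1 : z ≠ 1) {ρ : Option (Fin p) → ℂ}
    (h : ∀ i, Tendsto (fun τ => (xx τ - z) * lefTerm r p 1 (heckeMat p i) τ)
      (𝓝[≠] (secX z : ℂ)) (𝓝 (ρ i))) :
    Tendsto (fun w => (w - z) * lefH r p w) (𝓝[≠] z) (𝓝 (∑ i, ρ i)) := by
  have hτ := (secX z).2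
  have hz := xx_secX h0 h1
  obtain ⟨g, hg, hgτ, hev⟩ := exists_local_section hτ
  have hlim := tendsto_nhdsNE_of_section hg hgτ hev
  rw [hz] at hlim hev
  have hs := (tendsto_finsetSum univ fun i _ => h i).comp hlim
  refine hs.congr' ?_
  filter_upwards [nhdsWithin_le_nhds hev] with w hw
  have h2 : lefH r p w = ∑ i, lefTerm r p 1 (heckeMat p i) (g w) := by
    conv_lhs => rw [← hw.1]
    exact lefH_xx hp hodd hw.2
  rw [h2, Finset.mul_sum, Function.comp_apply]
  simp only [hw.1]

/-- In the upper half-plane, `xx τ - xx (N τ)` is eventually nonzero near a fixed point. -/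
lemma tendsto_mul_lefTerm_of_ne {r p : ℕ} {N : Matrix (Fin 2) (Fin 2) ℤ} (hN : 0 < N.det) {τ : ℂ}
    (hτ : 0 < τ.im) (hne : xx (mob N τ) ≠ xx τ) :
    Tendsto (fun σ => (xx σ - xx τ) * lefTerm r p 1 N σ) (𝓝[≠] τ) (𝓝 0) := by
  have h1 := (differentiableAt_lefTerm (r := r) (p := p) hN hτ hne).continuousAt.tendsto
  have h2 := ((differentiableAt_xx hτ).continuousAt.tendsto.sub_const (xx τ)).mul h1
  rw [sub_self, zero_mul] at h2
  exact h2.mono_left nhdsWithin_le_nhds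

lemma hasDerivAt_xx_mob_of_fixed {N : Matrix (Fin 2) (Fin 2) ℤ} (hN : 0 < N.det) {τ : ℂ}
    (hτ : 0 < τ.im) (hfix : mob N τ = τ) :
    HasDerivAt (fun σ => xx σ - xx (mob N σ))
      (Real.pi * Complex.I * (-(ww τ * xx τ)) * (1 - N.det / den N τ ^ 2)) τ := by
  have h1 := hasDerivAt_xx hτ
  have h2 := h1
  rw [← hfix] at h2
  refine (h1.sub (h2.comp τ (hasDerivAt_mob hN.ne' hτ))).congr_deriv ?_
  rw [hfix]
  ring

lemma tendsto_mul_lefTerm_of_fixed {r p : ℕ} {N : Matrix (Fin 2) (Fin 2) ℤ} (hN : 0 < N.det) {τ : ℂ}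
    (hτ : 0 < τ.im) (hfix : mob N τ = τ) (hne : (N.det : ℂ) / den N τ ^ 2 ≠ 1) :
    Tendsto (fun σ => (xx σ - xx τ) * lefTerm r p 1 N σ) (𝓝[≠] τ)
      (𝓝 ((p : ℂ) ^ (2 * r + 1) / den N τ ^ (2 * r + 2) / (1 - N.det / den N τ ^ 2))) := by
  have h1 := (hasDerivAt_xx hτ).tendsto_slope
  have h2 := (hasDerivAt_xx_mob_of_fixed hN hτ hfix).tendsto_slope
  have hd := xx_deriv_ne_zero hτ
  have hne' : (1 : ℂ) - N.det / den N τ ^ 2 ≠ 0 := sub_ne_zero.2 hne.symm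
  have h3 := (differentiableAt_slash (r := r) hN hτ).continuousAt.tendsto.mono_left
    (nhdsWithin_le_nhds (s := {τ}ᶜ))
  have h4 := (differentiableAt_phi (r := r) hτ).continuousAt.tendsto.mono_left
    (nhdsWithin_le_nhds (s := {τ}ᶜ))
  have h5 := ((h3.const_mul ((p : ℂ) ^ (2 * r + 1))).div h4 (phi_ne_zero hτ)).mul
    (h1.div h2 (mul_ne_zero hd hne'))
  have hval : (p : ℂ) ^ (2 * r + 1) * slash r N τ / phi r τ *
      (Real.pi * Complex.I * (-(ww τ * xx τ)) /
        (Real.pi * Complex.I * (-(ww τ * xx τ)) * (1 - N.det / den N τ ^ 2))) =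
      (p : ℂ) ^ (2 * r + 1) / den N τ ^ (2 * r + 2) / (1 - N.det / den N τ ^ 2) := by
    rw [slash, hfix, div_mul_cancel_left₀ hd, ← div_eq_mul_inv]
    congr 1
    have := phi_ne_zero (r := r) hτ
    field_simp
  rw [hval] at h5
  refine h5.congr' ?_
  filter_upwards [self_mem_nhdsWithin] with σ hσ
  have hσ' : σ - τ ≠ 0 := sub_ne_zero.2 hσ
  simp only [lefTerm, one_mul, mob_one, slash_one, Pi.div_apply, slope_def_field, hfix, sub_self,
    sub_zero]
  rw [div_div_div_cancel_right₀ hσ', div_mul_div_comm, mul_comm _ (xx σ - xx τ), mul_div_assoc]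

lemma fixed_den {N : Matrix (Fin 2) (Fin 2) ℤ} {p : ℕ} (hp : p.Prime) (hN : N.det = p) {τ : ℂ}
    (hτ : 0 < τ.im) (hfix : mob N τ = τ) :
    den N τ * conj (den N τ) = p ∧ den N τ + conj (den N τ) = (N 0 0 + N 1 1 : ℤ) ∧
      den N τ ≠ conj (den N τ) := by
  have hdet : N.det ≠ 0 := by rw [hN]; exact_mod_cast hp.ne_zero
  have hd := den_ne_zero hdet hτ
  have h1 : Complex.normSq (den N τ) = p := by
    have := im_mob N τ
    rw [hfix, hN, eq_div_iff (Complex.normSq_pos.2 hd).ne'] at this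
    push_cast at this
    rw [mul_comm] at this
    exact mul_right_cancel₀ hτ.ne' this
  have hc : N 1 0 ≠ 0 := by
    intro hc
    have h2 : den N τ = (N 1 1 : ℤ) := by simp [den, hc]
    rw [h2] at h1
    have h3 : (N 1 1) * (N 1 1) = (p : ℤ) := by
      have : ((N 1 1 : ℤ) : ℝ) * ((N 1 1 : ℤ) : ℝ) = p := by simpa [Complex.normSq] using h1
      exact_mod_cast this
    have h4 : (N 1 1).natAbs * (N 1 1).natAbs = p := by
      have := congrArg Int.natAbs h3
      rwa [Int.natAbs_mul, Int.natAbs_natCast] at this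
    rw [← h4] at hp
    rcases Nat.prime_mul_iff.1 hp with ⟨h, h'⟩ | ⟨h, h'⟩ <;> exact h.ne_one h'
  refine ⟨by rw [Complex.mul_conj, h1]; simp, ?_, ?_⟩
  · have h2 : (N 0 0 : ℂ) * τ + N 0 1 = τ * den N τ := by
      rw [mob, div_eq_iff hd] at hfix
      exact hfix
    have h3 := congrArg Complex.im h2
    simp [den] at h3
    have h4 : (N 0 0 : ℝ) = N 1 0 * τ.re * 2 + N 1 1 := by
      have : τ.im * ((N 0 0 : ℝ) - (N 1 0 * τ.re * 2 + N 1 1)) = 0 := by linarith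
      rcases mul_eq_zero.1 this with h | h
      · exact absurd h hτ.ne'
      · linarith
    rw [Complex.add_conj]
    have h5 : (den N τ).re = N 1 0 * τ.re + N 1 1 := by simp [den]
    rw [h5]
    have h6 : 2 * (N 1 0 * τ.re + N 1 1 : ℝ) = ((N 0 0 + N 1 1 : ℤ) : ℝ) := by
      push_cast; linarith
    exact_mod_cast congrArg (Complex.ofReal) h6
  · intro h
    have := congrArg Complex.im h
    simp [den] at this
    have h2 : (N 1 0 : ℝ) * τ.im = 0 := by linarith
    rcases mul_eq_zero.1 h2 with h | h
    · exact hc (by exact_mod_cast h)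
    · exact hτ.ne' h

lemma trace_sq_lt {α : ℂ} {p : ℕ} {t : ℤ} (h1 : α * conj α = p) (h2 : α + conj α = t)
    (h3 : α ≠ conj α) : t ^ 2 < 4 * p := by
  have him : α.im ≠ 0 := fun h => h3 (Complex.conj_eq_iff_im.2 h).symm
  rw [Complex.mul_conj] at h1
  rw [Complex.add_conj] at h2
  have h1' : Complex.normSq α = p := by exact_mod_cast h1
  have h2' : 2 * α.re = t := by exact_mod_cast h2
  rw [Complex.normSq_apply] at h1'
  have : (t : ℝ) ^ 2 < 4 * p := by
    rw [← h1', ← h2']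
    have := sq_pos_of_ne_zero him
    nlinarith
  exact_mod_cast this

lemma exists_residue {p : ℕ} (hp : p.Prime) (i : Option (Fin p)) {τ : ℂ} (hτ : 0 < τ.im)
    (hfix : xx (mob (heckeMat p i) τ) = xx τ) : ∃ t : ℤ, t ^ 2 < 4 * p ∧
      (∀ᶠ σ in 𝓝[≠] τ, xx (mob (heckeMat p i) σ) ≠ xx σ) ∧
      ∀ r, ∃ ρ : ℂ, 2 * ρ.re = -vPoly p r t ∧
        Tendsto (fun σ => (xx σ - xx τ) * lefTerm r p 1 (heckeMat p i) σ) (𝓝[≠] τ) (𝓝 ρ) := by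
  have hM := det_heckeMat_pos hp i
  obtain ⟨g, hg, he⟩ := equiv2_of_xx_eq (σ := ⟨_, im_mob_pos hM hτ⟩) (τ := ⟨τ, hτ⟩) hfix
  have he' : mob (g.1 * heckeMat p i) τ = τ := by
    have := congrArg UpperHalfPlane.coe he
    rw [coe_smul_eq_mob] at this
    rwa [mob_mul hM.ne' hτ]
  have hN : (g.1 * heckeMat p i).det = p := by rw [Matrix.det_mul, g.2, det_heckeMat, one_mul]
  have hN0 : 0 < (g.1 * heckeMat p i).det := by rw [hN]; exact_mod_cast hp.pos
  obtain ⟨h1, h2, h3⟩ := fixed_den hp hN hτ he'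
  set α := den (g.1 * heckeMat p i) τ with hα
  have hα0 : α ≠ 0 := den_ne_zero hN0.ne' hτ
  have hsub : α - conj α ≠ 0 := sub_ne_zero.2 h3
  have h1' : α * conj α = ((p : ℤ) : ℂ) := by rw [h1]; simp
  have hne : ((g.1 * heckeMat p i).det : ℂ) / α ^ 2 ≠ 1 := by
    rw [hN]
    intro h
    rw [div_eq_one_iff_eq (pow_ne_zero _ hα0), ← h1', sq] at h
    exact h3 (mul_left_cancel₀ hα0 h).symm
  refine ⟨_, trace_sq_lt h1 h2 h3, ?_, fun r => ⟨_, two_re_residue h1' h2 h3 r, ?_⟩⟩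
  · have hderiv := hasDerivAt_xx_mob_of_fixed hN0 hτ he'
    have := hderiv.eventually_ne (c := 0) (mul_ne_zero (xx_deriv_ne_zero hτ) (sub_ne_zero.2 hne.symm))
    filter_upwards [this, nhdsWithin_le_nhds (isOpen_upper.mem_nhds hτ)] with σ hσ hσ' h
    rw [xx_level_mul hg hM hσ', h, sub_self] at hσ
    exact hσ rfl
  · have h := tendsto_mul_lefTerm_of_fixed (r := r) (p := p) hN0 hτ he' hne
    rw [hN, ← hα, ← h1'] at h
    have hval : (p : ℂ) ^ (2 * r + 1) / α ^ (2 * r + 2) / (1 - α * conj α / α ^ 2) =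
        conj α ^ (2 * r + 1) / (α - conj α) := by
      rw [← h1]
      have e1 : 1 - α * conj α / α ^ 2 = (α - conj α) / α := by field_simp
      rw [e1, mul_pow, pow_succ α (2 * r + 1)]
      field_simp
    rw [hval] at h
    refine h.congr' ?_
    filter_upwards [nhdsWithin_le_nhds (isOpen_upper.mem_nhds hτ)] with σ hσ
    simp only [lefTerm, one_mul, mob_one, slash_one]
    rw [slash_level_mul hg hM hσ, xx_level_mul hg hM hσ]

end LegendreMoments

namespace LegendreMoments

open Matrix MatrixGroups Topology

section cusps

/-- The local parameter `v / w` at the cusps `0` and `1`. -/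
noncomputable def zz (τ : ℂ) : ℂ := vv τ / ww τ

/-- The form `phi r` at the cusps `0` and `1`, up to sign. -/
noncomputable def cphi (r : ℕ) (τ : ℂ) : ℂ := ww τ ^ r * uu τ * zz τ

/-- The cusp represented by `g`, at which `xx` takes the value `c`. -/
def IsCusp (g : SL(2, ℤ)) (c : ℂ) : Prop :=
  ∃ s : ℂ, s ≠ 0 ∧ (∀ τ : ℂ, 0 < τ.im → xx (mob g.1 τ) = c + s * zz τ) ∧
    ∀ r, ∃ e : ℂ, e ≠ 0 ∧ ∀ τ : ℂ, 0 < τ.im → slash r g.1 τ = e * cphi r τ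

variable {p : ℕ}

lemma isCusp_one : IsCusp ModularGroup.S 1 := by
  have hS : ModularGroup.S.1 = !![0, -1; 1, 0] := rfl
  have hrep : thetaRepInt !![0, -1; 1, 0] = !![-1, 0; -1, 1] := by decide
  refine ⟨1, one_ne_zero, fun τ hτ => ?_, fun r => ⟨(-1) ^ (r + 1), by simp, fun τ hτ => ?_⟩⟩
  all_goals
    have hw := ww_ne_zero hτ
    have hv := vv_ne_zero hτ
    have hd := den_ne_zero (sl_det_ne ModularGroup.S) hτ
    obtain ⟨h1, h2⟩ := thetaLaw ModularGroup.S τ hτ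
    have h3 := ww_eq (im_mob_pos (sl_det_pos ModularGroup.S) hτ)
    rw [h1, h2, hS, hrep] at h3
    rw [hS, hrep] at h1 h2
    rw [hS] at hd
    simp only [Matrix.cons_val', Matrix.cons_val_zero, Matrix.cons_val_one, Matrix.of_apply,
      Matrix.cons_val_fin_one, Int.cast_neg, Int.cast_one, Int.cast_zero] at h1 h2 h3
    have h1' : uu (mob !![0, -1; 1, 0] τ) = den !![0, -1; 1, 0] τ ^ 2 * -uu τ := by
      rw [h1]; ring
    have h2' : vv (mob !![0, -1; 1, 0] τ) = den !![0, -1; 1, 0] τ ^ 2 * -ww τ := by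
      rw [h2, ww_eq hτ]; ring
    have h3' : ww (mob !![0, -1; 1, 0] τ) = den !![0, -1; 1, 0] τ ^ 2 * -vv τ := by
      rw [h3]; ring
    rw [hS]
  · rw [xx, h1', h2', mul_div_mul_left _ _ (pow_ne_zero _ hd), zz, neg_div_neg_eq, one_mul]
    field_simp
    rw [ww_eq hτ]
    ring
  · rw [slash, phi, xx, h1', h2', h3', mul_div_mul_left _ _ (pow_ne_zero _ hd), cphi, zz,
      div_eq_iff (pow_ne_zero _ hd)]
    field_simp
    ring

lemma isCusp_zero : IsCusp (ModularGroup.T * ModularGroup.S) 0 := by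
  have hS : (ModularGroup.T * ModularGroup.S).1 = !![1, -1; 1, 0] := by
    rw [Matrix.SpecialLinearGroup.coe_mul]
    decide
  have hrep : thetaRepInt !![1, -1; 1, 0] = !![0, -1; 1, -1] := by decide
  refine ⟨-1, by simp, fun τ hτ => ?_, fun r => ⟨1, by simp, fun τ hτ => ?_⟩⟩
  all_goals
    have hw := ww_ne_zero hτ
    have hv := vv_ne_zero hτ
    have hd := den_ne_zero (sl_det_ne (ModularGroup.T * ModularGroup.S)) hτ
    obtain ⟨h1, h2⟩ := thetaLaw (ModularGroup.T * ModularGroup.S) τ hτ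
    have h3 := ww_eq (im_mob_pos (sl_det_pos (ModularGroup.T * ModularGroup.S)) hτ)
    rw [h1, h2, hS, hrep] at h3
    rw [hS, hrep] at h1 h2
    rw [hS] at hd
    simp only [Matrix.cons_val', Matrix.cons_val_zero, Matrix.cons_val_one, Matrix.of_apply,
      Matrix.cons_val_fin_one, Int.cast_neg, Int.cast_one, Int.cast_zero] at h1 h2 h3
    have h1' : uu (mob !![1, -1; 1, 0] τ) = den !![1, -1; 1, 0] τ ^ 2 * -vv τ := by
      rw [h1]; ring
    have h2' : vv (mob !![1, -1; 1, 0] τ) = den !![1, -1; 1, 0] τ ^ 2 * ww τ := by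
      rw [h2, ww_eq hτ]; ring
    have h3' : ww (mob !![1, -1; 1, 0] τ) = den !![1, -1; 1, 0] τ ^ 2 * -uu τ := by
      rw [h3]; ring
    rw [hS]
  · rw [xx, h1', h2', mul_div_mul_left _ _ (pow_ne_zero _ hd), zz]
    ring
  · rw [slash, phi, xx, h1', h2', h3', mul_div_mul_left _ _ (pow_ne_zero _ hd), cphi, zz,
      div_eq_iff (pow_ne_zero _ hd)]
    field_simp
    ring

lemma mob_none (τ : ℂ) : mob (heckeMat p none) τ = p * τ := by simp [heckeMat, mob, den]

lemma den_none (τ : ℂ) : den (heckeMat p none) τ = 1 := by simp [heckeMat, den]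

lemma mob_some (j : Fin p) (τ : ℂ) :
    mob (heckeMat p (some j)) τ = (τ + 2 * ((j : ℕ) : ℂ)) / p := by simp [heckeMat, mob, den]

lemma den_some (j : Fin p) (τ : ℂ) : den (heckeMat p (some j)) τ = p := by simp [heckeMat, den]

lemma im_mob_none (τ : ℂ) : (mob (heckeMat p none) τ).im = p * τ.im := by simp [mob_none]

lemma im_mob_some (j : Fin p) (τ : ℂ) : (mob (heckeMat p (some j)) τ).im = τ.im / p := by
  simp [mob_some, Complex.div_natCast_im]

lemma tendsto_mob_imInf (hp : p.Prime) (i : Option (Fin p)) :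
    Tendsto (mob (heckeMat p i)) imInf imInf := by
  have hp0 : (0 : ℝ) < p := by exact_mod_cast hp.pos
  have h : Tendsto Complex.im imInf atTop := tendsto_comap
  rw [imInf, tendsto_comap_iff]
  cases i with
  | none =>
    refine (h.const_mul_atTop hp0).congr fun τ => (im_mob_none τ).symm
  | some j =>
    refine (h.atTop_div_const hp0).congr fun τ => (im_mob_some j τ).symm

lemma tendsto_qq_div (hp : p.Prime) (j : Fin p) :
    Tendsto (fun τ => qq τ / qq (mob (heckeMat p (some j)) τ)) imInf (𝓝 0) := by
  rw [tendsto_zero_iff_norm_tendsto_zero]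
  have hp1 : (1 : ℝ) < p := by exact_mod_cast hp.one_lt
  have hc : 0 < Real.pi * (1 - 1 / p) :=
    mul_pos Real.pi_pos (sub_pos.2 (by rw [div_lt_one (by linarith)]; exact hp1))
  have h : Tendsto Complex.im imInf atTop := tendsto_comap
  refine (Real.tendsto_exp_neg_atTop_nhds_zero.comp (h.const_mul_atTop hc)).congr fun τ => ?_
  rw [norm_div, norm_qq, norm_qq, ← Real.exp_sub, im_mob_some, Function.comp_apply]
  congr 1
  field_simp
  ring

lemma tendsto_qq_div' (hp : p.Prime) :
    Tendsto (fun τ => qq (mob (heckeMat p none) τ) / qq τ) imInf (𝓝 0) := by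
  rw [tendsto_zero_iff_norm_tendsto_zero]
  have hp1 : (1 : ℝ) < p := by exact_mod_cast hp.one_lt
  have hc : 0 < Real.pi * (p - 1) := mul_pos Real.pi_pos (sub_pos.2 hp1)
  have h : Tendsto Complex.im imInf atTop := tendsto_comap
  refine (Real.tendsto_exp_neg_atTop_nhds_zero.comp (h.const_mul_atTop hc)).congr fun τ => ?_
  rw [norm_div, norm_qq, norm_qq, ← Real.exp_sub, im_mob_none, Function.comp_apply]
  congr 1
  ring

section param
variable {f : ℂ → ℂ}

lemma tendsto_param_div (hf : Tendsto (fun τ => f τ / qq τ) imInf (𝓝 16))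
    (hp : p.Prime) (j : Fin p) :
    Tendsto (fun τ => f τ / f (mob (heckeMat p (some j)) τ)) imInf (𝓝 0) := by
  have h1 := (hf.div (hf.comp (tendsto_mob_imInf hp (some j))) (by norm_num)).mul
    (tendsto_qq_div hp j)
  rw [mul_zero] at h1
  refine h1.congr fun τ => ?_
  have a := qq_ne_zero τ
  have b := qq_ne_zero (mob (heckeMat p (some j)) τ)
  simp only [Pi.div_apply, Function.comp_apply]
  field_simp

lemma tendsto_param_div' (hf : Tendsto (fun τ => f τ / qq τ) imInf (𝓝 16))
    (hp : p.Prime) :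
    Tendsto (fun τ => f (mob (heckeMat p none) τ) / f τ) imInf (𝓝 0) := by
  have h1 := ((hf.comp (tendsto_mob_imInf hp none)).div hf (by norm_num)).mul
    (tendsto_qq_div' hp)
  rw [mul_zero] at h1
  refine h1.congr fun τ => ?_
  have a := qq_ne_zero τ
  have b := qq_ne_zero (mob (heckeMat p none) τ)
  simp only [Pi.div_apply, Function.comp_apply]
  field_simp

lemma eventually_param_ne (hf : Tendsto (fun τ => f τ / qq τ) imInf (𝓝 16))
    (hp : p.Prime) (i : Option (Fin p)) :
    ∀ᶠ τ in imInf, f (mob (heckeMat p i) τ) ≠ f τ := by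
  have hne : ∀ᶠ τ in imInf, f τ / qq τ ≠ 0 := hf.eventually_ne (by norm_num)
  cases i with
  | none =>
    filter_upwards [(tendsto_param_div' hf hp).eventually_ne (zero_ne_one' ℂ), hne] with τ h h' he
    have : f τ ≠ 0 := fun h0 => h' (by rw [h0, zero_div])
    exact h (by rw [he, div_self this])
  | some j =>
    filter_upwards [(tendsto_param_div hf hp j).eventually_ne (zero_ne_one' ℂ), hne] with τ h h' he
    have : f τ ≠ 0 := fun h0 => h' (by rw [h0, zero_div])
    exact h (by rw [he, div_self this])

end param

lemma tendsto_zz_div_qq : Tendsto (fun τ => zz τ / qq τ) imInf (𝓝 16) := by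
  have := tendsto_vv_div_qq.div tendsto_ww one_ne_zero
  rw [div_one] at this
  refine this.congr fun τ => ?_
  rw [Pi.div_apply, zz, div_right_comm]

lemma tendsto_xx_inv_div_qq : Tendsto (fun τ => (xx τ)⁻¹ / qq τ) imInf (𝓝 16) := by
  have := tendsto_vv_div_qq.div tendsto_uu one_ne_zero
  rw [div_one] at this
  refine this.congr fun τ => ?_
  rw [Pi.div_apply, xx, inv_div, div_right_comm]

lemma zz_ne_zero {τ : ℂ} (hτ : 0 < τ.im) : zz τ ≠ 0 := div_ne_zero (vv_ne_zero hτ) (ww_ne_zero hτ)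

lemma zz_eq {τ : ℂ} (hτ : 0 < τ.im) : zz τ = (xx τ - 1)⁻¹ := by
  rw [xx_sub_one hτ, inv_div, zz]

/-- The contribution of `M` to the Lefschetz function near the cusps `0` and `1`. -/
noncomputable def cuspTerm (r p : ℕ) (M : Matrix (Fin 2) (Fin 2) ℤ) (τ : ℂ) : ℂ :=
  (p : ℂ) ^ (2 * r + 1) / den M τ ^ (2 * r + 2) *
    ((ww (mob M τ) ^ r * uu (mob M τ)) / (ww τ ^ r * uu τ)) * (zz τ / zz (mob M τ) - 1)⁻¹

lemma tendsto_cusp_ratio (r : ℕ) (hp : p.Prime) (i : Option (Fin p)) :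
    Tendsto (fun τ => (ww (mob (heckeMat p i) τ) ^ r * uu (mob (heckeMat p i) τ)) /
      (ww τ ^ r * uu τ)) imInf (𝓝 1) := by
  have h := (tendsto_ww.pow r).mul tendsto_uu
  have h2 := (h.comp (tendsto_mob_imInf hp i)).div h (by simp)
  simp only [one_pow, mul_one, div_one] at h2
  exact h2

lemma tendsto_cuspTerm_some (r : ℕ) (hp : p.Prime) (j : Fin p) :
    Tendsto (cuspTerm r p (heckeMat p (some j))) imInf (𝓝 (-(p : ℂ)⁻¹)) := by
  have hp0 : (p : ℂ) ≠ 0 := by exact_mod_cast hp.ne_zero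
  have h := ((tendsto_cusp_ratio r hp (some j)).const_mul
    ((p : ℂ) ^ (2 * r + 1) / (p : ℂ) ^ (2 * r + 2))).mul
    (((tendsto_param_div tendsto_zz_div_qq hp j).sub_const 1).inv₀ (by simp))
  have hval : (p : ℂ) ^ (2 * r + 1) / (p : ℂ) ^ (2 * r + 2) * 1 * (0 - 1)⁻¹ = -(p : ℂ)⁻¹ := by
    rw [pow_succ _ (2 * r + 1)]
    field_simp
    norm_num
  rw [hval] at h
  refine h.congr fun τ => ?_
  rw [cuspTerm, den_some]

lemma tendsto_cuspTerm_none (r : ℕ) (hp : p.Prime) :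
    Tendsto (cuspTerm r p (heckeMat p none)) imInf (𝓝 0) := by
  have h1 := tendsto_param_div' tendsto_zz_div_qq hp
  have h2 := h1.div (h1.const_sub 1) (by simp)
  have h := ((tendsto_cusp_ratio r hp none).const_mul ((p : ℂ) ^ (2 * r + 1))).mul h2
  rw [zero_div, mul_zero] at h
  refine h.congr' ?_
  filter_upwards [eventually_imInf 0] with τ hτ
  have hz := zz_ne_zero hτ
  have hz' := zz_ne_zero (im_mob_pos (det_heckeMat_pos hp none) hτ)
  rw [cuspTerm, den_none, one_pow, div_one]
  congr 1
  rw [Pi.div_apply, one_sub_div hz, div_div_div_cancel_right₀ hz, div_sub_one hz', inv_div]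

lemma tendsto_sum_cuspTerm (r : ℕ) (hp : p.Prime) :
    Tendsto (fun τ => ∑ i, cuspTerm r p (heckeMat p i) τ) imInf (𝓝 (-1)) := by
  have hp0 : (p : ℂ) ≠ 0 := by exact_mod_cast hp.ne_zero
  simp only [Fintype.sum_option]
  have h := (tendsto_cuspTerm_none r hp).add
    (tendsto_finsetSum univ fun j _ => tendsto_cuspTerm_some r hp j)
  have hval : (0 : ℂ) + ∑ _j : Fin p, -(p : ℂ)⁻¹ = -1 := by
    simp [hp0]
  rwa [hval] at h

variable {g : SL(2, ℤ)} {c : ℂ}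

lemma IsCusp.mul_lefSum (hg : IsCusp g c) (r : ℕ) (hp : p.Prime) {τ : ℂ} (hτ : 0 < τ.im) :
    (xx (mob g.1 τ) - c) * lefSum r p g.1 τ = ∑ i, cuspTerm r p (heckeMat p i) τ := by
  obtain ⟨s, hs, hx, hsl⟩ := hg
  obtain ⟨e, he, hsl⟩ := hsl r
  rw [lefSum, Finset.mul_sum]
  refine Finset.sum_congr rfl fun i _ => ?_
  have hM := det_heckeMat_pos hp i
  have hτ' := im_mob_pos hM hτ
  have h1 : slash r (g.1 * heckeMat p i) τ =
      e * cphi r (mob (heckeMat p i) τ) / den (heckeMat p i) τ ^ (2 * r + 2) := by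
    rw [slash_mul hM hτ, hsl _ hτ']
  have hz := zz_ne_zero hτ
  have hz' := zz_ne_zero hτ'
  have hd := den_ne_zero hM.ne' hτ
  have hwu : ww τ ^ r * uu τ ≠ 0 := mul_ne_zero (pow_ne_zero _ (ww_ne_zero hτ)) (uu_ne_zero hτ)
  rw [lefTerm, h1, hsl _ hτ, mob_mul hM.ne' hτ, hx _ hτ, hx _ hτ', cuspTerm, cphi, cphi,
    add_sub_cancel_left, add_sub_add_left_eq_sub, ← mul_sub, div_sub_one hz', inv_div]
  rcases eq_or_ne (zz τ - zz (mob (heckeMat p i) τ)) 0 with h0 | h0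
  · rw [h0]; simp
  · field_simp

lemma eventually_exists_high {P : ℂ → Prop} {l : Filter ℂ} {f : ℂ → ℂ}
    (hf : Tendsto (fun z => ‖f z‖) l atTop) (hP : ∀ᶠ τ in imInf, P τ) :
    ∀ᶠ z in l, ∃ σ : ℂ, 0 < σ.im ∧ xx σ = f z ∧ P σ := by
  obtain ⟨Y, hY⟩ := eventually_imInf_iff.1 hP
  obtain ⟨B, hB⟩ := exists_equiv_im_large Y
  filter_upwards [hf.eventually_gt_atTop B, hf.eventually_gt_atTop 1] with z hz hz1
  have h0 : f z ≠ 0 := by rintro h; rw [h, norm_zero] at hz1; linarith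
  have h1 : f z ≠ 1 := by rintro h; rw [h, norm_one] at hz1; linarith
  obtain ⟨τ, hτ⟩ := exists_xx_eq h0 h1
  obtain ⟨σ, hσ, hσY⟩ := hB τ (by rwa [hτ])
  exact ⟨σ, σ.2, hσ.xx_eq.symm.trans hτ, hY _ hσY.le⟩

lemma IsCusp.eventually (hg : IsCusp g c) {P : ℂ → Prop} (hP : ∀ᶠ τ in imInf, P τ) :
    ∀ᶠ z in 𝓝[≠] c, ∃ σ : ℂ, 0 < σ.im ∧ xx (mob g.1 σ) = z ∧ P σ := by
  obtain ⟨s, hs, hx, -⟩ := hg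
  have hf : Tendsto (fun z : ℂ => ‖1 + s / (z - c)‖) (𝓝[≠] c) atTop := by
    have h1 : Tendsto (fun z : ℂ => ‖z - c‖) (𝓝[≠] c) (𝓝[>] 0) := by
      refine tendsto_nhdsWithin_iff.2 ⟨?_, ?_⟩
      · have : Tendsto (fun z : ℂ => ‖z - c‖) (𝓝 c) (𝓝 ‖c - c‖) := by
          exact (continuous_id.sub continuous_const).norm.tendsto c
        rw [sub_self, norm_zero] at this
        exact this.mono_left nhdsWithin_le_nhds
      · filter_upwards [self_mem_nhdsWithin] with z hz
        exact norm_pos_iff.2 (sub_ne_zero.2 hz)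
    have h2 := (tendsto_inv_nhdsGT_zero.comp h1).const_mul_atTop (norm_pos_iff.2 hs)
    refine tendsto_atTop_mono (fun z => ?_) (tendsto_atTop_add_const_right _ (-1) h2)
    have := norm_sub_norm_le (s / (z - c)) (-1)
    rw [norm_neg, norm_one, norm_div, sub_neg_eq_add, add_comm (s / _) 1] at this
    simpa [div_eq_mul_inv, sub_eq_add_neg] using this
  filter_upwards [eventually_exists_high hf hP, self_mem_nhdsWithin] with z ⟨σ, hσ, hxσ, hPσ⟩ hz
  refine ⟨σ, hσ, ?_, hPσ⟩
  rw [hx σ hσ, zz_eq hσ, hxσ, add_sub_cancel_left, inv_div, mul_div_cancel₀ _ hs,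
    add_sub_cancel]

lemma IsCusp.tendsto (hg : IsCusp g c) (r : ℕ) (hp : p.Prime) (hodd : Odd p) :
    Tendsto (fun z => (z - c) * lefH r p z) (𝓝[≠] c) (𝓝 (-1)) := by
  rw [tendsto_iff_eventually]
  intro P hP
  filter_upwards [hg.eventually ((tendsto_sum_cuspTerm r hp).eventually hP)] with z ⟨σ, hσ, hx, hPσ⟩
  rw [← hx, lefH_xx hp hodd (im_mob_pos (sl_det_pos g) hσ), lefSum_mob hp hodd g hσ,
    hg.mul_lefSum r hp hσ]
  exact hPσ

/-- The poles of the Lefschetz function away from the cusps. -/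
def poles (p : ℕ) : Set ℂ := {z | z ≠ 0 ∧ z ≠ 1 ∧ IsFix p (secX z)}

lemma IsCusp.eventually_notMem_poles (hg : IsCusp g c) (hp : p.Prime) (hodd : Odd p) :
    ∀ᶠ z in 𝓝[≠] c, z ∉ poles p := by
  have h : ∀ᶠ τ in imInf, ∀ i, zz (mob (heckeMat p i) τ) ≠ zz τ :=
    eventually_all.2 fun i => eventually_param_ne tendsto_zz_div_qq hp i
  filter_upwards [hg.eventually h] with z ⟨σ, hσ, hx, hPσ⟩ hz
  have hz2 := hz.2.2
  rw [← hx, isFix_secX hp hodd (im_mob_pos (sl_det_pos g) hσ), isFix_mob hp hodd g hσ] at hz2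
  obtain ⟨i, hi⟩ := hz2
  obtain ⟨s, hs, hx, -⟩ := hg
  have hM := det_heckeMat_pos hp i
  rw [mob_mul hM.ne' hσ, hx _ hσ, hx _ (im_mob_pos hM hσ)] at hi
  exact hPσ i (mul_left_cancel₀ hs (add_left_cancel hi))

lemma eventually_notMem_poles {z : ℂ} (hp : p.Prime) (h0 : z ≠ 0)
    (h1 : z ≠ 1) (hodd : Odd p) : ∀ᶠ w in 𝓝[≠] z, w ∉ poles p := by
  have hτ := (secX z).2
  have hz := xx_secX h0 h1
  have h : ∀ᶠ τ in 𝓝[≠] (secX z : ℂ), ∀ i, xx (mob (heckeMat p i) τ) ≠ xx τ := by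
    refine eventually_all.2 fun i => ?_
    by_cases hfix : xx (mob (heckeMat p i) (secX z)) = xx (secX z)
    · obtain ⟨t, -, h, -⟩ := exists_residue hp i hτ hfix
      exact h
    · have h1 := (differentiableAt_xx_mob (det_heckeMat_pos hp i) hτ).continuousAt
      have h2 := (h1.sub (differentiableAt_xx hτ).continuousAt).eventually_ne
        (sub_ne_zero.2 hfix)
      exact nhdsWithin_le_nhds (h2.mono fun σ hσ => sub_ne_zero.1 hσ)
  obtain ⟨g, hg, hgτ, hev⟩ := exists_local_section hτ
  have hlim := tendsto_nhdsNE_of_section hg hgτ hev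
  rw [hz] at hlim hev
  filter_upwards [hlim.eventually h, nhdsWithin_le_nhds hev] with w hw hw' hwp
  have h2 := hwp.2.2
  rw [← hw'.1, isFix_secX hp hodd hw'.2] at h2
  obtain ⟨i, hi⟩ := h2
  exact hw i hi

lemma finite_poles (hp : p.Prime) (hodd : Odd p) : (poles p).Finite := by
  have hiso : ∀ z : ℂ, ∀ᶠ w in 𝓝[≠] z, w ∉ poles p := by
    intro z
    rcases eq_or_ne z 0 with rfl | h0
    · exact isCusp_zero.eventually_notMem_poles hp hodd
    rcases eq_or_ne z 1 with rfl | h1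
    · exact isCusp_one.eventually_notMem_poles hp hodd
    exact eventually_notMem_poles hp h0 h1 hodd
  have hinf : ∀ᶠ τ in imInf, ∀ i, (xx (mob (heckeMat p i) τ))⁻¹ ≠ (xx τ)⁻¹ :=
    eventually_all.2 fun i => eventually_param_ne tendsto_xx_inv_div_qq hp i
  have h2 : ∀ᶠ z in Bornology.cobounded ℂ, z ∉ poles p := by
    filter_upwards [eventually_exists_high (f := id) tendsto_norm_cobounded_atTop hinf] with
      z ⟨σ, hσ, hx, hPσ⟩ hz
    have hz2 := hz.2.2
    rw [id_eq] at hx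
    rw [← hx, isFix_secX hp hodd hσ] at hz2
    obtain ⟨i, hi⟩ := hz2
    exact hPσ i (by rw [hi])
  have hb : Bornology.IsBounded (poles p) := by
    rw [Bornology.isBounded_def]
    exact h2
  by_contra hfin
  obtain ⟨R, hR⟩ := hb.subset_closedBall (0 : ℂ)
  obtain ⟨a, -, ha⟩ := Set.Infinite.exists_accPt_of_subset_isCompact hfin
    (isCompact_closedBall (0 : ℂ) R) hR
  exact (accPt_iff_frequently_nhdsNE.1 ha) ((hiso a).mono fun w hw => by simpa using hw)

end cusps

end LegendreMoments

namespace LegendreMoments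

open Matrix MatrixGroups Topology

lemma exists_entire_extension (F : Finset ℂ) : ∀ f : ℂ → ℂ,
    (∀ z ∉ F, DifferentiableAt ℂ f z) →
    (∀ s ∈ F, Tendsto (fun z => (z - s) * f z) (𝓝[≠] s) (𝓝 0)) →
    ∃ E : ℂ → ℂ, Differentiable ℂ E ∧ ∀ z ∉ F, E z = f z := by
  induction F using Finset.induction_on with
  | empty => exact fun f hf _ => ⟨f, fun z => hf z (by simp), fun _ _ => rfl⟩
  | insert a F ha ih =>
    intro f hf hres
    set f' := Function.update f a (limUnder (𝓝[≠] a) f) with hf'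
    have heq : ∀ z, z ≠ a → f' =ᶠ[𝓝 z] f := by
      intro z hz
      filter_upwards [isOpen_ne.mem_nhds hz] with w hw
      exact Function.update_of_ne hw _ _
    suffices h : (∀ z ∉ F, DifferentiableAt ℂ f' z) ∧
        ∀ s ∈ F, Tendsto (fun z => (z - s) * f' z) (𝓝[≠] s) (𝓝 0) by
      obtain ⟨E, hE, hEf⟩ := ih f' h.1 h.2
      refine ⟨E, hE, fun z hz => ?_⟩
      rw [Finset.mem_insert, not_or] at hz
      rw [hEf z hz.2, (heq z hz.1).eq_of_nhds]
    constructor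
    · intro z hz
      rcases eq_or_ne z a with rfl | hza
      · have hU : ((F : Set ℂ)ᶜ) ∈ 𝓝 z := F.finite_toSet.isClosed.isOpen_compl.mem_nhds (by simpa)
        refine (Complex.differentiableOn_update_limUnder_of_isLittleO hU ?_ ?_).differentiableAt hU
        · intro w hw
          refine (hf w ?_).differentiableWithinAt
          rw [Finset.mem_insert, not_or]
          exact ⟨hw.2, hw.1⟩
        · refine (Asymptotics.isLittleO_iff_tendsto' ?_).2 ?_
          · filter_upwards [self_mem_nhdsWithin] with w hw h
            exact absurd (inv_eq_zero.1 h) (sub_ne_zero.2 hw)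
          · have h1 := hres z (Finset.mem_insert_self _ _)
            have h2 : Tendsto (fun w : ℂ => (w - z) * f z) (𝓝[≠] z) (𝓝 0) := by
              have : Tendsto (fun w : ℂ => (w - z) * f z) (𝓝 z) (𝓝 ((z - z) * f z)) :=
                Continuous.tendsto (by fun_prop) z
              rw [sub_self, zero_mul] at this
              exact this.mono_left nhdsWithin_le_nhds
            have h3 := h1.sub h2
            rw [sub_zero] at h3
            refine h3.congr fun w => ?_
            rw [div_inv_eq_mul]
            ring
      · refine (hf z ?_).congr_of_eventuallyEq (heq z hza)
        rw [Finset.mem_insert, not_or]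
        exact ⟨hza, hz⟩
    · intro s hs
      have hsa : s ≠ a := fun h => ha (h ▸ hs)
      refine (hres s (Finset.mem_insert_of_mem hs)).congr' ?_
      filter_upwards [nhdsWithin_le_nhds (heq s hsa)] with z hz
      rw [hz]

lemma exists_partial_fractions (F : Finset ℂ) (f ρ : ℂ → ℂ)
    (hf : ∀ z ∉ F, DifferentiableAt ℂ f z)
    (hres : ∀ s ∈ F, Tendsto (fun z => (z - s) * f z) (𝓝[≠] s) (𝓝 (ρ s))) :
    ∃ E : ℂ → ℂ, Differentiable ℂ E ∧ ∀ z ∉ F, f z = E z + ∑ s ∈ F, ρ s / (z - s) := by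
  have hpole : ∀ s z : ℂ, z ≠ s → DifferentiableAt ℂ (fun z => ρ s / (z - s)) z := fun s z h =>
    (differentiableAt_const _).div (differentiableAt_id.sub_const s) (sub_ne_zero.2 h)
  suffices h : (∀ z ∉ F, DifferentiableAt ℂ (fun z => f z - ∑ s ∈ F, ρ s / (z - s)) z) ∧
      ∀ s ∈ F, Tendsto (fun z => (z - s) * (f z - ∑ s ∈ F, ρ s / (z - s))) (𝓝[≠] s) (𝓝 0) by
    obtain ⟨E, hE, hEf⟩ := exists_entire_extension F _ h.1 h.2
    exact ⟨E, hE, fun z hz => by rw [hEf z hz]; ring⟩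
  constructor
  · intro z hz
    refine (hf z hz).sub (DifferentiableAt.fun_sum fun s hs => hpole s z ?_)
    rintro rfl
    exact hz hs
  · intro s hs
    have h1 : Tendsto (fun z => ∑ t ∈ F, (z - s) * (ρ t / (z - t))) (𝓝[≠] s)
        (𝓝 (∑ t ∈ F, if t = s then ρ s else 0)) := by
      refine tendsto_finsetSum _ fun t _ => ?_
      split_ifs with h
      · subst h
        refine tendsto_const_nhds.congr' ?_
        filter_upwards [self_mem_nhdsWithin] with z hz
        rw [mul_div_cancel₀]
        exact sub_ne_zero.2 hz
      · have h2 := (hpole t s (Ne.symm h)).continuousAt.tendsto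
        have h3 : Tendsto (fun z : ℂ => z - s) (𝓝 s) (𝓝 (s - s)) :=
          Continuous.tendsto (by fun_prop) s
        have h4 := h3.mul h2
        rw [sub_self, zero_mul] at h4
        exact h4.mono_left nhdsWithin_le_nhds
    rw [Finset.sum_ite_eq' F s, if_pos hs] at h1
    have h5 := (hres s hs).sub h1
    rw [sub_self] at h5
    refine h5.congr fun z => ?_
    rw [mul_sub, Finset.mul_sum]

/-- The mean over a period `2` at height `Y`. -/
noncomputable def mean (f : ℂ → ℂ) (Y : ℝ) : ℂ := (1 / 2) * ∫ x in (0 : ℝ)..2, f (x + Y * Complex.I)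

lemma im_add_mul_I (x Y : ℝ) : ((x : ℂ) + Y * Complex.I).im = Y := by simp

lemma continuous_horizontal {f : ℂ → ℂ} {Y : ℝ} (hf : ∀ τ : ℂ, τ.im = Y → ContinuousAt f τ) :
    Continuous fun x : ℝ => f (x + Y * Complex.I) := by
  rw [continuous_iff_continuousAt]
  intro x
  exact ContinuousAt.comp (f := fun x : ℝ => (x : ℂ) + Y * Complex.I) (hf _ (im_add_mul_I x Y))
    (by fun_prop)

lemma eventually_height {P : ℂ → Prop} (h : ∀ᶠ τ in imInf, P τ) :
    ∀ᶠ Y : ℝ in atTop, ∀ τ : ℂ, τ.im = Y → P τ := by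
  obtain ⟨Y, hY⟩ := eventually_imInf_iff.1 h
  filter_upwards [eventually_ge_atTop Y] with Z hZ τ hτ
  exact hY τ (hτ ▸ hZ)

lemma mean_add {f g : ℂ → ℂ} {Y : ℝ} (hf : ∀ τ : ℂ, τ.im = Y → ContinuousAt f τ)
    (hg : ∀ τ : ℂ, τ.im = Y → ContinuousAt g τ) :
    mean (fun τ => f τ + g τ) Y = mean f Y + mean g Y := by
  rw [mean, mean, mean, intervalIntegral.integral_add
    ((continuous_horizontal hf).intervalIntegrable _ _)
    ((continuous_horizontal hg).intervalIntegrable _ _), mul_add]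

lemma mean_sum {ι : Type*} (s : Finset ι) {f : ι → ℂ → ℂ} {Y : ℝ}
    (hf : ∀ i ∈ s, ∀ τ : ℂ, τ.im = Y → ContinuousAt (f i) τ) :
    mean (fun τ => ∑ i ∈ s, f i τ) Y = ∑ i ∈ s, mean (f i) Y := by
  simp only [mean]
  rw [intervalIntegral.integral_finsetSum fun i hi =>
    (continuous_horizontal (hf i hi)).intervalIntegrable _ _, Finset.mul_sum]

lemma mean_const_mul (c : ℂ) (f : ℂ → ℂ) (Y : ℝ) :
    mean (fun τ => c * f τ) Y = c * mean f Y := by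
  rw [mean, mean, intervalIntegral.integral_const_mul]
  ring

lemma mean_congr {f g : ℂ → ℂ} {Y : ℝ} (h : ∀ τ : ℂ, τ.im = Y → f τ = g τ) :
    mean f Y = mean g Y := by
  rw [mean, mean]
  congr 2
  ext x
  exact h _ (im_add_mul_I x Y)

lemma tendsto_mean {f : ℂ → ℂ} {L : ℂ} (hf : ∀ᶠ τ in imInf, ContinuousAt f τ)
    (h : Tendsto f imInf (𝓝 L)) : Tendsto (mean f) atTop (𝓝 L) := by
  rw [Metric.tendsto_nhds]
  intro ε hε
  have h2 := Metric.tendsto_nhds.1 h (ε / 2) (half_pos hε)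
  filter_upwards [eventually_height hf, eventually_height h2] with Y hY hY2
  have h_intble := (continuous_horizontal hY).intervalIntegrable (μ := MeasureTheory.volume) 0 2
  have h3 : mean f Y - L = (1 / 2) * ∫ x in (0 : ℝ)..2, (f (x + Y * Complex.I) - L) := by
    rw [intervalIntegral.integral_sub h_intble intervalIntegrable_const, mean]
    simp
    ring
  rw [dist_eq_norm, h3, norm_mul]
  have h4 : ‖∫ x in (0 : ℝ)..2, (f (x + Y * Complex.I) - L)‖ ≤ ε / 2 * |2 - 0| := by
    refine intervalIntegral.norm_integral_le_of_norm_le_const fun x _ => ?_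
    have := hY2 _ (im_add_mul_I x Y)
    rw [dist_eq_norm] at this
    exact this.le
  norm_num at h4 ⊢
  linarith

/-- The normalised derivative of `xx`. -/
noncomputable def dX (τ : ℂ) : ℂ := -(ww τ * xx τ)

lemma xx_add_two {τ : ℂ} (hτ : 0 < τ.im) : xx (τ + 2) = xx τ := by
  have h : 0 < (τ + 1).im := by simpa using hτ
  have e : τ + 2 = τ + 1 + 1 := by ring
  rw [xx, xx, e, uu_add_one, ww_add_one, vv_add_one h, vv_add_one hτ, neg_neg]

lemma mean_entire_eq_zero {E : ℂ → ℂ} (hE : Differentiable ℂ E) {Y : ℝ} (hY : 0 < Y) :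
    mean (fun τ => E (xx τ) * dX τ) Y = 0 := by
  have him : ∀ τ : ℂ, τ.im = Y → 0 < τ.im := fun τ h => h ▸ hY
  have hcX : Continuous fun x : ℝ => xx (x + Y * Complex.I) :=
    continuous_horizontal fun τ h => (differentiableAt_xx (him τ h)).continuousAt
  obtain ⟨R, hR⟩ := (isCompact_Icc (a := (0 : ℝ)) (b := 2)).exists_bound_of_continuousOn
    hcX.continuousOn
  obtain ⟨P, hP⟩ := hE.differentiableOn.isExactOn_ball (c := 0) (r := R + 1)
  have hpi : (Real.pi * Complex.I : ℂ) ≠ 0 :=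
    mul_ne_zero (by exact_mod_cast Real.pi_ne_zero) Complex.I_ne_zero
  have hderiv : ∀ x ∈ Set.uIcc (0 : ℝ) 2, HasDerivAt (fun x : ℝ => P (xx (x + Y * Complex.I)))
      (Real.pi * Complex.I * (E (xx (x + Y * Complex.I)) * dX (x + Y * Complex.I))) x := by
    intro x hx
    rw [Set.uIcc_of_le (by norm_num)] at hx
    have h1 := hP (xx (x + Y * Complex.I)) (by
      rw [Metric.mem_ball, dist_zero_right]
      exact (hR x hx).trans_lt (by linarith))
    have h2 := hasDerivAt_xx (him _ (im_add_mul_I x Y))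
    have h3 : HasDerivAt (fun x : ℝ => (x : ℂ) + Y * Complex.I) 1 x :=
      (Complex.ofRealCLM.hasDerivAt).add_const _
    refine ((h1.comp _ h2).comp_of_eq x h3 rfl).congr_deriv ?_
    rw [dX]
    ring
  have hcont : Continuous fun x : ℝ =>
      Real.pi * Complex.I * (E (xx (x + Y * Complex.I)) * dX (x + Y * Complex.I)) := by
    refine continuous_const.mul ((hE.continuous.comp hcX).mul ?_)
    refine continuous_horizontal (f := dX) fun τ h => ?_
    exact ((differentiableAt_ww (him τ h)).mul (differentiableAt_xx (him τ h))).neg.continuousAt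
  have h := intervalIntegral.integral_eq_sub_of_hasDerivAt hderiv (hcont.intervalIntegrable _ _)
  have hper : xx ((2 : ℝ) + Y * Complex.I) = xx ((0 : ℝ) + Y * Complex.I) := by
    rw [← xx_add_two (τ := (0 : ℝ) + Y * Complex.I) (by simpa using hY)]
    congr 1
    push_cast
    ring
  rw [hper, sub_self, intervalIntegral.integral_const_mul] at h
  rw [mean, (mul_eq_zero.1 h).resolve_left hpi, mul_zero]

lemma differentiableAt_dX {τ : ℂ} (hτ : 0 < τ.im) : DifferentiableAt ℂ dX τ :=
  ((differentiableAt_ww hτ).mul (differentiableAt_xx hτ)).neg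

lemma eventually_xx_ne (s : ℂ) : ∀ᶠ τ in imInf, xx τ ≠ s := by
  filter_upwards [tendsto_norm_xx.eventually_gt_atTop ‖s‖] with τ hτ h
  rw [h] at hτ
  exact lt_irrefl _ hτ

lemma tendsto_dX_div (s : ℂ) : Tendsto (fun τ => dX τ / (xx τ - s)) imInf (𝓝 (-1)) := by
  have h := tendsto_ww.neg.div ((tendsto_xx.const_mul s).const_sub 1) (by simp)
  rw [mul_zero, sub_zero, div_one] at h
  refine h.congr' ?_
  filter_upwards [eventually_imInf 0] with τ hτ
  have h0 := xx_ne_zero hτ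
  have h2 : xx τ - s = xx τ * (1 - s * (xx τ)⁻¹) := by field_simp
  rw [Pi.div_apply, dX, h2, mul_comm (ww τ), ← mul_neg, mul_div_mul_left _ _ h0]

lemma tendsto_mean_residues {F : Finset ℂ} {f ρ : ℂ → ℂ}
    (hf : ∀ z ∉ F, DifferentiableAt ℂ f z)
    (hres : ∀ s ∈ F, Tendsto (fun z => (z - s) * f z) (𝓝[≠] s) (𝓝 (ρ s))) :
    Tendsto (mean fun τ => f (xx τ) * dX τ) atTop (𝓝 (-∑ s ∈ F, ρ s)) := by
  obtain ⟨E, hE, hEf⟩ := exists_partial_fractions F f ρ hf hres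
  have hF : ∀ᶠ τ in imInf, 0 < τ.im ∧ ∀ s ∈ F, xx τ ≠ s :=
    (eventually_imInf 0).and ((Finset.eventually_all F).2 fun s _ => eventually_xx_ne s)
  have hc : ∀ s ∈ F, ∀ τ : ℂ, (0 < τ.im ∧ ∀ s ∈ F, xx τ ≠ s) →
      ContinuousAt (fun τ => dX τ / (xx τ - s)) τ := fun s hs τ h =>
    ((differentiableAt_dX h.1).div ((differentiableAt_xx h.1).sub_const s)
      (sub_ne_zero.2 (h.2 s hs))).continuousAt
  have h1 : Tendsto (fun Y => ∑ s ∈ F, ρ s * mean (fun τ => dX τ / (xx τ - s)) Y) atTop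
      (𝓝 (∑ s ∈ F, ρ s * (-1))) := tendsto_finsetSum _ fun s hs =>
    (tendsto_mean (hF.mono fun τ h => hc s hs τ h) (tendsto_dX_div s)).const_mul _
  have h2 : ∑ s ∈ F, ρ s * (-1) = -∑ s ∈ F, ρ s := by
    rw [← Finset.sum_mul, mul_neg_one]
  rw [h2] at h1
  refine h1.congr' ?_
  filter_upwards [eventually_height hF, eventually_gt_atTop 0] with Y hY hY0
  have h3 : mean (fun τ => f (xx τ) * dX τ) Y =
      mean (fun τ => E (xx τ) * dX τ + ∑ s ∈ F, ρ s * (dX τ / (xx τ - s))) Y := by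
    refine mean_congr fun τ hτ => ?_
    rw [hEf _ (fun hmem => (hY τ hτ).2 _ hmem rfl), add_mul, Finset.sum_mul]
    congr 1
    exact Finset.sum_congr rfl fun s _ => by ring
  have hcs : ∀ s ∈ F, ∀ τ : ℂ, τ.im = Y →
      ContinuousAt (fun τ => ρ s * (dX τ / (xx τ - s))) τ := fun s hs τ hτ =>
    (hc s hs τ (hY τ hτ)).const_mul _
  rw [h3, mean_add, mean_entire_eq_zero hE hY0, zero_add, mean_sum F hcs]
  · exact Finset.sum_congr rfl fun s _ => (mean_const_mul _ _ _).symm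
  · intro τ hτ
    have := (hY τ hτ).1
    exact (hE.continuous.continuousAt.comp (differentiableAt_xx this).continuousAt).mul
      (differentiableAt_dX this).continuousAt
  · intro τ hτ
    exact tendsto_finsetSum F fun s hs => hcs s hs τ hτ

open Classical in
lemma exists_residues {p : ℕ} (hp : p.Prime) (s : ℂ) : ∃ t : Option (Fin p) → ℤ, ∀ i,
    (xx (mob (heckeMat p i) (secX s)) = xx (secX s) → t i ^ 2 < 4 * p) ∧
    ∀ r, ∃ ρ : ℂ, 2 * ρ.re = (if xx (mob (heckeMat p i) (secX s)) = xx (secX s) then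
        -(vPoly p r (t i) : ℝ) else 0) ∧
      Tendsto (fun σ => (xx σ - xx (secX s)) * lefTerm r p 1 (heckeMat p i) σ)
        (𝓝[≠] (secX s : ℂ)) (𝓝 ρ) := by
  have h : ∀ i, ∃ t : ℤ, (xx (mob (heckeMat p i) (secX s)) = xx (secX s) → t ^ 2 < 4 * p) ∧
      ∀ r, ∃ ρ : ℂ, 2 * ρ.re = (if xx (mob (heckeMat p i) (secX s)) = xx (secX s) then
        -(vPoly p r t : ℝ) else 0) ∧
      Tendsto (fun σ => (xx σ - xx (secX s)) * lefTerm r p 1 (heckeMat p i) σ)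
        (𝓝[≠] (secX s : ℂ)) (𝓝 ρ) := by
    intro i
    by_cases hfix : xx (mob (heckeMat p i) (secX s)) = xx (secX s)
    · obtain ⟨t, ht, -, h⟩ := exists_residue hp i (secX s).2 hfix
      refine ⟨t, fun _ => ht, fun r => ?_⟩
      obtain ⟨ρ, h1, h2⟩ := h r
      exact ⟨ρ, by rw [if_pos hfix, h1], h2⟩
    · exact ⟨0, fun h => absurd h hfix, fun r => ⟨0, by rw [if_neg hfix]; simp,
        tendsto_mul_lefTerm_of_ne (det_heckeMat_pos hp i) (secX s).2 hfix⟩⟩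
  choose t ht using h
  exact ⟨t, ht⟩

/-- The Lefschetz fixed point formula for the Hecke correspondence. -/
theorem lefschetz {p : ℕ} (hp : p.Prime) (hodd : Odd p) :
    ∃ T : Multiset ℤ, (∀ t ∈ T, t ^ 2 < 4 * p) ∧ ∀ r, ∃ L : ℂ,
      Tendsto (mean fun τ => lefSum r p 1 τ * dX τ) atTop (𝓝 L) ∧
        2 * L.re = 4 + ((T.map (vPoly p r)).sum : ℤ) := by
  classical
  choose t ht using exists_residues hp
  set P := (finite_poles hp hodd).toFinset with hP
  have hPmem : ∀ s, s ∈ P ↔ s ∈ poles p := fun s => Set.Finite.mem_toFinset _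
  set S := (P ×ˢ (univ : Finset (Option (Fin p)))).filter
    (fun x => xx (mob (heckeMat p x.2) (secX x.1)) = xx (secX x.1)) with hS
  refine ⟨S.val.map fun x => t x.1 x.2, ?_, fun r => ?_⟩
  · intro u hu
    obtain ⟨x, hx, rfl⟩ := Multiset.mem_map.1 hu
    exact (ht x.1 x.2).1 (Finset.mem_filter.1 hx).2
  have hr := fun s i => (ht s i).2 r
  choose ρ hρ using hr
  set R : ℂ → ℂ := fun s => if s = 0 ∨ s = 1 then -1 else ∑ i, ρ s i with hR
  have h0 : (0 : ℂ) ∉ insert (1 : ℂ) P := by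
    rw [Finset.mem_insert, hPmem, not_or]
    exact ⟨zero_ne_one, fun h => h.1 rfl⟩
  have h1 : (1 : ℂ) ∉ P := by
    rw [hPmem]
    exact fun h => h.2.1 rfl
  have key := tendsto_mean_residues (F := insert 0 (insert 1 P)) (f := lefH r p) (ρ := R) ?_ ?_
  · refine ⟨_, key.congr' ?_, ?_⟩
    · filter_upwards [eventually_gt_atTop 0] with Y hY
      exact mean_congr fun τ hτ => by rw [lefH_xx hp hodd (hτ ▸ hY)]
    · have hRP : ∀ s ∈ P, R s = ∑ i, ρ s i := by
        intro s hs
        have := (hPmem s).1 hs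
        rw [hR]
        simp [this.1, this.2.1]
      rw [Finset.sum_insert h0, Finset.sum_insert h1, Finset.sum_congr rfl hRP]
      have hR0 : R 0 = -1 := by simp [hR]
      have hR1 : R 1 = -1 := by simp [hR]
      rw [hR0, hR1, Multiset.map_map]
      have h2 : 2 * (∑ s ∈ P, ∑ i, ρ s i).re = -∑ x ∈ S, (vPoly p r (t x.1 x.2) : ℝ) := by
        rw [hS, Finset.sum_filter, Finset.sum_product, Complex.re_sum, Finset.mul_sum,
          ← Finset.sum_neg_distrib]
        refine Finset.sum_congr rfl fun s _ => ?_
        rw [Complex.re_sum, Finset.mul_sum, ← Finset.sum_neg_distrib]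
        refine Finset.sum_congr rfl fun i _ => ?_
        rw [(hρ s i).1]
        split_ifs <;> simp
      have h3 : ((S.val.map ((vPoly p r) ∘ fun x => t x.1 x.2)).sum : ℤ) =
          ∑ x ∈ S, vPoly p r (t x.1 x.2) := rfl
      rw [h3]
      push_cast
      rw [Complex.neg_re, Complex.add_re, Complex.add_re, Complex.neg_re, Complex.one_re]
      linarith
  · intro z hz
    simp only [Finset.mem_insert, not_or, hPmem] at hz
    exact differentiableAt_lefH hp hodd hz.1 hz.2.1 fun h => hz.2.2 ⟨hz.1, hz.2.1, h⟩
  · intro s hs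
    by_cases hs0 : s = 0
    · subst hs0
      simpa [hR] using isCusp_zero.tendsto r hp hodd
    by_cases hs1 : s = 1
    · subst hs1
      simpa [hR] using isCusp_one.tendsto r hp hodd
    have : R s = ∑ i, ρ s i := by simp [hR, hs0, hs1]
    rw [this]
    refine tendsto_mul_lefH hp hodd hs0 hs1 fun i => ?_
    have h := (hρ s i).2
    rwa [xx_secX hs0 hs1] at h

end LegendreMoments

namespace LegendreMoments

open Matrix MatrixGroups Topology

section hecke
open PowerSeries

lemma conv_heckeU {p : ℕ} (hp : p ≠ 0) {f : ℤ⟦X⟧} (hf : Conv f) : Conv (heckeU p f) := by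
  intro r h0 h1
  have hs : (r ^ ((p : ℝ)⁻¹)) ^ p = r := Real.rpow_inv_natCast_pow h0 hp
  have h := hf (r ^ ((p : ℝ)⁻¹)) (Real.rpow_nonneg h0 _)
    (Real.rpow_lt_one h0 h1 (by positivity))
  have hinj : Function.Injective fun n : ℕ => p * n :=
    fun a b h => Nat.eq_of_mul_eq_mul_left (Nat.pos_of_ne_zero hp) h
  refine (h.comp_injective hinj).congr fun n => ?_
  rw [Function.comp_apply, heckeU, coeff_mk, pow_mul, hs]

lemma qq_mob_some {p : ℕ} (hp : p ≠ 0) (j : Fin p) (τ : ℂ) :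
    qq (mob (heckeMat p (some j)) τ) = Complex.exp (2 * Real.pi * Complex.I / p) ^ (j : ℕ) *
      qq (τ / p) := by
  have hp0 : (p : ℂ) ≠ 0 := by exact_mod_cast hp
  rw [mob_some, add_div, qq_add, mul_comm]
  congr 1
  rw [qq, ← Complex.exp_nat_mul]
  congr 1
  field_simp

lemma sum_ev_mob {p : ℕ} (hp : p ≠ 0) {f : ℤ⟦X⟧} (hf : Conv f) {τ : ℂ} (hτ : 0 < τ.im) :
    ∑ j : Fin p, ev f (qq (mob (heckeMat p (some j)) τ)) = p * ev (heckeU p f) (qq τ) := by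
  have hp0 : (p : ℂ) ≠ 0 := by exact_mod_cast hp
  have hinj : Function.Injective fun n : ℕ => p * n :=
    fun a b h => Nat.eq_of_mul_eq_mul_left (Nat.pos_of_ne_zero hp) h
  set ζ := Complex.exp (2 * Real.pi * Complex.I / p) with hζ
  have hprim : IsPrimitiveRoot ζ p := Complex.isPrimitiveRoot_exp p hp
  have him : ∀ j : Fin p, 0 < (mob (heckeMat p (some j)) τ).im := fun j => by
    rw [im_mob_some]
    have : (0 : ℝ) < p := by exact_mod_cast Nat.pos_of_ne_zero hp
    positivity
  have h1 := hasSum_sum (s := univ) fun (j : Fin p) _ => hf.hasSum (norm_qq_lt_one (him j))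
  have hroot : ∀ n : ℕ, ∑ j : Fin p, qq (mob (heckeMat p (some j)) τ) ^ n =
      (∑ j ∈ range p, (ζ ^ n) ^ j) * qq (τ / p) ^ n := by
    intro n
    rw [Finset.sum_mul, Finset.sum_range]
    refine Finset.sum_congr rfl fun j _ => ?_
    rw [qq_mob_some hp, mul_pow, ← pow_mul, ← pow_mul, mul_comm n]
  have hq : qq (τ / p) ^ p = qq τ := by
    rw [← qq_natCast_mul, mul_div_cancel₀ _ hp0]
  have h2 := ((conv_heckeU hp hf).hasSum (norm_qq_lt_one hτ)).mul_left (p : ℂ)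
  refine h1.unique ((hinj.hasSum_iff ?_).1 (h2.congr_fun ?_))
  · intro n hn
    rw [← Finset.mul_sum, hroot]
    have hne : ζ ^ n ≠ 1 := fun h => by
      obtain ⟨k, hk⟩ := hprim.dvd_of_pow_eq_one n h
      exact hn ⟨k, hk.symm⟩
    have h0 := mul_geom_sum (ζ ^ n) p
    rw [← pow_mul, mul_comm n, pow_mul, hprim.pow_eq_one, one_pow, sub_self] at h0
    rw [(mul_eq_zero.1 h0).resolve_left (sub_ne_zero.2 hne), zero_mul, mul_zero]
  · intro n
    rw [Function.comp_apply, ← Finset.mul_sum, hroot, pow_mul, hprim.pow_eq_one, one_pow]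
    simp only [one_pow, sum_const, card_range, nsmul_eq_mul, mul_one]
    rw [pow_mul, hq, heckeU, coeff_mk]
    ring

lemma Conv.of_X_mul {f : ℤ⟦X⟧} (hf : Conv (X * f)) : Conv f := by
  intro r h0 h1
  obtain ⟨s, hs, hs1⟩ := exists_between h1
  have hs0 : 0 < s := h0.trans_lt hs
  refine (((summable_nat_add_iff 1).2 (hf s hs0.le hs1)).mul_left s⁻¹).of_nonneg_of_le
    (fun n => by positivity) fun n => ?_
  rw [coeff_succ_X_mul, pow_succ]
  have : s⁻¹ * (|((coeff n f : ℤ) : ℝ)| * (s ^ n * s)) = |((coeff n f : ℤ) : ℝ)| * s ^ n := by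
    field_simp
  rw [this]
  gcongr

lemma mean_qq_inv (e : ℕ) (Y : ℝ) : mean (fun τ => (qq τ ^ (e + 1))⁻¹) Y = 0 := by
  set c : ℂ := -((e + 1) * (Real.pi * Complex.I)) with hc
  have hpi : (Real.pi : ℂ) ≠ 0 := by exact_mod_cast Real.pi_ne_zero
  have hc0 : c ≠ 0 := neg_ne_zero.2 (mul_ne_zero (by exact_mod_cast Nat.succ_ne_zero e)
    (mul_ne_zero hpi Complex.I_ne_zero))
  have h : ∀ x : ℝ, (qq (x + Y * Complex.I) ^ (e + 1))⁻¹ =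
      Complex.exp (c * (Y * Complex.I)) * Complex.exp (c * x) := by
    intro x
    rw [qq, ← Complex.exp_nat_mul, ← Complex.exp_neg, ← Complex.exp_add, hc]
    congr 1
    push_cast
    ring
  have h2 : Complex.exp (c * (2 : ℝ)) = 1 := by
    rw [Complex.exp_eq_one_iff]
    exact ⟨-(e + 1), by rw [hc]; push_cast; ring⟩
  simp only [mean, h]
  rw [intervalIntegral.integral_const_mul, integral_exp_mul_complex hc0, h2]
  simp

lemma eventually_ev_qq_ne {f : ℤ⟦X⟧} (hf : Conv f) (hf1 : constantCoeff f = 1) :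
    ∀ᶠ τ in imInf, ev f (qq τ) ≠ 0 := by
  have h := tendsto_ev_qq hf
  rw [ev_zero_right, hf1, Int.cast_one] at h
  exact h.eventually_ne one_ne_zero

lemma continuousAt_ev_qq {f : ℤ⟦X⟧} (hf : Conv f) {τ : ℂ} (hτ : 0 < τ.im) :
    ContinuousAt (fun τ => ev f (qq τ)) τ := (hasDerivAt_ev_qq hf hτ).continuousAt

lemma continuousAt_quot {f g : ℤ⟦X⟧} (hf : Conv f) (hg : Conv g) (e : ℕ) {τ : ℂ} (hτ : 0 < τ.im)
    (h : ev f (qq τ) ≠ 0) :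
    ContinuousAt (fun τ => ev g (qq τ) / (qq τ ^ e * ev f (qq τ))) τ :=
  (continuousAt_ev_qq hg hτ).div (((hasDerivAt_qq τ).continuousAt.pow e).mul
    (continuousAt_ev_qq hf hτ)) (mul_ne_zero (pow_ne_zero _ (qq_ne_zero τ)) h)

/-- The `e`-th coefficient of a quotient of power series as a limit of means. -/
lemma tendsto_mean_quot {f : ℤ⟦X⟧} (hf : Conv f) (hf1 : constantCoeff f = 1) (e : ℕ) :
    ∀ g : ℤ⟦X⟧, Conv g → Tendsto (mean fun τ => ev g (qq τ) / (qq τ ^ e * ev f (qq τ))) atTop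
      (𝓝 ((coeff e (invOfUnit f 1 * g) : ℤ) : ℂ)) := by
  have hev : ∀ᶠ τ in imInf, 0 < τ.im ∧ ev f (qq τ) ≠ 0 :=
    (eventually_imInf 0).and (eventually_ev_qq_ne hf hf1)
  have hinv : invOfUnit f 1 * f = 1 := by
    rw [mul_comm]
    exact mul_invOfUnit f 1 (by simpa using hf1)
  induction e with
  | zero =>
    intro g hg
    refine tendsto_mean (hev.mono fun τ h => continuousAt_quot hf hg 0 h.1 h.2) ?_
    have h := (tendsto_ev_qq hg).div (tendsto_ev_qq hf) (by rw [ev_zero_right, hf1]; simp)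
    rw [ev_zero_right, ev_zero_right, hf1, Int.cast_one, div_one] at h
    have h2 : coeff 0 (invOfUnit f 1 * g) = constantCoeff g := by simp
    rw [h2]
    refine h.congr fun τ => ?_
    rw [Pi.div_apply, pow_zero, one_mul]
  | succ e ih =>
    intro g hg
    set c : ℤ := constantCoeff g with hc
    obtain ⟨k, hk⟩ : X ∣ g - C c * f := by
      rw [X_dvd_iff]
      simp [hf1, hc]
    have hCc : Conv (C c) := conv_of_finite_support 1 fun n hn => by
      rw [coeff_C, if_neg (by omega)]
    have hck : Conv k := Conv.of_X_mul (hk ▸ hg.sub (hCc.mul hf))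
    have hgk : g = C c * f + X * k := by rw [← hk]; ring
    have hcoeff : coeff (e + 1) (invOfUnit f 1 * g) = coeff e (invOfUnit f 1 * k) := by
      have : invOfUnit f 1 * g = C c + X * (invOfUnit f 1 * k) := by
        rw [hgk]
        linear_combination (C c) * hinv
      rw [this, map_add, coeff_succ_X_mul, coeff_C, if_neg (by omega), zero_add]
    rw [hcoeff]
    refine (ih k hck).congr' ?_
    filter_upwards [eventually_height hev] with Y hY
    have h1 : ∀ τ : ℂ, τ.im = Y → ev g (qq τ) / (qq τ ^ (e + 1) * ev f (qq τ)) =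
        c * (qq τ ^ (e + 1))⁻¹ + ev k (qq τ) / (qq τ ^ e * ev f (qq τ)) := by
      intro τ hτ
      have hq := norm_qq_lt_one (hY τ hτ).1
      have hfne := (hY τ hτ).2
      have hq0 := qq_ne_zero τ
      have hevC : ev (C c) (qq τ) = c := by
        rw [ev, tsum_eq_single 0]
        · simp
        · intro n hn; rw [coeff_C, if_neg hn]; simp
      have : ev g (qq τ) = c * ev f (qq τ) + qq τ * ev k (qq τ) := by
        conv_lhs => rw [hgk]
        rw [ev_add (hCc.mul hf) (conv_X.mul hck) hq, ev_mul hCc hf hq, ev_mul conv_X hck hq, ev_X,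
          hevC]
      rw [this]
      field_simp
      ring
    rw [mean_congr h1, mean_add, mean_const_mul, mean_qq_inv, mul_zero, zero_add]
    · intro τ _
      exact ContinuousAt.const_mul (((hasDerivAt_qq τ).continuousAt.pow _).inv₀
        (pow_ne_zero _ (qq_ne_zero τ))) _
    · exact fun τ hτ => continuousAt_quot hf hck e (hY τ hτ).1 (hY τ hτ).2

end hecke

end LegendreMoments

namespace LegendreMoments

open Matrix MatrixGroups Topology

lemma geom_quotient {K : Type*} [Field K] (r : ℕ) {u v u' v' w w' : K} (hu : u ≠ 0) (hv : v ≠ 0)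
    (hv' : v' ≠ 0) (hw : w ≠ 0) (hne : u / v - u' / v' ≠ 0) :
    v' ^ r * w' * (u' / v') * (w * (u / v)) / (v ^ r * w * (u / v) * (u / v - u' / v')) =
      ∑ e ∈ range r, v' ^ e * u' ^ (r - e) * w' / (v ^ e * u ^ (r - e)) +
        (u' / u) ^ r * w' * (u' / v' / (u / v - u' / v')) := by
  have hD : v' / v - u' / u ≠ 0 := by
    intro h
    apply hne
    field_simp at h ⊢
    linear_combination h
  have hK : u' / v' / (u / v - u' / v') = (u' / u) / (v' / v - u' / u) := by
    rw [div_eq_div_iff hne hD]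
    field_simp
  have hsum : ∑ e ∈ range r, v' ^ e * u' ^ (r - e) * w' / (v ^ e * u ^ (r - e)) =
      w' * (u' / u) * ∑ e ∈ range r, (v' / v) ^ e * (u' / u) ^ (r - 1 - e) := by
    rw [Finset.mul_sum]
    refine Finset.sum_congr rfl fun e he => ?_
    have : r - e = r - 1 - e + 1 := by have := Finset.mem_range.1 he; omega
    rw [this, pow_succ, pow_succ, div_pow, div_pow]
    field_simp
  have hl : v' ^ r * w' * (u' / v') * (w * (u / v)) / (v ^ r * w * (u / v) * (u / v - u' / v')) =
      (v' / v) ^ r * w' * (u' / v' / (u / v - u' / v')) := by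
    rw [div_pow]
    have : u / v ≠ 0 := div_ne_zero hu hv
    field_simp
  rw [hl, hK, hsum]
  have h2 := geom_sum₂_mul (v' / v) (u' / u) r
  generalize ∑ e ∈ range r, (v' / v) ^ e * (u' / u) ^ (r - 1 - e) = S at *
  generalize v' / v = a at *
  generalize u' / u = b at *
  field_simp
  linear_combination (-b * w') * h2

section
open PowerSeries

lemma conv_thetaMono (r e : ℕ) : Conv (thetaMono r e) :=
  (conv_thetaA.pow _).mul (conv_thetaPsi.pow _)

lemma pow_mul_pow_eq_ev (r e : ℕ) {τ : ℂ} (hτ : 0 < τ.im) :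
    vv τ ^ e * uu τ ^ (r - e) = 16 ^ e * (qq τ ^ e * ev (thetaMono r e) (qq τ)) := by
  have hq := norm_qq_lt_one hτ
  rw [thetaMono, ev_mul (conv_thetaA.pow _) (conv_thetaPsi.pow _) hq, ev_pow conv_thetaA hq,
    ev_pow conv_thetaPsi hq, vv, uu, mul_pow, mul_pow, ← pow_mul, ← pow_mul]
  ring

lemma pow_mul_pow_mul_eq_ev (r e : ℕ) {τ : ℂ} (hτ : 0 < τ.im) :
    vv τ ^ e * uu τ ^ (r - e) * ww τ =
      16 ^ e * ev (X ^ e * (thetaMono r e * thetaW)) (qq τ) := by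
  have hq := norm_qq_lt_one hτ
  rw [ev_mul (conv_X.pow e) ((conv_thetaMono r e).mul conv_thetaW) hq,
    ev_mul (conv_thetaMono r e) conv_thetaW hq, ev_pow conv_X hq, ev_X, pow_mul_pow_eq_ev r e hτ,
    ww_eq_ev hτ]
  ring

/-- The polar part of the Lefschetz function at the cusp `∞`. -/
noncomputable def polarTerm (r p e : ℕ) (τ : ℂ) : ℂ :=
  ev (heckeU p (X ^ e * (thetaMono r e * thetaW))) (qq τ) / (qq τ ^ e * ev (thetaMono r e) (qq τ))

lemma conv_heckeU_mono {p : ℕ} (hp : p ≠ 0) (r e : ℕ) :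
    Conv (heckeU p (X ^ e * (thetaMono r e * thetaW))) :=
  conv_heckeU hp ((conv_X.pow e).mul ((conv_thetaMono r e).mul conv_thetaW))

lemma tendsto_mean_polarTerm {p : ℕ} (hp : p ≠ 0) (r e : ℕ) :
    Tendsto (mean (polarTerm r p e)) atTop (𝓝 (traceTerm r p e : ℂ)) :=
  tendsto_mean_quot (conv_thetaMono r e) (constantCoeff_thetaMono r e) e _ (conv_heckeU_mono hp r e)

lemma thetaMono_ne_zero (r e : ℕ) {τ : ℂ} (hτ : 0 < τ.im) : ev (thetaMono r e) (qq τ) ≠ 0 := by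
  intro h
  have := pow_mul_pow_eq_ev r e hτ
  rw [h, mul_zero, mul_zero] at this
  exact mul_ne_zero (pow_ne_zero _ (vv_ne_zero hτ)) (pow_ne_zero _ (uu_ne_zero hτ)) this

lemma continuousAt_polarTerm {p : ℕ} (hp : p ≠ 0) (r e : ℕ) {τ : ℂ} (hτ : 0 < τ.im) :
    ContinuousAt (polarTerm r p e) τ :=
  continuousAt_quot (conv_thetaMono r e) (conv_heckeU_mono hp r e) e hτ (thetaMono_ne_zero r e hτ)

lemma sum_mob_eq_polarTerm {p : ℕ} (hp : p ≠ 0) (r e : ℕ) {τ : ℂ} (hτ : 0 < τ.im) :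
    ∑ j : Fin p, vv (mob (heckeMat p (some j)) τ) ^ e * uu (mob (heckeMat p (some j)) τ) ^ (r - e) *
      ww (mob (heckeMat p (some j)) τ) / (vv τ ^ e * uu τ ^ (r - e)) = p * polarTerm r p e τ := by
  have hp0 : (0 : ℝ) < p := by exact_mod_cast Nat.pos_of_ne_zero hp
  have h : ∀ j : Fin p, 0 < (mob (heckeMat p (some j)) τ).im := fun j => by
    rw [im_mob_some]; positivity
  rw [← Finset.sum_div, Finset.sum_congr rfl fun j _ => pow_mul_pow_mul_eq_ev r e (h j),
    ← Finset.mul_sum, sum_ev_mob hp ((conv_X.pow e).mul ((conv_thetaMono r e).mul conv_thetaW)) hτ,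
    pow_mul_pow_eq_ev r e hτ, polarTerm, mul_div_mul_left _ _ (pow_ne_zero _ (by norm_num)),
    mul_div_assoc]

end

/-- The error term in the expansion of the Lefschetz function at the cusp `∞`. -/
noncomputable def remTerm (r p : ℕ) (j : Fin p) (τ : ℂ) : ℂ :=
  (uu (mob (heckeMat p (some j)) τ) / uu τ) ^ r * ww (mob (heckeMat p (some j)) τ) *
    (xx (mob (heckeMat p (some j)) τ) / (xx τ - xx (mob (heckeMat p (some j)) τ)))

lemma lefTerm_some_mul_dX {p : ℕ} (hp : p.Prime) (r : ℕ) (j : Fin p) {τ : ℂ} (hτ : 0 < τ.im)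
    (hne : xx (mob (heckeMat p (some j)) τ) ≠ xx τ) :
    lefTerm r p 1 (heckeMat p (some j)) τ * dX τ =
      -(p : ℂ)⁻¹ * (∑ e ∈ range r, vv (mob (heckeMat p (some j)) τ) ^ e *
        uu (mob (heckeMat p (some j)) τ) ^ (r - e) * ww (mob (heckeMat p (some j)) τ) /
          (vv τ ^ e * uu τ ^ (r - e)) + remTerm r p j τ) := by
  have hp0 : (p : ℂ) ≠ 0 := by exact_mod_cast hp.ne_zero
  have hj := im_mob_pos (det_heckeMat_pos hp (some j)) hτ
  have h := geom_quotient r (uu_ne_zero hτ) (vv_ne_zero hτ) (vv_ne_zero hj) (ww_ne_zero hτ)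
    (w' := ww (mob (heckeMat p (some j)) τ)) (sub_ne_zero.2 hne.symm)
  rw [remTerm, xx, xx, ← h, lefTerm, one_mul, slash_one, mob_one, slash, den_some, dX, phi, phi,
    xx, xx]
  field_simp
  ring

lemma tendsto_comp_mob {f : ℂ → ℂ} {p : ℕ} (hp : p.Prime) (i : Option (Fin p))
    (hf : Tendsto f imInf (𝓝 1)) : Tendsto (fun τ => f (mob (heckeMat p i) τ)) imInf (𝓝 1) :=
  hf.comp (tendsto_mob_imInf hp i)

lemma tendsto_remTerm {p : ℕ} (hp : p.Prime) (r : ℕ) (j : Fin p) :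
    Tendsto (remTerm r p j) imInf (𝓝 0) := by
  have h1 := ((((tendsto_comp_mob hp (some j) tendsto_uu).div tendsto_uu one_ne_zero).pow r).mul
    (tendsto_comp_mob hp (some j) tendsto_ww))
  have h2 := tendsto_param_div tendsto_xx_inv_div_qq hp j
  have h3 := h1.mul (h2.div (h2.const_sub 1) (by simp))
  rw [zero_div, mul_zero] at h3
  refine h3.congr' ?_
  filter_upwards [eventually_imInf 0] with τ hτ
  have h0 := xx_ne_zero hτ
  simp only [remTerm, Pi.div_apply]
  congr 1
  rw [← mul_div_mul_left _ _ h0]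
  congr 1
  · field_simp
  · field_simp

/-- The contribution of multiplication by `p` to the Lefschetz function at `∞`. -/
lemma tendsto_lefTerm_none_mul_dX {p : ℕ} (hp : p.Prime) (r : ℕ) :
    Tendsto (fun τ => lefTerm r p 1 (heckeMat p none) τ * dX τ) imInf
      (𝓝 ((p : ℂ) ^ (2 * r + 1) * 0 ^ r)) := by
  have h2 := tendsto_param_div' tendsto_xx_inv_div_qq hp
  have h3 := ((((tendsto_param_div' tendsto_vv_div_qq hp).pow r).mul
    (tendsto_comp_mob hp none tendsto_ww)).mul ((h2.sub_const 1).inv₀ (by simp))).const_mul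
      (-(p : ℂ) ^ (2 * r + 1))
  have e : -(p : ℂ) ^ (2 * r + 1) * ((0 ^ r * 1) * (0 - 1)⁻¹) = (p : ℂ) ^ (2 * r + 1) * 0 ^ r := by
    norm_num
  rw [e] at h3
  refine h3.congr' ?_
  filter_upwards [eventually_imInf 0, eventually_param_ne tendsto_xx_inv_div_qq hp none] with
    τ hτ hne
  have hj := im_mob_pos (det_heckeMat_pos hp none) hτ
  rw [lefTerm, one_mul, slash_one, mob_one, slash, den_none, dX, phi, phi, one_pow, div_one]
  have h0 := xx_ne_zero hτ
  have h0' := xx_ne_zero hj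
  have hv := vv_ne_zero hτ
  have hw := ww_ne_zero hτ
  have hne' : xx τ - xx (mob (heckeMat p none) τ) ≠ 0 :=
    sub_ne_zero.2 fun h => hne (by rw [h])
  have e2 : (xx (mob (heckeMat p none) τ))⁻¹ / (xx τ)⁻¹ - 1 =
      (xx τ - xx (mob (heckeMat p none) τ)) / xx (mob (heckeMat p none) τ) := by
    field_simp
  rw [e2, inv_div, div_pow]
  field_simp

theorem tendsto_mean_lefSum {p : ℕ} (hp : p.Prime) (r : ℕ) :
    Tendsto (mean fun τ => lefSum r p 1 τ * dX τ) atTop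
      (𝓝 ((p : ℂ) ^ (2 * r + 1) * 0 ^ r + (traceS r p : ℤ))) := by
  have hp0 : (p : ℂ) ≠ 0 := by exact_mod_cast hp.ne_zero
  set G : ℂ → ℂ := fun τ => lefSum r p 1 τ * dX τ + ∑ e ∈ range r, polarTerm r p e τ with hG
  have hne : ∀ᶠ τ in imInf, 0 < τ.im ∧ ∀ i, xx (mob (heckeMat p i) τ) ≠ xx τ :=
    (eventually_imInf 0).and (eventually_all.2 fun i =>
      (eventually_param_ne tendsto_xx_inv_div_qq hp i).mono fun τ h h' => h (by rw [h']))
  have hcl : ∀ τ : ℂ, (0 < τ.im ∧ ∀ i, xx (mob (heckeMat p i) τ) ≠ xx τ) →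
      ContinuousAt (fun τ => lefSum r p 1 τ * dX τ) τ := fun τ h => by
    refine ContinuousAt.mul ?_ (differentiableAt_dX h.1).continuousAt
    exact tendsto_finsetSum _ fun i _ =>
      (differentiableAt_lefTerm (det_heckeMat_pos hp i) h.1 (h.2 i)).continuousAt
  have hcp : ∀ τ : ℂ, 0 < τ.im → ContinuousAt (fun τ => ∑ e ∈ range r, polarTerm r p e τ) τ :=
    fun τ h => tendsto_finsetSum _ fun e _ => continuousAt_polarTerm hp.ne_zero r e h
  have hlim : Tendsto G imInf (𝓝 ((p : ℂ) ^ (2 * r + 1) * 0 ^ r)) := by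
    have h := (tendsto_lefTerm_none_mul_dX hp r).add
      ((tendsto_finsetSum univ fun j _ => tendsto_remTerm hp r j).const_mul (-(p : ℂ)⁻¹))
    simp only [Finset.sum_const_zero, mul_zero, add_zero] at h
    refine h.congr' ?_
    filter_upwards [hne] with τ hτ
    rw [hG]
    simp only [lefSum, Fintype.sum_option, add_mul, Finset.sum_mul]
    rw [Finset.sum_congr rfl fun j _ => lefTerm_some_mul_dX hp r j hτ.1 (hτ.2 (some j)),
      ← Finset.mul_sum, Finset.sum_add_distrib, Finset.sum_comm,
      Finset.sum_congr rfl fun e _ => sum_mob_eq_polarTerm hp.ne_zero r e hτ.1, ← Finset.mul_sum]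
    field_simp
    ring
  have h1 := tendsto_mean (f := G) (hne.mono fun τ h => (hcl τ h).add (hcp τ h.1)) hlim
  have h2 := h1.sub (tendsto_finsetSum (range r) fun e _ =>
    tendsto_mean_polarTerm hp.ne_zero r e)
  rw [traceS]
  push_cast
  rw [← sub_eq_add_neg]
  refine h2.congr' ?_
  filter_upwards [eventually_height hne] with Y hY
  rw [hG, mean_add (fun τ h => hcl τ (hY τ h)) fun τ h => hcp τ (hY τ h).1,
    mean_sum _ fun e _ τ h => continuousAt_polarTerm hp.ne_zero r e (hY τ h).1, add_sub_cancel_right]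

/-- The traces of the Hecke operator as a sum over a multiset of Frobenius traces. -/
theorem exists_trace_multiset {p : ℕ} (hp : p.Prime) (hodd : Odd p) :
    ∃ T : Multiset ℤ, (∀ t ∈ T, t ^ 2 < 4 * p) ∧ (Multiset.card T : ℤ) = 2 * (p - 2) ∧
      ∀ r, 0 < r → (T.map (vPoly p r)).sum = 2 * (traceS r p - 2) := by
  obtain ⟨T, hT, h⟩ := lefschetz hp hodd
  have key : ∀ r, 4 + ((T.map (vPoly p r)).sum : ℤ) =
      2 * ((p : ℤ) ^ (2 * r + 1) * 0 ^ r + traceS r p) := by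
    intro r
    obtain ⟨L, hL, h2⟩ := h r
    rw [tendsto_nhds_unique hL (tendsto_mean_lefSum hp r)] at h2
    have : ((p : ℂ) ^ (2 * r + 1) * 0 ^ r + (traceS r p : ℤ)) =
        (((p : ℤ) ^ (2 * r + 1) * 0 ^ r + traceS r p : ℤ) : ℂ) := by push_cast; ring
    rw [this, Complex.intCast_re] at h2
    exact_mod_cast h2.symm
  refine ⟨T, hT, ?_, fun r hr => ?_⟩
  · have h0 := key 0
    have h1 : (T.map (vPoly p 0)).sum = (Multiset.card T : ℤ) := by
      have : T.map (vPoly p 0) = T.map fun _ => 1 := Multiset.map_congr rfl fun _ _ => rfl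
      rw [this, Multiset.map_const', Multiset.sum_replicate]
      simp
    rw [h1] at h0
    simp [traceS] at h0
    linarith
  · have := key r
    rw [zero_pow hr.ne', mul_zero, zero_add] at this
    linarith

end LegendreMoments

namespace LegendreMoments

open Matrix MatrixGroups Topology

lemma integral_pow_mul_exp {j k : ℕ} (hj : 0 < j) (hk : 0 < k) :
    ∫ t in Set.Ioi (0 : ℝ), t ^ (k - 1) * Real.exp (-(j * t)) = Real.Gamma k / (j : ℝ) ^ k := by
  have h := Real.integral_rpow_mul_exp_neg_mul_Ioi (a := k) (r := j) (by exact_mod_cast hk)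
    (by exact_mod_cast hj)
  rw [Real.rpow_natCast] at h
  have : (1 / (j : ℝ)) ^ k * Real.Gamma k = Real.Gamma k / (j : ℝ) ^ k := by
    rw [div_pow, one_pow]; ring
  rw [← this, ← h]
  refine MeasureTheory.integral_congr_ae (MeasureTheory.ae_of_all _ fun t => ?_)
  have : ((k : ℝ) - 1) = ((k - 1 : ℕ) : ℝ) := by rw [Nat.cast_sub hk]; simp
  simp only [this, Real.rpow_natCast]

lemma integrableOn_pow_mul_exp {j k : ℕ} (hj : 0 < j) (hk : 0 < k) :
    MeasureTheory.IntegrableOn (fun t : ℝ => t ^ (k - 1) * Real.exp (-(j * t))) (Set.Ioi 0) := by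
  by_contra h
  have h1 := MeasureTheory.integral_undef h
  rw [integral_pow_mul_exp hj hk] at h1
  have := Real.Gamma_pos_of_pos (s := k) (by exact_mod_cast hk)
  have hj' : (0 : ℝ) < j := by exact_mod_cast hj
  have : 0 < Real.Gamma k / (j : ℝ) ^ k := by positivity
  exact this.ne' h1

lemma integral_eval_exp {k : ℕ} (hk : 0 < k) (Q : Polynomial ℝ) (h0 : Q.coeff 0 = 0) :
    ∫ t in Set.Ioi (0 : ℝ), t ^ (k - 1) * Q.eval (Real.exp (-t)) =
      Real.Gamma k * ∑ j ∈ range (Q.natDegree + 1), Q.coeff j / (j : ℝ) ^ k := by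
  have h1 : ∀ t : ℝ, t ^ (k - 1) * Q.eval (Real.exp (-t)) =
      ∑ j ∈ range (Q.natDegree + 1), Q.coeff j * (t ^ (k - 1) * Real.exp (-(j * t))) := by
    intro t
    rw [Polynomial.eval_eq_sum_range, mul_sum]
    refine sum_congr rfl fun j _ => ?_
    rw [← Real.exp_nat_mul]
    ring_nf
  simp_rw [h1]
  rw [MeasureTheory.integral_finsetSum, mul_sum]
  · refine sum_congr rfl fun j _ => ?_
    rw [MeasureTheory.integral_const_mul]
    rcases Nat.eq_zero_or_pos j with rfl | hj
    · simp [h0]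
    · rw [integral_pow_mul_exp hj hk]; ring
  · intro j _
    rcases Nat.eq_zero_or_pos j with rfl | hj
    · simp [h0]
    · exact (integrableOn_pow_mul_exp hj hk).const_mul _

/-- Polynomials vanishing at `0`, nonnegative on `[0, 1]`, with value `1` at `1 / 2` and small
Laplace-type average. -/
lemma exists_peak_polynomial {k : ℕ} (hk : 0 < k) {ε : ℝ} (hε : 0 < ε) :
    ∃ Q : Polynomial ℝ, Q.coeff 0 = 0 ∧ Q.eval (1 / 2) = 1 ∧
      (∀ x ∈ Set.Icc (0 : ℝ) 1, 0 ≤ Q.eval x) ∧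
      ∑ j ∈ range (Q.natDegree + 1), Q.coeff j / (j : ℝ) ^ k < ε := by
  let P : Polynomial ℝ := 4 * Polynomial.X * (1 - Polynomial.X)
  have hP : ∀ x, P.eval x = 4 * x * (1 - x) := by intro x; simp [P]
  have hP01 : ∀ x ∈ Set.Icc (0 : ℝ) 1, 0 ≤ P.eval x ∧ P.eval x ≤ 1 := by
    rintro x ⟨h0, h1⟩
    rw [hP]
    refine ⟨by have : 0 ≤ 1 - x := by linarith
               positivity, by nlinarith [sq_nonneg (2 * x - 1)]⟩
  have hlim : Tendsto (fun l : ℕ => ∫ t in Set.Ioi (0 : ℝ), t ^ (k - 1) *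
      (P ^ (l + 1)).eval (Real.exp (-t))) atTop (𝓝 (∫ t in Set.Ioi (0 : ℝ), (0 : ℝ))) := by
    refine MeasureTheory.tendsto_integral_of_dominated_convergence
      (fun t => 4 * (t ^ (k - 1) * Real.exp (-((1 : ℕ) * t)))) ?_ ?_ ?_ ?_
    · intro l
      refine Continuous.aestronglyMeasurable ?_
      have := (P ^ (l + 1)).continuous
      fun_prop
    · exact (integrableOn_pow_mul_exp one_pos hk).const_mul _
    · intro l
      refine (MeasureTheory.ae_restrict_iff' measurableSet_Ioi).2 (MeasureTheory.ae_of_all _ fun t ht => ?_)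
      have ht : 0 < t := ht
      have he : Real.exp (-t) ∈ Set.Icc (0 : ℝ) 1 :=
        ⟨(Real.exp_pos _).le, Real.exp_le_one_iff.2 (by linarith)⟩
      obtain ⟨h0, h1⟩ := hP01 _ he
      rw [Polynomial.eval_pow, Real.norm_of_nonneg (by positivity)]
      have h2 : P.eval (Real.exp (-t)) ^ (l + 1) ≤ P.eval (Real.exp (-t)) :=
        pow_le_of_le_one h0 h1 (by omega)
      have h3 : P.eval (Real.exp (-t)) ≤ 4 * Real.exp (-t) := by
        rw [hP]; nlinarith [sq_nonneg (Real.exp (-t))]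
      calc t ^ (k - 1) * P.eval (Real.exp (-t)) ^ (l + 1) ≤ t ^ (k - 1) * (4 * Real.exp (-t)) := by
            gcongr; linarith
        _ = _ := by push_cast; ring_nf
    · have hae : ∀ᵐ t : ℝ, t ≠ Real.log 2 := by
        simp [MeasureTheory.ae_iff]
      refine (MeasureTheory.ae_restrict_iff' measurableSet_Ioi).2 ?_
      filter_upwards [hae] with t ht0 ht
      have ht : 0 < t := ht
      have he : Real.exp (-t) ∈ Set.Icc (0 : ℝ) 1 :=
        ⟨(Real.exp_pos _).le, Real.exp_le_one_iff.2 (by linarith)⟩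
      obtain ⟨h0, h1⟩ := hP01 _ he
      have hlt : P.eval (Real.exp (-t)) < 1 := by
        refine lt_of_le_of_ne h1 fun h => ht0 ?_
        rw [hP] at h
        have h5 : (2 * Real.exp (-t) - 1) ^ 2 = 0 := by nlinarith
        have h6 : Real.exp (-t) = 2⁻¹ := by
          have := pow_eq_zero_iff (two_ne_zero) |>.1 h5
          linarith
        rw [← neg_neg t, ← Real.log_exp (-t), h6, Real.log_inv, neg_neg]
      simp only [Polynomial.eval_pow]
      have := ((tendsto_pow_atTop_nhds_zero_of_lt_one h0 hlt).comp
        (tendsto_add_atTop_nat 1)).const_mul (t ^ (k - 1))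
      simpa using this
  rw [MeasureTheory.integral_zero] at hlim
  have hG := Real.Gamma_pos_of_pos (s := k) (by exact_mod_cast hk)
  obtain ⟨l, hl⟩ := (hlim.eventually (gt_mem_nhds (mul_pos hG hε))).exists
  have h0 : (P ^ (l + 1)).coeff 0 = 0 := by
    rw [Polynomial.coeff_zero_eq_eval_zero, Polynomial.eval_pow, hP]; simp
  refine ⟨P ^ (l + 1), h0, ?_, ?_, ?_⟩
  · rw [Polynomial.eval_pow, hP]; norm_num
  · intro x hx
    rw [Polynomial.eval_pow]; exact pow_nonneg (hP01 x hx).1 _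
  · rw [integral_eval_exp hk _ h0] at hl
    exact lt_of_mul_lt_mul_left hl hG.le

/-- A Tauberian step: `s` behaves like `∫ y in Ici Y, y ^ (k - 2) * d y` with `d` decreasing. -/
lemma tendsto_of_tail {s d : ℝ → ℝ} {k : ℕ} {L : ℝ} (hk : 2 ≤ k)
    (hlo : ∀ y z, 0 < y → y < z → (z - y) * y ^ (k - 2) * d z ≤ s y - s z)
    (hhi : ∀ y z, 0 < y → y < z → s y - s z ≤ (z - y) * z ^ (k - 2) * d y)
    (hlim : Tendsto (fun y => y * s y) (𝓝[>] 0) (𝓝 L)) :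
    Tendsto (fun y => y ^ k * d y) (𝓝[>] 0) (𝓝 L) := by
  obtain ⟨m, rfl⟩ := Nat.exists_eq_add_of_le' hk
  have hm : m + 2 - 2 = m := by omega
  rw [hm] at hlo hhi
  -- the difference quotient along a fixed ratio
  have hdiff : ∀ c : ℝ, 1 < c → Tendsto (fun y => y * (s y - s (c * y)) / (c - 1)) (𝓝[>] 0)
      (𝓝 (L / c)) := by
    intro c hc
    have h1 : Tendsto (fun y : ℝ => c * y) (𝓝[>] 0) (𝓝[>] 0) := by
      refine tendsto_nhdsWithin_iff.2 ⟨?_, ?_⟩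
      · have : Tendsto (fun y : ℝ => c * y) (𝓝 0) (𝓝 (c * 0)) :=
          (continuous_const.mul continuous_id).tendsto 0
        rw [mul_zero] at this
        exact this.mono_left nhdsWithin_le_nhds
      · filter_upwards [self_mem_nhdsWithin] with y hy
        have : (0 : ℝ) < y := hy
        exact mul_pos (by linarith) this
    have h2 := (hlim.sub ((hlim.comp h1).div_const c)).div_const (c - 1)
    have h3 : (L - L / c) / (c - 1) = L / c := by
      have : c - 1 ≠ 0 := by linarith
      field_simp
    rw [h3] at h2
    refine h2.congr fun y => ?_
    have : c ≠ 0 := by linarith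
    simp only [Function.comp]
    field_simp
  have hcont1 : Tendsto (fun c : ℝ => c ^ (m + 1) * L) (𝓝[>] 1) (𝓝 L) := by
    have : Tendsto (fun c : ℝ => c ^ (m + 1) * L) (𝓝 1) (𝓝 ((1 : ℝ) ^ (m + 1) * L)) :=
      Continuous.tendsto (by fun_prop) _
    rw [one_pow, one_mul] at this
    exact this.mono_left nhdsWithin_le_nhds
  have hcont2 : Tendsto (fun c : ℝ => L / c / c ^ m) (𝓝[>] 1) (𝓝 L) := by
    have : ContinuousAt (fun c : ℝ => L / c / c ^ m) 1 := by
      refine ContinuousAt.div (ContinuousAt.div (by fun_prop) (by fun_prop) (by simp))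
        (by fun_prop) (by simp)
    have h := this.tendsto
    simp only [one_pow, div_one] at h
    exact h.mono_left nhdsWithin_le_nhds
  rw [tendsto_order]
  constructor
  · intro a ha
    obtain ⟨c, hac, hc⟩ := ((hcont2.eventually (lt_mem_nhds ha)).and self_mem_nhdsWithin).exists
    have hc : 1 < c := hc
    have h1 := ((hdiff c hc).div_const (c ^ m)).eventually (lt_mem_nhds hac)
    filter_upwards [h1, self_mem_nhdsWithin] with y hy1 hy
    have hy : 0 < y := hy
    refine hy1.trans_le ?_
    have h2 := hhi y (c * y) hy (by nlinarith)
    have hc1 : 0 < c - 1 := by linarith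
    rw [div_div, div_le_iff₀ (by positivity)]
    calc y * (s y - s (c * y)) ≤ y * ((c * y - y) * (c * y) ^ m * d y) := by gcongr
      _ = _ := by ring
  · intro a ha
    obtain ⟨c, hac, hc⟩ := ((hcont1.eventually (gt_mem_nhds ha)).and self_mem_nhdsWithin).exists
    have hc : 1 < c := hc
    have hc0 : 0 < c := by linarith
    have hac' : c ^ (m + 2) * (L / c) < a := by
      have : c ^ (m + 2) * (L / c) = c ^ (m + 1) * L := by rw [pow_succ c (m + 1)]; field_simp
      rwa [this]
    have h1 := ((hdiff c hc).const_mul (c ^ (m + 2))).eventually (gt_mem_nhds hac')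
    have h2 : Tendsto (fun y : ℝ => y / c) (𝓝[>] 0) (𝓝[>] 0) := by
      refine tendsto_nhdsWithin_iff.2 ⟨?_, ?_⟩
      · have : Tendsto (fun y : ℝ => y / c) (𝓝 0) (𝓝 (0 / c)) :=
          (continuous_id.div_const c).tendsto 0
        rw [zero_div] at this
        exact this.mono_left nhdsWithin_le_nhds
      · filter_upwards [self_mem_nhdsWithin] with y hy
        have : (0 : ℝ) < y := hy
        exact div_pos this hc0
    filter_upwards [h2.eventually h1, self_mem_nhdsWithin] with z hz1 hz
    have hz : 0 < z := hz
    refine lt_of_le_of_lt ?_ hz1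
    obtain ⟨y, rfl⟩ : ∃ y, z = c * y := ⟨z / c, by field_simp⟩
    rw [mul_div_cancel_left₀ _ hc0.ne']
    have hy0 : 0 < y := pos_of_mul_pos_right hz hc0.le
    have h2 := hlo y (c * y) hy0 (by nlinarith)
    have hc1 : 0 < c - 1 := by linarith
    rw [← mul_div_assoc, le_div_iff₀ hc1]
    calc (c * y) ^ (m + 2) * d (c * y) * (c - 1)
        = c ^ (m + 2) * (y * ((c * y - y) * y ^ m * d (c * y))) := by ring
      _ ≤ c ^ (m + 2) * (y * (s y - s (c * y))) := by gcongr

end LegendreMoments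

namespace LegendreMoments

open Matrix MatrixGroups Topology

open MeasureTheory in
/-- A Tauberian bound for the coefficients of a nonnegative Dirichlet-type series in terms of the
asymptotics of its tail integral. -/
lemma tauberian_bound {ι : Type*} {c ν : ι → ℝ} (hc : ∀ i, 0 ≤ c i)
    (hν : ∀ i, 0 ≤ ν i) {k : ℕ} (hk : 2 ≤ k) {L : ENNReal} (hL : L ≠ ⊤)
    (hlim : Tendsto (fun Y : ℝ => ENNReal.ofReal Y * ∫⁻ y in Set.Ici Y, ENNReal.ofReal (y ^ (k - 2)) *
      ∑' i, ENNReal.ofReal (c i * Real.exp (-(ν i * y)))) (𝓝[>] 0) (𝓝 L)) {ε : ℝ} (hε : 0 < ε) :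
    ∃ M, ∀ i, M ≤ ν i → c i ≤ ε * ν i ^ k := by
  set D : ℝ → ENNReal := fun y => ∑' i, ENNReal.ofReal (c i * Real.exp (-(ν i * y))) with hD
  set S : ℝ → ENNReal := fun Y => ∫⁻ y in Set.Ici Y, ENNReal.ofReal (y ^ (k - 2)) * D y with hS
  have hDanti : Antitone D := by
    intro y z hyz
    refine ENNReal.tsum_le_tsum fun i => ENNReal.ofReal_le_ofReal ?_
    have := hc i
    have := hν i
    gcongr
  have hSanti : Antitone S := fun y z hyz => lintegral_mono_set (Set.Ici_subset_Ici.2 hyz)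
  have hsplit : ∀ y z, y ≤ z →
      S y = (∫⁻ t in Set.Ico y z, ENNReal.ofReal (t ^ (k - 2)) * D t) + S z := by
    intro y z hyz
    rw [hS]
    simp only
    rw [← Set.Ico_union_Ici_eq_Ici hyz, lintegral_union measurableSet_Ici]
    refine Set.disjoint_left.2 fun t ht ht' => absurd ht.2 (not_lt.2 ht')
  have hlo' : ∀ y z, 0 < y → y < z →
      ENNReal.ofReal ((z - y) * y ^ (k - 2)) * D z ≤
        ∫⁻ t in Set.Ico y z, ENNReal.ofReal (t ^ (k - 2)) * D t := by
    intro y z hy hyz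
    calc ENNReal.ofReal ((z - y) * y ^ (k - 2)) * D z
        = ∫⁻ t in Set.Ico y z, ENNReal.ofReal (y ^ (k - 2)) * D z := by
          rw [setLIntegral_const, Real.volume_Ico, ENNReal.ofReal_mul (by linarith)]
          ring
      _ ≤ _ := by
          refine setLIntegral_mono' measurableSet_Ico fun t ht => ?_
          have h1 := ht.1
          have h2 := hDanti ht.2.le
          gcongr
  have hhi' : ∀ y z, 0 < y → y < z →
      (∫⁻ t in Set.Ico y z, ENNReal.ofReal (t ^ (k - 2)) * D t) ≤
        ENNReal.ofReal ((z - y) * z ^ (k - 2)) * D y := by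
    intro y z hy hyz
    calc _ ≤ ∫⁻ t in Set.Ico y z, ENNReal.ofReal (z ^ (k - 2)) * D y := by
          refine setLIntegral_mono' measurableSet_Ico fun t ht => ?_
          have h1 := ht.2
          have h0 : 0 ≤ t := hy.le.trans ht.1
          have h2 := hDanti ht.1
          gcongr
      _ = _ := by
          rw [setLIntegral_const, Real.volume_Ico, ENNReal.ofReal_mul (by linarith)]
          ring
  have hSfin : ∀ Y, 0 < Y → S Y ≠ ⊤ := by
    intro Y hY
    have h1 := hlim.eventually (gt_mem_nhds (lt_top_iff_ne_top.2 hL))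
    have h2 : ∀ᶠ y : ℝ in 𝓝[>] 0, y < Y := nhdsWithin_le_nhds (gt_mem_nhds hY)
    obtain ⟨y, ⟨h3, h4⟩, h5⟩ := ((h1.and h2).and self_mem_nhdsWithin).exists
    have h5 : 0 < y := h5
    have h6 : S y ≠ ⊤ := by
      intro h
      change ENNReal.ofReal y * S y < ⊤ at h3
      rw [h, ENNReal.mul_top (by simpa using h5)] at h3
      exact lt_irrefl _ h3
    exact ne_top_of_le_ne_top h6 (hSanti h4.le)
  have hDfin : ∀ y, 0 < y → D y ≠ ⊤ := by
    intro y hy h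
    have h1 := hlo' (y / 2) y (by positivity) (by linarith)
    have h2 := hsplit (y / 2) y (by linarith)
    have h3 : ENNReal.ofReal ((y - y / 2) * (y / 2) ^ (k - 2)) ≠ 0 := by
      have : 0 < (y - y / 2) * (y / 2) ^ (k - 2) := mul_pos (by linarith) (by positivity)
      simpa using this
    rw [h, ENNReal.mul_top h3, top_le_iff] at h1
    rw [h1, top_add] at h2
    exact hSfin _ (by positivity) h2
  have hdsum : ∀ y, 0 < y → HasSum (fun i => c i * Real.exp (-(ν i * y))) (D y).toReal := by
    intro y hy
    have h := ENNReal.hasSum_toReal (hDfin y hy)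
    have h2 : (D y).toReal = ∑' i, (ENNReal.ofReal (c i * Real.exp (-(ν i * y)))).toReal :=
      ENNReal.tsum_toReal_eq fun i => ENNReal.ofReal_ne_top
    rw [h2]
    refine h.congr_fun fun i => ?_
    exact (ENNReal.toReal_ofReal (mul_nonneg (hc i) (Real.exp_pos _).le)).symm
  have hreal : Tendsto (fun y => y ^ k * (D y).toReal) (𝓝[>] 0) (𝓝 L.toReal) := by
    refine tendsto_of_tail (s := fun y => (S y).toReal) hk ?_ ?_ ?_
    · intro y z hy hyz
      have h1 := hlo' y z hy hyz
      have h2 := hsplit y z hyz.le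
      have h3 : ENNReal.ofReal ((z - y) * y ^ (k - 2)) * D z + S z ≤ S y := by
        rw [h2]; gcongr
      have h4 := ENNReal.toReal_mono (hSfin y hy) h3
      rw [ENNReal.toReal_add (ENNReal.mul_ne_top ENNReal.ofReal_ne_top (hDfin z (hy.trans hyz)))
        (hSfin z (hy.trans hyz)), ENNReal.toReal_mul, ENNReal.toReal_ofReal
        (mul_nonneg (by linarith) (by positivity))] at h4
      linarith
    · intro y z hy hyz
      have h1 := hhi' y z hy hyz
      have h2 := hsplit y z hyz.le
      have h3 : S y ≤ ENNReal.ofReal ((z - y) * z ^ (k - 2)) * D y + S z := by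
        rw [h2]; gcongr
      have hz : 0 < z := hy.trans hyz
      have h5 : ENNReal.ofReal ((z - y) * z ^ (k - 2)) * D y ≠ ⊤ :=
        ENNReal.mul_ne_top ENNReal.ofReal_ne_top (hDfin y hy)
      have h4 := ENNReal.toReal_mono (ENNReal.add_ne_top.2 ⟨h5, hSfin z hz⟩) h3
      rw [ENNReal.toReal_add h5 (hSfin z hz), ENNReal.toReal_mul, ENNReal.toReal_ofReal
        (mul_nonneg (by linarith) (by positivity))] at h4
      linarith
    · have := (ENNReal.tendsto_toReal hL).comp hlim
      refine this.congr' ?_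
      filter_upwards [self_mem_nhdsWithin] with y hy
      have hy : 0 < y := hy
      simp only [Function.comp, ENNReal.toReal_mul, ENNReal.toReal_ofReal hy.le]
      rfl
  have hLpos : 0 < L.toReal + 1 := by positivity
  have hδ : 0 < ε * Real.log 2 ^ k / (L.toReal + 1) := by
    have := Real.log_pos one_lt_two
    positivity
  obtain ⟨Q, hQ0, hQ1, hQpos, hQsmall⟩ := exists_peak_polynomial (by omega : 0 < k) hδ
  have hlimQ : Tendsto (fun y => y ^ k * ∑ j ∈ range (Q.natDegree + 1), Q.coeff j * (D (j * y)).toReal)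
      (𝓝[>] 0) (𝓝 (L.toReal * ∑ j ∈ range (Q.natDegree + 1), Q.coeff j / (j : ℝ) ^ k)) := by
    simp_rw [mul_sum]
    refine tendsto_finsetSum _ fun j _ => ?_
    rcases Nat.eq_zero_or_pos j with rfl | hj
    · simp [hQ0]
    · have hj' : (0 : ℝ) < j := by exact_mod_cast hj
      have h1 : Tendsto (fun y : ℝ => j * y) (𝓝[>] 0) (𝓝[>] 0) := by
        refine tendsto_nhdsWithin_iff.2 ⟨?_, ?_⟩
        · have : Tendsto (fun y : ℝ => j * y) (𝓝 0) (𝓝 (j * 0)) :=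
            (continuous_const.mul continuous_id).tendsto 0
          rw [mul_zero] at this
          exact this.mono_left nhdsWithin_le_nhds
        · filter_upwards [self_mem_nhdsWithin] with y hy
          exact mul_pos hj' hy
      have h2 := (hreal.comp h1).mul_const (Q.coeff j / (j : ℝ) ^ k)
      refine h2.congr fun y => ?_
      simp only [Function.comp]
      field_simp
      ring
  have hbound : L.toReal * ∑ j ∈ range (Q.natDegree + 1), Q.coeff j / (j : ℝ) ^ k
      < ε * Real.log 2 ^ k := by
    rcases eq_or_lt_of_le (ENNReal.toReal_nonneg (a := L)) with h | h
    · rw [← h, zero_mul]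
      have := Real.log_pos one_lt_two
      positivity
    · calc _ < L.toReal * (ε * Real.log 2 ^ k / (L.toReal + 1)) := by gcongr
        _ ≤ (L.toReal + 1) * (ε * Real.log 2 ^ k / (L.toReal + 1)) := by
            gcongr; linarith
        _ = _ := by field_simp
  have hev := (hlimQ.eventually (gt_mem_nhds hbound))
  obtain ⟨η, hη, hηsub⟩ := mem_nhdsGT_iff_exists_Ioo_subset.1 hev
  have hη : 0 < η := hη
  have hlog := Real.log_pos one_lt_two
  refine ⟨Real.log 2 / η + 1, fun i hi => ?_⟩
  have hνi : 0 < ν i := lt_of_lt_of_le (by positivity) hi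
  set y := Real.log 2 / ν i with hy
  have hy0 : 0 < y := by positivity
  have hyη : y < η := by
    rw [hy, div_lt_iff₀ hνi]
    have : Real.log 2 / η < ν i := by linarith
    rw [div_lt_iff₀ hη] at this
    linarith
  have hmem := hηsub ⟨hy0, hyη⟩
  have hQsum : HasSum (fun i => c i * Q.eval (Real.exp (-(ν i * y))))
      (∑ j ∈ range (Q.natDegree + 1), Q.coeff j * (D (j * y)).toReal) := by
    have h1 : ∀ i, c i * Q.eval (Real.exp (-(ν i * y))) = ∑ j ∈ range (Q.natDegree + 1),
        Q.coeff j * (c i * Real.exp (-(ν i * (j * y)))) := by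
      intro i
      rw [Polynomial.eval_eq_sum_range, mul_sum]
      refine sum_congr rfl fun j _ => ?_
      rw [← Real.exp_nat_mul]
      ring_nf
    simp_rw [h1]
    refine hasSum_sum fun j _ => ?_
    rcases Nat.eq_zero_or_pos j with rfl | hj
    · simp [hQ0, hasSum_zero]
    · exact (hdsum _ (by positivity)).mul_left _
  have hle := le_hasSum hQsum i fun i' _ => mul_nonneg (hc i') (hQpos _
    ⟨(Real.exp_pos _).le, Real.exp_le_one_iff.2 (by have := hν i'; nlinarith [mul_nonneg this hy0.le])⟩)
  have hexp : Real.exp (-(ν i * y)) = 1 / 2 := by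
    have : ν i * y = Real.log 2 := by rw [hy]; field_simp
    rw [this, Real.exp_neg, Real.exp_log two_pos]; norm_num
  rw [hexp, hQ1, mul_one] at hle
  have hfin : y ^ k * c i < ε * Real.log 2 ^ k :=
    lt_of_le_of_lt (mul_le_mul_of_nonneg_left hle (by positivity)) hmem
  rw [hy, div_pow, div_mul_eq_mul_div, div_lt_iff₀ (by positivity)] at hfin
  have h7 : 0 < Real.log 2 ^ k := by positivity
  refine le_of_mul_le_mul_left ?_ h7
  linarith

end LegendreMoments

namespace LegendreMoments

open Matrix MatrixGroups Topology

open scoped Modular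

/-- Number of nonzero `(c, d)` with `‖c z + d‖ ^ 2 ≤ T`. -/
noncomputable def latCount (z : ℂ) (T : ℝ) : ENNReal :=
  ∑' v : ℤ × ℤ, {v : ℤ × ℤ | v ≠ 0 ∧ ‖(v.1 : ℂ) * z + v.2‖ ^ 2 ≤ T}.indicator 1 v

lemma sq_add_sq_le_of_mem_fd {z : UpperHalfPlane} (hz : z ∈ 𝒟) (c d : ℝ) :
    c ^ 2 + d ^ 2 ≤ 2 * ‖(c : ℂ) * z + d‖ ^ 2 := by
  obtain ⟨h1, h2⟩ := hz
  have h3 : ‖(c : ℂ) * z + d‖ ^ 2 = (c * z.re + d) ^ 2 + (c * z.im) ^ 2 := by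
    rw [← Complex.normSq_eq_norm_sq, Complex.normSq_apply]
    simp [Complex.add_re, Complex.mul_re]
    ring
  rw [Complex.normSq_apply] at h1
  have h1' : 1 ≤ z.re * z.re + z.im * z.im := h1
  rw [h3]
  obtain ⟨h4, h5⟩ := abs_le.1 h2
  rcases le_total 0 (c * d) with h | h
  · nlinarith [mul_nonneg h (by linarith : 0 ≤ 1 / 2 + z.re), sq_nonneg (c - d),
      mul_nonneg (sq_nonneg c) (by linarith : 0 ≤ z.re * z.re + z.im * z.im - 1)]
  · nlinarith [mul_nonneg (by linarith : 0 ≤ -(c * d)) (by linarith : 0 ≤ 1 / 2 - z.re),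
      sq_nonneg (c + d),
      mul_nonneg (sq_nonneg c) (by linarith : 0 ≤ z.re * z.re + z.im * z.im - 1)]

/-- The pairs with `‖c z + d‖ ^ 2 ≤ T` lie in a box when `z` is in the fundamental domain. -/
lemma mem_box_of_norm_sq_le {z : UpperHalfPlane} (hz : z ∈ 𝒟) {T : ℝ} {v : ℤ × ℤ}
    (hv : ‖(v.1 : ℂ) * z + v.2‖ ^ 2 ≤ T) :
    v ∈ Icc (-(Nat.floor √(2 * T) : ℤ)) (Nat.floor √(2 * T)) ×ˢ
      Icc (-(Nat.floor √(2 * T) : ℤ)) (Nat.floor √(2 * T)) := by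
  have h := sq_add_sq_le_of_mem_fd hz v.1 v.2
  have h' : ((v.1 : ℝ)) ^ 2 + (v.2 : ℝ) ^ 2 ≤ 2 * T := by
    have : ‖((v.1 : ℝ) : ℂ) * z + ((v.2 : ℝ) : ℂ)‖ ^ 2 = ‖(v.1 : ℂ) * z + v.2‖ ^ 2 := by
      push_cast; rfl
    rw [this] at h
    linarith
  have key : ∀ c : ℤ, (c : ℝ) ^ 2 ≤ 2 * T → c ∈ Icc (-(Nat.floor √(2 * T) : ℤ)) (Nat.floor √(2 * T)) := by
    intro c hc
    rw [Finset.mem_Icc, ← abs_le]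
    have h1 : |(c : ℝ)| ≤ √(2 * T) := Real.abs_le_sqrt hc
    have h2 : c.natAbs ≤ Nat.floor √(2 * T) := by
      refine Nat.le_floor ?_
      rw [Nat.cast_natAbs, Int.cast_abs]; exact h1
    rw [Int.abs_eq_natAbs]
    exact_mod_cast h2
  rw [Finset.mem_product]
  exact ⟨key _ (by nlinarith [sq_nonneg (v.2 : ℝ)]), key _ (by nlinarith [sq_nonneg (v.1 : ℝ)])⟩

lemma latCount_le {z : UpperHalfPlane} (hz : z ∈ 𝒟) (T : ℝ) :
    latCount z T ≤ ENNReal.ofReal (18 * T) := by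
  set s : Set (ℤ × ℤ) := {v : ℤ × ℤ | v ≠ 0 ∧ ‖(v.1 : ℂ) * z + v.2‖ ^ 2 ≤ T} with hs
  by_cases hT : T < 1 / 2
  · have : ∀ v, s.indicator (1 : ℤ × ℤ → ENNReal) v = 0 := by
      intro v
      refine Set.indicator_of_notMem ?_ _
      rintro ⟨h0, hv⟩
      have h := sq_add_sq_le_of_mem_fd hz v.1 v.2
      have h2 : ((v.1 : ℝ)) ^ 2 + (v.2 : ℝ) ^ 2 < 1 := by
        have : ‖((v.1 : ℝ) : ℂ) * z + ((v.2 : ℝ) : ℂ)‖ ^ 2 = ‖(v.1 : ℂ) * z + v.2‖ ^ 2 := by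
          push_cast; rfl
        rw [this] at h
        linarith
      have h3 : v.1 ^ 2 + v.2 ^ 2 < 1 := by exact_mod_cast h2
      refine h0 (Prod.ext ?_ ?_)
      · have : v.1 ^ 2 = 0 := by nlinarith [sq_nonneg v.1, sq_nonneg v.2]
        simpa using this
      · have : v.2 ^ 2 = 0 := by nlinarith [sq_nonneg v.1, sq_nonneg v.2]
        simpa using this
    rw [latCount, ENNReal.tsum_eq_zero.2 this]
    exact bot_le
  · push Not at hT
    set m := Nat.floor √(2 * T) with hm
    set B := Icc (-(m : ℤ)) m ×ˢ Icc (-(m : ℤ)) m with hB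
    have h1 : latCount z T ≤ B.card := by
      rw [latCount, tsum_eq_sum (s := B)]
      · calc _ ≤ ∑ v ∈ B, (1 : ENNReal) := sum_le_sum fun v _ => Set.indicator_le_self' (by simp) v
          _ = _ := by simp
      · intro v hv
        exact Set.indicator_of_notMem (fun h => hv (mem_box_of_norm_sq_le hz h.2)) _
    refine h1.trans ?_
    have hcard : B.card = (2 * m + 1) ^ 2 := by
      rw [hB, card_product, Int.card_Icc, sq]
      congr 1 <;> omega
    rw [hcard, ← ENNReal.ofReal_natCast]
    refine ENNReal.ofReal_le_ofReal ?_
    have h2 : (m : ℝ) ≤ √(2 * T) := Nat.floor_le (Real.sqrt_nonneg _)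
    have h3 : 1 ≤ √(2 * T) := Real.one_le_sqrt.2 (by linarith)
    have h4 : √(2 * T) ^ 2 = 2 * T := Real.sq_sqrt (by linarith)
    have h5 : (0 : ℝ) ≤ m := by positivity
    push_cast
    calc (2 * (m : ℝ) + 1) ^ 2 ≤ (3 * √(2 * T)) ^ 2 := by
          gcongr; linarith
      _ = 18 * T := by rw [mul_pow, h4]; ring

lemma tendsto_latCount {z : UpperHalfPlane} (hz : z ∈ 𝒟) :
    ∃ C : ENNReal, Tendsto (fun T : ℝ => latCount z T / ENNReal.ofReal T) atTop (𝓝 C) := by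
  let F : (Fin 2 → ℝ) → ℝ := fun v => ‖(v 0 : ℂ) * z + v 1‖ ^ 2
  have hFcont : Continuous F := by fun_prop
  let b := Pi.basisFun ℝ (Fin 2)
  have hset : {x ∈ (Set.univ : Set (Fin 2 → ℝ)) | F x ≤ 1} = {x | F x ≤ 1} := by ext; simp
  have hbdd : Bornology.IsBounded {x | F x ≤ 1} := by
    refine (Metric.isBounded_closedBall (x := (0 : Fin 2 → ℝ)) (r := 2)).subset fun x hx => ?_
    have hx : F x ≤ 1 := hx
    have h := sq_add_sq_le_of_mem_fd hz (x 0) (x 1)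
    rw [mem_closedBall_zero_iff, pi_norm_le_iff_of_nonneg two_pos.le]
    have h2 : x 0 ^ 2 + x 1 ^ 2 ≤ 2 := h.trans (by linarith)
    intro i
    rw [Real.norm_eq_abs]
    refine abs_le_of_sq_le_sq ?_ two_pos.le
    fin_cases i
    · simp; nlinarith [sq_nonneg (x 1)]
    · simp; nlinarith [sq_nonneg (x 0)]
  have hconv : Convex ℝ {x | F x ≤ 1} := by
    have h1 : {x | F x ≤ 1} = {x : Fin 2 → ℝ | x ∈ Set.univ ∧ ‖(x 0 : ℂ) * z + x 1‖ ≤ 1} := by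
      ext x
      simp only [Set.mem_ofPred_eq, F, Set.mem_univ, true_and]
      exact sq_le_one_iff₀ (norm_nonneg _)
    rw [h1]
    refine ConvexOn.convex_le ⟨convex_univ, fun x _ y _ a b ha hb hab => ?_⟩ 1
    have h2 : (((a • x + b • y) 0 : ℝ) : ℂ) * z + ((a • x + b • y) 1 : ℝ) =
        a • ((x 0 : ℂ) * z + x 1) + b • ((y 0 : ℂ) * z + y 1) := by
      simp; ring
    rw [h2]
    refine (norm_add_le _ _).trans ?_
    rw [norm_smul, norm_smul, Real.norm_of_nonneg ha, Real.norm_of_nonneg hb]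
    rfl
  have h := ZLattice.covolume.tendsto_card_le_div (Submodule.span ℤ (Set.range b))
    (X := Set.univ) (fun _ _ _ _ => Set.mem_univ _) (F := F) ?_ (by rwa [hset])
    (by rw [hset]; exact (isClosed_le hFcont continuous_const).measurableSet)
    (by
      have : {x : Fin 2 → ℝ | x ∈ Set.univ ∧ F x ≤ 1} = {x | F x ≤ 1} := hset
      rw [this]; exact hconv.addHaar_frontier MeasureTheory.volume)
  swap
  · intro x r hr
    simp only [F, Fintype.card_fin, Pi.smul_apply, smul_eq_mul, Complex.ofReal_mul]
    have : (r : ℂ) * (x 0 : ℂ) * z + (r : ℂ) * x 1 = r * ((x 0 : ℂ) * z + x 1) := by ring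
    rw [this, norm_mul, mul_pow, Complex.norm_real, Real.norm_of_nonneg hr]
  set C := MeasureTheory.volume.real {x ∈ (Set.univ : Set (Fin 2 → ℝ)) | F x ≤ 1} /
    ZLattice.covolume (Submodule.span ℤ (Set.range b)) with hC
  refine ⟨ENNReal.ofReal C, ?_⟩
  have h1 : Tendsto (fun T : ℝ => (1 : ℝ) / T) atTop (𝓝 0) := by
    simpa using tendsto_inv_atTop_zero (𝕜 := ℝ)
  have h2 := ENNReal.tendsto_ofReal (h.sub h1)
  rw [sub_zero] at h2
  refine h2.congr' ?_
  filter_upwards [eventually_gt_atTop 0] with T hT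
  -- the integral vectors, as a finset of pairs
  classical
  set m := Nat.floor √(2 * T) with hm
  set s := {v ∈ Icc (-(m : ℤ)) m ×ˢ Icc (-(m : ℤ)) m | ‖(v.1 : ℂ) * z + v.2‖ ^ 2 ≤ T} with hs
  have hmem : ∀ v : ℤ × ℤ, v ∈ s ↔ ‖(v.1 : ℂ) * z + v.2‖ ^ 2 ≤ T := by
    intro v
    rw [hs, Finset.mem_filter]
    exact ⟨fun h => h.2, fun h => ⟨mem_box_of_norm_sq_le hz h, h⟩⟩
  have h0 : (0 : ℤ × ℤ) ∈ s := by rw [hmem]; simp [hT.le]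
  have hlat : latCount z T = ((s.erase 0).card : ENNReal) := by
    rw [latCount, tsum_eq_sum (s := s.erase 0)]
    · rw [sum_congr rfl (g := fun _ => (1 : ENNReal))]
      · simp
      · intro v hv
        rw [mem_erase, hmem] at hv
        exact Set.indicator_of_mem (s := {v : ℤ × ℤ | v ≠ 0 ∧ ‖(v.1 : ℂ) * z + v.2‖ ^ 2 ≤ T}) hv 1
    · intro v hv
      rw [mem_erase, hmem] at hv
      exact Set.indicator_of_notMem
        (s := {v : ℤ × ℤ | v ≠ 0 ∧ ‖(v.1 : ℂ) * z + v.2‖ ^ 2 ≤ T}) hv 1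
  let ι : ℤ × ℤ → (Fin 2 → ℝ) := fun v => ![(v.1 : ℝ), v.2]
  have hι : Function.Injective ι := by
    intro v w hvw
    have e0 := congrFun hvw 0
    have e1 := congrFun hvw 1
    simp only [ι, Matrix.cons_val_zero, Matrix.cons_val_one, Int.cast_inj] at e0 e1
    exact Prod.ext e0 e1
  have hspan : ∀ x : Fin 2 → ℝ, x ∈ Submodule.span ℤ (Set.range b) ↔ ∃ v, ι v = x := by
    intro x
    rw [b.mem_span_iff_repr_mem ℤ]
    constructor
    · intro h
      obtain ⟨c, hc⟩ := h 0
      obtain ⟨d, hd⟩ := h 1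
      refine ⟨(c, d), ?_⟩
      ext i
      fin_cases i
      · simpa [ι, b] using hc
      · simpa [ι, b] using hd
    · rintro ⟨v, rfl⟩ i
      fin_cases i
      · exact ⟨v.1, by simp [ι, b]⟩
      · exact ⟨v.2, by simp [ι, b]⟩
  have hcard : Nat.card (({x ∈ (Set.univ : Set (Fin 2 → ℝ)) | F x ≤ T} ∩
      (Submodule.span ℤ (Set.range b) : Set (Fin 2 → ℝ)) : Set (Fin 2 → ℝ))) = s.card := by
    have : ({x ∈ (Set.univ : Set (Fin 2 → ℝ)) | F x ≤ T} ∩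
      (Submodule.span ℤ (Set.range b) : Set (Fin 2 → ℝ)) : Set (Fin 2 → ℝ)) = ι '' s := by
      ext x
      constructor
      · rintro ⟨⟨-, hx⟩, hx2⟩
        obtain ⟨v, rfl⟩ := (hspan x).1 hx2
        refine ⟨v, ?_, rfl⟩
        rw [SetLike.mem_coe, hmem]
        simpa [F, ι] using hx
      · rintro ⟨v, hv, rfl⟩
        refine ⟨⟨Set.mem_univ _, ?_⟩, (hspan _).2 ⟨v, rfl⟩⟩
        rw [SetLike.mem_coe, hmem] at hv
        simpa [F, ι] using hv
    rw [this, Nat.card_coe_set_eq, Set.ncard_image_of_injective _ hι, Set.ncard_coe_finset]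
  have hle : 1 ≤ s.card := card_pos.2 ⟨0, h0⟩
  rw [hcard, hlat, card_erase_of_mem h0, ← sub_div, ENNReal.ofReal_div_of_pos hT]
  congr 1
  rw [← ENNReal.ofReal_natCast, Nat.cast_sub hle, Nat.cast_one]

/-- Rescaled form of `tendsto_latCount`. -/
lemma tendsto_mul_latCount {z : UpperHalfPlane} (hz : z ∈ 𝒟) :
    ∃ C : ENNReal, Tendsto (fun Y : ℝ => ENNReal.ofReal Y * latCount z (z.im / Y)) (𝓝[>] 0) (𝓝 C) := by
  obtain ⟨C, hC⟩ := tendsto_latCount hz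
  refine ⟨ENNReal.ofReal z.im * C, ?_⟩
  have h1 : Tendsto (fun Y : ℝ => z.im / Y) (𝓝[>] 0) atTop :=
    tendsto_inv_nhdsGT_zero.const_mul_atTop z.im_pos
  refine (ENNReal.Tendsto.const_mul (hC.comp h1) (Or.inr ENNReal.ofReal_ne_top)).congr' ?_
  filter_upwards [self_mem_nhdsWithin] with Y hY
  have hY : 0 < Y := hY
  simp only [Function.comp]
  rw [ENNReal.ofReal_div_of_pos hY, div_eq_mul_inv, ENNReal.inv_div (Or.inl ENNReal.ofReal_ne_top)
    (Or.inl (by simpa using hY)), mul_comm, mul_assoc, mul_comm]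
  congr 1
  refine ENNReal.div_mul_cancel ?_ ENNReal.ofReal_ne_top
  simpa using z.im_pos

end LegendreMoments

namespace LegendreMoments

open Matrix MatrixGroups Topology

open scoped Modular

/-- The part of a vertical strip of width one lying above height `Y`. -/
def strip (Y : ℝ) : Set UpperHalfPlane := {z | z.re ∈ Set.Ico (0 : ℝ) 1 ∧ Y ≤ z.im}

lemma im_smul_eq_div_norm_sq (g : SL(2, ℤ)) (z : UpperHalfPlane) :
    (g • z).im = z.im / ‖(g.1 1 0 : ℂ) * z + g.1 1 1‖ ^ 2 := by
  have h : (g • z).im = ((g • z : UpperHalfPlane) : ℂ).im := rfl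
  rw [h, coe_smul_eq_mob, im_mob, g.2, Int.cast_one, one_mul, Complex.normSq_eq_norm_sq]
  rfl

lemma norm_row_pos (g : SL(2, ℤ)) (z : UpperHalfPlane) :
    0 < ‖(g.1 1 0 : ℂ) * z + g.1 1 1‖ := by
  have h := (g • z).im_pos
  rw [im_smul_eq_div_norm_sq] at h
  by_contra h0
  have : ‖(g.1 1 0 : ℂ) * z + g.1 1 1‖ = 0 := le_antisymm (not_lt.1 h0) (norm_nonneg _)
  rw [this] at h
  simp at h

lemma eq_T_zpow_mul_of_row_eq {g h : SL(2, ℤ)} (h0 : g.1 1 0 = h.1 1 0) (h1 : g.1 1 1 = h.1 1 1) :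
    ∃ n : ℤ, g = ModularGroup.T ^ n * h := by
  have hg := g.2
  have hh := h.2
  rw [Matrix.det_fin_two] at hg hh
  refine ⟨g.1 0 1 * h.1 0 0 - g.1 0 0 * h.1 0 1, ?_⟩
  rw [h0, h1] at hg
  ext i j
  fin_cases i <;> fin_cases j <;>
    simp [ModularGroup.coe_T_zpow, Matrix.mul_apply, Fin.sum_univ_two, h0, h1]
  · linear_combination (-g.1 0 0) * hh + h.1 0 0 * hg
  · linear_combination (-g.1 0 1) * hh + h.1 0 1 * hg

lemma exists_strip_rep (z : UpperHalfPlane) (v : {v : ℤ × ℤ // Int.gcd v.1 v.2 = 1}) :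
    ∃ g : SL(2, ℤ), g.1 1 0 = v.1.1 ∧ g.1 1 1 = v.1.2 ∧ (g • z).re ∈ Set.Ico (0 : ℝ) 1 := by
  obtain ⟨⟨c, d⟩, hv⟩ := v
  have hcop : IsCoprime c d := Int.isCoprime_iff_gcd_eq_one.2 hv
  obtain ⟨g, -, hg⟩ := ModularGroup.bottom_row_surj (R := ℤ) (a := ![c, d]) hcop
  have hg0 : g.1 1 0 = c := congrFun hg 0
  have hg1 : g.1 1 1 = d := congrFun hg 1
  refine ⟨ModularGroup.T ^ (-⌊(g • z).re⌋) * g, ?_, ?_, ?_⟩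
  · simp [ModularGroup.coe_T_zpow, Matrix.mul_apply, Fin.sum_univ_two, hg0]
  · simp [ModularGroup.coe_T_zpow, Matrix.mul_apply, Fin.sum_univ_two, hg1]
  · rw [mul_smul, ModularGroup.re_T_zpow_smul]
    push_cast
    exact ⟨by linarith [Int.floor_le (g • z).re], by linarith [Int.lt_floor_add_one (g • z).re]⟩

lemma tsum_strip (z : UpperHalfPlane) {Y : ℝ} (hY : 0 < Y) :
    ∑' g : SL(2, ℤ), (strip Y).indicator (1 : UpperHalfPlane → ENNReal) (g • z) =
      ∑' v : {v : ℤ × ℤ // Int.gcd v.1 v.2 = 1},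
        {v : ℤ × ℤ | ‖(v.1 : ℂ) * z + v.2‖ ^ 2 ≤ z.im / Y}.indicator 1 v.1 := by
  choose G hG0 hG1 hGre using exists_strip_rep z
  have hinj : Function.Injective G := by
    intro v w hvw
    refine Subtype.ext (Prod.ext ?_ ?_)
    · rw [← hG0, ← hG0, hvw]
    · rw [← hG1, ← hG1, hvw]
  rw [← hinj.tsum_eq]
  · refine tsum_congr fun v => ?_
    have hpos := norm_row_pos (G v) z
    have him := im_smul_eq_div_norm_sq (G v) z
    rw [hG0, hG1] at hpos him
    have hiff : G v • z ∈ strip Y ↔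
        v.1 ∈ {v : ℤ × ℤ | ‖(v.1 : ℂ) * z + v.2‖ ^ 2 ≤ z.im / Y} := by
      rw [strip, Set.mem_ofPred_eq, Set.mem_ofPred_eq, him, and_iff_right (hGre v),
        le_div_iff₀ (by positivity), le_div_iff₀ hY, mul_comm]
    by_cases h : G v • z ∈ strip Y
    · rw [Set.indicator_of_mem h, Set.indicator_of_mem (hiff.1 h)]; rfl
    · rw [Set.indicator_of_notMem h, Set.indicator_of_notMem (fun h' => h (hiff.2 h'))]
  · intro g hg
    have hg' : g • z ∈ strip Y := by
      by_contra h
      exact hg (Set.indicator_of_notMem h _)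
    have hcop : Int.gcd (g.1 1 0) (g.1 1 1) = 1 :=
      Int.isCoprime_iff_gcd_eq_one.1 (ModularGroup.bottom_row_coprime g)
    refine ⟨⟨(g.1 1 0, g.1 1 1), hcop⟩, ?_⟩
    obtain ⟨n, hn⟩ := eq_T_zpow_mul_of_row_eq (hG0 ⟨(g.1 1 0, g.1 1 1), hcop⟩)
      (hG1 ⟨(g.1 1 0, g.1 1 1), hcop⟩)
    have hre := hGre ⟨(g.1 1 0, g.1 1 1), hcop⟩
    rw [hn, mul_smul, ModularGroup.re_T_zpow_smul] at hre
    have h1 := hg'.1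
    have hn0 : n = 0 := by
      have h2 : (n : ℝ) < 1 := by linarith [hre.2, h1.1]
      have h3 : (-1 : ℝ) < n := by linarith [hre.1, h1.2]
      have h4 : n < 1 := by exact_mod_cast h2
      have h5 : -1 < n := by exact_mod_cast h3
      omega
    rw [hn, hn0, zpow_zero, one_mul]

lemma tsum_coprime_eq_latCount (z : ℂ) (T : ℝ) :
    ∑' m : ℕ, ∑' v : {v : ℤ × ℤ // Int.gcd v.1 v.2 = 1},
      {v : ℤ × ℤ | ‖(v.1 : ℂ) * z + v.2‖ ^ 2 ≤ T / ((m : ℝ) + 1) ^ 2}.indicator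
        (1 : ℤ × ℤ → ENNReal) v.1 = latCount z T := by
  rw [← ENNReal.tsum_prod, latCount]
  set f : ℕ × {v : ℤ × ℤ // Int.gcd v.1 v.2 = 1} → ℤ × ℤ :=
    fun x => (x.2.1.1 * (x.1 + 1 : ℕ), x.2.1.2 * (x.1 + 1 : ℕ)) with hf
  have hgcd : ∀ x, Int.gcd (f x).1 (f x).2 = x.1 + 1 := by
    rintro ⟨m, ⟨⟨c, d⟩, hv⟩⟩
    simp only [hf]
    rw [Int.gcd_mul_right, hv, one_mul, Int.natAbs_natCast]
  have hinj : Function.Injective f := by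
    intro x y hxy
    have h1 : x.1 = y.1 := by
      have := hgcd x
      rw [hxy, hgcd y] at this
      omega
    obtain ⟨m, ⟨⟨c, d⟩, hv⟩⟩ := x
    obtain ⟨m', ⟨⟨c', d'⟩, hv'⟩⟩ := y
    simp only at h1
    subst h1
    have hm : ((m + 1 : ℕ) : ℤ) ≠ 0 := by positivity
    have h2 := congrArg Prod.fst hxy
    have h3 := congrArg Prod.snd hxy
    simp only [hf] at h2 h3
    have h2 := mul_right_cancel₀ hm h2
    have h3 := mul_right_cancel₀ hm h3
    subst h2 h3
    rfl
  rw [← hinj.tsum_eq]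
  · refine tsum_congr fun x => ?_
    obtain ⟨m, ⟨⟨c, d⟩, hv⟩⟩ := x
    have hne : f (m, ⟨(c, d), hv⟩) ≠ 0 := by
      intro h
      have := hgcd (m, ⟨(c, d), hv⟩)
      rw [h] at this
      simp at this
    have hm : (0 : ℝ) < (m : ℝ) + 1 := by positivity
    have hiff : (c, d) ∈ {v : ℤ × ℤ | ‖(v.1 : ℂ) * z + v.2‖ ^ 2 ≤ T / ((m : ℝ) + 1) ^ 2} ↔
        f (m, ⟨(c, d), hv⟩) ∈ {v : ℤ × ℤ | v ≠ 0 ∧ ‖(v.1 : ℂ) * z + v.2‖ ^ 2 ≤ T} := by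
      rw [Set.mem_ofPred_eq, Set.mem_ofPred_eq, and_iff_right hne, le_div_iff₀ (by positivity)]
      have : (((f (m, ⟨(c, d), hv⟩)).1 : ℂ) * z + (f (m, ⟨(c, d), hv⟩)).2) =
          ((c : ℂ) * z + d) * (((m : ℝ) + 1 : ℝ) : ℂ) := by
        simp only [hf]; push_cast; ring
      rw [this, norm_mul, mul_pow, Complex.norm_real, Real.norm_of_nonneg hm.le]
    by_cases h : (c, d) ∈ {v : ℤ × ℤ | ‖(v.1 : ℂ) * z + v.2‖ ^ 2 ≤ T / ((m : ℝ) + 1) ^ 2}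
    · rw [Set.indicator_of_mem (hiff.1 h)]
      exact Set.indicator_of_mem h _
    · rw [Set.indicator_of_notMem (fun h' => h (hiff.2 h'))]
      exact Set.indicator_of_notMem h _
  · intro v hv
    have hv0 : v ≠ 0 := by
      rintro rfl
      exact hv (Set.indicator_of_notMem (fun h => h.1 rfl) _)
    obtain ⟨c, d⟩ := v
    have hpos : 0 < Int.gcd c d := by
      rw [Nat.pos_iff_ne_zero]
      intro h
      rw [Int.gcd_eq_zero_iff] at h
      exact hv0 (Prod.ext h.1 h.2)
    obtain ⟨c', d', h1, h2, h3⟩ := Int.exists_gcd_one hpos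
    refine ⟨(Int.gcd c d - 1, ⟨(c', d'), h1⟩), ?_⟩
    simp only [hf, Nat.sub_add_cancel hpos]
    exact Prod.ext h2.symm h3.symm

end LegendreMoments

namespace LegendreMoments

open Matrix MatrixGroups Topology

open scoped Modular

open MeasureTheory

lemma measurePreserving_sl_smul (g : SL(2, ℤ)) :
    MeasurePreserving (fun z : UpperHalfPlane => g • z) volume volume :=
  measurePreserving_smul (SpecialLinearGroup.mapGL ℝ g) volume

lemma measurableSet_fd : MeasurableSet (𝒟 : Set UpperHalfPlane) :=
  ModularGroup.isClosed_fd.measurableSet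

lemma measurableSet_strip (Y : ℝ) : MeasurableSet (strip Y) := by
  have h1 : Continuous fun z : UpperHalfPlane => z.re := UpperHalfPlane.continuous_re
  have h2 : Continuous fun z : UpperHalfPlane => z.im := UpperHalfPlane.continuous_im
  exact (h1.measurable measurableSet_Ico).inter (h2.measurable measurableSet_Ici)

instance : Countable SL(2, ℤ) :=
  haveI : Countable (Matrix (Fin 2) (Fin 2) ℤ) :=
    inferInstanceAs (Countable (Fin 2 → Fin 2 → ℤ))
  inferInstanceAs (Countable {A : Matrix (Fin 2) (Fin 2) ℤ // A.det = 1})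

/-- Number of elements of the modular group bringing `z` to the fundamental domain. -/
noncomputable def fdCount (z : UpperHalfPlane) : ENNReal :=
  ∑' g : SL(2, ℤ), (𝒟 : Set UpperHalfPlane).indicator (1 : UpperHalfPlane → ENNReal) (g • z)

lemma fdCount_smul (g : SL(2, ℤ)) (z : UpperHalfPlane) : fdCount (g • z) = fdCount z := by
  rw [fdCount, fdCount, ← (Equiv.mulRight g).tsum_eq
    (fun h : SL(2, ℤ) => (𝒟 : Set UpperHalfPlane).indicator (1 : UpperHalfPlane → ENNReal) (h • z))]
  refine tsum_congr fun h => ?_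
  rw [Equiv.coe_mulRight, mul_smul]

lemma one_le_fdCount (z : UpperHalfPlane) : 1 ≤ fdCount z := by
  obtain ⟨g, hg⟩ := ModularGroup.exists_smul_mem_fd z
  refine le_trans ?_ (ENNReal.le_tsum g)
  rw [Set.indicator_of_mem hg]; rfl

lemma fdCount_ne_top (z : UpperHalfPlane) : fdCount z ≠ ⊤ := by
  have hfin := finite_meeting (isCompact_singleton (x := z))
    (ModularGroup.isCompact_truncatedFundamentalDomain (max z.im (4 / z.im)))
  rw [fdCount, tsum_eq_sum (s := hfin.toFinset)]
  · refine (ENNReal.sum_lt_top.2 fun g _ => ?_).ne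
    exact lt_of_le_of_lt (Set.indicator_le_self' (by simp) _) ENNReal.one_lt_top
  · intro g hg
    refine Set.indicator_of_notMem (fun hmem => hg ?_) _
    rw [Set.Finite.mem_toFinset]
    refine ⟨g • z, ⟨z, rfl, rfl⟩, hmem, ?_⟩
    have hz := z.im_pos
    have hpos := norm_row_pos g z
    have him := im_smul_eq_div_norm_sq g z
    rw [him, le_max_iff, div_le_iff₀ (by positivity), div_le_iff₀ (by positivity)]
    have hsq : ‖(g.1 1 0 : ℂ) * z + g.1 1 1‖ ^ 2 =
        (g.1 1 0 * z.re + g.1 1 1) ^ 2 + (g.1 1 0 * z.im) ^ 2 := by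
      rw [← Complex.normSq_eq_norm_sq, Complex.normSq_apply]
      simp
      ring
    rw [hsq]
    have hdet := g.2
    rw [Matrix.det_fin_two] at hdet
    by_cases hc : g.1 1 0 = 0
    · left
      rw [hc] at hdet ⊢
      have hd : (g.1 1 1) ^ 2 = 1 := by
        have : g.1 1 1 ∣ 1 := ⟨g.1 0 0, by linarith⟩
        rcases Int.isUnit_iff.1 (isUnit_of_dvd_one this) with h | h <;> rw [h] <;> norm_num
      have hd' : ((g.1 1 1 : ℤ) : ℝ) ^ 2 = 1 := by exact_mod_cast hd
      simp [hd']
    · right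
      have h1 : (1 : ℝ) ≤ (g.1 1 0 : ℝ) ^ 2 := by
        have : 0 < (g.1 1 0) ^ 2 := by positivity
        exact_mod_cast this
      rw [div_mul_eq_mul_div, le_div_iff₀ hz]
      nlinarith [sq_nonneg ((g.1 1 0 : ℝ) * z.re + g.1 1 1), mul_pos hz hz]

lemma measurable_fdCount : Measurable fdCount := by
  refine Measurable.tsum fun g => ?_
  exact (measurable_one.indicator measurableSet_fd).comp (continuous_sl_smul g).measurable

/-- Unfolding of a strip integral of an invariant function. -/
lemma lintegral_strip_eq {f : UpperHalfPlane → ENNReal} (hf : Measurable f)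
    (hinv : ∀ (g : SL(2, ℤ)) z, f (g • z) = f z) (Y : ℝ) :
    ∫⁻ z in strip Y, f z = ∫⁻ z, (𝒟 : Set UpperHalfPlane).indicator f z / fdCount z *
      ∑' g : SL(2, ℤ), (strip Y).indicator (1 : UpperHalfPlane → ENNReal) (g • z) := by
  set ψ : UpperHalfPlane → ENNReal := fun z => (𝒟 : Set UpperHalfPlane).indicator f z / fdCount z
    with hψ
  have hψm : Measurable ψ := (hf.indicator measurableSet_fd).div measurable_fdCount
  have hsum : ∀ z, ∑' g : SL(2, ℤ), ψ (g • z) = f z := by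
    intro z
    have h1 : ∀ g : SL(2, ℤ), ψ (g • z) = f z / fdCount z *
        (𝒟 : Set UpperHalfPlane).indicator (1 : UpperHalfPlane → ENNReal) (g • z) := by
      intro g
      simp only [hψ, fdCount_smul]
      by_cases h : g • z ∈ (𝒟 : Set UpperHalfPlane)
      · rw [Set.indicator_of_mem h, Set.indicator_of_mem h, hinv]; simp
      · rw [Set.indicator_of_notMem h, Set.indicator_of_notMem h]; simp
    simp_rw [h1]
    rw [ENNReal.tsum_mul_left]
    exact ENNReal.div_mul_cancel (lt_of_lt_of_le one_pos (one_le_fdCount z)).ne' (fdCount_ne_top z)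
  have hSm : Measurable ((strip Y).indicator (1 : UpperHalfPlane → ENNReal)) :=
    measurable_one.indicator (measurableSet_strip Y)
  calc ∫⁻ z in strip Y, f z
      = ∫⁻ z, ∑' g : SL(2, ℤ), (strip Y).indicator 1 z * ψ (g • z) := by
        rw [← lintegral_indicator (measurableSet_strip Y)]
        refine lintegral_congr fun z => ?_
        rw [ENNReal.tsum_mul_left, hsum]
        by_cases h : z ∈ strip Y
        · rw [Set.indicator_of_mem h, Set.indicator_of_mem h]; simp
        · rw [Set.indicator_of_notMem h, Set.indicator_of_notMem h]; simp
    _ = ∑' g : SL(2, ℤ), ∫⁻ z, (strip Y).indicator 1 z * ψ (g • z) := by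
        refine lintegral_tsum fun g => ?_
        exact (hSm.mul (hψm.comp (continuous_sl_smul g).measurable)).aemeasurable
    _ = ∑' g : SL(2, ℤ), ∫⁻ z, (strip Y).indicator 1 (g⁻¹ • z) * ψ z := by
        refine tsum_congr fun g => ?_
        have := (measurePreserving_sl_smul g).lintegral_comp
          (f := fun z => (strip Y).indicator 1 (g⁻¹ • z) * ψ z)
          ((hSm.comp (continuous_sl_smul g⁻¹).measurable).mul hψm)
        rw [← this]
        simp
    _ = ∑' g : SL(2, ℤ), ∫⁻ z, ψ z * (strip Y).indicator 1 (g • z) := by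
        rw [← (Equiv.inv SL(2, ℤ)).tsum_eq]
        simp [mul_comm]
    _ = _ := by
        rw [← lintegral_tsum]
        · simp_rw [ENNReal.tsum_mul_left]
          rfl
        · intro g
          exact (hψm.mul (hSm.comp (continuous_sl_smul g).measurable)).aemeasurable

/-- Integration over a region of the upper half plane in coordinates. -/
lemma lintegral_coords {g : ℂ → ENNReal} (hg : Measurable g) {I : Set ℝ} (hI : MeasurableSet I)
    {Y : ℝ} (hY : 0 < Y) :
    ∫⁻ z in {z : UpperHalfPlane | z.re ∈ I ∧ Y ≤ z.im}, g z =
      ∫⁻ y in Set.Ici Y, ENNReal.ofReal ((y ^ 2)⁻¹) * ∫⁻ x in I, g (x + y * Complex.I) := by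
  set E : Set ℂ := {z | z.re ∈ I ∧ Y ≤ z.im} with hE
  have hEm : MeasurableSet E :=
    (Complex.measurable_re hI).inter (Complex.measurable_im measurableSet_Ici)
  have hpre : {z : UpperHalfPlane | z.re ∈ I ∧ Y ≤ z.im} = UpperHalfPlane.coe ⁻¹' E := rfl
  have hmp : MeasurePreserving UpperHalfPlane.coe
      ((volume : Measure ℂ).comap UpperHalfPlane.coe)
      (volume.restrict (.range UpperHalfPlane.coe)) :=
    ⟨UpperHalfPlane.measurable_coe, by rw [UpperHalfPlane.measurableEmbedding_coe.map_comap]⟩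
  have hd : Measurable fun z : UpperHalfPlane =>
      (((1 / NNReal.mk z.im z.im_pos.le : NNReal) ^ 2 : NNReal) : ENNReal) := by
    have : Continuous fun z : UpperHalfPlane =>
        (1 / NNReal.mk z.im z.im_pos.le : NNReal) ^ 2 := by
      refine Continuous.pow (Continuous.div₀ continuous_const ?_ ?_) _
      · exact UpperHalfPlane.continuous_im.subtype_mk _
      · exact fun x => NNReal.ne_iff.mp x.im_ne_zero
    exact this.measurable.coe_nnreal_ennreal
  have hsubset : E ⊆ Set.range UpperHalfPlane.coe := by
    intro z hz
    exact ⟨⟨z, hY.trans_le hz.2⟩, rfl⟩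
  have hpreim : MeasurableSet (UpperHalfPlane.coe ⁻¹' E) := UpperHalfPlane.measurable_coe hEm
  have hw : Measurable fun z : ℂ => ENNReal.ofReal ((z.im ^ 2)⁻¹) * g z :=
    ((Complex.measurable_im.pow_const 2).inv.ennreal_ofReal).mul hg
  calc ∫⁻ z in {z : UpperHalfPlane | z.re ∈ I ∧ Y ≤ z.im}, g z
      = ∫⁻ z in UpperHalfPlane.coe ⁻¹' E, ENNReal.ofReal (((z : ℂ).im ^ 2)⁻¹) * g z
          ∂((volume : Measure ℂ).comap UpperHalfPlane.coe) := by
        have h := setLIntegral_withDensity_eq_setLIntegral_mul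
          ((volume : Measure ℂ).comap UpperHalfPlane.coe) hd
          (hg.comp UpperHalfPlane.measurable_coe) hpreim
        rw [hpre, UpperHalfPlane.volume_def]
        refine Eq.trans h ?_
        refine setLIntegral_congr_fun hpreim fun z _ => ?_
        simp only [Pi.mul_apply]
        congr 1
        rw [ENNReal.ofReal, ENNReal.coe_inj]
        ext
        have hz := z.im_pos
        rw [Real.coe_toNNReal _ (by positivity)]
        simp
    _ = ∫⁻ z in E, ENNReal.ofReal ((z.im ^ 2)⁻¹) * g z := by
        rw [hmp.setLIntegral_comp_preimage hEm hw, Measure.restrict_restrict hEm,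
          Set.inter_eq_left.2 hsubset]
    _ = ∫⁻ p in I ×ˢ Set.Ici Y, ENNReal.ofReal ((p.2 ^ 2)⁻¹) * g (p.1 + p.2 * Complex.I) := by
        rw [← Complex.volume_preserving_equiv_real_prod.symm.setLIntegral_comp_preimage hEm hw]
        have : Complex.measurableEquivRealProd.symm ⁻¹' E = I ×ˢ Set.Ici Y := by
          ext p
          simp [hE, Complex.measurableEquivRealProd]
        rw [this]
        refine setLIntegral_congr_fun (hI.prod measurableSet_Ici) fun p _ => ?_
        have h2 : Complex.measurableEquivRealProd.symm p = p.1 + p.2 * Complex.I :=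
          Complex.mk_eq_add_mul_I _ _
        simp only [h2]
        simp
    _ = _ := by
        have hm : Measurable fun p : ℝ × ℝ =>
            ENNReal.ofReal ((p.2 ^ 2)⁻¹) * g (p.1 + p.2 * Complex.I) := by
          refine ((measurable_snd.pow_const 2).inv.ennreal_ofReal).mul (hg.comp ?_)
          have : Continuous fun p : ℝ × ℝ => (p.1 : ℂ) + p.2 * Complex.I := by fun_prop
          exact this.measurable
        rw [Measure.volume_eq_prod, ← Measure.prod_restrict, lintegral_prod_symm _ hm.aemeasurable]
        refine lintegral_congr fun y => ?_
        have : Continuous fun x : ℝ => (x : ℂ) + y * Complex.I := by fun_prop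
        exact lintegral_const_mul (f := fun x : ℝ => g (x + y * Complex.I)) (μ := volume.restrict I)
          (ENNReal.ofReal ((y ^ 2)⁻¹))
          (hg.comp this.measurable)

lemma volume_fd_lt_top : volume (𝒟 : Set UpperHalfPlane) < ⊤ := by
  have hsub : (𝒟 : Set UpperHalfPlane) ⊆
      {z : UpperHalfPlane | z.re ∈ Set.Icc (-1 : ℝ) 1 ∧ 1 / 2 ≤ z.im} := by
    intro z hz
    have h1 := ModularGroup.three_le_four_mul_im_sq_of_mem_fd hz
    have h2 := abs_le.1 hz.2
    refine ⟨⟨by linarith, by linarith⟩, ?_⟩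
    nlinarith [z.im_pos]
  refine (measure_mono hsub).trans_lt ?_
  have h := lintegral_coords (g := fun _ => 1) measurable_const (measurableSet_Icc (a := (-1 : ℝ)) (b := 1))
    (one_half_pos (α := ℝ))
  rw [setLIntegral_one] at h
  rw [h]
  simp only [setLIntegral_one, Real.volume_Icc]
  rw [lintegral_mul_const']
  · refine ENNReal.mul_lt_top ?_ ENNReal.ofReal_lt_top
    have h_intble : IntegrableOn (fun y : ℝ => y ^ (-2 : ℝ)) (Set.Ioi (1 / 4)) :=
      integrableOn_Ioi_rpow_of_lt (by norm_num) (by norm_num)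
    refine lt_of_le_of_lt (lintegral_mono_set (t := Set.Ioi (1 / 4 : ℝ)) ?_) ?_
    · intro y hy
      have : (1 / 2 : ℝ) ≤ y := hy
      exact lt_of_lt_of_le (by norm_num) this
    · have h2 := h_intble.lintegral_lt_top
      refine lt_of_eq_of_lt ?_ h2
      refine setLIntegral_congr_fun measurableSet_Ioi fun y hy => ?_
      have hy : (0 : ℝ) < y := lt_trans (by norm_num) hy
      rw [Real.rpow_neg hy.le]
      norm_num
  · exact ENNReal.ofReal_ne_top

/-- Asymptotics of the strip integrals of an invariant function of moderate growth. -/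
lemma tendsto_strip_integrals {f : UpperHalfPlane → ENNReal} (hf : Measurable f)
    (hinv : ∀ (g : SL(2, ℤ)) z, f (g • z) = f z) {M : ENNReal} (hM : M ≠ ⊤)
    (hbd : ∀ z ∈ (𝒟 : Set UpperHalfPlane), f z * ENNReal.ofReal z.im ≤ M) :
    ∃ L : ENNReal, L ≠ ⊤ ∧ Tendsto (fun Y : ℝ => ENNReal.ofReal Y *
      ∑' m : ℕ, ∫⁻ z in strip (((m : ℝ) + 1) ^ 2 * Y), f z) (𝓝[>] 0) (𝓝 L) := by
  set ψ : UpperHalfPlane → ENNReal := fun z => (𝒟 : Set UpperHalfPlane).indicator f z / fdCount z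
    with hψ
  have hψm : Measurable ψ := (hf.indicator measurableSet_fd).div measurable_fdCount
  have hlatm : ∀ Y : ℝ, Measurable fun z : UpperHalfPlane => latCount z (z.im / Y) := by
    intro Y
    refine Measurable.tsum fun v => ?_
    have hs : MeasurableSet {z : UpperHalfPlane | v ≠ 0 ∧
        ‖(v.1 : ℂ) * z + v.2‖ ^ 2 ≤ z.im / Y} := by
      have h2 : MeasurableSet {z : UpperHalfPlane | ‖(v.1 : ℂ) * z + v.2‖ ^ 2 ≤ z.im / Y} := by
        refine measurableSet_le ?_ (UpperHalfPlane.continuous_im.measurable.div_const Y)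
        have : Continuous fun z : UpperHalfPlane => ‖(v.1 : ℂ) * z + v.2‖ ^ 2 := by fun_prop
        exact this.measurable
      exact (MeasurableSet.const _).inter h2
    exact (measurable_const (a := (1 : ENNReal))).indicator hs
  have hkey : ∀ Y : ℝ, 0 < Y → ENNReal.ofReal Y *
      ∑' m : ℕ, ∫⁻ z in strip (((m : ℝ) + 1) ^ 2 * Y), f z =
      ∫⁻ z, ψ z * (ENNReal.ofReal Y * latCount z (z.im / Y)) := by
    intro Y hY
    simp_rw [lintegral_strip_eq hf hinv]
    rw [← lintegral_tsum]
    · rw [← lintegral_const_mul' _ _ ENNReal.ofReal_ne_top]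
      refine lintegral_congr fun z => ?_
      rw [ENNReal.tsum_mul_left, mul_left_comm]
      congr 2
      rw [← tsum_coprime_eq_latCount]
      refine tsum_congr fun m => ?_
      rw [tsum_strip z (by positivity)]
      have : z.im / (((m : ℝ) + 1) ^ 2 * Y) = z.im / Y / ((m : ℝ) + 1) ^ 2 := by
        field_simp
      rw [this]
    · intro m
      refine (hψm.mul (Measurable.tsum fun g => ?_)).aemeasurable
      exact (measurable_one.indicator (measurableSet_strip _)).comp (continuous_sl_smul g).measurable
  have hψ0 : ∀ z, z ∉ (𝒟 : Set UpperHalfPlane) → ψ z = 0 := by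
    intro z hz
    simp only [hψ, Set.indicator_of_notMem hz, ENNReal.zero_div]
  have hψle : ∀ z, ψ z ≤ (𝒟 : Set UpperHalfPlane).indicator f z := by
    intro z
    calc ψ z ≤ (𝒟 : Set UpperHalfPlane).indicator f z / 1 :=
          ENNReal.div_le_div_left (one_le_fdCount z) _
      _ = _ := div_one _
  have hC : ∀ z : UpperHalfPlane, ∃ C : ENNReal, Tendsto (fun Y : ℝ => ψ z *
      (ENNReal.ofReal Y * latCount z (z.im / Y))) (𝓝[>] 0) (𝓝 C) := by
    intro z
    by_cases hz : z ∈ (𝒟 : Set UpperHalfPlane)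
    · obtain ⟨C, hC⟩ := tendsto_mul_latCount hz
      refine ⟨ψ z * C, ENNReal.Tendsto.const_mul hC (Or.inr ?_)⟩
      refine ne_top_of_le_ne_top ?_ (hψle z)
      rw [Set.indicator_of_mem hz]
      intro htop
      have := hbd z hz
      rw [htop, ENNReal.top_mul (by simpa using z.im_pos), top_le_iff] at this
      exact hM this
    · refine ⟨0, ?_⟩
      simp [hψ0 z hz]
  choose C hC using hC
  have hbound : ∀ Y : ℝ, 0 < Y → ∀ z, ψ z * (ENNReal.ofReal Y * latCount z (z.im / Y)) ≤
      (𝒟 : Set UpperHalfPlane).indicator (fun _ => 18 * M) z := by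
    intro Y hY z
    by_cases hz : z ∈ (𝒟 : Set UpperHalfPlane)
    · rw [Set.indicator_of_mem hz]
      have h1 := hψle z
      rw [Set.indicator_of_mem hz] at h1
      have h2 : ENNReal.ofReal Y * latCount z (z.im / Y) ≤ 18 * ENNReal.ofReal z.im := by
        calc _ ≤ ENNReal.ofReal Y * ENNReal.ofReal (18 * (z.im / Y)) := by
              gcongr; exact latCount_le hz _
          _ = ENNReal.ofReal (18 * z.im) := by
              rw [← ENNReal.ofReal_mul hY.le]
              congr 1
              field_simp
          _ = _ := by
              rw [ENNReal.ofReal_mul (by norm_num)]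
              norm_num
      calc _ ≤ f z * (18 * ENNReal.ofReal z.im) := by gcongr
        _ = 18 * (f z * ENNReal.ofReal z.im) := by ring
        _ ≤ _ := by gcongr; exact hbd z hz
    · rw [hψ0 z hz, zero_mul]; exact bot_le
  have hfinite : ∫⁻ z, (𝒟 : Set UpperHalfPlane).indicator (fun _ => 18 * M) z ≠ ⊤ := by
    rw [lintegral_indicator measurableSet_fd, setLIntegral_const]
    exact ENNReal.mul_ne_top (ENNReal.mul_ne_top (by norm_num) hM) volume_fd_lt_top.ne
  refine ⟨∫⁻ z, C z, ?_, ?_⟩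
  · refine ne_top_of_le_ne_top hfinite (lintegral_mono fun z => ?_)
    refine le_of_tendsto (hC z) ?_
    filter_upwards [self_mem_nhdsWithin] with Y hY
    exact hbound Y hY z
  · have h := tendsto_lintegral_filter_of_dominated_convergence (μ := volume) (l := 𝓝[>] (0 : ℝ))
      (F := fun Y z => ψ z * (ENNReal.ofReal Y * latCount z (z.im / Y))) (f := C)
      ((𝒟 : Set UpperHalfPlane).indicator (fun _ => 18 * M))
      (Eventually.of_forall fun Y => hψm.mul ((hlatm Y).const_mul _))
      (by filter_upwards [self_mem_nhdsWithin] with Y hY using ae_of_all _ (hbound Y hY))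
      hfinite (ae_of_all _ hC)
    refine h.congr' ?_
    filter_upwards [self_mem_nhdsWithin] with Y hY
    exact (hkey Y hY).symm

end LegendreMoments

namespace LegendreMoments

open Matrix MatrixGroups Topology

open scoped Modular

open MeasureTheory

section parseval
open PowerSeries

lemma integral_qq_pow_mul_conj (n m : ℕ) (y : ℝ) :
    ∫ x in (0 : ℝ)..2, qq (x + y * Complex.I) ^ n *
        (starRingEnd ℂ) (qq (x + y * Complex.I) ^ m) =
      if m = n then 2 * Complex.exp (-(2 * Real.pi * n * y)) else 0 := by
  have hpi : (Real.pi : ℂ) ≠ 0 := by exact_mod_cast Real.pi_ne_zero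
  set c : ℂ := (n - m : ℂ) * (Real.pi * Complex.I) with hc
  have h : ∀ x : ℝ, qq (x + y * Complex.I) ^ n * (starRingEnd ℂ) (qq (x + y * Complex.I) ^ m) =
      Complex.exp (-(Real.pi * (n + m) * y)) * Complex.exp (c * x) := by
    intro x
    rw [qq, ← Complex.exp_nat_mul, ← Complex.exp_nat_mul, ← Complex.exp_conj, ← Complex.exp_add,
      ← Complex.exp_add, hc]
    congr 1
    simp only [map_mul, map_add, map_natCast, Complex.conj_ofReal, Complex.conj_I]
    linear_combination (Real.pi * y * (n + m) : ℂ) * Complex.I_sq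
  simp only [h]
  rw [intervalIntegral.integral_const_mul]
  split_ifs with hnm
  · have : c = 0 := by rw [hc, hnm, sub_self, zero_mul]
    simp only [this, zero_mul, Complex.exp_zero, intervalIntegral.integral_const, hnm]
    rw [show (Real.pi * (n + n) * y : ℂ) = 2 * Real.pi * n * y by ring]
    simp [mul_comm]
  · have hc0 : c ≠ 0 := by
      refine mul_ne_zero (sub_ne_zero.2 ?_) (mul_ne_zero hpi Complex.I_ne_zero)
      exact_mod_cast Ne.symm hnm
    have h2 : Complex.exp (c * (2 : ℝ)) = 1 := by
      rw [Complex.exp_eq_one_iff]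
      exact ⟨n - m, by rw [hc]; push_cast; ring⟩
    rw [integral_exp_mul_complex hc0, h2]
    simp

lemma continuous_ev_qq_line {f : PowerSeries ℤ} (hf : Conv f) {y : ℝ} (hy : 0 < y) :
    Continuous fun x : ℝ => ev f (qq (x + y * Complex.I)) := by
  rw [continuous_iff_continuousAt]
  intro x
  have him : 0 < ((x : ℂ) + y * Complex.I).im := by simpa using hy
  have h1 := (hasDerivAt_ev_qq hf him).continuousAt
  have h2 : ContinuousAt (fun x : ℝ => (x : ℂ) + y * Complex.I) x := by fun_prop
  exact ContinuousAt.comp (f := fun x : ℝ => (x : ℂ) + y * Complex.I) h1 h2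

lemma continuous_qq_line (y : ℝ) : Continuous fun x : ℝ => qq (x + y * Complex.I) := by
  unfold qq
  fun_prop

lemma norm_qq_line (x y : ℝ) : ‖qq (x + y * Complex.I)‖ = Real.exp (-Real.pi * y) := by
  rw [norm_qq]; simp

/-- Termwise integration of a convergent series against a bounded function on a horizontal line. -/
lemma hasSum_integral_ev_mul {f : PowerSeries ℤ} (hf : Conv f) {y : ℝ} (hy : 0 < y) {g : ℝ → ℂ}
    (hg : Continuous g) {C : ℝ} (hC : ∀ x, ‖g x‖ ≤ C) :
    HasSum (fun n => ∫ x in (0 : ℝ)..2, ((coeff n f : ℤ) : ℂ) * qq (x + y * Complex.I) ^ n * g x)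
      (∫ x in (0 : ℝ)..2, ev f (qq (x + y * Complex.I)) * g x) := by
  have hr0 := (Real.exp_pos (-Real.pi * y)).le
  have hr1 : Real.exp (-Real.pi * y) < 1 := by
    rw [Real.exp_lt_one_iff]; nlinarith [Real.pi_pos]
  refine intervalIntegral.hasSum_integral_of_dominated_convergence
    (fun n _ => |((coeff n f : ℤ) : ℝ)| * Real.exp (-Real.pi * y) ^ n * C) (fun n => ?_)
    (fun n => ae_of_all _ fun x _ => ?_) (ae_of_all _ fun x _ => (hf _ hr0 hr1).mul_right C)
    intervalIntegrable_const (ae_of_all _ fun x _ => ?_)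
  · exact ((continuous_const.mul ((continuous_qq_line y).pow n)).mul hg).aestronglyMeasurable
  · rw [norm_mul, norm_mul, norm_pow, norm_qq_line, Complex.norm_intCast]
    gcongr
    exact hC x
  · exact (hf.hasSum (by rw [norm_qq_line]; exact hr1)).mul_right _

lemma norm_ev_qq_le {f : PowerSeries ℤ} (hf : Conv f) {y : ℝ} (hy : 0 < y) :
    ∃ C : ℝ, ∀ τ : ℂ, y ≤ τ.im → ‖ev f (qq τ)‖ ≤ C := by
  have hr0 := (Real.exp_pos (-Real.pi * y)).le
  have hr1 : Real.exp (-Real.pi * y) < 1 := by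
    rw [Real.exp_lt_one_iff]; nlinarith [Real.pi_pos]
  refine ⟨∑' n, |((coeff n f : ℤ) : ℝ)| * Real.exp (-Real.pi * y) ^ n, fun τ hτ => ?_⟩
  refine tsum_of_norm_bounded (hf _ hr0 hr1).hasSum fun n => ?_
  rw [norm_mul, norm_pow, norm_qq, Complex.norm_intCast]
  have : Real.exp (-Real.pi * τ.im) ≤ Real.exp (-Real.pi * y) := by
    rw [Real.exp_le_exp]; nlinarith [Real.pi_pos]
  gcongr

lemma integral_qq_pow_mul_conj_ev {f : PowerSeries ℤ} (hf : Conv f) {y : ℝ} (hy : 0 < y) (n : ℕ) :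
    ∫ x in (0 : ℝ)..2, qq (x + y * Complex.I) ^ n *
        (starRingEnd ℂ) (ev f (qq (x + y * Complex.I))) =
      ((coeff n f : ℤ) : ℂ) * (2 * Complex.exp (-(2 * Real.pi * n * y))) := by
  have h := hasSum_integral_ev_mul hf hy (g := fun x => (starRingEnd ℂ) (qq (x + y * Complex.I) ^ n))
    (C := 1) (Complex.continuous_conj.comp ((continuous_qq_line y).pow n)) (fun x => by
      rw [RCLike.norm_conj, norm_pow]
      exact pow_le_one₀ (norm_nonneg _) (norm_qq_lt_one (by simpa using hy)).le)
  have h2 : ∀ m, ∫ x in (0 : ℝ)..2, ((coeff m f : ℤ) : ℂ) * qq (x + y * Complex.I) ^ m *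
      (starRingEnd ℂ) (qq (x + y * Complex.I) ^ n) = if m = n then
        ((coeff n f : ℤ) : ℂ) * (2 * Complex.exp (-(2 * Real.pi * n * y))) else 0 := by
    intro m
    simp_rw [mul_assoc]
    rw [intervalIntegral.integral_const_mul, integral_qq_pow_mul_conj]
    by_cases hnm : m = n
    · subst hnm; simp [mul_assoc]
    · rw [if_neg (Ne.symm hnm), if_neg hnm, mul_zero]
  simp_rw [h2] at h
  have h3 := h.unique (hasSum_ite_eq n _)
  have h4 := congrArg (starRingEnd ℂ) h3
  rw [intervalIntegral.integral_of_le (by norm_num), ← integral_conj,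
    ← intervalIntegral.integral_of_le (by norm_num)] at h4
  simp only [map_mul, Complex.conj_conj] at h4
  simp_rw [mul_comm (qq _ ^ n)]
  rw [h4]
  congr 1
  · simp
  · have h2 : (starRingEnd ℂ) 2 = 2 := map_ofNat _ 2
    rw [← Complex.exp_conj]
    simp [h2]

/-- Parseval's identity on a horizontal line. -/
lemma hasSum_integral_norm_sq {f : PowerSeries ℤ} (hf : Conv f) {y : ℝ} (hy : 0 < y) :
    HasSum (fun n : ℕ => ((coeff n f : ℤ) : ℝ) ^ 2 * (2 * Real.exp (-(2 * Real.pi * n * y))))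
      (∫ x in (0 : ℝ)..2, ‖ev f (qq (x + y * Complex.I))‖ ^ 2) := by
  obtain ⟨C, hC⟩ := norm_ev_qq_le hf hy
  have h := hasSum_integral_ev_mul hf hy
    (g := fun x => (starRingEnd ℂ) (ev f (qq (x + y * Complex.I)))) (C := C)
    (Complex.continuous_conj.comp (continuous_ev_qq_line hf hy)) (fun x => by
      rw [RCLike.norm_conj]
      exact hC _ (by simp))
  simp_rw [mul_assoc] at h
  simp_rw [intervalIntegral.integral_const_mul, integral_qq_pow_mul_conj_ev hf hy,
    Complex.mul_conj, Complex.normSq_eq_norm_sq] at h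
  rw [intervalIntegral.integral_ofReal] at h
  rw [← Complex.hasSum_ofReal]
  convert h using 2 with n
  · push_cast
    ring

lemma lintegral_norm_sq {f : PowerSeries ℤ} (hf : Conv f) {y : ℝ} (hy : 0 < y) :
    ∫⁻ x in Set.Ico (0 : ℝ) 2, ENNReal.ofReal (‖ev f (qq (x + y * Complex.I))‖ ^ 2) =
      2 * ∑' n : ℕ, ENNReal.ofReal (((coeff n f : ℤ) : ℝ) ^ 2 *
        Real.exp (-(2 * Real.pi * n * y))) := by
  have h := hasSum_integral_norm_sq hf hy
  have hcont : Continuous fun x : ℝ => ‖ev f (qq (x + y * Complex.I))‖ ^ 2 :=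
    (continuous_ev_qq_line hf hy).norm.pow 2
  rw [setLIntegral_congr Ico_ae_eq_Ioc, ← ofReal_integral_eq_lintegral_ofReal
    (hcont.integrableOn_Ioc) (ae_of_all _ fun x => by positivity),
    ← intervalIntegral.integral_of_le (by norm_num), ← h.tsum_eq,
    ENNReal.ofReal_tsum_of_nonneg (fun n => by positivity) h.summable, ← ENNReal.tsum_mul_left]
  refine tsum_congr fun n => ?_
  rw [mul_left_comm, ENNReal.ofReal_mul (by norm_num)]
  norm_num

end parseval

end LegendreMoments

namespace LegendreMoments

open Matrix MatrixGroups Topology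

open scoped Modular

open MeasureTheory

section rankinForm
open PowerSeries

/-- Power series of a monomial in the fourth powers of the three theta functions. -/
noncomputable def thetaProd (e : Fin 3 → ℕ) : ℤ⟦X⟧ :=
  (thetaA ^ 4) ^ e 0 * (16 * X * thetaPsi ^ 4) ^ e 1 * thetaW ^ e 2

/-- A monomial in the fourth powers of the three theta functions. -/
noncomputable def thetaForm (e : Fin 3 → ℕ) (τ : ℂ) : ℂ := uu τ ^ e 0 * vv τ ^ e 1 * ww τ ^ e 2

/-- The Petersson norm of a theta monomial, symmetrized over the three theta functions. -/
noncomputable def petersson (e : Fin 3 → ℕ) (τ : ℂ) : ℝ :=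
  τ.im ^ (2 * (e 0 + e 1 + e 2)) * ∑ σ : Equiv.Perm (Fin 3), ‖thetaForm (e ∘ σ) τ‖ ^ 2

variable (e : Fin 3 → ℕ)

lemma conv_thetaProd : Conv (thetaProd e) :=
  (((conv_thetaA.pow 4).pow _).mul ((((conv_ofNat 16).mul conv_X).mul
    (conv_thetaPsi.pow 4)).pow _)).mul (conv_thetaW.pow _)

lemma ev_thetaProd {τ : ℂ} (hτ : 0 < τ.im) : ev (thetaProd e) (qq τ) = thetaForm e τ := by
  have hq := norm_qq_lt_one hτ
  have hA := conv_thetaA.pow 4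
  have h16 := (conv_ofNat 16).mul conv_X
  have hV := h16.mul (conv_thetaPsi.pow 4)
  rw [thetaProd, thetaForm, ev_mul ((hA.pow _).mul (hV.pow _)) (conv_thetaW.pow _) hq,
    ev_mul (hA.pow _) (hV.pow _) hq, ev_pow hA hq, ev_pow hV hq, ev_pow conv_thetaW hq,
    ← ww_eq_ev hτ, ev_mul h16 (conv_thetaPsi.pow 4) hq, ev_mul (conv_ofNat 16) conv_X hq,
    ev_pow conv_thetaA hq, ev_pow conv_thetaPsi hq, ev_X, ev_ofNat]
  rfl

lemma petersson_nonneg {τ : ℂ} (hτ : 0 < τ.im) : 0 ≤ petersson e τ := by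
  unfold petersson; positivity

lemma petersson_add_one {τ : ℂ} (hτ : 0 < τ.im) : petersson e (τ + 1) = petersson e τ := by
  have him : (τ + 1).im = τ.im := by simp
  rw [petersson, petersson, him]
  congr 1
  refine Fintype.sum_equiv (Equiv.mulRight (Equiv.swap 0 2)) _ _ fun σ => ?_
  have h1 : (Equiv.swap 0 2 : Equiv.Perm (Fin 3)) 0 = 2 := by decide
  have h2 : (Equiv.swap 0 2 : Equiv.Perm (Fin 3)) 1 = 1 := by decide
  have h3 : (Equiv.swap 0 2 : Equiv.Perm (Fin 3)) 2 = 0 := by decide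
  simp only [thetaForm, Function.comp_apply, Equiv.coe_mulRight, Equiv.Perm.mul_apply, h1, h2, h3,
    uu_add_one, ww_add_one, vv_add_one hτ, norm_mul, norm_pow, norm_neg]
  ring

lemma sum_comp_perm (σ : Equiv.Perm (Fin 3)) :
    e (σ 0) + e (σ 1) + e (σ 2) = e 0 + e 1 + e 2 := by
  have := Equiv.sum_comp σ e
  rwa [Fin.sum_univ_three, Fin.sum_univ_three] at this

lemma petersson_S {τ : ℂ} (hτ : 0 < τ.im) : petersson e (-1 / τ) = petersson e τ := by
  have hτ0 : τ ≠ 0 := by rintro rfl; simp at hτ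
  have hn : ‖τ‖ ≠ 0 := norm_ne_zero_iff.2 hτ0
  have him : (-1 / τ).im = τ.im / ‖τ‖ ^ 2 := by
    rw [neg_div, one_div, Complex.neg_im, Complex.inv_im, Complex.normSq_eq_norm_sq]
    ring
  rw [petersson, petersson, him, div_pow, div_mul_eq_mul_div, mul_div_assoc]
  congr 1
  rw [Finset.sum_div]
  refine Fintype.sum_equiv (Equiv.mulRight (Equiv.swap 1 2)) _ _ fun σ => ?_
  have h1 : (Equiv.swap 1 2 : Equiv.Perm (Fin 3)) 0 = 0 := by decide
  have h2 : (Equiv.swap 1 2 : Equiv.Perm (Fin 3)) 1 = 2 := by decide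
  have h3 : (Equiv.swap 1 2 : Equiv.Perm (Fin 3)) 2 = 1 := by decide
  simp only [thetaForm, Function.comp_apply, Equiv.coe_mulRight, Equiv.Perm.mul_apply, h1, h2, h3,
    uu_S hτ, ww_S hτ, vv_S hτ, norm_mul, norm_pow, norm_neg, mul_pow]
  rw [← sum_comp_perm e σ, div_eq_iff (by positivity)]
  ring

/-- The symmetrized Petersson norm as a function on the upper half plane. -/
noncomputable def peterssonH (z : UpperHalfPlane) : ENNReal := ENNReal.ofReal (petersson e z)

lemma peterssonH_smul (g : SL(2, ℤ)) : ∀ z, peterssonH e (g • z) = peterssonH e z := by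
  have hg : g ∈ Subgroup.closure {ModularGroup.S, ModularGroup.T} := by
    rw [SpecialLinearGroup.SL2Z_generators]; trivial
  have hgen : ∀ x ∈ ({ModularGroup.S, ModularGroup.T} : Set SL(2, ℤ)), ∀ z,
      peterssonH e (x • z) = peterssonH e z := by
    have hS : ModularGroup.S.1 = !![0, -1; 1, 0] := rfl
    have hT : ModularGroup.T.1 = !![1, 1; 0, 1] := rfl
    rintro x (rfl | rfl) z
    · have : mob !![0, -1; 1, 0] z = -1 / z := by simp [mob, den]
      rw [peterssonH, peterssonH, coe_smul_eq_mob, hS, this, petersson_S e z.im_pos]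
    · have : mob !![1, 1; 0, 1] z = z + 1 := by simp [mob, den]
      rw [peterssonH, peterssonH, coe_smul_eq_mob, hT, this, petersson_add_one e z.im_pos]
  induction hg using Subgroup.closure_induction_left with
  | one => intro z; rw [one_smul]
  | mul_left x hx y hy ih => intro z; rw [mul_smul, hgen x hx, ih]
  | inv_mul_cancel x hx y hy ih =>
    intro z
    rw [mul_smul, ← hgen x hx, smul_inv_smul, ih]

lemma continuousAt_petersson {τ : ℂ} (hτ : 0 < τ.im) : ContinuousAt (petersson e) τ := by
  have hu := (differentiableAt_uu hτ).continuousAt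
  have hv := (differentiableAt_vv hτ).continuousAt
  have hw := (differentiableAt_ww hτ).continuousAt
  unfold petersson thetaForm
  refine ContinuousAt.mul (Complex.continuous_im.continuousAt.pow _) ?_
  refine tendsto_finsetSum _ fun σ _ => ?_
  exact ((((hu.pow _).mul (hv.pow _)).mul (hw.pow _)).norm.pow 2)

/-- A measurable extension of the Petersson norm to the whole plane. -/
noncomputable def peterssonC (τ : ℂ) : ENNReal :=
  ENNReal.ofReal ({τ : ℂ | 0 < τ.im}.indicator (petersson e) τ)

lemma measurable_peterssonC : Measurable (peterssonC e) := by
  refine Measurable.ennreal_ofReal ?_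
  have h : ContinuousOn (petersson e) {τ : ℂ | 0 < τ.im} := fun τ hτ =>
    (continuousAt_petersson e hτ).continuousWithinAt
  classical
  rw [← Set.piecewise_eq_indicator]
  exact h.measurable_piecewise continuousOn_const isOpen_upper.measurableSet

lemma peterssonC_eq {τ : ℂ} (hτ : 0 < τ.im) : peterssonC e τ = ENNReal.ofReal (petersson e τ) := by
  rw [peterssonC, Set.indicator_of_mem (show τ ∈ {τ : ℂ | 0 < τ.im} from hτ)]

lemma peterssonC_coe (z : UpperHalfPlane) : peterssonC e z = peterssonH e z :=
  peterssonC_eq e z.im_pos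

lemma measurable_peterssonH : Measurable (peterssonH e) := by
  have : peterssonH e = fun z : UpperHalfPlane => peterssonC e (z : ℂ) := by
    funext z; rw [peterssonC_coe]
  rw [this]
  exact (measurable_peterssonC e).comp UpperHalfPlane.measurable_coe

lemma exists_norm_uvw_le : ∃ C : ℝ, 1 ≤ C ∧ ∀ τ : ℂ, 1 / 2 ≤ τ.im → ‖uu τ‖ ≤ C ∧
    ‖vv τ‖ ≤ C * Real.exp (-Real.pi * τ.im) ∧ ‖ww τ‖ ≤ C := by
  obtain ⟨A, hA⟩ := norm_ev_qq_le (conv_thetaA.pow 4) one_half_pos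
  obtain ⟨B, hB⟩ := norm_ev_qq_le (conv_thetaPsi.pow 4) one_half_pos
  obtain ⟨D, hD⟩ := norm_ev_qq_le conv_thetaW one_half_pos
  refine ⟨max 1 (max A (max (16 * B) D)), le_max_left _ _, fun τ hτ => ?_⟩
  have hpos : 0 < τ.im := by linarith
  have hq := norm_qq_lt_one hpos
  have h1 := hA τ hτ
  have h2 := hB τ hτ
  have h3 := hD τ hτ
  rw [ev_pow conv_thetaA hq] at h1
  rw [ev_pow conv_thetaPsi hq] at h2
  rw [← ww_eq_ev hpos] at h3
  refine ⟨h1.trans ?_, ?_, h3.trans ?_⟩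
  · exact (le_max_left _ _).trans (le_max_right _ _)
  · rw [vv, norm_mul, norm_mul, norm_qq, mul_right_comm]
    gcongr
    refine le_trans ?_ ((le_max_left _ _).trans ((le_max_right _ _).trans (le_max_right _ _)))
    have : ‖(16 : ℂ)‖ = 16 := by simp
    rw [this]
    gcongr
  · exact (le_max_right _ _).trans ((le_max_right _ _).trans (le_max_right _ _))

lemma norm_thetaForm_sq_le {C y u v w : ℝ} (hC : 1 ≤ C) (hy : 0 ≤ y) (hu0 : 0 ≤ u) (hv0 : 0 ≤ v)
    (hw0 : 0 ≤ w) (hu : u ≤ C) (hv : v ≤ C * Real.exp (-Real.pi * y)) (hw : w ≤ C) {a b c : ℕ}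
    (hb : 0 < b) : (u ^ a * v ^ b * w ^ c) ^ 2 ≤
      (C ^ (a + b + c)) ^ 2 * Real.exp (-y) := by
  have hE : Real.exp (-Real.pi * y) ≤ 1 := by
    rw [Real.exp_le_one_iff]; nlinarith [Real.pi_pos]
  have hE0 := (Real.exp_pos (-Real.pi * y)).le
  have hEy : Real.exp (-Real.pi * y) ≤ Real.exp (-y) := by
    rw [Real.exp_le_exp]; nlinarith [Real.pi_gt_three]
  have hvb : v ^ b ≤ C ^ b * Real.exp (-Real.pi * y) := by
    calc v ^ b ≤ (C * Real.exp (-Real.pi * y)) ^ b := by gcongr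
      _ = C ^ b * Real.exp (-Real.pi * y) ^ b := mul_pow _ _ _
      _ ≤ C ^ b * Real.exp (-Real.pi * y) := by
        gcongr
        exact pow_le_of_le_one hE0 hE hb.ne'
  calc (u ^ a * v ^ b * w ^ c) ^ 2
      ≤ (C ^ a * (C ^ b * Real.exp (-Real.pi * y)) * C ^ c) ^ 2 := by gcongr
    _ = (C ^ (a + b + c)) ^ 2 * (Real.exp (-Real.pi * y) * Real.exp (-Real.pi * y)) := by ring
    _ ≤ (C ^ (a + b + c)) ^ 2 * (Real.exp (-y) * 1) := by gcongr
    _ = _ := by ring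

lemma exists_petersson_bound (he : ∀ i, 0 < e i) :
    ∃ M : ℝ, ∀ z ∈ (𝒟 : Set UpperHalfPlane), petersson e z * z.im ≤ M := by
  obtain ⟨C, hC1, hC⟩ := exists_norm_uvw_le
  set k := 2 * (e 0 + e 1 + e 2) with hk
  have hlim := Real.tendsto_pow_mul_exp_neg_atTop_nhds_zero (k + 1)
  have hcont : Continuous fun y : ℝ => y ^ (k + 1) * Real.exp (-y) := by fun_prop
  obtain ⟨B, hB⟩ : ∃ B : ℝ, ∀ y : ℝ, 0 ≤ y → y ^ (k + 1) * Real.exp (-y) ≤ B := by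
    obtain ⟨Y, hY⟩ := eventually_atTop.1 (hlim.eventually (ge_mem_nhds one_pos))
    obtain ⟨B, hB⟩ := (isCompact_Icc (a := (0 : ℝ)) (b := Y)).bddAbove_image hcont.continuousOn
    refine ⟨max 1 B, fun y hy => ?_⟩
    rcases le_total Y y with h | h
    · exact (hY y h).trans (le_max_left _ _)
    · exact (hB ⟨y, ⟨hy, h⟩, rfl⟩).trans (le_max_right _ _)
  refine ⟨∑ σ : Equiv.Perm (Fin 3), (C ^ (e 0 + e 1 + e 2)) ^ 2 * B, fun z hz => ?_⟩
  have h3 := ModularGroup.three_le_four_mul_im_sq_of_mem_fd hz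
  have him : 1 / 2 ≤ (z : ℂ).im := by
    have : (z : ℂ).im = z.im := rfl
    rw [this]
    nlinarith [z.im_pos]
  have him' : (z : ℂ).im = z.im := rfl
  obtain ⟨hu, hv, hw⟩ := hC z him
  rw [petersson, Finset.mul_sum, Finset.sum_mul]
  refine Finset.sum_le_sum fun σ _ => ?_
  have h := norm_thetaForm_sq_le hC1 z.im_pos.le (norm_nonneg _) (norm_nonneg _) (norm_nonneg _)
    hu hv hw (a := e (σ 0)) (c := e (σ 2)) (he (σ 1))
  rw [sum_comp_perm e σ] at h
  rw [thetaForm, norm_mul, norm_mul, norm_pow, norm_pow, norm_pow, ← hk, him']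
  simp only [Function.comp_apply]
  calc _ ≤ z.im ^ k * ((C ^ (e 0 + e 1 + e 2)) ^ 2 * Real.exp (-z.im)) * z.im := by
        have := z.im_pos
        gcongr
    _ = (C ^ (e 0 + e 1 + e 2)) ^ 2 * (z.im ^ (k + 1) * Real.exp (-z.im)) := by ring
    _ ≤ _ := by
        gcongr
        exact hB _ z.im_pos.le

/-- Sum of the squares of the coefficients of the theta monomials. -/
noncomputable def rankinCoeff (n : ℕ) : ℝ :=
  ∑ σ : Equiv.Perm (Fin 3), ((coeff n (thetaProd (e ∘ σ)) : ℤ) : ℝ) ^ 2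

lemma rankinCoeff_nonneg (n : ℕ) : 0 ≤ rankinCoeff e n := by
  unfold rankinCoeff; positivity

lemma lintegral_peterssonC {y : ℝ} (hy : 0 < y) :
    ∫⁻ x in Set.Ico (0 : ℝ) 1, peterssonC e (x + y * Complex.I) =
      ENNReal.ofReal (y ^ (2 * (e 0 + e 1 + e 2))) *
        ∑' n : ℕ, ENNReal.ofReal (rankinCoeff e n * Real.exp (-(2 * Real.pi * n * y))) := by
  have him : ∀ x : ℝ, 0 < ((x : ℂ) + y * Complex.I).im := fun x => by simpa using hy
  have hmeas : Measurable fun x : ℝ => peterssonC e (x + y * Complex.I) := by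
    have : Continuous fun x : ℝ => (x : ℂ) + y * Complex.I := by fun_prop
    exact (measurable_peterssonC e).comp this.measurable
  have hshift : ∫⁻ x in Set.Ico (1 : ℝ) 2, peterssonC e (x + y * Complex.I) =
      ∫⁻ x in Set.Ico (0 : ℝ) 1, peterssonC e (x + y * Complex.I) := by
    have h := (measurePreserving_add_right (volume : Measure ℝ) 1).setLIntegral_comp_preimage
      (measurableSet_Ico (a := (1 : ℝ)) (b := 2)) hmeas
    rw [← h]
    have : (fun x : ℝ => x + 1) ⁻¹' Set.Ico 1 2 = Set.Ico 0 1 := by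
      ext x
      simp only [Set.mem_preimage, Set.mem_Ico]
      constructor <;> rintro ⟨h1, h2⟩ <;> constructor <;> linarith
    rw [this]
    refine lintegral_congr fun x => ?_
    have h1 : ((x + 1 : ℝ) : ℂ) + y * Complex.I = (x + y * Complex.I) + 1 := by push_cast; ring
    rw [h1, peterssonC_eq e (by simpa using hy), petersson_add_one e (him x), peterssonC_eq e (him x)]
  have h2 : ∫⁻ x in Set.Ico (0 : ℝ) 2, peterssonC e (x + y * Complex.I) =
      2 * ∫⁻ x in Set.Ico (0 : ℝ) 1, peterssonC e (x + y * Complex.I) := by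
    rw [← Set.Ico_union_Ico_eq_Ico (zero_le_one (α := ℝ)) (one_le_two (α := ℝ)),
      lintegral_union measurableSet_Ico (Set.Ico_disjoint_Ico_same), hshift, two_mul]
  have h3 : ∫⁻ x in Set.Ico (0 : ℝ) 2, peterssonC e (x + y * Complex.I) =
      2 * (ENNReal.ofReal (y ^ (2 * (e 0 + e 1 + e 2))) *
        ∑' n : ℕ, ENNReal.ofReal (rankinCoeff e n * Real.exp (-(2 * Real.pi * n * y)))) := by
    have h4 : ∀ x : ℝ, peterssonC e (x + y * Complex.I) =
        ENNReal.ofReal (y ^ (2 * (e 0 + e 1 + e 2))) * ∑ σ : Equiv.Perm (Fin 3),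
          ENNReal.ofReal (‖ev (thetaProd (e ∘ σ)) (qq (x + y * Complex.I))‖ ^ 2) := by
      intro x
      have : ((x : ℂ) + y * Complex.I).im = y := by simp
      rw [peterssonC_eq e (him x), petersson, ENNReal.ofReal_mul (by rw [this]; positivity),
        ENNReal.ofReal_sum_of_nonneg (fun _ _ => by positivity), this]
      simp_rw [ev_thetaProd _ (him x)]
    simp_rw [h4]
    rw [lintegral_const_mul' _ _ ENNReal.ofReal_ne_top, lintegral_finsetSum]
    · simp_rw [lintegral_norm_sq (conv_thetaProd _) hy]
      rw [← Finset.mul_sum, mul_left_comm, ← Summable.tsum_finsetSum fun _ _ => ENNReal.summable]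
      congr 2
      refine tsum_congr fun n => ?_
      rw [rankinCoeff, Finset.sum_mul, ENNReal.ofReal_sum_of_nonneg (fun _ _ => by positivity)]
    · intro σ _
      exact ((continuous_ev_qq_line (conv_thetaProd _) hy).norm.pow 2).measurable.ennreal_ofReal
  rw [h2] at h3
  exact (ENNReal.mul_right_inj (by norm_num) (by norm_num)).1 h3

end rankinForm

end LegendreMoments

namespace LegendreMoments

open Matrix MatrixGroups Topology

open scoped Modular

open MeasureTheory

lemma setLIntegral_Ici_mul {M : ℝ} (hM : 0 < M) (Y : ℝ) {h : ℝ → ENNReal} (hh : Measurable h) :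
    ∫⁻ y in Set.Ici (M * Y), h y = ENNReal.ofReal M * ∫⁻ y in Set.Ici Y, h (M * y) := by
  have hpre : (fun y => M * y) ⁻¹' Set.Ici (M * Y) = Set.Ici Y := by
    ext y
    simp only [Set.mem_preimage, Set.mem_Ici]
    exact mul_le_mul_iff_right₀ hM
  conv_lhs => rw [← Real.smul_map_volume_mul_left hM.ne', abs_of_pos hM]
  rw [Measure.restrict_smul, lintegral_smul_measure,
    setLIntegral_map measurableSet_Ici hh (measurable_const_mul M), hpre, smul_eq_mul]

section rankinForm

variable (e : Fin 3 → ℕ)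

lemma lintegral_strip_petersson {Y : ℝ} (hY : 0 < Y) (he : 0 < e 0) :
    ∫⁻ z in strip Y, peterssonH e z = ∫⁻ y in Set.Ici Y,
      ENNReal.ofReal (y ^ (2 * (e 0 + e 1 + e 2) - 2)) *
        ∑' n : ℕ, ENNReal.ofReal (rankinCoeff e n * Real.exp (-(2 * Real.pi * n * y))) := by
  have h := lintegral_coords (measurable_peterssonC e) (measurableSet_Ico (a := (0 : ℝ)) (b := 1)) hY
  simp_rw [peterssonC_coe] at h
  refine h.trans (setLIntegral_congr_fun measurableSet_Ici fun y hy => ?_)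
  have hy : 0 < y := hY.trans_le hy
  rw [lintegral_peterssonC e hy, ← mul_assoc, ← ENNReal.ofReal_mul (by positivity)]
  congr 2
  rw [inv_mul_eq_div, div_eq_iff (by positivity), ← pow_add]
  congr 1
  omega

lemma lintegral_strip_scaled {M Y : ℝ} (hM : 0 < M) (hY : 0 < Y) (he : 0 < e 0) :
    ∫⁻ z in strip (M * Y), peterssonH e z = ∫⁻ y in Set.Ici Y,
      ENNReal.ofReal (y ^ (2 * (e 0 + e 1 + e 2) - 2)) *
        ∑' n : ℕ, ENNReal.ofReal (M ^ (2 * (e 0 + e 1 + e 2) - 1) * rankinCoeff e n *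
          Real.exp (-(2 * Real.pi * n * M * y))) := by
  set k := 2 * (e 0 + e 1 + e 2) with hk
  have hmeas : Measurable fun y : ℝ => ENNReal.ofReal (y ^ (k - 2)) *
      ∑' n : ℕ, ENNReal.ofReal (rankinCoeff e n * Real.exp (-(2 * Real.pi * n * y))) := by
    refine Measurable.mul (by fun_prop) (Measurable.tsum fun n => ?_)
    fun_prop
  rw [lintegral_strip_petersson e (mul_pos hM hY) he, ← hk, setLIntegral_Ici_mul hM Y hmeas,
    ← lintegral_const_mul' _ _ ENNReal.ofReal_ne_top]
  refine setLIntegral_congr_fun measurableSet_Ici fun y hy => ?_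
  have hy : 0 < y := hY.trans_le hy
  rw [← mul_assoc, ← ENNReal.ofReal_mul hM.le, mul_pow,
    show M * (M ^ (k - 2) * y ^ (k - 2)) = y ^ (k - 2) * M ^ (k - 1) by
      rw [show k - 1 = k - 2 + 1 by omega]; ring,
    ENNReal.ofReal_mul (by positivity), mul_assoc, ← ENNReal.tsum_mul_left]
  congr 1
  refine tsum_congr fun n => ?_
  rw [← ENNReal.ofReal_mul (by positivity), ← mul_assoc]
  congr 3
  ring_nf

/-- The Rankin bound, with `o` in place of `O`, for coefficients of theta monomials that vanish
at all cusps. -/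
lemma rankinCoeff_le (he : ∀ i, 0 < e i) {ε : ℝ} (hε : 0 < ε) :
    ∃ N : ℕ, ∀ n ≥ N, rankinCoeff e n ≤ ε * (n : ℝ) ^ (2 * (e 0 + e 1 + e 2)) := by
  obtain ⟨B, hB⟩ := exists_petersson_bound e he
  have hbd : ∀ z ∈ (𝒟 : Set UpperHalfPlane),
      peterssonH e z * ENNReal.ofReal z.im ≤ ENNReal.ofReal B := by
    intro z hz
    rw [peterssonH, ← ENNReal.ofReal_mul (petersson_nonneg e z.im_pos)]
    exact ENNReal.ofReal_le_ofReal (hB z hz)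
  obtain ⟨L, hL, hlim⟩ := tendsto_strip_integrals (measurable_peterssonH e) (peterssonH_smul e)
    ENNReal.ofReal_ne_top hbd
  set k := 2 * (e 0 + e 1 + e 2) with hk
  have h0 := he 0
  set c : ℕ × ℕ → ℝ := fun i => (((i.1 : ℝ) + 1) ^ 2) ^ (k - 1) * rankinCoeff e i.2 with hc
  set ν : ℕ × ℕ → ℝ := fun i => 2 * Real.pi * i.2 * ((i.1 : ℝ) + 1) ^ 2 with hν
  have hpi := Real.pi_pos
  have hc0 : ∀ i, 0 ≤ c i := fun i => mul_nonneg (by positivity) (rankinCoeff_nonneg e _)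
  have hν0 : ∀ i, 0 ≤ ν i := fun i => by positivity
  have hlim2 : Tendsto (fun Y : ℝ => ENNReal.ofReal Y * ∫⁻ y in Set.Ici Y,
      ENNReal.ofReal (y ^ (k - 2)) * ∑' i, ENNReal.ofReal (c i * Real.exp (-(ν i * y))))
      (𝓝[>] 0) (𝓝 L) := by
    refine hlim.congr' ?_
    filter_upwards [self_mem_nhdsWithin] with Y hY
    congr 1
    have h1 : ∀ m : ℕ, ∫⁻ z in strip (((m : ℝ) + 1) ^ 2 * Y), peterssonH e z =
        ∫⁻ y in Set.Ici Y, ENNReal.ofReal (y ^ (k - 2)) *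
          ∑' n : ℕ, ENNReal.ofReal (c (m, n) * Real.exp (-(ν (m, n) * y))) := fun m =>
      lintegral_strip_scaled e (by positivity) hY h0
    simp_rw [h1]
    rw [← lintegral_tsum]
    · refine lintegral_congr fun y => ?_
      rw [ENNReal.tsum_mul_left, ENNReal.tsum_prod
        (f := fun m n => ENNReal.ofReal (c (m, n) * Real.exp (-(ν (m, n) * y))))]
    · intro m
      refine (Measurable.mul (by fun_prop) (Measurable.tsum fun n => ?_)).aemeasurable
      fun_prop
  obtain ⟨M, hM⟩ := tauberian_bound hc0 hν0 (k := k) (by omega) hL hlim2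
    (ε := ε / (2 * Real.pi) ^ k) (by positivity)
  obtain ⟨N, hN⟩ := exists_nat_ge (M / (2 * Real.pi))
  refine ⟨N, fun n hn => ?_⟩
  have hn' : (N : ℝ) ≤ n := by exact_mod_cast hn
  have h := hM (0, n) (by
    simp only [hν]
    have := (div_le_iff₀ (by positivity)).1 (hN.trans hn')
    norm_num
    linarith)
  simp only [hc, hν] at h
  norm_num at h
  refine h.trans (le_of_eq ?_)
  rw [mul_pow, mul_pow, mul_pow]
  field_simp

end rankinForm

end LegendreMoments

namespace LegendreMoments

open Matrix MatrixGroups Topology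

section traceBound
open PowerSeries

lemma thetaProd_eq (r e : ℕ) :
    thetaProd ![r - e, e, 1] = 16 ^ e * (X ^ e * (thetaMono r e * thetaW)) := by
  simp only [thetaProd, thetaMono, Matrix.cons_val]
  ring

lemma sq_coeff_le_rankinCoeff (e : Fin 3 → ℕ) (n : ℕ) :
    ((coeff n (thetaProd e) : ℤ) : ℝ) ^ 2 ≤ rankinCoeff e n := by
  have h1 : e ∘ ((1 : Equiv.Perm (Fin 3)) : Fin 3 → Fin 3) = e := rfl
  unfold rankinCoeff
  refine le_trans (le_of_eq ?_) (Finset.single_le_sum (fun _ _ => sq_nonneg _)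
    (Finset.mem_univ (1 : Equiv.Perm (Fin 3))))
  simp only [h1]

lemma tendsto_coeff_cusp {r e : ℕ} (he : 0 < e) (her : e < r) :
    Tendsto (fun n : ℕ => ((coeff n (X ^ e * (thetaMono r e * thetaW)) : ℤ) : ℝ) /
      (n : ℝ) ^ (r + 1)) atTop (𝓝 0) := by
  rw [Metric.tendsto_atTop]
  intro ε hε
  obtain ⟨d, hd⟩ : ∃ d : Fin 3 → ℕ, d = ![r - e, e, 1] := ⟨_, rfl⟩
  have hd0 : ∀ i, 0 < d i := by
    intro i
    rw [hd]
    fin_cases i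
    · exact Nat.sub_pos_of_lt her
    · exact he
    · exact one_pos
  have hsum : d 0 + d 1 + d 2 = r + 1 := by
    have : d 0 + d 1 + d 2 = r - e + e + 1 := by rw [hd]; rfl
    omega
  obtain ⟨N, hN⟩ := rankinCoeff_le d hd0 (ε := ε ^ 2 / 4) (by positivity)
  rw [hsum] at hN
  refine ⟨max N 1, fun n hn => ?_⟩
  have hn1 : 0 < (n : ℝ) := by exact_mod_cast (le_max_right N 1).trans hn
  set a : ℤ := coeff n (X ^ e * (thetaMono r e * thetaW)) with ha
  have hcoeff : coeff n (thetaProd d) = 16 ^ e * a := by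
    rw [hd, thetaProd_eq, show (16 : ℤ⟦X⟧) ^ e = C ((16 : ℤ) ^ e) by simp, coeff_C_mul]
  have h1 : ((a : ℤ) : ℝ) ^ 2 ≤ rankinCoeff d n := by
    refine le_trans ?_ (sq_coeff_le_rankinCoeff d n)
    rw [hcoeff]
    push_cast
    rw [mul_pow]
    have h3 : (1 : ℝ) ≤ ((16 : ℝ) ^ e) ^ 2 := one_le_pow₀ (one_le_pow₀ (by norm_num))
    nlinarith [sq_nonneg (a : ℝ)]
  have h4 : (a : ℝ) ^ 2 ≤ (ε / 2 * (n : ℝ) ^ (r + 1)) ^ 2 := by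
    refine (h1.trans (hN n ((le_max_left _ _).trans hn))).trans (le_of_eq ?_)
    ring
  have h5 := abs_le_of_sq_le_sq' h4 (by positivity)
  rw [Real.dist_0_eq_abs, abs_div, abs_of_pos (by positivity : (0 : ℝ) < (n : ℝ) ^ (r + 1)),
    div_lt_iff₀ (by positivity)]
  have h6 : |(a : ℝ)| ≤ ε / 2 * (n : ℝ) ^ (r + 1) := abs_le.2 h5
  have h7 : 0 < ε * (n : ℝ) ^ (r + 1) := by positivity
  linarith

lemma tendsto_traceTerm {r e : ℕ} (her : e < r) :
    Tendsto (fun p : ℕ => (traceTerm r p e : ℝ) / (p : ℝ) ^ (r + 1)) atTop (𝓝 0) := by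
  have hpow : Tendsto (fun p : ℕ => (p : ℝ) ^ (r + 1)) atTop atTop :=
    (tendsto_pow_atTop (Nat.succ_ne_zero r)).comp tendsto_natCast_atTop_atTop
  have hterm : ∀ ij ∈ antidiagonal e, Tendsto (fun p : ℕ =>
      ((coeff ij.1 (invOfUnit (thetaMono r e) 1) : ℤ) : ℝ) *
        (((coeff (p * ij.2) (X ^ e * (thetaMono r e * thetaW)) : ℤ) : ℝ) / (p : ℝ) ^ (r + 1)))
      atTop (𝓝 0) := by
    rintro ⟨i, j⟩ hij
    rw [HasAntidiagonal.mem_antidiagonal] at hij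
    simp only at hij ⊢
    rw [← mul_zero ((coeff i (invOfUnit (thetaMono r e) 1) : ℤ) : ℝ)]
    refine Tendsto.const_mul _ ?_
    rcases Nat.eq_zero_or_pos j with rfl | hj
    · simp only [mul_zero]
      exact hpow.const_div_atTop _
    · have he : 0 < e := by omega
      have hj' : (j : ℝ) ≠ 0 := by exact_mod_cast hj.ne'
      have h := ((tendsto_coeff_cusp he her).comp
        (tendsto_id.atTop_mul_const' hj)).mul_const ((j : ℝ) ^ (r + 1))
      rw [zero_mul] at h
      refine h.congr fun p => ?_
      simp only [Function.comp_apply, id]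
      push_cast
      rw [mul_pow, ← div_div, div_mul_cancel₀ _ (pow_ne_zero _ hj')]
  have h := tendsto_finsetSum (antidiagonal e) hterm
  rw [Finset.sum_const_zero] at h
  refine h.congr fun p => ?_
  rw [traceTerm, coeff_mul]
  push_cast
  rw [Finset.sum_div]
  refine Finset.sum_congr rfl fun ij _ => ?_
  rw [heckeU, coeff_mk, mul_div_assoc]

lemma tendsto_traceS (r : ℕ) :
    Tendsto (fun p : ℕ => (traceS r p : ℝ) / (p : ℝ) ^ (r + 1)) atTop (𝓝 0) := by
  have h := (tendsto_finsetSum (range r) fun e he =>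
    tendsto_traceTerm (Finset.mem_range.1 he)).neg
  rw [Finset.sum_const_zero, neg_zero] at h
  refine h.congr fun p => ?_
  rw [traceS]
  push_cast
  rw [neg_div, Finset.sum_div]

lemma traceS_one (p : ℕ) : traceS 1 p = -1 := by
  simp [traceS, traceTerm, heckeU, constantCoeff_thetaMono, constantCoeff_thetaW]

end traceBound

end LegendreMoments

namespace LegendreMoments

section finiteField

variable (p : ℕ) [Fact p.Prime]

/-- The trace of Frobenius of the Legendre curve `y² = x(x-1)(x-l)`. -/
def legendreTrace (l : ZMod p) : ℤ :=
  -∑ x : ZMod p, quadraticChar (ZMod p) (x * (x - 1) * (x - l))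

variable {p}

lemma sum_zmod_pow (k : ℕ) (hk : k < 2 * (p - 1)) :
    ∑ x : ZMod p, x ^ k = if k = p - 1 then -1 else 0 := by
  have hp : 1 < p := (Fact.out : p.Prime).one_lt
  rcases lt_trichotomy k (p - 1) with h | h | h
  · rw [if_neg h.ne, FiniteField.sum_pow_lt_card_sub_one]
    rwa [ZMod.card]
  · rw [if_pos h, h]
    have h1 : ∀ x : ZMod p, x ^ (p - 1) = 1 - if x = 0 then 1 else 0 := by
      intro x
      split_ifs with hx
      · rw [hx, zero_pow (by omega), sub_self]
      · rw [ZMod.pow_card_sub_one_eq_one hx, sub_zero]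
    simp [h1, Finset.sum_sub_distrib]
  · rw [if_neg h.ne']
    obtain ⟨j, rfl⟩ : ∃ j, k = j + p := ⟨k - p, by omega⟩
    simp_rw [pow_add, ZMod.pow_card, ← pow_succ]
    apply FiniteField.sum_pow_lt_card_sub_one
    rw [ZMod.card]
    omega

lemma sum_zmod_eval (P : Polynomial (ZMod p)) (hP : P.natDegree < 2 * (p - 1)) :
    ∑ x : ZMod p, P.eval x = -P.coeff (p - 1) := by
  have hp : 1 < p := (Fact.out : p.Prime).one_lt
  simp_rw [Polynomial.eval_eq_sum_range' hP]
  rw [Finset.sum_comm]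
  simp_rw [← Finset.mul_sum]
  rw [Finset.sum_congr rfl fun k hk => by rw [sum_zmod_pow k (Finset.mem_range.1 hk)],
    Finset.sum_eq_single (p - 1)]
  · simp
  · intro k _ hk
    simp [hk]
  · intro h
    exact absurd (Finset.mem_range.2 (by omega)) h

lemma sub_C_pow_coeff (m i : ℕ) (a : ZMod p) :
    ((Polynomial.X - Polynomial.C a) ^ m).coeff i = (-a) ^ (m - i) * (m.choose i : ZMod p) := by
  rw [sub_eq_add_neg, ← Polynomial.C_neg, Polynomial.coeff_X_add_C_pow]

lemma legendreTrace_cast {m : ℕ} (hm : p = 2 * m + 1) (l : ZMod p) :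
    (legendreTrace p l : ZMod p) = (-1) ^ m * (hassePoly (ZMod p) m).eval l := by
  have hchar : ringChar (ZMod p) ≠ 2 := by
    rw [ZMod.ringChar_zmod_n]; omega
  have hm0 : 0 < m := by
    have := (Fact.out : p.Prime).one_lt
    omega
  set Q : Polynomial (ZMod p) := (Polynomial.X - Polynomial.C 1) ^ m *
    (Polynomial.X - Polynomial.C l) ^ m with hQ
  have hdeg : (Q * Polynomial.X ^ m).natDegree < 2 * (p - 1) := by
    have h1 : (Q * Polynomial.X ^ m).natDegree ≤ m * 1 + m * 1 + m := by
      refine Polynomial.natDegree_mul_le.trans (add_le_add (Polynomial.natDegree_mul_le.trans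
        (add_le_add ?_ ?_)) (Polynomial.natDegree_X_pow_le m))
      · exact Polynomial.natDegree_pow_le_of_le m (Polynomial.natDegree_X_sub_C_le _)
      · exact Polynomial.natDegree_pow_le_of_le m (Polynomial.natDegree_X_sub_C_le _)
    omega
  have h2 : (legendreTrace p l : ZMod p) = -∑ x : ZMod p, (Q * Polynomial.X ^ m).eval x := by
    rw [legendreTrace]
    push_cast
    congr 1
    refine Finset.sum_congr rfl fun x _ => ?_
    rw [quadraticChar_eq_pow_of_char_ne_two' hchar, ZMod.card,
      show p / 2 = m by omega, mul_pow, mul_pow, hQ]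
    simp only [Polynomial.eval_mul, Polynomial.eval_pow, Polynomial.eval_sub, Polynomial.eval_X,
      Polynomial.eval_C]
    ring
  rw [h2, sum_zmod_eval _ hdeg, neg_neg, show p - 1 = m + m by omega, Polynomial.coeff_mul_X_pow,
    hQ, Polynomial.coeff_mul, hassePoly, Polynomial.eval_finsetSum, Finset.mul_sum,
    Finset.Nat.sum_antidiagonal_eq_sum_range_succ_mk]
  refine Finset.sum_congr rfl fun i hi => ?_
  have hi' : i ≤ m := by
    have := Finset.mem_range.1 hi
    omega
  rw [sub_C_pow_coeff, sub_C_pow_coeff]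
  simp only [Polynomial.eval_mul, Polynomial.eval_pow, Polynomial.eval_X, Polynomial.eval_C]
  rw [show m - (m - i) = i by omega,
    Nat.choose_symm hi', neg_pow l, neg_pow 1, one_pow]
  rw [show m = m - i + i by omega, pow_add, show m - i + i = m by omega]
  ring

lemma quadraticChar_sq_ne_zero {x : ZMod p} (hx : x ≠ 0) (y : ZMod p) :
    quadraticChar (ZMod p) (x ^ 2 * y) = quadraticChar (ZMod p) y := by
  rw [map_mul, quadraticChar_sq_one' hx, one_mul]

lemma legendreTrace_one_sub (l : ZMod p) :
    legendreTrace p (1 - l) = quadraticChar (ZMod p) (-1) * legendreTrace p l := by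
  rw [legendreTrace, legendreTrace, mul_neg, Finset.mul_sum]
  congr 1
  rw [← (Equiv.subLeft (1 : ZMod p)).sum_comp]
  refine Finset.sum_congr rfl fun x _ => ?_
  rw [← map_mul, Equiv.subLeft_apply]
  congr 1
  ring

lemma legendreTrace_inv {l : ZMod p} (hl : l ≠ 0) :
    legendreTrace p l⁻¹ = quadraticChar (ZMod p) l * legendreTrace p l := by
  rw [legendreTrace, legendreTrace, mul_neg, Finset.mul_sum]
  congr 1
  rw [← Equiv.sum_comp (Equiv.mulRight₀ l⁻¹ (inv_ne_zero hl))]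
  refine Finset.sum_congr rfl fun x _ => ?_
  rw [← map_mul, Equiv.mulRight₀_apply,
    ← quadraticChar_sq_ne_zero (pow_ne_zero 2 hl) (x * l⁻¹ * _ * _)]
  congr 1
  field_simp

lemma legendreTrace_one_sub_sq (l : ZMod p) :
    legendreTrace p (1 - l) ^ 2 = legendreTrace p l ^ 2 := by
  rw [legendreTrace_one_sub, mul_pow, quadraticChar_sq_one (neg_ne_zero.2 one_ne_zero), one_mul]

lemma legendreTrace_inv_sq {l : ZMod p} (hl : l ≠ 0) :
    legendreTrace p l⁻¹ ^ 2 = legendreTrace p l ^ 2 := by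
  rw [legendreTrace_inv hl, mul_pow, quadraticChar_sq_one hl, one_mul]

lemma sum_quadraticChar_mul_sub_one (hp : p ≠ 2) :
    ∑ x : ZMod p, quadraticChar (ZMod p) (x * (1 - x)) = -quadraticChar (ZMod p) (-1) := by
  have hchar : ringChar (ZMod p) ≠ 2 := by rwa [ZMod.ringChar_zmod_n]
  have h := jacobiSum_nontrivial_inv (quadraticChar_ne_one hchar)
  rw [(quadraticChar_isQuadratic (ZMod p)).inv, jacobiSum] at h
  simpa only [map_mul] using h

lemma sum_quadraticChar_shift (hp : p ≠ 2) (x y : ZMod p) :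
    ∑ l : ZMod p, quadraticChar (ZMod p) (x - l) * quadraticChar (ZMod p) (y - l) =
      (p : ℤ) * (if x = y then 1 else 0) - 1 := by
  split_ifs with h
  · subst h
    refine ((Equiv.subLeft x).sum_comp fun l =>
      quadraticChar (ZMod p) l * quadraticChar (ZMod p) l).trans ?_
    have h1 : ∀ l : ZMod p, quadraticChar (ZMod p) l * quadraticChar (ZMod p) l =
        1 - if l = 0 then 1 else 0 := by
      intro l
      split_ifs with hl
      · simp [hl]
      · rw [← sq, quadraticChar_sq_one hl, sub_zero]
    rw [Finset.sum_congr rfl fun l _ => h1 l]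
    simp [Finset.sum_sub_distrib, ZMod.card]
  · have hc : y - x ≠ 0 := sub_ne_zero.2 (Ne.symm h)
    rw [← ((Equiv.mulLeft₀ (y - x) hc).trans (Equiv.addLeft x)).sum_comp]
    have h1 : ∀ u : ZMod p,
        quadraticChar (ZMod p) (x - ((Equiv.mulLeft₀ (y - x) hc).trans (Equiv.addLeft x)) u) *
          quadraticChar (ZMod p) (y - ((Equiv.mulLeft₀ (y - x) hc).trans (Equiv.addLeft x)) u) =
        quadraticChar (ZMod p) (-1) * quadraticChar (ZMod p) (u * (1 - u)) := by
      intro u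
      rw [← map_mul, ← map_mul, ← quadraticChar_sq_ne_zero hc (-1 * _)]
      congr 1
      simp only [Equiv.trans_apply, Equiv.mulLeft₀_apply, Equiv.coe_addLeft]
      ring
    rw [Finset.sum_congr rfl fun u _ => h1 u, ← Finset.mul_sum, sum_quadraticChar_mul_sub_one hp,
      mul_neg, ← sq, quadraticChar_sq_one (neg_ne_zero.2 one_ne_zero)]
    ring

lemma sum_legendreTrace_sq (hp : p ≠ 2) :
    ∑ l : ZMod p, legendreTrace p l ^ 2 = (p : ℤ) * (p - 2) - 1 := by
  set χ := quadraticChar (ZMod p) with hχ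
  have h1 : ∀ l : ZMod p, legendreTrace p l ^ 2 = ∑ x : ZMod p, ∑ y : ZMod p,
      χ (x * (x - 1)) * χ (y * (y - 1)) * (χ (x - l) * χ (y - l)) := by
    intro l
    rw [legendreTrace, neg_sq, sq, Finset.sum_mul_sum]
    refine Finset.sum_congr rfl fun x _ => Finset.sum_congr rfl fun y _ => ?_
    simp only [map_mul, ← hχ]
    ring
  have h2 : ∑ x : ZMod p, χ (x * (x - 1)) = -1 := by
    have h3 : ∀ x : ZMod p, χ (x * (x - 1)) = χ (-1) * χ (x * (1 - x)) := by
      intro x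
      rw [← map_mul]
      congr 1
      ring
    rw [Finset.sum_congr rfl fun x _ => h3 x, ← Finset.mul_sum, sum_quadraticChar_mul_sub_one hp,
      mul_neg, ← sq, quadraticChar_sq_one (neg_ne_zero.2 one_ne_zero)]
  have h4 : ∑ x : ZMod p, χ (x * (x - 1)) * χ (x * (x - 1)) = (p : ℤ) - 2 := by
    have h5 : ∀ x : ZMod p, χ (x * (x - 1)) * χ (x * (x - 1)) =
        1 - (if x = 0 then 1 else 0) - (if x = 1 then 1 else 0) := by
      intro x
      by_cases hx : x = 0
      · simp [hx, MulChar.map_zero]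
      by_cases hx1 : x = 1
      · simp [hx1, MulChar.map_zero]
      rw [← sq, quadraticChar_sq_one (mul_ne_zero hx (sub_ne_zero.2 hx1)), if_neg hx, if_neg hx1]
      norm_num
    rw [Finset.sum_congr rfl fun x _ => h5 x]
    simp [Finset.sum_sub_distrib, ZMod.card]
    ring
  rw [Finset.sum_congr rfl fun l _ => h1 l, Finset.sum_comm]
  have h6 : ∀ x : ZMod p, ∑ l : ZMod p, ∑ y : ZMod p,
      χ (x * (x - 1)) * χ (y * (y - 1)) * (χ (x - l) * χ (y - l)) =
      p * (χ (x * (x - 1)) * χ (x * (x - 1))) -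
        χ (x * (x - 1)) * ∑ y : ZMod p, χ (y * (y - 1)) := by
    intro x
    rw [Finset.sum_comm]
    simp_rw [← Finset.mul_sum]
    rw [Finset.sum_congr rfl fun y _ => by rw [sum_quadraticChar_shift hp x y]]
    simp_rw [mul_sub, Finset.sum_sub_distrib]
    simp [Finset.mul_sum]
    ring
  rw [Finset.sum_congr rfl fun x _ => h6 x, Finset.sum_sub_distrib, ← Finset.mul_sum,
    ← Finset.sum_mul, h4, h2]
  ring

lemma legendreTrace_zero (hp : p ≠ 2) :
    legendreTrace p 0 = quadraticChar (ZMod p) (-1) := by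
  have hchar : ringChar (ZMod p) ≠ 2 := by rwa [ZMod.ringChar_zmod_n]
  have h1 : ∀ x : ZMod p, quadraticChar (ZMod p) (x * (x - 1) * (x - 0)) =
      quadraticChar (ZMod p) (x - 1) - if x = 0 then quadraticChar (ZMod p) (-1) else 0 := by
    intro x
    split_ifs with hx
    · simp [hx]
    · rw [sub_zero, sub_zero, ← quadraticChar_sq_ne_zero hx (x - 1)]
      congr 1
      ring
  have h2 : ∑ x : ZMod p, quadraticChar (ZMod p) (x - 1) = 0 := by
    refine ((Equiv.subRight (1 : ZMod p)).sum_comp fun x => quadraticChar (ZMod p) x).trans ?_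
    exact quadraticChar_sum_zero hchar
  rw [legendreTrace, Finset.sum_congr rfl fun x _ => h1 x, Finset.sum_sub_distrib, h2]
  simp

variable (p) in
/-- The parameters of the nonsingular Legendre curves. -/
def legendreParams : Finset (ZMod p) := univ.filter fun l => l ≠ 0 ∧ l ≠ 1

lemma sum_legendreParams {M : Type*} [AddCommGroup M] (f : ZMod p → M) :
    ∑ l ∈ legendreParams p, f l = ∑ l, f l - f 0 - f 1 := by
  have h : legendreParams p = (univ.erase 0).erase 1 := by
    ext l
    simp [legendreParams, and_comm]
  rw [h, Finset.sum_erase_eq_sub (by simp), Finset.sum_erase_eq_sub (by simp)]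

lemma sum_legendreParams_sq (hp : p ≠ 2) :
    ∑ l ∈ legendreParams p, legendreTrace p l ^ 2 = (p : ℤ) * (p - 2) - 3 := by
  have h0 : legendreTrace p 0 ^ 2 = 1 := by
    rw [legendreTrace_zero hp, quadraticChar_sq_one (neg_ne_zero.2 one_ne_zero)]
  have h1 := legendreTrace_one_sub_sq (p := p) 0
  rw [sub_zero] at h1
  rw [sum_legendreParams, sum_legendreTrace_sq hp, h1, h0]
  ring

lemma card_legendreParams : ((legendreParams p).card : ℤ) = p - 2 := by
  have h := sum_legendreParams (p := p) fun _ => (1 : ℤ)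
  simp only [Finset.sum_const, Finset.card_univ, ZMod.card, nsmul_eq_mul, mul_one] at h
  linarith

/-- Every parameter has a companion with the same trace up to sign. -/
lemma exists_companion (hp : 3 < p) {l : ZMod p} (hl : l ∈ legendreParams p) :
    ∃ l' ∈ legendreParams p, l' ≠ l ∧ legendreTrace p l' ^ 2 = legendreTrace p l ^ 2 := by
  simp only [legendreParams, Finset.mem_filter, Finset.mem_univ, true_and] at hl ⊢
  by_cases h : 1 - l = l
  · have h2 : l * 2 = 1 := by linear_combination -h
    refine ⟨l⁻¹, ⟨inv_ne_zero hl.1, fun h1 => hl.2 (inv_eq_one.1 h1)⟩, fun h1 => ?_,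
      legendreTrace_inv_sq hl.1⟩
    have h3 : l * l = 1 := by
      nth_rw 1 [← h1]
      exact inv_mul_cancel₀ hl.1
    have h4 : ((3 : ℕ) : ZMod p) = 0 := by
      push_cast
      linear_combination (2 * l + 1) * h2 - 4 * h3
    rw [ZMod.natCast_eq_zero_iff] at h4
    exact absurd (Nat.le_of_dvd (by norm_num) h4) (by omega)
  · exact ⟨1 - l, ⟨sub_ne_zero.2 (Ne.symm hl.2), fun h1 => hl.1 (by linear_combination -h1)⟩, h,
      legendreTrace_one_sub_sq l⟩

lemma two_mul_legendreTrace_sq_lt (hp : 3 < p) {l : ZMod p} (hl : l ∈ legendreParams p) :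
    2 * legendreTrace p l ^ 2 < (p : ℤ) ^ 2 := by
  obtain ⟨l', hl', hne, h⟩ := exists_companion hp hl
  have h1 : ∑ k ∈ {l', l}, legendreTrace p k ^ 2 ≤ ∑ k ∈ legendreParams p, legendreTrace p k ^ 2 :=
    Finset.sum_le_sum_of_subset_of_nonneg (by
      intro k hk
      simp only [Finset.mem_insert, Finset.mem_singleton] at hk
      rcases hk with rfl | rfl <;> assumption) fun _ _ _ => sq_nonneg _
  rw [Finset.sum_pair hne, sum_legendreParams_sq (by omega), h] at h1
  have : (0 : ℤ) < p := by exact_mod_cast (by omega : 0 < p)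
  nlinarith

lemma legendreTrace_sq_add_sq_lt (hp : 3 < p) {l k : ZMod p} (hl : l ∈ legendreParams p)
    (hk : k ∈ legendreParams p) (hne : legendreTrace p l ^ 2 ≠ legendreTrace p k ^ 2) :
    2 * (legendreTrace p l ^ 2 + legendreTrace p k ^ 2) < (p : ℤ) ^ 2 := by
  obtain ⟨l', hl', hnl, hl2⟩ := exists_companion hp hl
  obtain ⟨k', hk', hnk, hk2⟩ := exists_companion hp hk
  have d1 : l ≠ k := by rintro rfl; exact hne rfl
  have d2 : l ≠ k' := by rintro rfl; exact hne hk2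
  have d3 : l' ≠ k := by rintro rfl; exact hne hl2.symm
  have d4 : l' ≠ k' := by rintro rfl; exact hne (hl2.symm.trans hk2)
  have h1 : ∑ j ∈ {l', l, k', k}, legendreTrace p j ^ 2 ≤
      ∑ j ∈ legendreParams p, legendreTrace p j ^ 2 :=
    Finset.sum_le_sum_of_subset_of_nonneg (by
      intro j hj
      simp only [Finset.mem_insert, Finset.mem_singleton] at hj
      rcases hj with rfl | rfl | rfl | rfl <;> assumption) fun _ _ _ => sq_nonneg _
  rw [Finset.sum_insert (by simp [hnl, d3, d4]), Finset.sum_insert (by simp [d1, d2]),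
    Finset.sum_pair hnk, sum_legendreParams_sq (by omega), hl2, hk2] at h1
  have : (0 : ℤ) < p := by exact_mod_cast (by omega : 0 < p)
  nlinarith

end finiteField

end LegendreMoments

namespace LegendreMoments

open Topology

/-- A small integer-valued function on a finite set that is orthogonal to `1` and to an injective
function vanishes. -/
lemma eq_zero_of_sum_abs_lt_four {W : Finset ℤ} {h : ℤ → ℤ} (h0 : ∑ w ∈ W, h w = 0)
    (h1 : ∑ w ∈ W, h w * w = 0) (h4 : ∑ w ∈ W, |h w| < 4) : ∀ w ∈ W, h w = 0 := by
  by_contra! hne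
  obtain ⟨a, ha, hapos⟩ := Finset.exists_pos_of_sum_zero_of_exists_nonzero h h0 hne
  obtain ⟨b, hb, hbpos⟩ := Finset.exists_pos_of_sum_zero_of_exists_nonzero (fun w => -h w)
    (by rw [Finset.sum_neg_distrib, h0, neg_zero])
    (by simpa using hne)
  have hab : a ≠ b := by
    rintro rfl
    omega
  set k : ℤ → ℤ := fun w => h w - (if w = a then 1 else 0) + (if w = b then 1 else 0) with hk
  have hk0 : ∑ w ∈ W, k w = 0 := by
    simp [hk, Finset.sum_add_distrib, Finset.sum_sub_distrib, h0, ha, hb]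
  have hkabs : ∀ w, |k w| ≤ |h w| - (if w = a then 1 else 0) - (if w = b then 1 else 0) := by
    intro w
    simp only [hk]
    by_cases hwa : w = a
    · subst hwa
      rw [if_pos rfl, if_neg hab, abs_of_pos hapos, abs_of_nonneg (by omega)]
      omega
    · by_cases hwb : w = b
      · subst hwb
        rw [if_pos rfl, if_neg hwa, abs_of_neg (by omega : h w < 0), abs_of_nonpos (by omega)]
        omega
      · simp [hwa, hwb]
  have hk2 : ∑ w ∈ W, |k w| < 2 := by
    refine (Finset.sum_le_sum fun w _ => hkabs w).trans_lt ?_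
    simp [Finset.sum_sub_distrib, ha, hb]
    omega
  have hkz : ∀ w ∈ W, k w = 0 := by
    by_contra! hne'
    obtain ⟨c, hc, hcpos⟩ := Finset.exists_pos_of_sum_zero_of_exists_nonzero k hk0 hne'
    obtain ⟨d, hd, hdpos⟩ := Finset.exists_pos_of_sum_zero_of_exists_nonzero (fun w => -k w)
      (by rw [Finset.sum_neg_distrib, hk0, neg_zero])
      (by simpa using hne')
    have hcd : c ≠ d := by
      rintro rfl
      omega
    have h5 : ∑ w ∈ {c, d}, |k w| ≤ ∑ w ∈ W, |k w| :=
      Finset.sum_le_sum_of_subset_of_nonneg (by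
        intro j hj
        simp only [Finset.mem_insert, Finset.mem_singleton] at hj
        rcases hj with rfl | rfl <;> assumption) fun _ _ _ => abs_nonneg _
    rw [Finset.sum_pair hcd, abs_of_pos hcpos, abs_of_neg (by omega : k d < 0)] at h5
    omega
  have h6 : ∑ w ∈ W, k w * w = 0 := Finset.sum_eq_zero fun w hw => by rw [hkz w hw, zero_mul]
  have h7 : ∑ w ∈ W, k w * w = b - a := by
    simp [hk, add_mul, sub_mul, Finset.sum_add_distrib, Finset.sum_sub_distrib, h1, ha, hb]
    ring
  exact hab (by omega)

lemma zmod_eq_zero_of_power_sums {p : ℕ} [Fact p.Prime] {W : Finset ℤ} {g : ℤ → ZMod p}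
    (hinj : ∀ x ∈ W, ∀ y ∈ W, (x : ZMod p) = y → x = y)
    (hpow : ∀ k : ℕ, ∑ w ∈ W, g w * (w : ZMod p) ^ k = 0) : ∀ w ∈ W, g w = 0 := by
  intro v hv
  have hpoly : ∀ P : Polynomial (ZMod p), ∑ w ∈ W, g w * P.eval (w : ZMod p) = 0 := by
    intro P
    simp_rw [Polynomial.eval_eq_sum_range, Finset.mul_sum]
    rw [Finset.sum_comm]
    refine Finset.sum_eq_zero fun k _ => ?_
    rw [Finset.sum_congr rfl fun w _ => show g w * (P.coeff k * (w : ZMod p) ^ k) =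
      P.coeff k * (g w * (w : ZMod p) ^ k) by ring, ← Finset.mul_sum, hpow, mul_zero]
  have h := hpoly (∏ w ∈ W.erase v, (Polynomial.X - Polynomial.C (w : ZMod p)))
  rw [Finset.sum_eq_single v] at h
  · refine (mul_eq_zero.1 h).resolve_right ?_
    rw [Polynomial.eval_prod]
    refine Finset.prod_ne_zero_iff.2 ?_
    intro w hw
    rw [Polynomial.eval_sub, Polynomial.eval_X, Polynomial.eval_C, sub_ne_zero]
    exact fun he => (Finset.ne_of_mem_erase hw) (hinj v hv w (Finset.mem_of_mem_erase hw) he).symm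
  · intro w hw hwv
    rw [Polynomial.eval_prod, Finset.prod_eq_zero (Finset.mem_erase.2 ⟨hwv, hw⟩), mul_zero]
    simp
  · exact fun hn => absurd hv hn

/-- Two short multisets of integers with the same sum and the same power sums modulo `p` agree. -/
lemma multiset_eq_of_power_sums {p : ℕ} [Fact p.Prime] {A B : Multiset ℤ}
    (hcard : Multiset.card A = Multiset.card B)
    (hlt : Multiset.card A + Multiset.card B < 4 * p) (hsum : A.sum = B.sum)
    (hpow : ∀ k : ℕ, (((A.map (· ^ k)).sum : ℤ) : ZMod p) = ((B.map (· ^ k)).sum : ℤ))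
    (hinj : ∀ x ∈ A + B, ∀ y ∈ A + B, (x : ZMod p) = y → x = y) : A = B := by
  have hp : 0 < p := (Fact.out : p.Prime).pos
  set W := (A + B).toFinset with hW
  have hmem : ∀ {x}, x ∈ W → x ∈ A + B := fun h => Multiset.mem_toFinset.1 h
  have hsumW : ∀ C : Multiset ℤ, C ≤ A + B → ∀ f : ℤ → ℤ,
      (C.map f).sum = ∑ w ∈ W, (C.count w : ℤ) * f w := by
    intro C hC f
    rw [Finset.sum_multiset_map_count]
    simp_rw [nsmul_eq_mul]
    refine Finset.sum_subset (fun x hx => ?_) fun x _ hx => ?_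
    · exact Multiset.mem_toFinset.2 (Multiset.mem_of_le hC (Multiset.mem_toFinset.1 hx))
    · rw [Multiset.count_eq_zero.2 fun h => hx (Multiset.mem_toFinset.2 h)]
      simp
  have hA := hsumW A (Multiset.le_add_right A B)
  have hB := hsumW B (Multiset.le_add_left B A)
  have hcardA : (Multiset.card A : ℤ) = ∑ w ∈ W, (A.count w : ℤ) := by
    simpa using hA fun _ => 1
  have hcardB : (Multiset.card B : ℤ) = ∑ w ∈ W, (B.count w : ℤ) := by
    simpa using hB fun _ => 1
  set g : ℤ → ℤ := fun w => (A.count w : ℤ) - B.count w with hg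
  have hdvd : ∀ w ∈ W, (p : ℤ) ∣ g w := by
    intro w hw
    rw [← ZMod.intCast_zmod_eq_zero_iff_dvd]
    refine zmod_eq_zero_of_power_sums (W := W) (g := fun w => ((g w : ℤ) : ZMod p))
      (fun x hx y hy => hinj x (hmem hx) y (hmem hy)) (fun k => ?_) w hw
    have h1 := hpow k
    rw [hA, hB] at h1
    push_cast at h1
    simp only [hg]
    push_cast
    simp_rw [sub_mul, Finset.sum_sub_distrib, h1, sub_self]
  have hgh : ∀ w ∈ W, g w = p * (g w / p) := fun w hw => (Int.mul_ediv_cancel' (hdvd w hw)).symm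
  have hp' : (p : ℤ) ≠ 0 := by exact_mod_cast hp.ne'
  have hz := eq_zero_of_sum_abs_lt_four (W := W) (h := fun w => g w / p) ?_ ?_ ?_
  · refine Multiset.ext.2 fun w => ?_
    by_cases hw : w ∈ W
    · have h1 := hgh w hw
      rw [hz w hw, mul_zero] at h1
      simp only [hg] at h1
      omega
    · rw [hW, Multiset.mem_toFinset, Multiset.mem_add, not_or] at hw
      rw [Multiset.count_eq_zero.2 hw.1, Multiset.count_eq_zero.2 hw.2]
  · refine (mul_eq_zero.1 ?_).resolve_left hp'
    rw [Finset.mul_sum, ← Finset.sum_congr rfl hgh]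
    simp only [hg, Finset.sum_sub_distrib]
    rw [← hcardA, ← hcardB, hcard, sub_self]
  · refine (mul_eq_zero.1 ?_).resolve_left hp'
    rw [Finset.mul_sum, Finset.sum_congr rfl fun w hw => show (p : ℤ) * (g w / p * w) = g w * w by
      nth_rw 2 [hgh w hw]; ring]
    simp only [hg, sub_mul, Finset.sum_sub_distrib]
    rw [← hA fun w => w, ← hB fun w => w, Multiset.map_id', Multiset.map_id', hsum, sub_self]
  · have h1 : (p : ℤ) * ∑ w ∈ W, |g w / p| < p * 4 := by
      rw [Finset.mul_sum]
      calc ∑ w ∈ W, (p : ℤ) * |g w / p| = ∑ w ∈ W, |g w| := by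
            refine Finset.sum_congr rfl fun w hw => ?_
            nth_rw 2 [hgh w hw]
            rw [abs_mul, abs_of_nonneg (by positivity : (0 : ℤ) ≤ p)]
        _ ≤ ∑ w ∈ W, ((A.count w : ℤ) + B.count w) := by
            refine Finset.sum_le_sum fun w _ => ?_
            simp only [hg]
            rw [abs_le]
            omega
        _ < p * 4 := by
            rw [Finset.sum_add_distrib, ← hcardA, ← hcardB]
            omega
    exact lt_of_mul_lt_mul_left h1 (by positivity)

section ballot

/-- The ballot number, the coefficient of `V_j` in the expansion of `t ^ (2 n)`. -/
def ballot (n j : ℕ) : ℤ := (2 * n).choose (n + j) - (2 * n).choose (n + j + 1)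

lemma ballot_zero_zero : ballot 0 0 = 1 := rfl

lemma ballot_eq_zero {n j : ℕ} (h : n < j) : ballot n j = 0 := by
  rw [ballot, Nat.choose_eq_zero_of_lt (by omega), Nat.choose_eq_zero_of_lt (by omega)]
  rfl

lemma choose_two_mul_succ (n k : ℕ) : (2 * (n + 1)).choose (k + 2) =
    (2 * n).choose (k + 2) + 2 * (2 * n).choose (k + 1) + (2 * n).choose k := by
  rw [show 2 * (n + 1) = 2 * n + 1 + 1 by ring, Nat.choose_succ_succ, Nat.choose_succ_succ,
    Nat.choose_succ_succ (2 * n) (k + 1)]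
  ring

lemma ballot_succ_succ (n j : ℕ) :
    ballot (n + 1) (j + 1) = ballot n j + 2 * ballot n (j + 1) + ballot n (j + 2) := by
  have h1 := choose_two_mul_succ n (n + j)
  have h2 := choose_two_mul_succ n (n + j + 1)
  simp only [ballot, show n + 1 + (j + 1) = n + j + 2 by ring,
    show n + j + 2 + 1 = n + j + 1 + 2 by ring, h1, h2, show n + (j + 1) = n + j + 1 by ring,
    show n + (j + 2) = n + j + 2 by ring, show n + j + 1 + 1 = n + j + 2 by ring]
  push_cast
  ring

lemma ballot_succ_zero (n : ℕ) : ballot (n + 1) 0 = ballot n 0 + ballot n 1 := by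
  rcases n with _ | n
  · rfl
  have h1 := choose_two_mul_succ (n + 1) n
  have h2 := choose_two_mul_succ (n + 1) (n + 1)
  have h3 : (2 * (n + 1)).choose n = (2 * (n + 1)).choose (n + 2) :=
    Nat.choose_symm_of_eq_add (by ring)
  simp only [ballot, show n + 1 + 1 + 0 = n + 2 by ring, h1, h3,
    show n + 2 + 1 = n + 1 + 2 by ring, h2, add_zero]
  push_cast
  ring

lemma ballot_zero_eq (n : ℕ) :
    (ballot n 0 : ℝ) = (Nat.factorial (2 * n) : ℝ) / (Nat.factorial n * Nat.factorial (n + 1)) := by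
  have h2 : (2 * n).choose (n + 1) * (n + 1) = (2 * n).choose n * n := by
    rw [Nat.choose_succ_right_eq]
    congr 1
    omega
  have h3 : (2 * n).choose n * n.factorial * n.factorial = (2 * n).factorial := by
    have := Nat.choose_mul_factorial_mul_factorial (show n ≤ 2 * n by omega)
    rwa [show 2 * n - n = n by omega] at this
  have h2' : ((2 * n).choose (n + 1) : ℝ) * (n + 1) = (2 * n).choose n * n := by exact_mod_cast h2
  have h3' : ((2 * n).choose n : ℝ) * n.factorial * n.factorial = (2 * n).factorial := by
    exact_mod_cast h3
  rw [ballot, eq_div_iff (by positivity), ← h3', Nat.factorial_succ]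
  push_cast
  rw [add_zero]
  linear_combination (-(n.factorial : ℝ) ^ 2) * h2'

/-- Expansion of powers in a system of orthogonal polynomials of Chebyshev type. -/
lemma pow_eq_sum_ballot {u : ℝ} {v : ℕ → ℝ} (h0 : v 0 = 1) (h1 : u * v 0 = v 1 + v 0)
    (h2 : ∀ j, u * v (j + 1) = v (j + 2) + 2 * v (j + 1) + v j) (n : ℕ) :
    u ^ n = ∑ j ∈ range (n + 1), ballot n j * v j := by
  induction n with
  | zero => simp [h0, ballot_zero_zero]
  | succ n ih =>
    have hext : ∀ (k l : ℕ) (f : ℕ → ℝ), n < k + l →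
        ∑ j ∈ range (k + 1), (ballot n (j + l) : ℝ) * f j =
          ∑ j ∈ range k, (ballot n (j + l) : ℝ) * f j := by
      intro k l f hkl
      rw [Finset.sum_range_succ, ballot_eq_zero hkl]
      simp
    have e1 : ∑ j ∈ range (n + 1), (ballot n (j + 1) : ℝ) * v (j + 1) =
        ∑ j ∈ range n, (ballot n (j + 1) : ℝ) * v (j + 1) := hext n 1 (fun j => v (j + 1)) (by omega)
    have e2 : ∑ j ∈ range n, (ballot n (j + 1) : ℝ) * v j =
        ballot n 1 * v 0 + ∑ j ∈ range (n + 1), (ballot n (j + 2) : ℝ) * v (j + 1) := by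
      rw [← hext n 1 v (by omega), ← hext (n + 1) 1 v (by omega), Finset.sum_range_succ' _ (n + 1),
        add_comm]
    rw [pow_succ', ih, Finset.sum_range_succ', Finset.sum_range_succ' _ (n + 1),
      ballot_succ_zero, mul_add, Finset.mul_sum]
    simp only [ballot_succ_succ]
    push_cast
    simp only [add_mul, Finset.sum_add_distrib]
    have e3 : ∑ j ∈ range n, u * ((ballot n (j + 1) : ℝ) * v (j + 1)) =
        ∑ j ∈ range n, (ballot n (j + 1) : ℝ) * v (j + 2) +
          2 * ∑ j ∈ range n, (ballot n (j + 1) : ℝ) * v (j + 1) +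
          ∑ j ∈ range n, (ballot n (j + 1) : ℝ) * v j := by
      rw [Finset.mul_sum, ← Finset.sum_add_distrib, ← Finset.sum_add_distrib]
      refine Finset.sum_congr rfl fun j _ => ?_
      linear_combination (ballot n (j + 1) : ℝ) * h2 j
    have e4 : ∑ j ∈ range (n + 1), (2 * (ballot n (j + 1) : ℝ)) * v (j + 1) =
        2 * ∑ j ∈ range n, (ballot n (j + 1) : ℝ) * v (j + 1) := by
      rw [← e1, Finset.mul_sum]
      exact Finset.sum_congr rfl fun j _ => by ring
    have e5 : ∑ j ∈ range (n + 1), (ballot n j : ℝ) * v (j + 1) =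
        ∑ j ∈ range n, (ballot n (j + 1) : ℝ) * v (j + 2) + ballot n 0 * v 1 := by
      rw [Finset.sum_range_succ']
    rw [e3, e2, e4, e5]
    linear_combination (ballot n 0 : ℝ) * h1

end ballot

end LegendreMoments

namespace LegendreMoments

open Topology

section moments

variable {p : ℕ} [Fact p.Prime]

lemma vPoly_cast (r : ℕ) (t : ℤ) : ((vPoly p r t : ℤ) : ZMod p) = ((t ^ 2) ^ r : ℤ) := by
  induction r using Nat.twoStepInduction with
  | zero => simp [vPoly]
  | one => simp [vPoly]
  | more r _ ih =>
    rw [vPoly]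
    push_cast at ih ⊢
    rw [ih]
    simp
    ring

lemma cast_multiset_sum_map (T : Multiset ℤ) (f : ℤ → ℤ) {R : Type*} [CommRing R] :
    (((T.map f).sum : ℤ) : R) = (T.map fun t => (f t : R)).sum := by
  induction T using Multiset.induction_on with
  | empty => simp
  | cons a T ih => simp [ih]

lemma multiset_sum_map_finsetSum {R ι : Type*} [CommRing R] (T : Multiset ℤ) (s : Finset ι)
    (f : ι → ℤ → R) :
    (T.map fun t => ∑ j ∈ s, f j t).sum = ∑ j ∈ s, (T.map (f j)).sum := by
  induction T using Multiset.induction_on with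
  | empty => simp
  | cons a T ih => simp [ih, Finset.sum_add_distrib]

lemma sq_eq_sq_of_cast_eq {x y : ℤ} (h : ((x ^ 2 : ℤ) : ZMod p) = ((y ^ 2 : ℤ) : ZMod p))
    (h1 : (x - y) ^ 2 < (p : ℤ) ^ 2) (h2 : (x + y) ^ 2 < (p : ℤ) ^ 2) : x ^ 2 = y ^ 2 := by
  have hp : Prime (p : ℤ) := Nat.prime_iff_prime_int.1 Fact.out
  have hz : ∀ z : ℤ, z ^ 2 < (p : ℤ) ^ 2 → (p : ℤ) ∣ z → z = 0 := fun z hz hd =>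
    Int.eq_zero_of_abs_lt_dvd hd (abs_lt_of_sq_lt_sq hz (by positivity))
  have hd : (p : ℤ) ∣ (x - y) * (x + y) := by
    rw [← ZMod.intCast_zmod_eq_zero_iff_dvd]
    push_cast at h ⊢
    linear_combination h
  have : (x - y) * (x + y) = 0 := by
    rcases hp.dvd_or_dvd hd with h | h
    · rw [hz _ h1 h, zero_mul]
    · rw [hz _ h2 h, mul_zero]
  linarith

lemma exists_trace_multiset_eq (hp : 100 ≤ p) :
    ∃ T : Multiset ℤ, (Multiset.card T : ℤ) = 2 * (p - 2) ∧
      (∀ r, 0 < r → (T.map (vPoly p r)).sum = 2 * (traceS r p - 2)) ∧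
      T.map (· ^ 2) = (legendreParams p).val.map (fun l => legendreTrace p l ^ 2) +
        (legendreParams p).val.map (fun l => legendreTrace p l ^ 2) := by
  have hodd : Odd p := (Fact.out : p.Prime).odd_of_ne_two (by omega)
  obtain ⟨m, hm⟩ := hodd
  obtain ⟨T, hT, hcard, hsum⟩ := exists_trace_multiset (Fact.out : p.Prime) ⟨m, hm⟩
  refine ⟨T, hcard, hsum, ?_⟩
  have hp' : (100 : ℤ) ≤ p := by exact_mod_cast hp
  set B := (legendreParams p).val.map (fun l => legendreTrace p l ^ 2) with hB
  have hcardB : (Multiset.card B : ℤ) = p - 2 := by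
    rw [hB, Multiset.card_map]
    exact card_legendreParams
  have hmem : ∀ x ∈ T.map (· ^ 2) + (B + B), (∃ t, t ^ 2 < 4 * (p : ℤ) ∧ x = t ^ 2) ∨
      ∃ l ∈ legendreParams p, x = legendreTrace p l ^ 2 := by
    intro x hx
    rw [Multiset.mem_add, Multiset.mem_add, or_self, Multiset.mem_map, hB, Multiset.mem_map] at hx
    rcases hx with ⟨t, ht, rfl⟩ | ⟨l, hl, rfl⟩
    · exact Or.inl ⟨t, hT t ht, rfl⟩
    · exact Or.inr ⟨l, hl, rfl⟩
  have hmixed : ∀ (t : ℤ) (l : ZMod p), t ^ 2 < 4 * (p : ℤ) → l ∈ legendreParams p →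
      ((t ^ 2 : ℤ) : ZMod p) = ((legendreTrace p l ^ 2 : ℤ) : ZMod p) →
      t ^ 2 = legendreTrace p l ^ 2 := by
    intro t l ht hl h
    have h1 := two_mul_legendreTrace_sq_lt (by omega) hl
    refine sq_eq_sq_of_cast_eq h ?_ ?_
    · nlinarith [sq_nonneg (legendreTrace p l + 2 * t)]
    · nlinarith [sq_nonneg (legendreTrace p l - 2 * t)]
  refine multiset_eq_of_power_sums (p := p) ?_ ?_ ?_ ?_ ?_
  · rw [Multiset.card_map, Multiset.card_add]
    omega
  · rw [Multiset.card_map, Multiset.card_add]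
    omega
  · have h1 := hsum 1 one_pos
    rw [traceS_one] at h1
    have h2 : (T.map (vPoly p 1)).sum = (T.map (· ^ 2)).sum - Multiset.card T * p := by
      simp only [vPoly, Multiset.sum_map_sub, Multiset.map_const', Multiset.sum_replicate,
        nsmul_eq_mul]
    have h3 : B.sum = ∑ l ∈ legendreParams p, legendreTrace p l ^ 2 := rfl
    rw [Multiset.sum_add, h3, sum_legendreParams_sq (by omega)]
    rw [h2, hcard] at h1
    linarith
  · intro k
    have h1 : (((T.map (vPoly p k)).sum : ℤ) : ZMod p) = 2 * ((traceS k p - 2 : ℤ) : ZMod p) := by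
      rcases Nat.eq_zero_or_pos k with rfl | hk
      · have h2 : (T.map (vPoly p 0)).sum = Multiset.card T := by
          simp [vPoly]
        rw [h2, hcard]
        simp [traceS]
      · rw [hsum k hk]
        push_cast
        ring
    have h2 : ((B.map (· ^ k)).sum : ℤ) = ∑ l ∈ legendreParams p, (legendreTrace p l ^ 2) ^ k := by
      rw [hB, Multiset.map_map]
      rfl
    rw [Multiset.map_add, Multiset.sum_add, h2, Multiset.map_map, cast_multiset_sum_map]
    rw [cast_multiset_sum_map, Multiset.map_congr rfl fun t _ => vPoly_cast k t,
      traceS_zmod p m k hm] at h1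
    simp only [Function.comp_apply]
    rw [h1]
    push_cast
    rw [two_mul]
    have h3 : ∀ l : ZMod p, ((legendreTrace p l : ZMod p) ^ 2) ^ k =
        (hassePoly (ZMod p) m).eval l ^ (2 * k) := by
      intro l
      rw [legendreTrace_cast hm, mul_pow, ← pow_mul, mul_comm m 2, pow_mul, neg_one_sq, one_pow,
        one_mul, pow_mul]
    simp only [h3, legendreParams]
  · intro x hx y hy hxy
    rcases hmem x hx with ⟨t, ht, rfl⟩ | ⟨l, hl, rfl⟩
    · rcases hmem y hy with ⟨s, hs, rfl⟩ | ⟨k, hk, rfl⟩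
      · refine sq_eq_sq_of_cast_eq hxy ?_ ?_
        · nlinarith [sq_nonneg (t + s)]
        · nlinarith [sq_nonneg (t - s)]
      · exact hmixed t k ht hk hxy
    · rcases hmem y hy with ⟨s, hs, rfl⟩ | ⟨k, hk, rfl⟩
      · exact (hmixed s l hs hl hxy.symm).symm
      · by_contra hne
        have h1 := legendreTrace_sq_add_sq_lt (by omega) hl hk hne
        refine hne (sq_eq_sq_of_cast_eq hxy ?_ ?_)
        · nlinarith [sq_nonneg (legendreTrace p l + legendreTrace p k)]
        · nlinarith [sq_nonneg (legendreTrace p l - legendreTrace p k)]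

/-- The even moments in terms of traces of Hecke operators. -/
lemma sum_legendreTrace_pow (hp : 100 ≤ p) (n : ℕ) :
    ∑ l ∈ legendreParams p, (legendreTrace p l : ℝ) ^ (2 * n) =
      (p : ℝ) ^ n * (ballot n 0 * (p - 2) +
        ∑ j ∈ range n, ballot n (j + 1) * (((traceS (j + 1) p : ℝ) - 2) / (p : ℝ) ^ (j + 1))) := by
  obtain ⟨T, hcard, hsum, hT⟩ := exists_trace_multiset_eq hp
  have hp0 : (p : ℝ) ≠ 0 := by
    have : 0 < p := by omega
    exact_mod_cast this.ne'
  have h1 : (((T.map (· ^ 2)).map (· ^ n)).sum : ℤ) =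
      2 * ∑ l ∈ legendreParams p, legendreTrace p l ^ (2 * n) := by
    rw [hT, Multiset.map_add, Multiset.sum_add, Multiset.map_map, two_mul]
    simp only [pow_mul]
    rfl
  have h2 : ∀ t : ℤ, ((((t ^ 2) ^ n : ℤ)) : ℝ) = (p : ℝ) ^ n *
      ∑ j ∈ range (n + 1), (ballot n j / (p : ℝ) ^ j) * (vPoly p j t : ℝ) := by
    intro t
    have h3 := pow_eq_sum_ballot (u := (t : ℝ) ^ 2 / p)
      (v := fun j => (vPoly p j t : ℝ) / (p : ℝ) ^ j) (by simp [vPoly])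
      (by
        simp only [vPoly]
        push_cast
        field_simp
        ring)
      (fun j => by
        simp only [vPoly]
        push_cast
        field_simp
        ring) n
    rw [div_pow, div_eq_iff (pow_ne_zero _ hp0)] at h3
    push_cast
    rw [h3, mul_comm]
    congr 1
    exact Finset.sum_congr rfl fun j _ => by ring
  have h4 : ((((T.map (· ^ 2)).map (· ^ n)).sum : ℤ) : ℝ) = (p : ℝ) ^ n *
      ∑ j ∈ range (n + 1), (ballot n j / (p : ℝ) ^ j) * ((T.map (vPoly p j)).sum : ℤ) := by
    rw [Multiset.map_map, cast_multiset_sum_map,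
      Multiset.map_congr rfl fun t _ => (show ((((· ^ n) ∘ (· ^ 2)) t : ℤ) : ℝ) = _ from h2 t),
      Multiset.sum_map_mul_left, multiset_sum_map_finsetSum]
    congr 1
    refine Finset.sum_congr rfl fun j _ => ?_
    rw [Multiset.sum_map_mul_left, cast_multiset_sum_map]
  have h5 : (T.map (vPoly p 0)).sum = 2 * (p - 2) := by
    rw [← hcard]
    simp [vPoly]
  rw [h1, Finset.sum_range_succ', h5] at h4
  have h6 : ∑ j ∈ range n, (ballot n (j + 1) / (p : ℝ) ^ (j + 1)) *
      (((T.map (vPoly p (j + 1))).sum : ℤ) : ℝ) =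
      2 * ∑ j ∈ range n, ballot n (j + 1) * (((traceS (j + 1) p : ℝ) - 2) / (p : ℝ) ^ (j + 1)) := by
    rw [Finset.mul_sum]
    refine Finset.sum_congr rfl fun j _ => ?_
    rw [hsum (j + 1) j.succ_pos]
    push_cast
    ring
  rw [h6] at h4
  push_cast at h4
  linear_combination h4 / 2

end moments

lemma tendsto_main_term (n : ℕ) :
    Tendsto (fun p : ℕ => (ballot n 0 : ℝ) * (1 - 2 / p) + ∑ j ∈ range n, ballot n (j + 1) *
      ((traceS (j + 1) p : ℝ) / (p : ℝ) ^ (j + 1 + 1) - 2 / (p : ℝ) ^ (j + 1 + 1))) atTop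
      (𝓝 (ballot n 0)) := by
  have hpow : ∀ k : ℕ, Tendsto (fun p : ℕ => (2 : ℝ) / (p : ℝ) ^ (k + 1)) atTop (𝓝 0) := fun k =>
    ((tendsto_pow_atTop (Nat.succ_ne_zero k)).comp
      tendsto_natCast_atTop_atTop).const_div_atTop 2
  have h0 := ((hpow 0).const_sub 1).const_mul (ballot n 0 : ℝ)
  have h1 := tendsto_finsetSum (range n) fun j _ =>
    ((tendsto_traceS (j + 1)).sub (hpow (j + 1))).const_mul (ballot n (j + 1) : ℝ)
  have h := h0.add h1
  simpa using h

end LegendreMoments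

/-- **Even power moments of the Legendre family traces of Frobenius.**
For a fixed positive integer `n`, as the prime `p` tends to infinity,
`p^{-(n+1)} · ∑_{λ ∈ F_p, λ ≠ 0, 1} a_p(λ)^{2n}` converges to the Catalan number
`(2n)! / (n! (n+1)!)`, where `a_p(λ) = -∑_{x ∈ F_p} φ(x(x-1)(x-λ))` and `φ` is the
quadratic character of `F_p` (with `φ(0) = 0`). -/
theorem even_moments_ap_tendsto_catalan (n : ℕ) (hn : 0 < n) :
    Tendsto
      (fun p : Nat.Primes =>
        haveI : Fact (p : ℕ).Prime := ⟨p.property⟩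
        ((p : ℕ) : ℝ) ^ (-((n : ℤ) + 1)) *
          ∑ l ∈ univ.filter (fun l : ZMod p => l ≠ 0 ∧ l ≠ 1),
            (((-∑ x : ZMod p, quadraticChar (ZMod p) (x * (x - 1) * (x - l))) ^ (2 * n) :
              ℤ) : ℝ))
      (Filter.comap ((↑) : Nat.Primes → ℕ) atTop)
      (nhds ((Nat.factorial (2 * n) : ℝ) /
        (Nat.factorial n * Nat.factorial (n + 1)))) := by
  rw [← LegendreMoments.ballot_zero_eq]
  refine ((LegendreMoments.tendsto_main_term n).comp tendsto_comap).congr' ?_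
  filter_upwards [tendsto_comap.eventually (eventually_ge_atTop 100)] with p hp
  have : Fact (p : ℕ).Prime := ⟨p.property⟩
  have hp0 : ((p : ℕ) : ℝ) ≠ 0 := by exact_mod_cast p.property.ne_zero
  have h := LegendreMoments.sum_legendreTrace_pow hp n
  rw [LegendreMoments.legendreParams] at h
  simp only [LegendreMoments.legendreTrace] at h
  push_cast at h ⊢
  change (LegendreMoments.ballot n 0 : ℝ) * (1 - 2 / (p : ℕ)) + _ = _
  rw [h, show -((n : ℤ) + 1) = -((n + 1 : ℕ) : ℤ) by push_cast; ring,
    zpow_neg, zpow_natCast, mul_add, mul_add, Finset.mul_sum, Finset.mul_sum]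
  congr 1
  · field_simp
    ring
  · refine Finset.sum_congr rfl fun j _ => ?_
    field_simp
    ring
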